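/- There are infinitely many complex cubic fields whose class group has 2-rank equal to 1 or 2. Precisely: the set of subfields K of ℂ with [K : ℚ] = 3, disc(K) < 0, and |Cl_K[2]| ∈ {2, 4} is infinite. -/

import Mathlib

open NumberField

/-- The cardinality of the 2-torsion subgroup `Cl_K[2] = {I ∈ Cl_K : I² = 1}` of the
class group of the ring of integers of `K`. -/
noncomputable def twoTorsionCard (K : IntermediateField ℚ ℂ) : ℕ :=
  Nat.card {I : ClassGroup (𝓞 K) // I ^ 2 = 1}

open scoped Classical in
/-- The discriminant of a subfield of `ℂ`, defined to be `0` if the field is not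
finite-dimensional over `ℚ`. -/
noncomputable def discOf (K : IntermediateField ℚ ℂ) : ℤ :=
  if h : FiniteDimensional ℚ K then
    letI := h
    letI : NumberField K := ⟨⟩
    NumberField.discr K
  else 0

section
open Matrix MeasureTheory

/-- bilinear value -/
def bv {R : Type*} [CommRing R] (S : Matrix (Fin 3) (Fin 3) R) (u v : Fin 3 → R) : R := u ⬝ᵥ (S *ᵥ v)

def Gm (R : Type*) [CommRing R] : Matrix (Fin 3) (Fin 3) R := !![0,0,1;0,1,0;1,0,0]

lemma exists_small_vec (h : Matrix (Fin 3) (Fin 3) ℝ) (hdet : |h.det| = 1) :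
    ∃ n : Fin 3 → ℤ, n ≠ 0 ∧
      |bv (Gm ℝ) ((fun i => (n i : ℝ)) ᵥ* h) ((fun i => (n i : ℝ)) ᵥ* h)| < 2 := by
  set Q : Matrix (Fin 3) (Fin 3) ℝ := !![1,0,1;0,1,0;1,0,-1] with hQ
  have hQd : Q.det = -2 := by simp [hQ, Matrix.det_fin_three]; norm_num
  set M : Matrix (Fin 3) (Fin 3) ℝ := (h * Q)ᵀ with hM
  have hMd : |M.det| = 2 := by
    rw [hM, Matrix.det_transpose, Matrix.det_mul, abs_mul, hdet, hQd]; norm_num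
  set f : (Fin 3 → ℝ) →ₗ[ℝ] (Fin 3 → ℝ) := Matrix.toLin' M with hf
  have hfd : LinearMap.det f = M.det := by simp [hf]
  set A : Fin 3 → ℝ := ![13/10, 1, 19/10] with hA
  set box : Set (Fin 3 → ℝ) := Set.pi Set.univ fun i => Set.Ioo (-(A i)) (A i) with hbox
  set L := (Submodule.span ℤ (Set.range (Pi.basisFun ℝ (Fin 3)))).toAddSubgroup with hL
  have hfund : IsAddFundamentalDomain L (ZSpan.fundamentalDomain (Pi.basisFun ℝ (Fin 3))) volume :=
    ZSpan.isAddFundamentalDomain _ _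
  have hvolbox : volume box = ENNReal.ofReal (8 * (13/10 * (19/10))) := by
    rw [hbox, Real.volume_pi_Ioo, Fin.prod_univ_three]
    rw [← ENNReal.ofReal_mul (by norm_num [hA]), ← ENNReal.ofReal_mul (by norm_num [hA])]
    congr 1
    simp [hA]; norm_num
  have hvol : volume (f ⁻¹' box) = ENNReal.ofReal (4 * (13/10 * (19/10))) := by
    rw [Measure.addHaar_preimage_linearMap _ (by rw [hfd]; intro h0; rw [h0] at hMd; norm_num at hMd),
      hvolbox, ← ENNReal.ofReal_mul (by positivity), hfd, abs_inv, hMd]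
    congr 1; norm_num
  have hF : volume (ZSpan.fundamentalDomain (Pi.basisFun ℝ (Fin 3))) = 1 := by
    rw [ZSpan.volume_fundamentalDomain]
    have : Matrix.of (Pi.basisFun ℝ (Fin 3)) = 1 := by
      ext i j
      simp [Matrix.one_apply, Pi.single_apply, eq_comm]
    rw [this]; simp
  have hconv : Convex ℝ (f ⁻¹' box) := (convex_pi fun i _ => convex_Ioo _ _).linear_preimage f
  have : Countable L := by
    have : Countable (Submodule.span ℤ (Set.range (Pi.basisFun ℝ (Fin 3)))) := inferInstance
    exact this
  obtain ⟨x, hx0, hx⟩ := exists_ne_zero_mem_lattice_of_measure_mul_two_pow_lt_measure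
    (L := L) (s := f ⁻¹' box) hfund (by
      intro x hx
      simp only [Set.mem_preimage, hbox, Set.mem_pi, Set.mem_univ, forall_true_left, Set.mem_Ioo, map_neg, Pi.neg_apply] at hx ⊢
      intro i; have := hx i; constructor <;> linarith) hconv (by
      rw [hF, hvol, one_mul]; simp only [Module.finrank_fintype_fun_eq_card, Fintype.card_fin]
      rw [show ((2:ENNReal)^3) = ENNReal.ofReal 8 by norm_num]
      apply ENNReal.ofReal_lt_ofReal_iff_of_nonneg (by norm_num) |>.2; norm_num)
  obtain ⟨x, hxL⟩ := x
  have hxi : ∀ i, ∃ n : ℤ, (n : ℝ) = x i := by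
    have := ((Pi.basisFun ℝ (Fin 3)).mem_span_iff_repr_mem ℤ x).1 hxL
    intro i
    obtain ⟨n, hn⟩ := this i
    exact ⟨n, by simpa using hn⟩
  choose n hn using hxi
  refine ⟨n, ?_, ?_⟩
  · rintro rfl
    apply hx0
    ext i
    simp [← hn i]
  · have hnx : (fun i => (n i : ℝ)) = x := funext hn
    rw [hnx]
    set v := x ᵥ* h with hv
    have hfx : f x = v ᵥ* Q := by
      rw [hf, Matrix.toLin'_apply, hM, Matrix.mulVec_transpose, hv, Matrix.vecMul_vecMul]
    have hb : ∀ i, -(A i) < (v ᵥ* Q) i ∧ (v ᵥ* Q) i < A i := by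
      intro i
      have := hx i (Set.mem_univ i)
      simp only [hfx] at this
      exact this
    have h0 := hb 0
    have h1 := hb 1
    have h2 := hb 2
    simp [hA, hQ, Matrix.vecMul, dotProduct, Fin.sum_univ_three] at h0 h1 h2
    simp only [bv, Gm, dotProduct, Matrix.mulVec, Fin.sum_univ_three]
    simp
    rw [abs_lt]
    have e : v 0 * v 2 + v 1 * v 1 + v 2 * v 0
      = ((v 0 + v 2)^2 - (v 0 - v 2)^2)/2 + (v 1)^2 := by ring
    rw [e]
    have k0 : (v 0 + v 2)^2 < (13/10)^2 := by rw [sq_lt_sq, abs_lt]; norm_num; exact h0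
    have k1 : (v 1)^2 < 1^2 := by rw [sq_lt_sq, abs_lt]; norm_num; exact h1
    have k2 : (v 0 - v 2)^2 < (19/10)^2 := by
      rw [sq_lt_sq, abs_lt]; norm_num; constructor <;> linarith [h2.1, h2.2]
    constructor <;> linarith [sq_nonneg (v 0 + v 2), sq_nonneg (v 1), sq_nonneg (v 0 - v 2)]
end

section
open Matrix MeasureTheory

lemma complete_vec (e ξ : Fin 3 → ℤ) (h : ξ 0 * e 0 + ξ 1 * e 1 + ξ 2 * e 2 = 1) :
    ∃ c d : Fin 3 → ℤ, ξ 0 * c 0 + ξ 1 * c 1 + ξ 2 * c 2 = 0 ∧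
      ξ 0 * d 0 + ξ 1 * d 1 + ξ 2 * d 2 = 0 ∧ IsUnit (!![e 0, e 1, e 2; c 0, c 1, c 2; d 0, d 1, d 2]).det := by
  by_cases hg : Int.gcd (ξ 0) (ξ 1) = 0
  · rw [Int.gcd_eq_zero_iff] at hg
    refine ⟨![1,0,0], ![0,1,0], by simp [hg.1], by simp [hg.2], ?_⟩
    simp [Matrix.det_fin_three]
    rw [hg.1, hg.2] at h
    exact IsUnit.of_mul_eq_one (ξ 2) (by linarith)
  · set g : ℤ := ((Int.gcd (ξ 0) (ξ 1) : ℕ) : ℤ) with hgd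
    have hg0 : g ≠ 0 := by rw [hgd]; exact_mod_cast hg
    obtain ⟨x', hx⟩ : g ∣ ξ 0 := Int.gcd_dvd_left ..
    obtain ⟨y', hy⟩ : g ∣ ξ 1 := Int.gcd_dvd_right ..
    have hb := Int.gcd_eq_gcd_ab (ξ 0) (ξ 1)
    rw [← hgd] at hb
    set s := Int.gcdA (ξ 0) (ξ 1)
    set t := Int.gcdB (ξ 0) (ξ 1)
    have h1 : x' * s + y' * t = 1 := by
      apply mul_left_cancel₀ hg0
      rw [hx, hy] at hb; linarith
    refine ⟨![-y', x', 0], ![-(ξ 2) * s, -(ξ 2)*t, g], ?_, ?_, ?_⟩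
    · simp; rw [hx, hy]; ring
    · simp; linear_combination (-(ξ 2)) * hb.symm
    · have : (!![e 0, e 1, e 2; ![-y', x', 0] 0, ![-y', x', 0] 1, ![-y', x', 0] 2; ![-(ξ 2) * s, -(ξ 2)*t, g] 0, ![-(ξ 2) * s, -(ξ 2)*t, g] 1, ![-(ξ 2) * s, -(ξ 2)*t, g] 2]).det = 1 := by
        simp [Matrix.det_fin_three]
        linear_combination h + e 2 * ξ 2 * h1 - e 0 * hx - e 1 * hy
      rw [this]; exact isUnit_one

lemma binary_repr_one : ∀ (N : ℕ) (p q r : ℤ), 0 < p → p.toNat ≤ N → p * r - q^2 = 1 →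
    ∃ x y : ℤ, p * x^2 + 2 * q * x * y + r * y^2 = 1 := by
  intro N
  induction N with
  | zero => intro p q r hp hN; omega
  | succ N ih =>
    intro p q r hp hN hd
    -- shift
    obtain ⟨k, hk⟩ : ∃ k : ℤ, 2 * |q + k * p| ≤ p := by
      refine ⟨-((2 * q + p) / (2 * p)), ?_⟩
      have h1 := Int.emod_add_mul_ediv (2 * q + p) (2 * p)
      have h2 := Int.emod_nonneg (2 * q + p) (show 2 * p ≠ 0 by omega)
      have h3 := Int.emod_lt_of_pos (2 * q + p) (show 0 < 2 * p by omega)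
      set m := (2 * q + p) / (2 * p)
      rcases abs_cases (q + -m * p) with ⟨h, _⟩ | ⟨h, _⟩ <;> rw [h] <;> nlinarith
    set q' := q + k * p with hq'
    set r' := r + 2 * k * q + k^2 * p with hr'
    have hd' : p * r' - q'^2 = 1 := by rw [hr', hq']; linear_combination hd
    have hq2 : 4 * q'^2 ≤ p^2 := by
      have : (2 * |q'|)^2 ≤ p^2 := by gcongr
      rw [mul_pow, sq_abs] at this; linarith
    have hr0 : 0 < r' := by nlinarith [sq_nonneg q']
    have key : ∃ x y : ℤ, p * x^2 + 2 * q' * x * y + r' * y^2 = 1 := by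
      by_cases hpr : p ≤ r'
      · have : p = 1 := by nlinarith
        exact ⟨1, 0, by rw [this]; ring⟩
      · push Not at hpr
        obtain ⟨x, y, h⟩ := ih r' q' p hr0 (by omega) (by linarith)
        exact ⟨y, x, by linarith⟩
    obtain ⟨x, y, h⟩ := key
    exact ⟨x + k * y, y, by rw [← h, hq', hr']; ring⟩

lemma bv_expand {R : Type*} [CommRing R] (S : Matrix (Fin 3) (Fin 3) R) (u v : Fin 3 → R) :
    bv S u v = u 0 * (S 0 0 * v 0 + S 0 1 * v 1 + S 0 2 * v 2) + u 1 * (S 1 0 * v 0 + S 1 1 * v 1 + S 1 2 * v 2)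
      + u 2 * (S 2 0 * v 0 + S 2 1 * v 1 + S 2 2 * v 2) := by
  simp [bv, dotProduct, Matrix.mulVec, Fin.sum_univ_three]

lemma bv_symm {R : Type*} [CommRing R] (S : Matrix (Fin 3) (Fin 3) R) (hS : Sᵀ = S) (u v : Fin 3 → R) :
    bv S u v = bv S v u := by
  have h : ∀ i j, S i j = S j i := fun i j => by rw [← Matrix.transpose_apply S j i, hS]
  rw [bv_expand, bv_expand, h 1 0, h 2 0, h 2 1]; ring

lemma bv_vecMul {R : Type*} [CommRing R] (S h : Matrix (Fin 3) (Fin 3) R) (u v : Fin 3 → R) :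
    bv S (u ᵥ* h) (v ᵥ* h) = bv (h * S * hᵀ) u v := by
  simp only [bv]
  rw [← Matrix.mulVec_transpose h v, Matrix.mulVec_mulVec, ← Matrix.dotProduct_mulVec, Matrix.mulVec_mulVec,
    mul_assoc]

lemma bv_map_cast (S : Matrix (Fin 3) (Fin 3) ℤ) (u v : Fin 3 → ℤ) :
    bv (S.map (Int.cast : ℤ → ℝ)) (fun i => (u i : ℝ)) (fun i => (v i : ℝ)) = ((bv S u v : ℤ) : ℝ) := by
  rw [bv_expand, bv_expand]; simp

lemma Gm_det (R : Type*) [CommRing R] : (Gm R).det = -1 := by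
  simp [Gm, Matrix.det_fin_three]

lemma Gm_transpose (R : Type*) [CommRing R] : (Gm R)ᵀ = Gm R := by
  ext i j; fin_cases i <;> fin_cases j <;> simp [Gm]

lemma Gm_sq (R : Type*) [CommRing R] : Gm R * Gm R = 1 := by
  ext i j; fin_cases i <;> fin_cases j <;> simp [Gm, Matrix.mul_apply, Fin.sum_univ_three, Matrix.one_apply]

lemma det_map_cast (S : Matrix (Fin 3) (Fin 3) ℤ) : (S.map (Int.cast : ℤ → ℝ)).det = (S.det : ℝ) := by
  simp [Matrix.det_fin_three]

lemma abs_det_of_gram (h : Matrix (Fin 3) (Fin 3) ℝ) (Sg : Matrix (Fin 3) (Fin 3) ℤ)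
    (hG : h * Gm ℝ * hᵀ = Sg.map (Int.cast : ℤ → ℝ)) (hd : Sg.det = -1) : |h.det| = 1 := by
  have := congrArg Matrix.det hG
  rw [det_map_cast, Matrix.det_mul, Matrix.det_mul, Matrix.det_transpose, Gm_det, hd] at this
  push_cast at this
  rw [← sq_eq_sq₀ (abs_nonneg _) zero_le_one, sq_abs]; linarith

lemma sym_of_gram (h : Matrix (Fin 3) (Fin 3) ℝ) (Sg : Matrix (Fin 3) (Fin 3) ℤ)
    (hG : h * Gm ℝ * hᵀ = Sg.map (Int.cast : ℤ → ℝ)) : Sgᵀ = Sg := by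
  have := congrArg Matrix.transpose hG
  rw [Matrix.transpose_mul, Matrix.transpose_mul, Matrix.transpose_transpose, Gm_transpose, ← mul_assoc, hG] at this
  ext i j
  have h2 := congrFun (congrFun this i) j
  simp at h2
  simpa using h2.symm

lemma exists_isotropic (h : Matrix (Fin 3) (Fin 3) ℝ) (Sg : Matrix (Fin 3) (Fin 3) ℤ)
    (hG : h * Gm ℝ * hᵀ = Sg.map (Int.cast : ℤ → ℝ)) (hd : Sg.det = -1) :
    ∃ n : Fin 3 → ℤ, n ≠ 0 ∧ bv Sg n n = 0 := by
  have hsym := sym_of_gram h Sg hG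
  have hs : ∀ i j, Sg i j = Sg j i := fun i j => by rw [← Matrix.transpose_apply Sg j i, hsym]
  have hdh := abs_det_of_gram h Sg hG hd
  obtain ⟨n, hn0, hn⟩ := exists_small_vec h hdh
  rw [bv_vecMul, hG, bv_map_cast] at hn
  have hn' : |bv Sg n n| < 2 := by exact_mod_cast hn
  by_cases h0 : bv Sg n n = 0
  · exact ⟨n, hn0, h0⟩
  obtain ⟨ε, hε, hε2⟩ : ∃ ε : ℤ, bv Sg n n = ε ∧ (ε = 1 ∨ ε = -1) :=
    ⟨_, rfl, by rw [abs_lt] at hn'; omega⟩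
  set ξ : Fin 3 → ℤ := fun i => ε * (Sg *ᵥ n) i with hξ
  have hee : ε * ε = 1 := by rcases hε2 with h | h <;> rw [h] <;> norm_num
  have hξb : ∀ c : Fin 3 → ℤ, ξ 0 * c 0 + ξ 1 * c 1 + ξ 2 * c 2 = ε * bv Sg c n := by
    intro c; simp [hξ, bv, dotProduct, Fin.sum_univ_three]; ring
  obtain ⟨c, d, hc, hdd, hU⟩ := complete_vec n ξ (by rw [hξb, hε, hee])
  rw [hξb] at hc hdd
  have hε0 : ε ≠ 0 := by rintro rfl; simp at hee
  have hc0 : bv Sg c n = 0 := by simpa [hε0] using hc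
  have hd0 : bv Sg d n = 0 := by simpa [hε0] using hdd
  set U := !![n 0, n 1, n 2; c 0, c 1, c 2; d 0, d 1, d 2] with hUdef
  set p := bv Sg c c with hp
  set q := bv Sg c d with hq
  set r := bv Sg d d with hr
  have hUS : U * Sg * Uᵀ = !![ε,0,0;0,p,q;0,q,r] := by
    have key : ∀ i j, (U * Sg * Uᵀ) i j = bv Sg (U i) (U j) := by
      intro i j
      simp [Matrix.mul_apply, bv_expand, Fin.sum_univ_three]; ring
    have r0 : U 0 = n := by ext i; fin_cases i <;> rfl
    have r1 : U 1 = c := by ext i; fin_cases i <;> rfl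
    have r2 : U 2 = d := by ext i; fin_cases i <;> rfl
    ext i j
    rw [key]
    fin_cases i <;> fin_cases j <;> simp [r0, r1, r2, hε, hc0, hd0, hp, hq, hr, bv_symm Sg hsym n, bv_symm Sg hsym d c]
  have hdet : ε * (p * r - q^2) = -1 := by
    have h1 := congrArg Matrix.det hUS
    rw [Matrix.det_mul, Matrix.det_mul, Matrix.det_transpose, hd] at h1
    have h2 : U.det * U.det = 1 := by rcases Int.isUnit_iff.1 hU with h | h <;> rw [h] <;> norm_num
    simp [Matrix.det_fin_three !![ε,0,0;0,p,q;0,q,r]] at h1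
    linear_combination -h1 - h2
  have hU0 : U.det ≠ 0 := hU.ne_zero
  have lin : ∀ x y z : ℤ, bv Sg (fun i => x * n i + y * c i + z * d i) (fun i => x * n i + y * c i + z * d i)
      = ε * x^2 + p * y^2 + 2 * q * y * z + r * z^2 := by
    intro x y z
    have e1 : (fun i => x * n i + y * c i + z * d i) = ![x,y,z] ᵥ* U := by
      ext i; fin_cases i <;> simp [hUdef, Matrix.vecMul, dotProduct, Fin.sum_univ_three]
    rw [e1, bv_vecMul, hUS, bv_expand]
    simp; ring
  have nz : ∀ x y z : ℤ, (fun i => x * n i + y * c i + z * d i) = 0 → x = 0 ∧ y = 0 ∧ z = 0 := by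
    intro x y z h0
    have e1 : (fun i => x * n i + y * c i + z * d i) = ![x,y,z] ᵥ* U := by
      ext i; fin_cases i <;> simp [hUdef, Matrix.vecMul, dotProduct, Fin.sum_univ_three]
    rw [e1] at h0
    have := Matrix.eq_zero_of_vecMul_eq_zero hU0 h0
    exact ⟨congrFun this 0, congrFun this 1, congrFun this 2⟩
  rcases hε2 with h1 | h1
  · subst h1
    by_cases hp0 : p = 0
    · refine ⟨_, fun h => ?_, (lin 0 1 0).trans ?_⟩
      · have := nz _ _ _ h; omega
      · rw [hp0]; ring
    · refine ⟨_, fun h => ?_, (lin 0 (1-q) p).trans ?_⟩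
      · have := nz _ _ _ h; omega
      · linear_combination p * hdet
  · subst h1
    have hdet' : p * r - q^2 = 1 := by linarith
    by_cases hp0 : 0 < p
    · obtain ⟨x, y, hxy⟩ := binary_repr_one _ p q r hp0 le_rfl hdet'
      refine ⟨_, fun h => ?_, (lin 1 x y).trans ?_⟩
      · have := nz _ _ _ h; omega
      · linear_combination hxy
    · exfalso
      have hpneg : p < 0 := by
        rcases lt_trichotomy p 0 with h | h | h
        · exact h
        · rw [h] at hdet'; nlinarith
        · exact absurd h hp0
      have hhd : IsUnit h.det := by
        rw [isUnit_iff_ne_zero]; intro h0; rw [h0] at hdh; simp at hdh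
      set UR := U.map (Int.cast : ℤ → ℝ)
      have hURd : IsUnit UR.det := by
        rw [det_map_cast]; exact_mod_cast (isUnit_iff_ne_zero.2 (by exact_mod_cast hU0 : (U.det:ℝ) ≠ 0))
      set y : Fin 3 → ℝ := ![0,1,0] ᵥ* (UR * h)⁻¹ with hy
      have hUh : IsUnit (UR * h).det := by rw [Matrix.det_mul]; exact hURd.mul hhd
      have e1 : y ᵥ* (UR * h) = ![0,1,0] := by
        rw [hy, Matrix.vecMul_vecMul, Matrix.nonsing_inv_mul _ hUh, Matrix.vecMul_one]
      have e2 : bv (Gm ℝ) (y ᵥ* (UR * h)) (y ᵥ* (UR * h)) = 1 := by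
        rw [e1, bv_expand]; simp [Gm]
      rw [bv_vecMul] at e2
      have e3 : UR * h * Gm ℝ * (UR * h)ᵀ = (U * Sg * Uᵀ).map (Int.cast : ℤ → ℝ) := by
        have : (U * Sg * Uᵀ).map (Int.cast : ℤ → ℝ) = UR * Sg.map (Int.cast : ℤ → ℝ) * URᵀ := by
          ext i j; simp [UR, Matrix.mul_apply]
        rw [this, ← hG, Matrix.transpose_mul]; simp only [mul_assoc]
      rw [e3, hUS, bv_expand] at e2
      simp at e2
      have hdR : (p:ℝ) * r - q^2 = 1 := by exact_mod_cast hdet'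
      have hpR : (p:ℝ) < 0 := by exact_mod_cast hpneg
      have : (p:ℝ) * (p * (y 1)^2 + 2 * q * y 1 * y 2 + r * (y 2)^2) = (p * y 1 + q * y 2)^2 + (y 2)^2 := by
        linear_combination (y 2)^2 * hdR
      have h5 : 0 ≤ (p:ℝ) * (p * (y 1)^2 + 2 * q * y 1 * y 2 + r * (y 2)^2) := by rw [this]; positivity
      nlinarith [sq_nonneg (y 0)]
end

section
open Matrix MeasureTheory

noncomputable def nM (x : ℝ) : Matrix (Fin 3) (Fin 3) ℝ := !![1,0,0; x,1,0; -x^2/2,-x,1]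
noncomputable def aM (q : ℝ) : Matrix (Fin 3) (Fin 3) ℝ := !![q,0,0; 0,1,0; 0,0,q⁻¹]
noncomputable def kM (ψ : ℝ) : Matrix (Fin 3) (Fin 3) ℝ :=
  !![(1+Real.cos ψ)/2, Real.sin ψ/√2, -(1-Real.cos ψ)/2;
     -(Real.sin ψ/√2), Real.cos ψ, -(Real.sin ψ/√2);
     -(1-Real.cos ψ)/2, Real.sin ψ/√2, (1+Real.cos ψ)/2]
noncomputable def nak (x q ψ : ℝ) : Matrix (Fin 3) (Fin 3) ℝ := nM x * aM q * kM ψ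

lemma kM_orth (ψ : ℝ) : kM ψ * (kM ψ)ᵀ = 1 := by
  have h2 : (Real.sin ψ / √2)^2 = (Real.sin ψ)^2/2 := by rw [div_pow, Real.sq_sqrt (by norm_num)]
  have h1 := Real.sin_sq_add_cos_sq ψ
  set s := Real.sin ψ / √2 with hs
  ext i j; fin_cases i <;> fin_cases j <;> simp [kM, Matrix.mul_apply, Fin.sum_univ_three, ← hs] <;> nlinarith

lemma kM_G (ψ : ℝ) : kM ψ * Gm ℝ * (kM ψ)ᵀ = Gm ℝ := by
  have h2 : (Real.sin ψ / √2)^2 = (Real.sin ψ)^2/2 := by rw [div_pow, Real.sq_sqrt (by norm_num)]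
  have h1 := Real.sin_sq_add_cos_sq ψ
  set s := Real.sin ψ / √2 with hs
  ext i j; fin_cases i <;> fin_cases j <;> simp [kM, Gm, Matrix.mul_apply, Fin.sum_univ_three, ← hs] <;> nlinarith

lemma nM_aM (x q : ℝ) (hq : q ≠ 0) : nM x * aM q = !![q,0,0; x*q,1,0; -x^2*q/2,-x,q⁻¹] := by
  ext i j; fin_cases i <;> fin_cases j <;> simp [nM, aM, Matrix.mul_apply, Fin.sum_univ_three] <;> field_simp

lemma nM_mul (x y : ℝ) : nM x * nM y = nM (x + y) := by
  ext i j; fin_cases i <;> fin_cases j <;> simp [nM, Matrix.mul_apply, Fin.sum_univ_three] <;> ring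

lemma finite_sublevel (h : Matrix (Fin 3) (Fin 3) ℝ) (hdh : |h.det| = 1) (C : ℝ) :
    Set.Finite {n : Fin 3 → ℤ | ((fun i => (n i : ℝ)) ᵥ* h) ⬝ᵥ ((fun i => (n i : ℝ)) ᵥ* h) ≤ C} := by
  have hhd : IsUnit h.det := by
    rw [isUnit_iff_ne_zero]; intro h0; rw [h0] at hdh; simp at hdh
  set B : ℝ := ∑ i, ∑ j, (C + 1) * |h⁻¹ i j| with hB
  refine (Set.finite_Icc (fun _ => -⌈B⌉) (fun _ => ⌈B⌉)).subset ?_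
  intro n hn
  set v := (fun i => (n i : ℝ)) ᵥ* h with hv
  have hvn : ∀ j, (n j : ℝ) = ∑ i, v i * h⁻¹ i j := by
    intro j
    have : v ᵥ* h⁻¹ = (fun i => (n i : ℝ)) := by
      rw [hv, Matrix.vecMul_vecMul, Matrix.mul_nonsing_inv _ hhd, Matrix.vecMul_one]
    have := congrFun this j
    simp only [Matrix.vecMul, dotProduct] at this
    exact this.symm
  have hvb : ∀ i, |v i| ≤ C + 1 := by
    intro i
    have h1 : v i * v i ≤ v ⬝ᵥ v := Finset.single_le_sum (f := fun i => v i * v i) (fun i _ => mul_self_nonneg _) (Finset.mem_univ i)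
    have h2 : v ⬝ᵥ v ≤ C := hn
    rw [abs_le]; constructor <;> nlinarith
  have hC : 0 ≤ C + 1 := (abs_nonneg _).trans (hvb 0)
  have hb : ∀ j, |(n j : ℝ)| ≤ B := by
    intro j
    rw [hvn j]
    refine (Finset.abs_sum_le_sum_abs _ _).trans (Finset.sum_le_sum fun i _ => ?_)
    rw [abs_mul]
    refine le_trans (mul_le_mul_of_nonneg_right (hvb i) (abs_nonneg _)) ?_
    exact Finset.single_le_sum (f := fun j => (C+1) * |h⁻¹ i j|) (fun j _ => by positivity) (Finset.mem_univ j)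
  constructor <;> intro j
  · have := (abs_le.1 (hb j)).1
    have h3 : (-⌈B⌉ : ℝ) ≤ n j := by linarith [Int.le_ceil B]
    exact_mod_cast h3
  · have := (abs_le.1 (hb j)).2
    have h3 : (n j : ℝ) ≤ ⌈B⌉ := by linarith [Int.le_ceil B]
    exact_mod_cast h3

lemma exists_min_isotropic (h : Matrix (Fin 3) (Fin 3) ℝ) (Sg : Matrix (Fin 3) (Fin 3) ℤ)
    (hG : h * Gm ℝ * hᵀ = Sg.map (Int.cast : ℤ → ℝ)) (hd : Sg.det = -1) :
    ∃ n : Fin 3 → ℤ, n ≠ 0 ∧ bv Sg n n = 0 ∧ ∀ m : Fin 3 → ℤ, m ≠ 0 → bv Sg m m = 0 →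
      ((fun i => (n i : ℝ)) ᵥ* h) ⬝ᵥ ((fun i => (n i : ℝ)) ᵥ* h) ≤
      ((fun i => (m i : ℝ)) ᵥ* h) ⬝ᵥ ((fun i => (m i : ℝ)) ᵥ* h) := by
  obtain ⟨n₀, h0, h1⟩ := exists_isotropic h Sg hG hd
  set P : (Fin 3 → ℤ) → ℝ := fun n => ((fun i => (n i : ℝ)) ᵥ* h) ⬝ᵥ ((fun i => (n i : ℝ)) ᵥ* h)
  have hfin := (finite_sublevel h (abs_det_of_gram h Sg hG hd) (P n₀)).inter_of_left {n | n ≠ 0 ∧ bv Sg n n = 0}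
  obtain ⟨n, ⟨hn1, hn2⟩, hn3⟩ := Set.exists_min_image _ P hfin ⟨n₀, le_refl (P n₀), h0, h1⟩
  refine ⟨n, hn2.1, hn2.2, fun m hm0 hm => ?_⟩
  by_cases hc : P m ≤ P n₀
  · exact hn3 m ⟨hc, hm0, hm⟩
  · exact le_trans hn1 (not_le.1 hc).le

lemma exists_bezout (n : Fin 3 → ℤ) (hn : n ≠ 0) : ∃ (g : ℤ) (n' ξ : Fin 3 → ℤ), g ≠ 0 ∧ n = g • n' ∧
    ξ 0 * n' 0 + ξ 1 * n' 1 + ξ 2 * n' 2 = 1 := by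
  obtain ⟨g, hg⟩ := (IsPrincipalIdealRing.principal (Ideal.span (Set.range n))).principal
  have hm : ∀ i, ∃ k, n i = g * k := by
    intro i
    have : n i ∈ Ideal.span (Set.range n) := Ideal.subset_span ⟨i, rfl⟩
    rw [hg] at this
    obtain ⟨k, hk⟩ := Ideal.mem_span_singleton'.1 this
    exact ⟨k, by rw [← hk]; ring⟩
  choose n' hn' using hm
  have hgm : g ∈ Ideal.span (Set.range n) := by rw [hg]; exact Ideal.mem_span_singleton_self g
  obtain ⟨ξ, hξ⟩ := (Ideal.mem_span_range_iff_exists_fun).1 hgm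
  have hg0 : g ≠ 0 := by
    rintro rfl
    apply hn; ext i; simp [hn' i]
  refine ⟨g, n', ξ, hg0, by ext i; simp [hn' i], ?_⟩
  rw [Fin.sum_univ_three, hn', hn', hn'] at hξ
  apply mul_left_cancel₀ hg0; linarith

lemma exists_G_basis (Sg : Matrix (Fin 3) (Fin 3) ℤ) (hsym : Sgᵀ = Sg) (hd : Sg.det = -1) (n ξ : Fin 3 → ℤ)
    (hn : bv Sg n n = 0) (hξ : ξ 0 * n 0 + ξ 1 * n 1 + ξ 2 * n 2 = 1) :
    ∃ U : Matrix (Fin 3) (Fin 3) ℤ, U 0 = n ∧ U * Sg * Uᵀ = Gm ℤ := by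
  have hs : ∀ i j, Sg i j = Sg j i := fun i j => by rw [← Matrix.transpose_apply Sg j i, hsym]
  have key : ∀ (U : Matrix (Fin 3) (Fin 3) ℤ) i j, (U * Sg * Uᵀ) i j = bv Sg (U i) (U j) := by
    intro U i j
    simp [Matrix.mul_apply, bv_expand, Fin.sum_univ_three]; ring
  suffices H : ∃ e w : Fin 3 → ℤ, bv Sg n e = 0 ∧ bv Sg n w = 1 ∧ bv Sg e e = 1 ∧ bv Sg e w = 0 ∧ bv Sg w w = 0 by
    obtain ⟨e, w, h1, h2, h3, h4, h5⟩ := H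
    refine ⟨Matrix.of ![n, e, w], rfl, ?_⟩
    have r0 : Matrix.of ![n, e, w] 0 = n := rfl
    have r1 : Matrix.of ![n, e, w] 1 = e := rfl
    have r2 : Matrix.of ![n, e, w] 2 = w := rfl
    ext i j
    rw [key]
    fin_cases i <;> fin_cases j <;> simp [r0, r1, r2, Gm, h1, h2, h3, h4, h5, hn, bv_symm Sg hsym e n, bv_symm Sg hsym w n, bv_symm Sg hsym w e]
  have add1 : ∀ (u v w : Fin 3 → ℤ) (k : ℤ), bv Sg (u + k • v) w = bv Sg u w + k * bv Sg v w := by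
    intro u v w k; simp only [bv_expand, Pi.add_apply, Pi.smul_apply, smul_eq_mul]; ring
  have add2 : ∀ (u v w : Fin 3 → ℤ) (k : ℤ), bv Sg w (u + k • v) = bv Sg w u + k * bv Sg w v := by
    intro u v w k; simp only [bv_expand, Pi.add_apply, Pi.smul_apply, smul_eq_mul]; ring
  -- even case suffices
  suffices H : ∃ e w : Fin 3 → ℤ, bv Sg n e = 0 ∧ bv Sg n w = 1 ∧ bv Sg e e = 1 ∧ bv Sg e w = 0 by
    obtain ⟨e, w, h1, h2, h3, h4⟩ := H
    have h1' : bv Sg e n = 0 := by rw [bv_symm Sg hsym]; exact h1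
    have h2' : bv Sg w n = 1 := by rw [bv_symm Sg hsym]; exact h2
    have h4' : bv Sg w e = 0 := by rw [bv_symm Sg hsym]; exact h4
    rcases Int.even_or_odd' (bv Sg w w) with ⟨t, ht | ht⟩
    · exact ⟨e, w + (-t) • n, h1, by rw [add2, h2, hn]; ring, h3, by rw [add2, h4, h1']; ring,
        by rw [add1, add2, add2, h2, h2', hn, ht]; ring⟩
    · refine ⟨e + (-1 : ℤ) • n, (w + (1:ℤ) • e) + (-(t+1)) • n, ?_, ?_, ?_, ?_, ?_⟩ <;>
        simp only [add1, add2, h1, h2, h3, h4, h1', h2', h4', hn, ht] <;> ring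
  set w : Fin 3 → ℤ := -(Sg.adjugate *ᵥ ξ) with hw
  have hSw : Sg *ᵥ w = ξ := by
    rw [hw, Matrix.mulVec_neg, Matrix.mulVec_mulVec, Matrix.mul_adjugate, hd, neg_one_smul,
      Matrix.neg_mulVec, Matrix.one_mulVec, neg_neg]
  have hnw : bv Sg n w = 1 := by
    rw [bv, hSw]; simp [dotProduct, Fin.sum_univ_three]; linarith
  set x := Sg *ᵥ n with hx
  set y := Sg *ᵥ w with hy
  have hxi : ∀ i, x i = Sg i 0 * n 0 + Sg i 1 * n 1 + Sg i 2 * n 2 := by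
    intro i; simp [hx, Matrix.mulVec, dotProduct, Fin.sum_univ_three]
  have hyi : ∀ i, y i = Sg i 0 * w 0 + Sg i 1 * w 1 + Sg i 2 * w 2 := by
    intro i; simp [hy, Matrix.mulVec, dotProduct, Fin.sum_univ_three]
  refine ⟨![x 1 * y 2 - x 2 * y 1, x 2 * y 0 - x 0 * y 2, x 0 * y 1 - x 1 * y 0], w, ?_, hnw, ?_, ?_⟩
  · rw [bv_symm Sg hsym, bv, ← hx]; simp [dotProduct, Fin.sum_univ_three]; ring
  · have e1 : bv Sg ![x 1 * y 2 - x 2 * y 1, x 2 * y 0 - x 0 * y 2, x 0 * y 1 - x 1 * y 0] ![x 1 * y 2 - x 2 * y 1, x 2 * y 0 - x 0 * y 2, x 0 * y 1 - x 1 * y 0]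
      = Sg.det * (bv Sg n n * bv Sg w w - (bv Sg n w)^2) := by
      simp only [bv_expand, Matrix.det_fin_three, hxi, hyi]
      simp
      rw [hs 1 0, hs 2 0, hs 2 1]
      ring
    rw [e1, hd, hn, hnw]; ring
  · rw [bv, ← hy]; simp [dotProduct, Fin.sum_univ_three]; ring
end

section
open Matrix MeasureTheory

lemma Gm_apply_mul (g : Matrix (Fin 3) (Fin 3) ℝ) (i j : Fin 3) :
    (g * Gm ℝ * gᵀ) i j = g i 0 * g j 2 + g i 1 * g j 1 + g i 2 * g j 0 := by
  simp [Gm, Matrix.mul_apply, Fin.sum_univ_three]; ring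

lemma iwasawa (g : Matrix (Fin 3) (Fin 3) ℝ) (hg : g * Gm ℝ * gᵀ = Gm ℝ) :
    ∃ ε δ : ℤ, (ε = 1 ∨ ε = -1) ∧ (δ = 1 ∨ δ = -1) ∧ ∃ x q ψ : ℝ, 0 < q ∧ 0 ≤ ψ ∧ ψ ≤ 2 * Real.pi ∧
      (!![ε,0,0;0,δ,0;0,0,ε]).map (Int.cast : ℤ → ℝ) * g = nak x q ψ := by
  have E : ∀ i j, g i 0 * g j 2 + g i 1 * g j 1 + g i 2 * g j 0 = Gm ℝ i j :=
    fun i j => by rw [← Gm_apply_mul, hg]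
  have e00 := E 0 0
  have e02 := E 0 2
  simp [Gm] at e00 e02
  -- choose sign
  have hq0 : g 0 0 - g 0 2 ≠ 0 := by
    intro h
    have h1 : g 0 0 = g 0 2 := by linarith
    rw [h1] at e00 e02
    have h2 : g 0 2 = 0 := by nlinarith [sq_nonneg (g 0 1), sq_nonneg (g 0 2)]
    have h3 : g 0 1 = 0 := by rw [h2] at e00; nlinarith
    rw [h2, h3] at e02; norm_num at e02
  obtain ⟨ε, hε, hq⟩ : ∃ ε : ℤ, (ε = 1 ∨ ε = -1) ∧ 0 < (ε:ℝ) * (g 0 0 - g 0 2) := by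
    rcases lt_or_gt_of_ne hq0 with h | h
    · exact ⟨-1, Or.inr rfl, by push_cast; linarith⟩
    · exact ⟨1, Or.inl rfl, by push_cast; linarith⟩
  have hεε : (ε:ℝ) * ε = 1 := by rcases hε with h | h <;> rw [h] <;> norm_num
  set q := (ε:ℝ) * (g 0 0 - g 0 2) with hqd
  set c := (ε:ℝ) * (g 0 0 + g 0 2) / q with hc
  set s := (ε:ℝ) * (√2 * g 0 1) / q with hs
  have hs2 : √2 ^ 2 = (2:ℝ) := Real.sq_sqrt (by norm_num)
  have hcs : c^2 + s^2 = 1 := by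
    rw [hc, hs, div_pow, div_pow, ← add_div, div_eq_one_iff_eq (by positivity), hqd]
    linear_combination (2 * (ε:ℝ)^2) * e00 + (ε:ℝ)^2 * (g 0 1)^2 * hs2
  obtain ⟨ψ, hψ0, hψ1, hψc, hψs⟩ : ∃ ψ : ℝ, 0 ≤ ψ ∧ ψ ≤ 2 * Real.pi ∧ Real.cos ψ = c ∧ Real.sin ψ = s := by
    have hz : ‖(⟨c, s⟩ : ℂ)‖ = 1 := by
      rw [Complex.norm_eq_sqrt_sq_add_sq]; simp [hcs]
    have h1 := Complex.cos_arg (x := ⟨c,s⟩) (by intro h; rw [h] at hz; simp at hz)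
    have h2 := Complex.sin_arg (⟨c,s⟩ : ℂ)
    rw [hz] at h1 h2
    simp at h1 h2
    have hb1 := Complex.neg_pi_lt_arg (⟨c,s⟩ : ℂ)
    have hb2 := Complex.arg_le_pi (⟨c,s⟩ : ℂ)
    by_cases h0 : 0 ≤ Complex.arg ⟨c,s⟩
    · exact ⟨_, h0, by linarith, h1, h2⟩
    · refine ⟨Complex.arg ⟨c,s⟩ + 2 * Real.pi, by linarith, by linarith, ?_, ?_⟩
      · rw [Real.cos_add_two_pi, h1]
      · rw [Real.sin_add_two_pi, h2]
  set m := g * (kM ψ)ᵀ with hm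
  have hko := kM_orth ψ
  have hko' : (kM ψ)ᵀ * kM ψ = 1 := mul_eq_one_comm.1 hko
  have hmk : g = m * kM ψ := by rw [hm, mul_assoc, hko', mul_one]
  have hkG : (kM ψ)ᵀ * Gm ℝ * kM ψ = Gm ℝ := by
    calc (kM ψ)ᵀ * Gm ℝ * kM ψ = (kM ψ)ᵀ * (kM ψ * Gm ℝ * (kM ψ)ᵀ) * kM ψ := by rw [kM_G]
      _ = ((kM ψ)ᵀ * kM ψ) * Gm ℝ * ((kM ψ)ᵀ * kM ψ) := by simp only [mul_assoc]
      _ = Gm ℝ := by rw [hko']; simp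
  have hmG : m * Gm ℝ * mᵀ = Gm ℝ := by
    rw [hm, Matrix.transpose_mul, Matrix.transpose_transpose]
    calc g * (kM ψ)ᵀ * Gm ℝ * (kM ψ * gᵀ) = g * ((kM ψ)ᵀ * Gm ℝ * kM ψ) * gᵀ := by simp only [mul_assoc]
      _ = Gm ℝ := by rw [hkG, hg]
  have hcq : c * q = ε * (g 0 0 + g 0 2) := by rw [hc]; field_simp
  have hsq : s * q = ε * (√2 * g 0 1) := by rw [hs]; field_simp
  have h2 : √2 ≠ 0 := by positivity
  set s' := s / √2 with hs'
  have hs'q : s' * q = ε * g 0 1 := by rw [hs', div_mul_eq_mul_div, hsq]; field_simp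
  have hs's : 2 * s'^2 = s^2 := by rw [hs', div_pow, hs2]; ring
  have h00 : g 0 0 = ε * q * (1 + c) / 2 := by
    linear_combination (-(ε:ℝ)/2) * hcq - ((ε:ℝ)/2) * hqd - (g 0 0) * hεε
  have h02 : g 0 2 = -(ε * q * (1 - c) / 2) := by
    linear_combination (-(ε:ℝ)/2) * hcq + ((ε:ℝ)/2) * hqd - (g 0 2) * hεε
  have h01 : g 0 1 = ε * q * s' := by
    linear_combination (-(ε:ℝ)) * hs'q - (g 0 1) * hεε
  have mi : ∀ i, m i 0 = g i 0 * ((1+c)/2) + g i 1 * s' + g i 2 * (-(1-c)/2) ∧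
      m i 1 = g i 0 * (-s') + g i 1 * c + g i 2 * (-s') ∧
      m i 2 = g i 0 * (-(1-c)/2) + g i 1 * s' + g i 2 * ((1+c)/2) := by
    intro i
    simp only [hm, Matrix.mul_apply, Fin.sum_univ_three, Matrix.transpose_apply, kM, hψc, hψs, ← hs']
    simp
  have m00 : m 0 0 = ε * q := by
    rw [(mi 0).1, h00, h01, h02]; linear_combination (ε * q / 2) * hs's + (ε * q/2) * hcs
  have m01 : m 0 1 = 0 := by
    rw [(mi 0).2.1, h00, h01, h02]; ring
  have m02 : m 0 2 = 0 := by
    rw [(mi 0).2.2, h00, h01, h02]; linear_combination (ε * q / 2) * hs's + (ε * q/2) * hcs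
  have F : ∀ i j, m i 0 * m j 2 + m i 1 * m j 1 + m i 2 * m j 0 = Gm ℝ i j :=
    fun i j => by rw [← Gm_apply_mul, hmG]
  have f01 := F 0 1
  have f02 := F 0 2
  have f11 := F 1 1
  have f12 := F 1 2
  have f22 := F 2 2
  simp [Gm, m00, m01, m02] at f01 f02 f11 f12 f22
  have hε0 : (ε:ℝ) ≠ 0 := by intro h; rw [h] at hεε; simp at hεε
  have m12 : m 1 2 = 0 := by
    rcases f01 with (h | h) | h
    · rw [h] at hε; norm_num at hε
    · exact absurd h hq.ne'
    · exact h
  rw [m12] at f11 f12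
  obtain ⟨δ, hδ, hδm⟩ : ∃ δ : ℤ, (δ = 1 ∨ δ = -1) ∧ m 1 1 = δ := by
    have : (m 1 1 - 1) * (m 1 1 + 1) = 0 := by linarith
    rcases mul_eq_zero.1 this with h | h
    · exact ⟨1, Or.inl rfl, by push_cast; linarith⟩
    · exact ⟨-1, Or.inr rfl, by push_cast; linarith⟩
  have hδδ : (δ:ℝ) * δ = 1 := by rcases hδ with h | h <;> rw [h] <;> norm_num
  have m22 : m 2 2 = ε * q⁻¹ := by
    field_simp; linear_combination (ε:ℝ) * f02 - q * m 2 2 * hεε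
  refine ⟨ε, δ, hε, hδ, δ * m 1 0 / q, q, ψ, hq, hψ0, hψ1, ?_⟩
  rw [nak, hmk, ← mul_assoc]
  congr 1
  rw [nM_aM _ _ hq.ne']
  have m21 : m 2 1 = -(δ * ε * m 1 0 / q) := by
    rw [m22, hδm] at f12
    field_simp
    field_simp at f12
    linear_combination δ * f12 - m 2 1 * q * hδδ
  have m20 : m 2 0 = -(ε * (m 1 0)^2/(2 * q)) := by
    rw [m22, m21] at f22
    field_simp
    field_simp at f22
    linear_combination ε * f22 - (2 * m 2 0 * q + ε * (m 1 0)^2) * hεε - ε * ε * ε * (m 1 0)^2 * hδδ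
  ext i j
  fin_cases i <;> fin_cases j <;> simp [Matrix.mul_apply, Fin.sum_univ_three, m00, m01, m02, m12, hδm, m22, m21, m20]
  all_goals try (field_simp)
  all_goals
    have e2 : (ε:ℝ)^2 = 1 := by rw [sq]; exact hεε
    have d2 : (δ:ℝ)^2 = 1 := by rw [sq]; exact hδδ
    simp [e2, d2]

lemma map_cast_mul (A B : Matrix (Fin 3) (Fin 3) ℤ) :
    (A * B).map (Int.cast : ℤ → ℝ) = A.map (Int.cast : ℤ → ℝ) * B.map (Int.cast : ℤ → ℝ) := by
  ext i j; simp [Matrix.mul_apply]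

lemma nak_row0 (x q ψ : ℝ) (hq : q ≠ 0) : (nak x q ψ) 0 ⬝ᵥ (nak x q ψ) 0 = q^2 := by
  have h2 : (nak x q ψ * (nak x q ψ)ᵀ) 0 0 = q^2 := by
    rw [nak, Matrix.transpose_mul, mul_assoc, ← mul_assoc (kM ψ), kM_orth, one_mul, nM_aM _ _ hq]
    simp [Matrix.mul_apply, Fin.sum_univ_three]; ring
  rw [← h2]; simp [Matrix.mul_apply, dotProduct]

lemma nak_row2 (x q ψ : ℝ) (hq : q ≠ 0) : (nak x q ψ) 2 ⬝ᵥ (nak x q ψ) 2 = (x^2*q/2 + q⁻¹)^2 := by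
  have h2 : (nak x q ψ * (nak x q ψ)ᵀ) 2 2 = (x^2*q/2 + q⁻¹)^2 := by
    rw [nak, Matrix.transpose_mul, mul_assoc, ← mul_assoc (kM ψ), kM_orth, one_mul, nM_aM _ _ hq]
    simp [Matrix.mul_apply, Fin.sum_univ_three]; field_simp; ring
  rw [← h2]; simp [Matrix.mul_apply, dotProduct]

/-- Reduction theory for unimodular ternary forms of signature (2,1). -/
theorem red (h : Matrix (Fin 3) (Fin 3) ℝ) (Sg : Matrix (Fin 3) (Fin 3) ℤ)
    (hG : h * Gm ℝ * hᵀ = Sg.map (Int.cast : ℤ → ℝ)) (hd : Sg.det = -1) :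
    ∃ U : Matrix (Fin 3) (Fin 3) ℤ, U * Sg * Uᵀ = Gm ℤ ∧ ∃ x q ψ : ℝ, 0 < q ∧ |x| ≤ 1 ∧
      q^2 * (1 - x^2/2) ≤ 1 ∧ 0 ≤ ψ ∧ ψ ≤ 2 * Real.pi ∧ U.map (Int.cast : ℤ → ℝ) * h = nak x q ψ := by
  have hsym := sym_of_gram h Sg hG
  obtain ⟨n, hn0, hn1, hmin⟩ := exists_min_isotropic h Sg hG hd
  set P : (Fin 3 → ℤ) → ℝ := fun n => ((fun i => (n i : ℝ)) ᵥ* h) ⬝ᵥ ((fun i => (n i : ℝ)) ᵥ* h) with hP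
  obtain ⟨g, n', ξ, hg0, hnn, hξ⟩ := exists_bezout n hn0
  have hn'0 : n' ≠ 0 := by rintro rfl; simp at hξ
  have hn'1 : bv Sg n' n' = 0 := by
    have : bv Sg n n = g * g * bv Sg n' n' := by
      rw [hnn]; simp only [bv_expand, Pi.smul_apply, smul_eq_mul]; ring
    rw [hn1] at this
    simpa [hg0] using this.symm
  have hP0 : ∀ m, 0 ≤ P m := fun m => Finset.sum_nonneg fun i _ => mul_self_nonneg _
  have hPn' : P n' ≤ P n := by
    have : P n = (g:ℝ)^2 * P n' := by
      simp only [hP, hnn]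
      have : (fun i => (((g • n') i : ℤ) : ℝ)) = (g:ℝ) • (fun i => (n' i : ℝ)) := by
        ext i; simp
      rw [this, Matrix.smul_vecMul, smul_dotProduct, dotProduct_smul]; simp; ring
    rw [this]
    have h1 : (1:ℝ) ≤ (g:ℝ)^2 := by
      have : 1 ≤ g^2 := by have := sq_pos_of_ne_zero hg0; linarith
      exact_mod_cast this
    nlinarith [hP0 n']
  have hmin' : ∀ m, m ≠ 0 → bv Sg m m = 0 → P n' ≤ P m := fun m h1 h2 => hPn'.trans (hmin m h1 h2)
  obtain ⟨U, hU0, hU⟩ := exists_G_basis Sg hsym hd n' ξ hn'1 hξ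
  set UR := U.map (Int.cast : ℤ → ℝ) with hUR
  have hGZ : (Gm ℤ).map (Int.cast : ℤ → ℝ) = Gm ℝ := by
    ext i j; fin_cases i <;> fin_cases j <;> simp [Gm]
  have hgen : ∀ V : Matrix (Fin 3) (Fin 3) ℤ, V * Sg * Vᵀ = Gm ℤ →
      (V.map (Int.cast : ℤ → ℝ) * h) * Gm ℝ * (V.map (Int.cast : ℤ → ℝ) * h)ᵀ = Gm ℝ := by
    intro V hV
    conv_rhs => rw [← hGZ, ← hV, map_cast_mul, map_cast_mul, ← hG, Matrix.transpose_map]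
    rw [Matrix.transpose_mul]
    simp only [mul_assoc]
  obtain ⟨ε, δ, hε, hδ, x, q, ψ, hq, hψ0, hψ1, hdec⟩ := iwasawa _ (hgen U hU)
  obtain ⟨k, hk⟩ : ∃ k : ℤ, |x + 2 * k| ≤ 1 := by
    refine ⟨-round (x/2), ?_⟩
    have := abs_sub_round (x/2)
    push_cast
    rw [abs_le] at this ⊢
    constructor <;> linarith [this.1, this.2]
  set D : Matrix (Fin 3) (Fin 3) ℤ := !![ε,0,0;0,δ,0;0,0,ε] with hD
  set S : Matrix (Fin 3) (Fin 3) ℤ := !![1,0,0;2*k,1,0;-2*k^2,-(2*k),1] with hS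
  have hεε : ε * ε = 1 := by rcases hε with h | h <;> rw [h] <;> norm_num
  have hδδ : δ * δ = 1 := by rcases hδ with h | h <;> rw [h] <;> norm_num
  have hDG : D * Gm ℤ * Dᵀ = Gm ℤ := by
    ext i j; fin_cases i <;> fin_cases j <;> simp [hD, Gm, Matrix.mul_apply, Fin.sum_univ_three, hεε, hδδ]
  have hSG : S * Gm ℤ * Sᵀ = Gm ℤ := by
    ext i j; fin_cases i <;> fin_cases j <;> simp [hS, Gm, Matrix.mul_apply, Fin.sum_univ_three] <;> ring
  have hSn : S.map (Int.cast : ℤ → ℝ) = nM (2 * k) := by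
    ext i j; fin_cases i <;> fin_cases j <;> simp [hS, nM] <;> ring
  have hV : (S * D * U) * Sg * (S * D * U)ᵀ = Gm ℤ := by
    calc (S * D * U) * Sg * (S * D * U)ᵀ = S * (D * (U * Sg * Uᵀ) * Dᵀ) * Sᵀ := by
          simp only [Matrix.transpose_mul, mul_assoc]
      _ = _ := by rw [hU, hDG, hSG]
  have hVh : (S * D * U).map (Int.cast : ℤ → ℝ) * h = nak (x + 2 * k) q ψ := by
    rw [map_cast_mul, map_cast_mul, hSn, mul_assoc, mul_assoc, hdec, nak, nak, ← mul_assoc, ← mul_assoc, nM_mul,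
      add_comm]
  refine ⟨S * D * U, hV, x + 2 * k, q, ψ, hq, hk, ?_, hψ0, hψ1, hVh⟩
  set V := S * D * U with hVd
  have rowP : ∀ i, P (V i) = (nak (x + 2 * k) q ψ) i ⬝ᵥ (nak (x + 2 * k) q ψ) i := by
    intro i; rw [← hVh]; rfl
  have hr0 : P (V 0) = P n' := by
    have : V 0 = ε • n' := by
      rw [← hU0]; ext j; simp [hVd, hS, hD, Matrix.vecMul, dotProduct, Fin.sum_univ_three]
    have e1 : (fun i => (((ε • n') i : ℤ) : ℝ)) = (ε:ℝ) • (fun i => (n' i : ℝ)) := by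
        ext i; simp
    have e2 : (ε:ℝ) * ε = 1 := by exact_mod_cast hεε
    simp only [hP]
    rw [this, e1, Matrix.smul_vecMul, smul_dotProduct, dotProduct_smul, smul_smul, e2, one_smul]
  have key : ∀ i j, (V * Sg * Vᵀ) i j = bv Sg (V i) (V j) := by
    intro i j
    simp [Matrix.mul_apply, bv_expand, Fin.sum_univ_three]; ring
  have hm := hmin' (V 2) (by
    intro h0
    have := key 2 0
    rw [hV, h0] at this
    simp [bv_expand, Gm] at this) (by rw [← key, hV]; simp [Gm])
  rw [← hr0, rowP, rowP, nak_row0 _ _ _ hq.ne', nak_row2 _ _ _ hq.ne'] at hm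
  set X := x + 2 * (k:ℝ)
  have h1 : q ≤ X^2 * q / 2 + q⁻¹ := by
    exact (sq_le_sq₀ hq.le (by positivity)).1 hm
  have h2 : q * q ≤ (X^2 * q / 2 + q⁻¹) * q := by gcongr
  have h3 : q⁻¹ * q = 1 := inv_mul_cancel₀ hq.ne'
  nlinarith
end

section
open Matrix MeasureTheory

abbrev I9 := Fin 3 × Fin 3

noncomputable def Sm (a b d : ℝ) : Matrix (Fin 3) (Fin 3) ℝ := !![0,0,1; 1,0,-a/2; 0,d,-b/2]
noncomputable def Psi (p : I9 → ℝ) : I9 → ℝ := fun ij =>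
  (nak (p (0,1)) (p (1,1)) (p (2,1)) * Sm (p (0,0)) (p (1,0)) (p (2,0)) *
    (nak (p (0,2)) (p (1,2)) (p (2,2)))ᵀ) ij.1 ij.2

noncomputable def slm (h e f : ℝ) : Matrix (Fin 3) (Fin 3) ℝ := !![h,e,0; f,0,-e; 0,-f,-h]
noncomputable def dSm (a b d : ℝ) : Matrix (Fin 3) (Fin 3) ℝ := !![0,0,0; 0,0,-a/2; 0,d,-b/2]
noncomputable def Mo (q ψ : ℝ) : Matrix (Fin 3) (Fin 3) ℝ :=
  !![-(Real.sin ψ/√2)*q, Real.cos ψ * q⁻¹, 0;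
    (Real.cos ψ - 1)/2*q, (Real.sin ψ/√2)*q⁻¹, 1/√2;
    (1 + Real.cos ψ)/2*q, (Real.sin ψ/√2)*q⁻¹, -(1/√2)]

lemma det_Mo_aux (s r c q q' : ℝ) (h : 2*s^2 + c^2 = 1) (hq : q*q' = 1) :
    Matrix.det !![-s*q, c*q', 0; (c-1)/2*q, s*q', r; (1+c)/2*q, s*q', -r] = r := by
  simp only [Matrix.det_fin_three, Matrix.of_apply, Matrix.cons_val]
  linear_combination (r * (2*s^2+c^2)) * hq + r * h

lemma det_Mo (q ψ : ℝ) (hq : q ≠ 0) : (Mo q ψ).det = 1/√2 := by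
  have h2 : (Real.sin ψ / √2)^2 = (Real.sin ψ)^2/2 := by rw [div_pow, Real.sq_sqrt (by norm_num)]
  have h1 := Real.sin_sq_add_cos_sq ψ
  exact det_Mo_aux _ _ _ _ _ (by rw [h2]; linarith) (mul_inv_cancel₀ hq)

lemma slm_add (h e f h' e' f' : ℝ) : slm (h+h') (e+e') (f+f') = slm h e f + slm h' e' f' := by
  ext i j; fin_cases i <;> fin_cases j <;> simp [slm] <;> ring
lemma slm_smul (c h e f : ℝ) : slm (c*h) (c*e) (c*f) = c • slm h e f := by
  ext i j; fin_cases i <;> fin_cases j <;> simp [slm]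
lemma dSm_add (h e f h' e' f' : ℝ) : dSm (h+h') (e+e') (f+f') = dSm h e f + dSm h' e' f' := by
  ext i j; fin_cases i <;> fin_cases j <;> simp [dSm] <;> ring
lemma dSm_smul (c h e f : ℝ) : dSm (c*h) (c*e) (c*f) = c • dSm h e f := by
  ext i j; fin_cases i <;> fin_cases j <;> simp [dSm] <;> ring

/-- T as a linear map in the Lie algebra coordinates -/
noncomputable def Tl (a b d : ℝ) : (I9 → ℝ) →ₗ[ℝ] (I9 → ℝ) where
  toFun v := fun ij => (slm (v (0,1)) (v (1,1)) (v (2,1)) * Sm a b d + dSm (v (0,0)) (v (1,0)) (v (2,0))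
    + Sm a b d * (slm (v (0,2)) (v (1,2)) (v (2,2)))ᵀ) ij.1 ij.2
  map_add' u v := by
    ext ⟨i, j⟩
    simp only [Pi.add_apply, slm_add, dSm_add, Matrix.add_mul, Matrix.mul_add, Matrix.transpose_add, Matrix.add_apply]
    ring
  map_smul' c v := by
    ext ⟨i, j⟩
    simp only [Pi.smul_apply, smul_eq_mul, slm_smul, dSm_smul, Matrix.smul_mul, Matrix.mul_smul, Matrix.transpose_smul, Matrix.add_apply, Matrix.smul_apply, RingHom.id_apply]
    ring

lemma Tl_eq (a b d : ℝ) (v : I9 → ℝ) (ij : I9) : Tl a b d v ij =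
   (!![v (1,1), -v (1,2), v (0,1) - v (1,1)*a/2 - v (0,2);
      v (0,2), -v (1,1)*d + v (2,2) + a*v (1,2)/2, v (2,1) + v (1,1)*b/2 + a*v (0,2)/2 - v (0,0)/2;
      -v (2,1) + d * v (1,2), -v (0,1)*d + b*v (1,2)/2 + v (2,0),
        v (2,1)*a/2 + v (0,1)*b/2 - d*v (2,2) + b*v (0,2)/2 - v (1,0)/2] : Matrix (Fin 3) (Fin 3) ℝ) ij.1 ij.2 := by
  obtain ⟨i, j⟩ := ij
  change (slm (v (0,1)) (v (1,1)) (v (2,1)) * Sm a b d + dSm (v (0,0)) (v (1,0)) (v (2,0))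
    + Sm a b d * (slm (v (0,2)) (v (1,2)) (v (2,2)))ᵀ) i j = _
  rw [Matrix.add_apply, Matrix.add_apply, Matrix.mul_apply, Matrix.mul_apply]
  simp only [Fin.sum_univ_three, Matrix.transpose_apply, slm, Sm, dSm]
  fin_cases i <;> fin_cases j <;> simp <;> ring

def rowOrd : Fin 9 → I9 := ![(0,0),(1,0),(0,1),(2,0),(0,2),(1,1),(2,1),(1,2),(2,2)]
def colOrd : Fin 9 → I9 := ![(1,1),(0,2),(1,2),(2,1),(0,1),(2,2),(2,0),(0,0),(1,0)]

lemma rowOrd_bij : Function.Bijective rowOrd := by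
  rw [Fintype.bijective_iff_injective_and_card]; exact ⟨by decide, by decide⟩
lemma colOrd_bij : Function.Bijective colOrd := by
  rw [Fintype.bijective_iff_injective_and_card]; exact ⟨by decide, by decide⟩

lemma det_Tl (a b d : ℝ) : |(LinearMap.toMatrix' (Tl a b d)).det| = 1/4 := by
  set M := LinearMap.toMatrix' (Tl a b d) with hM
  rw [← Matrix.abs_det_submatrix_equiv_equiv (Equiv.ofBijective _ rowOrd_bij) (Equiv.ofBijective _ colOrd_bij)]
  have hT : (M.submatrix (Equiv.ofBijective _ rowOrd_bij) (Equiv.ofBijective _ colOrd_bij)).BlockTriangular OrderDual.toDual := by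
    intro i j hij
    have hij' : i < j := hij
    simp only [Matrix.submatrix_apply, Equiv.ofBijective_apply, hM, LinearMap.toMatrix'_apply]
    revert hij'
    clear hij
    fin_cases i <;> fin_cases j <;> intro h <;> first | (exfalso; revert h; decide) | skip
    all_goals simp [Tl_eq, rowOrd, colOrd, Pi.single_apply]
  rw [Matrix.det_of_lowerTriangular _ hT]
  simp only [Matrix.submatrix_apply, Equiv.ofBijective_apply, hM, LinearMap.toMatrix'_apply]
  simp [Fin.prod_univ_succ, Tl_eq, rowOrd, colOrd, Pi.single_apply]
  norm_num
end

section
open Matrix MeasureTheory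

def MD (A : ℝ → Matrix (Fin 3) (Fin 3) ℝ) (A' : Matrix (Fin 3) (Fin 3) ℝ) : Prop :=
  ∀ i j, HasDerivAt (fun t => A t i j) (A' i j) 0

lemma MD.mul {A B : ℝ → Matrix (Fin 3) (Fin 3) ℝ} {A' B' : Matrix (Fin 3) (Fin 3) ℝ}
    (hA : MD A A') (hB : MD B B') : MD (fun t => A t * B t) (A' * B 0 + A 0 * B') := by
  intro i j
  simp only [Matrix.mul_apply, Matrix.add_apply, ← Finset.sum_add_distrib]
  exact HasDerivAt.fun_sum fun k _ => (hA i k).mul (hB k j)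

lemma MD.tr {A : ℝ → Matrix (Fin 3) (Fin 3) ℝ} {A' : Matrix (Fin 3) (Fin 3) ℝ}
    (hA : MD A A') : MD (fun t => (A t)ᵀ) A'ᵀ := fun i j => hA j i

noncomputable def Fh : Matrix (Fin 3) (Fin 3) ℝ := !![0,0,0;1,0,0;0,-1,0]
noncomputable def Hh : Matrix (Fin 3) (Fin 3) ℝ := !![1,0,0;0,0,0;0,0,-1]
noncomputable def Zh : Matrix (Fin 3) (Fin 3) ℝ := !![0,1/√2,0;-(1/√2),0,-(1/√2);0,1/√2,0]

lemma lin_deriv (x v : ℝ) : HasDerivAt (fun t : ℝ => x + t * v) v 0 := by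
  simpa using ((hasDerivAt_id (0:ℝ)).mul_const v).const_add x

lemma MD_nM (x v : ℝ) : MD (fun t => nM (x + t * v)) (v • (nM x * Fh)) := by
  have h1 := lin_deriv x v
  intro i j
  have h2 : HasDerivAt (fun t : ℝ => -(x+t*v)^2/2) (-(x*v)) 0 := by
    have := (h1.fun_pow 2).fun_neg.div_const 2
    refine this.congr_deriv ?_
    norm_num; ring
  fin_cases i <;> fin_cases j
  · exact HasDerivAt.congr_deriv (f := _) (hasDerivAt_const (0:ℝ) (1:ℝ)) (by simp [nM, Fh, Matrix.mul_apply, Fin.sum_univ_three] <;> ring_nf)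
  · exact HasDerivAt.congr_deriv (f := _) (hasDerivAt_const (0:ℝ) (0:ℝ)) (by simp [nM, Fh, Matrix.mul_apply, Fin.sum_univ_three] <;> ring_nf)
  · exact HasDerivAt.congr_deriv (f := _) (hasDerivAt_const (0:ℝ) (0:ℝ)) (by simp [nM, Fh, Matrix.mul_apply, Fin.sum_univ_three] <;> ring_nf)
  · exact HasDerivAt.congr_deriv (f := _) h1 (by simp [nM, Fh, Matrix.mul_apply, Fin.sum_univ_three] <;> ring_nf)
  · exact HasDerivAt.congr_deriv (f := _) (hasDerivAt_const (0:ℝ) (1:ℝ)) (by simp [nM, Fh, Matrix.mul_apply, Fin.sum_univ_three] <;> ring_nf)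
  · exact HasDerivAt.congr_deriv (f := _) (hasDerivAt_const (0:ℝ) (0:ℝ)) (by simp [nM, Fh, Matrix.mul_apply, Fin.sum_univ_three] <;> ring_nf)
  · exact HasDerivAt.congr_deriv (f := _) h2 (by simp [nM, Fh, Matrix.mul_apply, Fin.sum_univ_three] <;> ring_nf)
  · exact HasDerivAt.congr_deriv (f := _) h1.fun_neg (by simp [nM, Fh, Matrix.mul_apply, Fin.sum_univ_three] <;> ring_nf)
  · exact HasDerivAt.congr_deriv (f := _) (hasDerivAt_const (0:ℝ) (1:ℝ)) (by simp [nM, Fh, Matrix.mul_apply, Fin.sum_univ_three] <;> ring_nf)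

lemma MD_aM (q v : ℝ) (hq : q ≠ 0) : MD (fun t => aM (q + t * v)) ((v * q⁻¹) • (aM q * Hh)) := by
  have h1 := lin_deriv q v
  intro i j
  have h2 : HasDerivAt (fun t : ℝ => (q+t*v)⁻¹) (-(v*q⁻¹*q⁻¹)) 0 := by
    have := h1.fun_inv (by simpa using hq)
    refine this.congr_deriv ?_
    norm_num; field_simp
  have h1' : HasDerivAt (fun t : ℝ => q+t*v) (v*q⁻¹*q) 0 := h1.congr_deriv (by field_simp)
  fin_cases i <;> fin_cases j
  · exact HasDerivAt.congr_deriv (f := _) h1' (by simp [aM, Hh, Matrix.mul_apply, Fin.sum_univ_three] <;> ring_nf)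
  · exact HasDerivAt.congr_deriv (f := _) (hasDerivAt_const (0:ℝ) (0:ℝ)) (by simp [aM, Hh, Matrix.mul_apply, Fin.sum_univ_three] <;> ring_nf)
  · exact HasDerivAt.congr_deriv (f := _) (hasDerivAt_const (0:ℝ) (0:ℝ)) (by simp [aM, Hh, Matrix.mul_apply, Fin.sum_univ_three] <;> ring_nf)
  · exact HasDerivAt.congr_deriv (f := _) (hasDerivAt_const (0:ℝ) (0:ℝ)) (by simp [aM, Hh, Matrix.mul_apply, Fin.sum_univ_three] <;> ring_nf)
  · exact HasDerivAt.congr_deriv (f := _) (hasDerivAt_const (0:ℝ) (1:ℝ)) (by simp [aM, Hh, Matrix.mul_apply, Fin.sum_univ_three] <;> ring_nf)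
  · exact HasDerivAt.congr_deriv (f := _) (hasDerivAt_const (0:ℝ) (0:ℝ)) (by simp [aM, Hh, Matrix.mul_apply, Fin.sum_univ_three] <;> ring_nf)
  · exact HasDerivAt.congr_deriv (f := _) (hasDerivAt_const (0:ℝ) (0:ℝ)) (by simp [aM, Hh, Matrix.mul_apply, Fin.sum_univ_three] <;> ring_nf)
  · exact HasDerivAt.congr_deriv (f := _) (hasDerivAt_const (0:ℝ) (0:ℝ)) (by simp [aM, Hh, Matrix.mul_apply, Fin.sum_univ_three] <;> ring_nf)
  · exact HasDerivAt.congr_deriv (f := _) h2 (by simp [aM, Hh, Matrix.mul_apply, Fin.sum_univ_three] <;> ring_nf)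

lemma kM_Z (ψ : ℝ) : kM ψ * Zh = !![-(Real.sin ψ)/2, Real.cos ψ/√2, -(Real.sin ψ)/2;
   -(Real.cos ψ/√2), -Real.sin ψ, -(Real.cos ψ/√2);
   -(Real.sin ψ)/2, Real.cos ψ/√2, -(Real.sin ψ)/2] := by
  have h : (√2)⁻¹ * (√2)⁻¹ = (1/2:ℝ) := by rw [← mul_inv, Real.mul_self_sqrt (by norm_num)]; norm_num
  ext i j
  fin_cases i <;> fin_cases j <;> simp [kM, Zh, Matrix.mul_apply, Fin.sum_univ_three, div_eq_mul_inv]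
  all_goals first | linear_combination (Real.sin ψ) * h | linear_combination (-Real.sin ψ) * h | linear_combination (-2*Real.sin ψ) * h | ring

lemma MD_kM (ψ v : ℝ) : MD (fun t => kM (ψ + t * v)) (v • (kM ψ * Zh)) := by
  have h1 := lin_deriv ψ v
  have hs : HasDerivAt (fun t : ℝ => Real.sin (ψ + t*v)) (Real.cos ψ * v) 0 := by
    simpa using h1.sin
  have hc : HasDerivAt (fun t : ℝ => Real.cos (ψ + t*v)) (-Real.sin ψ * v) 0 := by
    simpa using h1.cos
  rw [kM_Z]
  intro i j
  have e1 := hs.div_const √2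
  have e2 := e1.fun_neg
  have e3 := (hc.const_add 1).div_const 2
  have e4 := (hc.const_sub 1).fun_neg.div_const 2
  fin_cases i <;> fin_cases j
  · exact HasDerivAt.congr_deriv (f := _) e3 (by simp [kM, Matrix.mul_apply, Fin.sum_univ_three] <;> ring_nf)
  · exact HasDerivAt.congr_deriv (f := _) e1 (by simp [kM, Matrix.mul_apply, Fin.sum_univ_three] <;> ring_nf)
  · exact HasDerivAt.congr_deriv (f := _) e4 (by simp [kM, Matrix.mul_apply, Fin.sum_univ_three] <;> ring_nf)
  · exact HasDerivAt.congr_deriv (f := _) e2 (by simp [kM, Matrix.mul_apply, Fin.sum_univ_three] <;> ring_nf)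
  · exact HasDerivAt.congr_deriv (f := _) hc (by simp [kM, Matrix.mul_apply, Fin.sum_univ_three] <;> ring_nf)
  · exact HasDerivAt.congr_deriv (f := _) e2 (by simp [kM, Matrix.mul_apply, Fin.sum_univ_three] <;> ring_nf)
  · exact HasDerivAt.congr_deriv (f := _) e4 (by simp [kM, Matrix.mul_apply, Fin.sum_univ_three] <;> ring_nf)
  · exact HasDerivAt.congr_deriv (f := _) e1 (by simp [kM, Matrix.mul_apply, Fin.sum_univ_three] <;> ring_nf)
  · exact HasDerivAt.congr_deriv (f := _) e3 (by simp [kM, Matrix.mul_apply, Fin.sum_univ_three] <;> ring_nf)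

lemma MD_Sm (a b d va vb vd : ℝ) : MD (fun t => Sm (a+t*va) (b+t*vb) (d+t*vd)) (dSm va vb vd) := by
  intro i j
  have e1 := (lin_deriv a va).fun_neg.div_const 2
  have e2 := (lin_deriv b vb).fun_neg.div_const 2
  have e3 := lin_deriv d vd
  fin_cases i <;> fin_cases j
  · exact HasDerivAt.congr_deriv (f := _) (hasDerivAt_const (0:ℝ) (0:ℝ)) (by simp [dSm, Matrix.mul_apply, Fin.sum_univ_three] <;> ring_nf)
  · exact HasDerivAt.congr_deriv (f := _) (hasDerivAt_const (0:ℝ) (0:ℝ)) (by simp [dSm, Matrix.mul_apply, Fin.sum_univ_three] <;> ring_nf)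
  · exact HasDerivAt.congr_deriv (f := _) (hasDerivAt_const (0:ℝ) (1:ℝ)) (by simp [dSm, Matrix.mul_apply, Fin.sum_univ_three] <;> ring_nf)
  · exact HasDerivAt.congr_deriv (f := _) (hasDerivAt_const (0:ℝ) (1:ℝ)) (by simp [dSm, Matrix.mul_apply, Fin.sum_univ_three] <;> ring_nf)
  · exact HasDerivAt.congr_deriv (f := _) (hasDerivAt_const (0:ℝ) (0:ℝ)) (by simp [dSm, Matrix.mul_apply, Fin.sum_univ_three] <;> ring_nf)
  · exact HasDerivAt.congr_deriv (f := _) e1 (by simp [dSm, Matrix.mul_apply, Fin.sum_univ_three] <;> ring_nf)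
  · exact HasDerivAt.congr_deriv (f := _) (hasDerivAt_const (0:ℝ) (0:ℝ)) (by simp [dSm, Matrix.mul_apply, Fin.sum_univ_three] <;> ring_nf)
  · exact HasDerivAt.congr_deriv (f := _) e3 (by simp [dSm, Matrix.mul_apply, Fin.sum_univ_three] <;> ring_nf)
  · exact HasDerivAt.congr_deriv (f := _) e2 (by simp [dSm, Matrix.mul_apply, Fin.sum_univ_three] <;> ring_nf)

lemma aM_F (q : ℝ) (hq : q ≠ 0) : Fh * aM q = q • (aM q * Fh) := by
  ext i j
  fin_cases i <;> fin_cases j <;> simp [Fh, aM, Matrix.mul_apply, Fin.sum_univ_three, hq]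

lemma F_kM (ψ : ℝ) : Fh * kM ψ = kM ψ * slm (-(Real.sin ψ/√2)) ((Real.cos ψ - 1)/2) ((1+Real.cos ψ)/2) := by
  have h2 : (Real.sin ψ / √2)^2 = (Real.sin ψ)^2/2 := by rw [div_pow, Real.sq_sqrt (by norm_num)]
  have h1 := Real.sin_sq_add_cos_sq ψ
  set s := Real.sin ψ / √2 with hs
  ext i j; fin_cases i <;> fin_cases j <;> simp [kM, Fh, slm, Matrix.mul_apply, Fin.sum_univ_three, ← hs] <;> nlinarith

lemma H_kM (ψ : ℝ) : Hh * kM ψ = kM ψ * slm (Real.cos ψ) (Real.sin ψ/√2) (Real.sin ψ/√2) := by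
  have h2 : (Real.sin ψ / √2)^2 = (Real.sin ψ)^2/2 := by rw [div_pow, Real.sq_sqrt (by norm_num)]
  have h1 := Real.sin_sq_add_cos_sq ψ
  set s := Real.sin ψ / √2 with hs
  ext i j; fin_cases i <;> fin_cases j <;> simp [kM, Hh, slm, Matrix.mul_apply, Fin.sum_univ_three, ← hs] <;> nlinarith

lemma H_aM (q : ℝ) : Hh * aM q = aM q * Hh := by
  ext i j; fin_cases i <;> fin_cases j <;> simp [aM, Hh, Matrix.mul_apply, Fin.sum_univ_three]

lemma Z_slm : Zh = slm 0 (1/√2) (-(1/√2)) := by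
  ext i j; fin_cases i <;> fin_cases j <;> simp [Zh, slm]

lemma MD_nak (x q ψ v0 v1 v2 : ℝ) (hq : q ≠ 0) :
    MD (fun t => nak (x+t*v0) (q+t*v1) (ψ+t*v2))
      (nak x q ψ * slm ((Mo q ψ *ᵥ ![v0,v1,v2]) 0) ((Mo q ψ *ᵥ ![v0,v1,v2]) 1) ((Mo q ψ *ᵥ ![v0,v1,v2]) 2)) := by
  have := ((MD_nM x v0).mul (MD_aM q v1 hq)).mul (MD_kM ψ v2)
  simp only [zero_mul, add_zero] at this
  refine Eq.mp (congrArg _ ?_) this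
  have e : slm ((Mo q ψ *ᵥ ![v0,v1,v2]) 0) ((Mo q ψ *ᵥ ![v0,v1,v2]) 1) ((Mo q ψ *ᵥ ![v0,v1,v2]) 2)
     = (v0*q) • slm (-(Real.sin ψ/√2)) ((Real.cos ψ - 1)/2) ((1+Real.cos ψ)/2)
      + (v1*q⁻¹) • slm (Real.cos ψ) (Real.sin ψ/√2) (Real.sin ψ/√2) + v2 • Zh := by
    rw [Z_slm, ← slm_smul, ← slm_smul, ← slm_smul, ← slm_add, ← slm_add]
    congr 1 <;> simp [Mo, Matrix.mulVec, dotProduct, Fin.sum_univ_three] <;> ring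
  rw [e, nak]
  symm
  simp only [Matrix.mul_add, Matrix.add_mul, Matrix.smul_mul, Matrix.mul_smul]
  congr 1
  congr 1
  · rw [Matrix.mul_assoc (nM x) Fh, aM_F q hq, Matrix.mul_smul, Matrix.smul_mul, smul_smul, Matrix.mul_assoc _ (kM ψ), ← F_kM]
    simp only [Matrix.mul_assoc]
  · simp only [Matrix.mul_assoc]; rw [← H_kM]
  · simp only [Matrix.mul_assoc]
end

section
open Matrix MeasureTheory

noncomputable def Kl (g g' : Matrix (Fin 3) (Fin 3) ℝ) : (I9 → ℝ) →ₗ[ℝ] (I9 → ℝ) :=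
  Matrix.toLin' (Matrix.kroneckerMap (· * ·) g g')

lemma Kl_apply (g g' : Matrix (Fin 3) (Fin 3) ℝ) (w : I9 → ℝ) (i j : Fin 3) :
    Kl g g' w (i,j) = (g * (Matrix.of fun k l => w (k,l)) * g'ᵀ) i j := by
  simp only [Kl, Matrix.toLin'_apply, Matrix.mulVec, dotProduct, Fintype.sum_prod_type, Fin.sum_univ_three,
    Matrix.mul_apply, Matrix.kroneckerMap_apply, Matrix.of_apply, Matrix.transpose_apply]
  ring

noncomputable def Bl (q ψ q' ψ' : ℝ) : (I9 → ℝ) →ₗ[ℝ] (I9 → ℝ) :=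
  Matrix.toLin' (Matrix.blockDiagonal ![1, Mo q ψ, Mo q' ψ'])

lemma blockDiag_mulVec (M : Fin 3 → Matrix (Fin 3) (Fin 3) ℝ) (v : I9 → ℝ) (i o : Fin 3) :
    (Matrix.blockDiagonal M *ᵥ v) (i,o) = (M o *ᵥ (fun j => v (j,o))) i := by
  simp only [Matrix.mulVec, dotProduct, Fintype.sum_prod_type, Matrix.blockDiagonal_apply, ite_mul, zero_mul,
    Finset.sum_ite_eq, Finset.mem_univ, if_true]

lemma vec3_eq (f : Fin 3 → ℝ) : f = ![f 0, f 1, f 2] := by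
  ext j; fin_cases j <;> rfl

lemma Bl_0 (q ψ q' ψ' : ℝ) (v : I9 → ℝ) (i : Fin 3) : Bl q ψ q' ψ' v (i,0) = v (i,0) := by
  rw [Bl, Matrix.toLin'_apply, blockDiag_mulVec]
  exact congrFun (Matrix.one_mulVec (fun j => v (j,0))) i
lemma Bl_1 (q ψ q' ψ' : ℝ) (v : I9 → ℝ) (i : Fin 3) :
    Bl q ψ q' ψ' v (i,1) = (Mo q ψ *ᵥ ![v (0,1), v (1,1), v (2,1)]) i := by
  rw [Bl, Matrix.toLin'_apply, blockDiag_mulVec, vec3_eq (fun j => v (j,1))]; rfl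
lemma Bl_2 (q ψ q' ψ' : ℝ) (v : I9 → ℝ) (i : Fin 3) :
    Bl q ψ q' ψ' v (i,2) = (Mo q' ψ' *ᵥ ![v (0,2), v (1,2), v (2,2)]) i := by
  rw [Bl, Matrix.toLin'_apply, blockDiag_mulVec, vec3_eq (fun j => v (j,2))]; rfl

lemma det_Bl (q ψ q' ψ' : ℝ) (hq : q ≠ 0) (hq' : q' ≠ 0) : LinearMap.det (Bl q ψ q' ψ') = 1/2 := by
  rw [Bl, LinearMap.det_toLin', Matrix.det_blockDiagonal, Fin.prod_univ_three]
  simp only [Matrix.cons_val, Matrix.det_one, det_Mo q ψ hq, det_Mo q' ψ' hq']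
  rw [one_mul, div_mul_div_comm, Real.mul_self_sqrt (by norm_num)]; norm_num

lemma det_nak (x q ψ : ℝ) (hq : q ≠ 0) : |(nak x q ψ).det| = 1 := by
  have h1 : (nM x).det = 1 := by simp [nM, Matrix.det_fin_three]
  have h2 : (aM q).det = 1 := by simp [aM, Matrix.det_fin_three, hq]
  have h3 : (kM ψ).det * (kM ψ).det = 1 := by
    have := congrArg Matrix.det (kM_orth ψ)
    rwa [Matrix.det_mul, Matrix.det_transpose, Matrix.det_one] at this
  rw [nak, Matrix.det_mul, Matrix.det_mul, h1, h2, one_mul, one_mul]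
  exact abs_eq (by norm_num) |>.2 (mul_self_eq_one_iff.1 h3)

lemma det_Kl (g g' : Matrix (Fin 3) (Fin 3) ℝ) (h : |g.det| = 1) (h' : |g'.det| = 1) :
    |LinearMap.det (Kl g g')| = 1 := by
  rw [Kl, LinearMap.det_toLin', Matrix.det_kronecker, abs_mul, abs_pow, abs_pow, h, h']
  simp

noncomputable def JPsi (p : I9 → ℝ) : (I9 → ℝ) →ₗ[ℝ] (I9 → ℝ) :=
  Kl (nak (p (0,1)) (p (1,1)) (p (2,1))) (nak (p (0,2)) (p (1,2)) (p (2,2))) ∘ₗ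
    Tl (p (0,0)) (p (1,0)) (p (2,0)) ∘ₗ Bl (p (1,1)) (p (2,1)) (p (1,2)) (p (2,2))

lemma det_JPsi (p : I9 → ℝ) (hq : p (1,1) ≠ 0) (hq' : p (1,2) ≠ 0) : |LinearMap.det (JPsi p)| = 1/8 := by
  rw [JPsi, LinearMap.det_comp, LinearMap.det_comp, abs_mul, abs_mul,
    det_Kl _ _ (det_nak _ _ _ hq) (det_nak _ _ _ hq'), det_Bl _ _ _ _ hq hq',
    ← LinearMap.det_toMatrix', det_Tl]
  norm_num

lemma Psi_line (p v : I9 → ℝ) (hq : p (1,1) ≠ 0) (hq' : p (1,2) ≠ 0) (ij : I9) :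
    HasDerivAt (fun t : ℝ => Psi (p + t • v) ij) (JPsi p v ij) 0 := by
  obtain ⟨i, j⟩ := ij
  have h := (((MD_nak (p (0,1)) (p (1,1)) (p (2,1)) (v (0,1)) (v (1,1)) (v (2,1)) hq).mul
    (MD_Sm (p (0,0)) (p (1,0)) (p (2,0)) (v (0,0)) (v (1,0)) (v (2,0)))).mul
    (MD_nak (p (0,2)) (p (1,2)) (p (2,2)) (v (0,2)) (v (1,2)) (v (2,2)) hq').tr) i j
  refine HasDerivAt.congr_deriv (f := fun t : ℝ => Psi (p + t • v) (i,j)) h ?_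
  simp only [zero_mul, add_zero]
  rw [JPsi, LinearMap.comp_apply, LinearMap.comp_apply, Kl_apply]
  set w := Bl (p (1,1)) (p (2,1)) (p (1,2)) (p (2,2)) v with hw
  have hT : (Matrix.of fun k l => Tl (p (0,0)) (p (1,0)) (p (2,0)) w (k,l)) =
    slm (w (0,1)) (w (1,1)) (w (2,1)) * Sm (p (0,0)) (p (1,0)) (p (2,0)) + dSm (w (0,0)) (w (1,0)) (w (2,0))
    + Sm (p (0,0)) (p (1,0)) (p (2,0)) * (slm (w (0,2)) (w (1,2)) (w (2,2)))ᵀ := rfl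
  rw [hT]
  simp only [hw, Bl_0, Bl_1, Bl_2]
  refine congrFun (congrFun ?_ i) j
  simp only [Matrix.transpose_mul, Matrix.mul_add, Matrix.add_mul, Matrix.mul_assoc]
  try abel

lemma Psi_diff (p : I9 → ℝ) (hq : p (1,1) ≠ 0) (hq' : p (1,2) ≠ 0) : DifferentiableAt ℝ Psi p := by
  have hnak : ∀ (o : Fin 3), p (1,o) ≠ 0 → ∀ i j, DifferentiableAt ℝ
      (fun p : I9 → ℝ => nak (p (0,o)) (p (1,o)) (p (2,o)) i j) p := by
    intro o ho i j
    have h1 : ∀ i j, DifferentiableAt ℝ (fun p : I9 → ℝ => nM (p (0,o)) i j) p := by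
      intro i j
      fin_cases i <;> fin_cases j <;> simp [nM] <;> fun_prop
    have h2 : ∀ i j, DifferentiableAt ℝ (fun p : I9 → ℝ => aM (p (1,o)) i j) p := by
      intro i j
      fin_cases i <;> fin_cases j <;> simp [aM] <;> fun_prop (disch := assumption)
    have h3 : ∀ i j, DifferentiableAt ℝ (fun p : I9 → ℝ => kM (p (2,o)) i j) p := by
      intro i j
      fin_cases i <;> fin_cases j <;> simp [kM] <;> fun_prop
    simp only [nak, Matrix.mul_apply]
    exact DifferentiableAt.fun_sum fun k _ =>
      (DifferentiableAt.fun_sum fun l _ => (h1 _ _).fun_mul (h2 _ _)).fun_mul (h3 _ _)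
  have hS : ∀ i j, DifferentiableAt ℝ (fun p : I9 → ℝ => Sm (p (0,0)) (p (1,0)) (p (2,0)) i j) p := by
    intro i j
    fin_cases i <;> fin_cases j <;> simp [Sm] <;> fun_prop
  rw [differentiableAt_pi]
  rintro ⟨i, j⟩
  have h1 := hnak 1 hq
  have h2 := hnak 2 hq'
  simp only [Psi, Matrix.mul_apply, Matrix.transpose_apply]
  exact DifferentiableAt.fun_sum fun k _ =>
      (DifferentiableAt.fun_sum fun l _ => (h1 _ _).fun_mul (hS _ _)).fun_mul (h2 _ _)

lemma Psi_fderiv (p : I9 → ℝ) (hq : p (1,1) ≠ 0) (hq' : p (1,2) ≠ 0) :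
    HasFDerivAt Psi (LinearMap.toContinuousLinearMap (JPsi p)) p := by
  have h := (Psi_diff p hq hq').hasFDerivAt
  convert h using 1
  ext v ij
  have h1 : HasDerivAt (fun t : ℝ => Psi (p + t • v)) (fderiv ℝ Psi p v) 0 := by
    have hl : HasDerivAt (fun t : ℝ => p + t • v) v 0 := by
      simpa using ((hasDerivAt_id (0:ℝ)).smul_const v).const_add p
    have h' : HasFDerivAt Psi (fderiv ℝ Psi p) (p + (0:ℝ) • v) := by simpa using h
    exact h'.comp_hasDerivAt 0 hl
  exact (Psi_line p v hq hq' ij).unique ((hasDerivAt_pi.1 h1) ij)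

theorem vol_Psi (D : Set (I9 → ℝ)) (hD : MeasurableSet D) (hq : ∀ p ∈ D, p (1,1) ≠ 0 ∧ p (1,2) ≠ 0) :
    volume (Psi '' D) ≤ ENNReal.ofReal (1/8) * volume D := by
  refine (addHaar_image_le_lintegral_abs_det_fderiv volume hD
    (f' := fun p => LinearMap.toContinuousLinearMap (JPsi p))
    (fun p hp => (Psi_fderiv p (hq p hp).1 (hq p hp).2).hasFDerivWithinAt)).trans ?_
  rw [← setLIntegral_const]
  refine le_of_eq (setLIntegral_congr_fun hD fun p hp => ?_)
  simp only [ContinuousLinearMap.det]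
  rw [LinearMap.coe_toContinuousLinearMap, det_JPsi _ (hq p hp).1 (hq p hp).2]
end

section
open Matrix MeasureTheory

lemma lattice_count {ι : Type*} [Fintype ι] (K : Set (ι → ℝ)) (hK : IsCompact K) (ε : ℝ) (hε : 0 < ε) :
    ∃ X0 : ℝ, 0 < X0 ∧ ∀ X : ℝ, X0 ≤ X → ∀ S : Finset (ι → ℤ), (∀ s ∈ S, (fun i => (s i : ℝ)/X) ∈ K) →
      (∀ s ∈ S, ∀ t ∈ S, ∀ i, (2:ℤ) ∣ s i - t i) →
      (S.card : ℝ) ≤ ((volume K).toReal + ε) * (X/2)^(Fintype.card ι) := by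
  have hfin : volume K ≠ ⊤ := hK.measure_lt_top.ne
  have ht := tendsto_measure_cthickening_of_isCompact (μ := volume) hK
  have hlt : volume K < volume K + ENNReal.ofReal ε :=
    ENNReal.lt_add_right hfin (by simpa using hε)
  have hev := ht.eventually_lt_const hlt
  obtain ⟨δ, hδ, hball⟩ := Metric.eventually_nhds_iff.1 hev
  refine ⟨4/δ, by positivity, fun X hX S hS hpar => ?_⟩
  have hX0 : 0 < X := lt_of_lt_of_le (by positivity) hX
  have hr : 2/X < δ := by
    rw [div_lt_iff₀ hX0]
    rw [div_le_iff₀ hδ] at hX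
    linarith
  have hvol := hball (y := 2/X) (by rw [Real.dist_eq, sub_zero, abs_of_pos (by positivity)]; exact hr)
  set C : (ι → ℤ) → Set (ι → ℝ) := fun s => Set.pi Set.univ fun i => Set.Ico ((s i : ℝ)/X) ((s i : ℝ)/X + 2/X) with hC
  have hCv : ∀ s, volume (C s) = ENNReal.ofReal ((2/X)^(Fintype.card ι)) := by
    intro s
    rw [hC, Real.volume_pi_Ico]
    simp only [add_sub_cancel_left, Finset.prod_const, Finset.card_univ]
    rw [ENNReal.ofReal_pow (by positivity)]
  have hdisj : (S : Set (ι → ℤ)).PairwiseDisjoint C := by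
    intro s hs t ht hst
    rw [Function.onFun, Set.disjoint_left]
    intro y hy hy'
    apply hst
    ext i
    have h1 := hy i (Set.mem_univ i)
    have h2 := hy' i (Set.mem_univ i)
    obtain ⟨h1a, h1b⟩ := h1
    obtain ⟨h2a, h2b⟩ := h2
    have e1 : ((s i : ℝ) - t i) < 2 := by
      have : (s i : ℝ)/X < (t i : ℝ)/X + 2/X := lt_of_le_of_lt h1a h2b
      rw [← add_div, div_lt_div_iff_of_pos_right hX0] at this; linarith
    have e2 : ((t i : ℝ) - s i) < 2 := by
      have : (t i : ℝ)/X < (s i : ℝ)/X + 2/X := lt_of_le_of_lt h2a h1b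
      rw [← add_div, div_lt_div_iff_of_pos_right hX0] at this; linarith
    have e1' : s i - t i < 2 := by exact_mod_cast e1
    have e2' : t i - s i < 2 := by exact_mod_cast e2
    have := hpar s hs t ht i
    omega
  have hsub : (⋃ s ∈ S, C s) ⊆ Metric.cthickening (2/X) K := by
    intro y hy
    simp only [Set.mem_iUnion] at hy
    obtain ⟨s, hs, hy⟩ := hy
    refine Metric.mem_cthickening_of_dist_le y _ _ _ (hS s hs) ?_
    rw [dist_pi_le_iff (by positivity)]
    intro i
    obtain ⟨h1, h2⟩ := hy i (Set.mem_univ i)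
    rw [Real.dist_eq, abs_of_nonneg (by linarith)]; linarith
  have hm : volume (⋃ s ∈ S, C s) = S.card * ENNReal.ofReal ((2/X)^(Fintype.card ι)) := by
    rw [measure_biUnion_finset hdisj (fun s _ => MeasurableSet.univ_pi fun i => measurableSet_Ico)]
    simp [hCv]
  have hle : (S.card : ENNReal) * ENNReal.ofReal ((2/X)^(Fintype.card ι)) ≤ volume K + ENNReal.ofReal ε := by
    rw [← hm]; exact (measure_mono hsub).trans hvol.le
  have hle2 := ENNReal.toReal_mono (by simp [hfin]) hle
  rw [ENNReal.toReal_mul, ENNReal.toReal_natCast, ENNReal.toReal_ofReal (by positivity),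
    ENNReal.toReal_add hfin (by simp), ENNReal.toReal_ofReal hε.le] at hle2
  have : (X/2)^(Fintype.card ι) * (2/X)^(Fintype.card ι) = 1 := by
    rw [← mul_pow]; field_simp; simp
  calc (S.card : ℝ) = (S.card * (2/X)^(Fintype.card ι)) * (X/2)^(Fintype.card ι) := by
        rw [mul_assoc, mul_comm ((2/X)^_), this, mul_one]
    _ ≤ _ := by gcongr

/-- the one-sided reduced domain -/
def RedDom (Y : ℝ) (x q ψ : ℝ) : Prop := |x| ≤ 1 ∧ 1/Y ≤ q ∧ q^2*(1-x^2/2) ≤ 1 ∧ 0 ≤ ψ ∧ ψ ≤ 2*Real.pi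

def DY (Y : ℝ) : Set (I9 → ℝ) := {p | (0 ≤ p (0,0) ∧ p (0,0) ≤ 1) ∧ (0 ≤ p (1,0) ∧ p (1,0) ≤ 1) ∧
  (1 ≤ p (2,0) ∧ p (2,0) ≤ 2) ∧ RedDom Y (p (0,1)) (p (1,1)) (p (2,1)) ∧ RedDom Y (p (0,2)) (p (1,2)) (p (2,2))}

lemma DY_closed (Y : ℝ) : IsClosed (DY Y) := by
  have h : ∀ o : Fin 3, IsClosed {p : I9 → ℝ | RedDom Y (p (0,o)) (p (1,o)) (p (2,o))} := by
    intro o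
    simp only [RedDom, Set.setOf_and]
    refine IsClosed.inter ?_ (IsClosed.inter ?_ (IsClosed.inter ?_ (IsClosed.inter ?_ ?_))) <;>
    exact isClosed_le (by fun_prop) (by fun_prop)
  simp only [DY, Set.setOf_and]
  refine IsClosed.inter (IsClosed.inter ?_ ?_) (IsClosed.inter (IsClosed.inter ?_ ?_) (IsClosed.inter (IsClosed.inter ?_ ?_)
    (IsClosed.inter (h 1) (h 2)))) <;>
    exact isClosed_le (by fun_prop) (by fun_prop)

lemma q_le_of (x q : ℝ) (hx : |x| ≤ 1) (h : q^2*(1-x^2/2) ≤ 1) : q ≤ 2 := by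
  have : x^2 ≤ 1 := (sq_le_one_iff_abs_le_one x).2 hx
  by_contra hq
  push Not at hq
  nlinarith

noncomputable def cks : Fin 10 → ℝ := ![1.4143, 1.2127, 1.1044, 1.0426, 1.0102, 1.0102, 1.0426, 1.1044, 1.2127, 1.4143]

noncomputable def boxLo (k l : Fin 10) (j : I9) : ℝ :=
  (!![0, -1 + (k:ℕ)/5, -1 + (l:ℕ)/5; 0, 0, 0; 1, 0, 0] : Matrix (Fin 3) (Fin 3) ℝ) j.1 j.2
noncomputable def boxHi (k l : Fin 10) (j : I9) : ℝ :=
  (!![1, -1 + ((k:ℕ)+1)/5, -1 + ((l:ℕ)+1)/5; 1, cks k, cks l; 2, 2*Real.pi, 2*Real.pi] : Matrix (Fin 3) (Fin 3) ℝ) j.1 j.2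

lemma sq_bound (x q c lo hi : ℝ) (h : q^2*(1-x^2/2) ≤ 1) (h0 : 0 ≤ lo ∨ hi ≤ 0) (h1 : lo ≤ x) (h2 : x ≤ hi)
   (hc : 0 < c) (e1 : 1 ≤ c^2*(1-lo^2/2)) (e2 : 1 ≤ c^2*(1-hi^2/2)) : q ≤ c := by
  by_contra hq
  push Not at hq
  have hx : x^2 ≤ lo^2 ∨ x^2 ≤ hi^2 := by
    rcases h0 with h0 | h0
    · right; nlinarith
    · left; nlinarith
  have hq2 : c^2 < q^2 := by nlinarith
  have : 1 ≤ c^2*(1-x^2/2) := by rcases hx with hx | hx <;> nlinarith [sq_nonneg c]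
  have hp : 0 < 1 - x^2/2 := by
    by_contra hh; push Not at hh; nlinarith [sq_nonneg c]
  nlinarith

lemma strip (x q : ℝ) (hx : |x| ≤ 1) (h : q^2*(1-x^2/2) ≤ 1) :
    ∃ k : Fin 10, -1 + (k:ℕ)/5 ≤ x ∧ x ≤ -1 + ((k:ℕ)+1)/5 ∧ q ≤ cks k := by
  obtain ⟨h1, h2⟩ := abs_le.1 hx
  have key : ∀ k : Fin 10, -1 + ((k:ℕ):ℝ)/5 ≤ x → x ≤ -1 + (((k:ℕ):ℝ)+1)/5 → q ≤ cks k := by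
    intro k ha hb
    fin_cases k <;> simp only [cks] at * <;> norm_num at ha hb ⊢
    all_goals refine sq_bound x q _ _ _ h ?_ ha hb ?_ ?_ ?_ <;> norm_num
  rcases le_or_gt x (-4/5) with c | c
  · exact ⟨0, by norm_num; linarith, by norm_num; linarith, key 0 (by norm_num; linarith) (by norm_num; linarith)⟩
  rcases le_or_gt x (-3/5) with c | c
  · exact ⟨1, by norm_num; linarith, by norm_num; linarith, key 1 (by norm_num; linarith) (by norm_num; linarith)⟩
  rcases le_or_gt x (-2/5) with c | c
  · exact ⟨2, by norm_num; linarith, by norm_num; linarith, key 2 (by norm_num; linarith) (by norm_num; linarith)⟩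
  rcases le_or_gt x (-1/5) with c | c
  · exact ⟨3, by norm_num; linarith, by norm_num; linarith, key 3 (by norm_num; linarith) (by norm_num; linarith)⟩
  rcases le_or_gt x 0 with c | c
  · exact ⟨4, by norm_num; linarith, by norm_num; linarith, key 4 (by norm_num; linarith) (by norm_num; linarith)⟩
  rcases le_or_gt x (1/5) with c | c
  · exact ⟨5, by norm_num; linarith, by norm_num; linarith, key 5 (by norm_num; linarith) (by norm_num; linarith)⟩
  rcases le_or_gt x (2/5) with c | c
  · exact ⟨6, by norm_num; linarith, by norm_num; linarith, key 6 (by norm_num; linarith) (by norm_num; linarith)⟩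
  rcases le_or_gt x (3/5) with c | c
  · exact ⟨7, by norm_num; linarith, by norm_num; linarith, key 7 (by norm_num; linarith) (by norm_num; linarith)⟩
  rcases le_or_gt x (4/5) with c | c
  · exact ⟨8, by norm_num; linarith, by norm_num; linarith, key 8 (by norm_num; linarith) (by norm_num; linarith)⟩
  · exact ⟨9, by norm_num; linarith, by norm_num; linarith, key 9 (by norm_num; linarith) (by norm_num; linarith)⟩

lemma DY_cover (Y : ℝ) (hY : 0 < Y) : DY Y ⊆ ⋃ kl : Fin 10 × Fin 10, Set.Icc (boxLo kl.1 kl.2) (boxHi kl.1 kl.2) := by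
  rintro p ⟨⟨a1, a2⟩, ⟨b1, b2⟩, ⟨d1, d2⟩, ⟨x1, x2, x3, x4, x5⟩, ⟨y1, y2, y3, y4, y5⟩⟩
  obtain ⟨k, k1, k2, k3⟩ := strip _ _ x1 x3
  obtain ⟨l, l1, l2, l3⟩ := strip _ _ y1 y3
  have hY' : 0 ≤ 1/Y := by positivity
  refine Set.mem_iUnion.2 ⟨(k,l), ?_, ?_⟩
  · rintro ⟨i, j⟩
    fin_cases i <;> fin_cases j <;> simp only [boxLo] <;> first | assumption | (simp; linarith)
  · rintro ⟨i, j⟩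
    fin_cases i <;> fin_cases j <;> simp only [boxHi] <;> first | assumption | (simp; linarith)

lemma box_vol (k l : Fin 10) : volume (Set.Icc (boxLo k l) (boxHi k l)) =
    ENNReal.ofReal ((2*Real.pi/5)^2 * (cks k * cks l)) := by
  have hck : ∀ k, 0 ≤ cks k := by intro k; fin_cases k <;> norm_num [cks]
  rw [Real.volume_Icc_pi, ← ENNReal.ofReal_prod_of_nonneg]
  · congr 1
    rw [Fintype.prod_prod_type]
    simp [Fin.prod_univ_three, boxLo, boxHi]
    ring
  · rintro ⟨i, j⟩ -
    fin_cases i <;> fin_cases j <;> simp [boxLo, boxHi] <;> first | exact hck _ | positivity | (norm_num; done) | skip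
    all_goals (try gcongr) <;> linarith

lemma DY_vol (Y : ℝ) (hY : 0 < Y) : volume (DY Y) ≤ ENNReal.ofReal 211.4 := by
  refine (measure_mono (DY_cover Y hY)).trans ((measure_iUnion_fintype_le _ _).trans ?_)
  have hck : ∀ k, 0 ≤ cks k := by intro k; fin_cases k <;> norm_num [cks]
  simp only [box_vol]
  rw [← ENNReal.ofReal_sum_of_nonneg (fun kl _ => by have := hck kl.1; have := hck kl.2; positivity)]
  apply ENNReal.ofReal_le_ofReal
  rw [← Finset.mul_sum, Fintype.sum_prod_type, ← Finset.sum_mul_sum]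
  have : ∑ i, cks i = 11.5684 := by simp [Fin.sum_univ_succ, cks]; norm_num
  rw [this]
  have hp := Real.pi_lt_d4
  have hp0 := Real.pi_pos
  have : Real.pi^2 ≤ 3.1416^2 := by gcongr
  nlinarith

lemma DY_compact (Y : ℝ) (hY : 0 < Y) : IsCompact (DY Y) := by
  refine Metric.isCompact_of_isClosed_isBounded (DY_closed Y) (Bornology.IsBounded.subset ?_ (DY_cover Y hY))
  rw [Bornology.isBounded_iUnion]
  exact fun kl => Metric.isBounded_Icc _ _

lemma DY_q (Y : ℝ) (hY : 0 < Y) : ∀ p ∈ DY Y, p (1,1) ≠ 0 ∧ p (1,2) ≠ 0 := by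
  rintro p ⟨-, -, -, ⟨-, x2, -⟩, ⟨-, y2, -⟩⟩
  have hY' : 0 < 1/Y := by positivity
  exact ⟨(by linarith : 0 < p (1,1)).ne', (by linarith : 0 < p (1,2)).ne'⟩

theorem PsiDY (Y : ℝ) (hY : 0 < Y) : IsCompact (Psi '' DY Y) ∧ (volume (Psi '' DY Y)).toReal ≤ 26.43 := by
  constructor
  · exact (DY_compact Y hY).image_of_continuousOn fun p hp =>
      ((Psi_diff p (DY_q Y hY p hp).1 (DY_q Y hY p hp).2).continuousAt).continuousWithinAt
  · have h := (vol_Psi (DY Y) (DY_closed Y).measurableSet (DY_q Y hY)).trans (mul_le_mul_right (DY_vol Y hY) _)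
    rw [← ENNReal.ofReal_mul (by norm_num)] at h
    refine (ENNReal.toReal_le_of_le_ofReal (by norm_num) h).trans (by norm_num)
end

section
open Matrix MeasureTheory

def cfR {R : Type*} [CommRing R] (N : Matrix (Fin 3) (Fin 3) R) : Prop :=
  N 1 1 = 0 ∧ N 0 0 * N 2 2 + N 0 1 * N 2 1 + N 0 2 * N 2 0 + N 1 0 * N 1 2 = 1 ∧
  N 0 0 * N 2 2 - N 0 2 * N 2 0 = 1 ∧
  (N 1 1 * N 2 2 - N 1 2 * N 2 1) * (N 0 0 * N 1 1 - N 0 1 * N 1 0) +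
  (N 1 0 * N 2 2 - N 1 2 * N 2 0) * (N 0 0 * N 1 2 - N 0 2 * N 1 0) +
  (N 1 0 * N 2 1 - N 1 1 * N 2 0) * (N 0 1 * N 1 2 - N 0 2 * N 1 1) +
  (N 0 1 * N 2 2 - N 0 2 * N 2 1) * (N 0 0 * N 2 1 - N 0 1 * N 2 0) = 0 ∧ N.det = 1

/-- the coefficients of the characteristic polynomial of N G Nᵀ G -/
def aN (N : Matrix (Fin 3) (Fin 3) ℤ) : ℤ :=
  -(2 * (N 0 0 * N 2 2 + N 0 1 * N 2 1 + N 0 2 * N 2 0 + N 1 0 * N 1 2) + N 1 1 ^ 2)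
def bN (N : Matrix (Fin 3) (Fin 3) ℤ) : ℤ :=
  2 * ((N 1 1 * N 2 2 - N 1 2 * N 2 1) * (N 0 0 * N 1 1 - N 0 1 * N 1 0) +
  (N 1 0 * N 2 2 - N 1 2 * N 2 0) * (N 0 0 * N 1 2 - N 0 2 * N 1 0) +
  (N 1 0 * N 2 1 - N 1 1 * N 2 0) * (N 0 1 * N 1 2 - N 0 2 * N 1 1) +
  (N 0 1 * N 2 2 - N 0 2 * N 2 1) * (N 0 0 * N 2 1 - N 0 1 * N 2 0)) + (N 0 0 * N 2 2 - N 0 2 * N 2 0)^2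

lemma mod4 (n c : ℤ) (h : (2 * n + c^2) % 4 = 2) : (c : ZMod 2) = 0 ∧ (n : ZMod 2) = 1 := by
  have h1 : c % 2 = 0 := by
    have h2 : (c^2) % 2 = 0 := by omega
    rcases Int.emod_two_eq_zero_or_one c with h | h
    · exact h
    · rw [pow_two, Int.mul_emod, h] at h2; simp at h2
  obtain ⟨k, hk⟩ := Int.dvd_of_emod_eq_zero h1
  have h3 : c^2 = 4 * k^2 := by rw [hk]; ring
  constructor
  · exact (ZMod.intCast_zmod_eq_zero_iff_dvd c 2).2 ⟨k, hk⟩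
  · have : n % 2 = 1 := by omega
    have h4 : ((2:ℕ):ℤ) ∣ n - 1 := by omega
    have := (ZMod.intCast_zmod_eq_zero_iff_dvd (n-1) 2).2 h4
    push_cast at this
    exact sub_eq_zero.1 this

lemma mod4' (n c : ℤ) (h : (2 * n + c^2) % 4 = 1) : (c : ZMod 2) = 1 ∧ (n : ZMod 2) = 0 := by
  have h1 : c % 2 = 1 := by
    rcases Int.emod_two_eq_zero_or_one c with h' | h'
    · exfalso
      have : c^2 % 2 = 0 := by rw [pow_two, Int.mul_emod, h']; simp
      omega
    · exact h'
  obtain ⟨k, hk⟩ : ∃ k, c = 2*k+1 := ⟨c/2, by omega⟩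
  have h3 : c^2 = 4 * (k^2+k) + 1 := by rw [hk]; ring
  constructor
  · have := (ZMod.intCast_zmod_eq_zero_iff_dvd (c-1) 2).2 ⟨k, by omega⟩
    push_cast at this
    exact sub_eq_zero.1 this
  · exact (ZMod.intCast_zmod_eq_zero_iff_dvd n 2).2 (by omega)

lemma res_of (N : Matrix (Fin 3) (Fin 3) ℤ) (ha : aN N % 4 = 2) (hb : bN N % 4 = 1) (hd : N.det % 2 = 1) :
    cfR (N.map (Int.cast : ℤ → ZMod 2)) := by
  obtain ⟨h1, h2⟩ := mod4 (N 0 0 * N 2 2 + N 0 1 * N 2 1 + N 0 2 * N 2 0 + N 1 0 * N 1 2) (N 1 1) (by unfold aN at ha; omega)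
  obtain ⟨h3, h4⟩ := mod4' _ _ hb
  refine ⟨h1, ?_, ?_, ?_, ?_⟩
  · push_cast at h2; exact h2
  · push_cast at h3; exact h3
  · push_cast at h4; exact h4
  · have : (N.map (Int.cast : ℤ → ZMod 2)).det = ((N.det : ℤ) : ZMod 2) :=
      (RingHom.map_det (Int.castRingHom (ZMod 2)) N).symm
    rw [this]
    have := (ZMod.intCast_zmod_eq_zero_iff_dvd (N.det-1) 2).2 (by omega)
    rw [Int.cast_sub] at this
    simpa using sub_eq_zero.1 this

instance (N : Matrix (Fin 3) (Fin 3) (ZMod 2)) : Decidable (cfR N) := by unfold cfR; infer_instance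

def resList : Finset (Fin 9 → ZMod 2) := {
 ![0, 0, 1, 1, 0, 0, 1, 1, 0], ![0, 1, 1, 0, 0, 1, 1, 0, 0], ![0, 1, 1, 1, 0, 0, 1, 0, 1],
 ![0, 1, 1, 1, 0, 1, 1, 1, 1], ![1, 0, 0, 0, 0, 1, 0, 1, 1], ![1, 0, 1, 0, 0, 1, 1, 1, 0],
 ![1, 0, 1, 1, 0, 0, 0, 1, 1], ![1, 1, 0, 0, 0, 1, 1, 0, 1], ![1, 1, 0, 1, 0, 0, 0, 0, 1],
 ![1, 1, 0, 1, 0, 1, 1, 1, 1], ![1, 1, 1, 1, 0, 1, 0, 1, 1], ![1, 1, 1, 1, 0, 1, 1, 1, 0]}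

lemma res_mem : ∀ a b c d e f g h : ZMod 2, cfR !![a,b,c;d,0,e;f,g,h] → ![a,b,c,d,0,e,f,g,h] ∈ resList := by
  decide +kernel

def res9 (N : Matrix (Fin 3) (Fin 3) (ZMod 2)) : Fin 9 → ZMod 2 :=
  ![N 0 0, N 0 1, N 0 2, N 1 0, N 1 1, N 1 2, N 2 0, N 2 1, N 2 2]

lemma res_mem' (N : Matrix (Fin 3) (Fin 3) (ZMod 2)) (h : cfR N) : res9 N ∈ resList := by
  have h0 := h.1
  have e := Matrix.eta_fin_three N
  rw [h0] at e
  unfold res9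
  rw [h0]
  apply res_mem
  rwa [← e]

lemma res9_inj (N M : Matrix (Fin 3) (Fin 3) (ZMod 2)) (h : res9 N = res9 M) (i j : Fin 3) : N i j = M i j := by
  have h0 := congrFun h 0; have h1 := congrFun h 1; have h2 := congrFun h 2
  have h3 := congrFun h 3; have h4 := congrFun h 4; have h5 := congrFun h 5
  have h6 := congrFun h 6; have h7 := congrFun h 7; have h8 := congrFun h 8
  fin_cases i <;> fin_cases j <;> assumption

theorem main_count (Y : ℝ) (hY : 0 < Y) : ∃ X0 : ℝ, 0 < X0 ∧ ∀ X : ℝ, X0 ≤ X →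
    ∀ S : Finset (Matrix (Fin 3) (Fin 3) ℤ), (∀ N ∈ S, ∃ p ∈ DY Y, ∀ i j, (N i j : ℝ) = X * Psi p (i,j)) →
    (∀ N ∈ S, cfR (N.map (Int.cast : ℤ → ZMod 2))) → (S.card : ℝ) ≤ 12 * (26.44 * (X/2)^9) := by
  obtain ⟨hc, hv⟩ := PsiDY Y hY
  obtain ⟨X0, hX0, h⟩ := lattice_count _ hc 0.01 (by norm_num)
  refine ⟨X0, hX0, fun X hX S hS hR => ?_⟩
  have hXp : 0 < X := lt_of_lt_of_le hX0 hX
  have hfib : ∀ r ∈ resList, ((S.filter fun N => res9 (N.map (Int.cast : ℤ → ZMod 2)) = r).card : ℝ) ≤ 26.44 * (X/2)^9 := by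
    intro r _
    set F := S.filter fun N => res9 (N.map (Int.cast : ℤ → ZMod 2)) = r with hF
    let φ : Matrix (Fin 3) (Fin 3) ℤ → (I9 → ℤ) := fun N ij => N ij.1 ij.2
    have hφ : Function.Injective φ := by
      intro N M hNM; ext i j; exact congrFun hNM (i,j)
    have hcard : (F.image φ).card = F.card := Finset.card_image_of_injective _ hφ
    have := h X hX (F.image φ) ?_ ?_
    · rw [hcard] at this
      refine this.trans ?_
      simp only [Fintype.card_prod, Fintype.card_fin]
      gcongr
      · linarith
    · intro s hs
      obtain ⟨N, hN, rfl⟩ := Finset.mem_image.1 hs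
      obtain ⟨p, hp, hpe⟩ := hS N (Finset.mem_filter.1 hN).1
      refine ⟨p, hp, ?_⟩
      ext ⟨i, j⟩
      simp only [φ, hpe]
      field_simp
    · intro s hs t ht ij
      obtain ⟨N, hN, rfl⟩ := Finset.mem_image.1 hs
      obtain ⟨M, hM, rfl⟩ := Finset.mem_image.1 ht
      have e := res9_inj _ _ ((Finset.mem_filter.1 hN).2.trans (Finset.mem_filter.1 hM).2.symm) ij.1 ij.2
      simp only [Matrix.map_apply] at e
      apply (ZMod.intCast_zmod_eq_zero_iff_dvd _ 2).1
      push_cast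
      exact sub_eq_zero.2 e
  have hsum : S.card = ∑ r ∈ resList, (S.filter fun N => res9 (N.map (Int.cast : ℤ → ZMod 2)) = r).card :=
    Finset.card_eq_sum_card_fiberwise fun N hN => res_mem' _ (hR N hN)
  rw [hsum]
  push_cast
  refine (Finset.sum_le_card_nsmul _ _ _ hfib).trans ?_
  have : resList.card ≤ 12 := by decide +kernel
  rw [nsmul_eq_mul]
  gcongr
  exact_mod_cast this
end

section
open Matrix MeasureTheory

def nZ (t : ℤ) : Matrix (Fin 3) (Fin 3) ℤ := !![1,0,0; 2*t,1,0; -2*t^2,-2*t,1]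

lemma nZ_mul (s t : ℤ) : nZ s * nZ t = nZ (s + t) := by
  ext i j; fin_cases i <;> fin_cases j <;> simp [nZ, Matrix.mul_apply, Fin.sum_univ_three] <;> ring
lemma nZ_zero : nZ 0 = 1 := by
  ext i j; fin_cases i <;> fin_cases j <;> simp [nZ]
lemma nZ_neg_mul (t : ℤ) : nZ (-t) * nZ t = 1 := by rw [nZ_mul, neg_add_cancel, nZ_zero]

lemma shear_apply (t t' : ℤ) (N : Matrix (Fin 3) (Fin 3) ℤ) (i j : Fin 3) :
    (nZ t * N * (nZ t')ᵀ) i j = ∑ k, ∑ l, nZ t i k * N k l * nZ t' j l := by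
  simp only [Matrix.mul_apply, Matrix.transpose_apply, Finset.sum_mul]
  rw [Finset.sum_comm]

lemma shear_fix_aux (t t' : ℤ) (N : Matrix (Fin 3) (Fin 3) ℤ) (h : nZ t * N * (nZ t')ᵀ = N)
   (hN : N 0 0 ≠ 0 ∨ N 1 0 ≠ 0) : t = 0 := by
  have h1 := congrFun (congrFun h 1) 0
  have h2 := congrFun (congrFun h 2) 0
  rw [shear_apply] at h1 h2
  simp [nZ, Fin.sum_univ_three] at h1 h2
  rcases h1 with h1 | h1
  · exact h1
  · rw [h1] at h2
    simp at h2
    rcases h2 with h2 | h2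
    · exact h2
    · rcases hN with hN | hN
      · exact absurd h1 hN
      · exact absurd h2 hN

lemma shear_fix (t t' : ℤ) (N : Matrix (Fin 3) (Fin 3) ℤ) (h : nZ t * N * (nZ t')ᵀ = N)
   (hN : N 0 0 ≠ 0 ∨ (N 0 1 ≠ 0 ∧ N 1 0 ≠ 0)) : t = 0 ∧ t' = 0 := by
  refine ⟨shear_fix_aux t t' N h (hN.imp id And.right), ?_⟩
  refine shear_fix_aux t' t Nᵀ ?_ (hN.imp id And.left)
  conv_rhs => rw [← h]
  simp [Matrix.transpose_mul, Matrix.mul_assoc]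

noncomputable def Wt (K : ℝ) : Fin 3 → ℝ := ![2/K, 1, K]

lemma nZ_W (K t : ℕ) (hK : 0 < K) (ht : t < K) (i : Fin 3) :
    ∑ k, |((nZ t i k : ℤ) : ℝ)| * Wt K k ≤ 7 * Wt K i := by
  have hK' : (1:ℝ) ≤ K := by exact_mod_cast hK
  have ht' : (t:ℝ) ≤ K := by exact_mod_cast ht.le
  have ht0 : (0:ℝ) ≤ t := by positivity
  have h2 : (t:ℝ) * (2/K) ≤ 2 := by
    rw [mul_div_assoc', div_le_iff₀ (by linarith)]; linarith
  have h3 : (0:ℝ) ≤ 2/K := by positivity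
  fin_cases i
  · simp [nZ, Wt, Fin.sum_univ_three]; linarith
  · simp [nZ, Wt, Fin.sum_univ_three, abs_of_nonneg ht0]; nlinarith
  · simp [nZ, Wt, Fin.sum_univ_three, abs_of_nonneg ht0]
    have : 2 * (t:ℝ)^2 * (2/K) ≤ 4 * K := by nlinarith
    nlinarith

lemma shear_bound (K L t t' : ℕ) (hK : 0 < K) (ht : t < K) (hL : 0 < L) (ht' : t' < L) (B : ℝ) (hB : 0 ≤ B)
    (N : Matrix (Fin 3) (Fin 3) ℤ) (hN : ∀ i j, |(N i j : ℝ)| ≤ B * Wt K i * Wt L j) (i j : Fin 3) :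
    |(((nZ t * N * (nZ t')ᵀ) i j : ℤ) : ℝ)| ≤ 49 * B * Wt K i * Wt L j := by
  have hw : ∀ (K : ℕ) i, 0 ≤ Wt K i := by intro K i; fin_cases i <;> simp [Wt] <;> positivity
  rw [shear_apply]
  push_cast
  refine (Finset.abs_sum_le_sum_abs _ _).trans ?_
  calc ∑ k, |∑ l, (nZ t i k : ℝ) * N k l * (nZ t' j l)| ≤
      ∑ k, ∑ l, (|(nZ t i k : ℝ)| * Wt K k) * (|(nZ t' j l : ℝ)| * Wt L l) * B := by
        refine Finset.sum_le_sum fun k _ => (Finset.abs_sum_le_sum_abs _ _).trans (Finset.sum_le_sum fun l _ => ?_)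
        rw [abs_mul, abs_mul]
        calc |(nZ t i k : ℝ)| * |(N k l : ℝ)| * |(nZ t' j l : ℝ)| ≤ |(nZ t i k : ℝ)| * (B * Wt K k * Wt L l) * |(nZ t' j l : ℝ)| := by
              gcongr; exact hN k l
          _ = _ := by ring
    _ = (∑ k, |(nZ t i k : ℝ)| * Wt K k) * (∑ l, |(nZ t' j l : ℝ)| * Wt L l) * B := by
        rw [Finset.sum_mul_sum, Finset.sum_mul]
        exact Finset.sum_congr rfl fun k _ => by rw [Finset.sum_mul]
    _ ≤ (7 * Wt K i) * (7 * Wt L j) * B := by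
        have h1 := nZ_W K t hK ht i
        have h2 := nZ_W L t' hL ht' j
        have h3 : 0 ≤ ∑ l, |(nZ t' j l : ℝ)| * Wt L l := Finset.sum_nonneg fun l _ => mul_nonneg (abs_nonneg _) (hw _ _)
        have := hw K i
        gcongr
    _ = _ := by ring

/-- the shears of an index set are distinct -/
lemma shear_card {I : Type*} (S : Finset I) (N : I → Matrix (Fin 3) (Fin 3) ℤ) (K L : ℕ)
    (hinj : ∀ i ∈ S, ∀ j ∈ S, ∀ t t' : ℤ, N i = nZ t * N j * (nZ t')ᵀ → i = j)
    (hN : ∀ i ∈ S, N i 0 0 ≠ 0 ∨ (N i 0 1 ≠ 0 ∧ N i 1 0 ≠ 0))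
    (P : Finset (I9 → ℤ)) (hP : ∀ i ∈ S, ∀ t < K, ∀ t' < L, (fun ij : I9 => (nZ t * N i * (nZ t')ᵀ) ij.1 ij.2) ∈ P) :
    S.card * (K * L) ≤ P.card := by
  have hc : (S ×ˢ (Finset.range K ×ˢ Finset.range L)).card = S.card * (K * L) := by simp
  rw [← hc]
  refine Finset.card_le_card_of_injOn (fun x => (fun ij : I9 => (nZ x.2.1 * N x.1 * (nZ x.2.2)ᵀ) ij.1 ij.2)) ?_ ?_
  · rintro ⟨i, t, t'⟩ hx
    simp only [Finset.coe_product, Set.mem_prod, Finset.mem_coe, Finset.mem_range] at hx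
    exact hP i hx.1 t hx.2.1 t' hx.2.2
  · rintro ⟨i, t, t'⟩ hx ⟨j, s, s'⟩ hy hxy
    simp only [Finset.coe_product, Set.mem_prod, Finset.mem_coe, Finset.mem_range] at hx hy
    have e : nZ t * N i * (nZ t')ᵀ = nZ s * N j * (nZ s')ᵀ := by
      ext a b; exact congrFun hxy (a,b)
    have e2 : N i = nZ (-t+s) * N j * (nZ (-t'+s'))ᵀ := by
      have : nZ (-t) * (nZ t * N i * (nZ t')ᵀ) * (nZ (-t'))ᵀ = N i := by
        rw [← Matrix.mul_assoc, ← Matrix.mul_assoc, nZ_neg_mul, Matrix.one_mul, Matrix.mul_assoc,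
          ← Matrix.transpose_mul, nZ_neg_mul, Matrix.transpose_one, Matrix.mul_one]
      rw [← this, e, ← nZ_mul, ← nZ_mul]
      simp only [Matrix.transpose_mul, Matrix.mul_assoc]
    have hij := hinj i hx.1 j hy.1 _ _ e2
    subst hij
    obtain ⟨h1, h2⟩ := shear_fix _ _ _ e2.symm (hN i hx.1)
    have h1' : t = s := by omega
    have h2' : t' = s' := by omega
    rw [h1', h2']

lemma Icc_card (B : ℝ) (hB : 1/4 ≤ B) : ((Finset.Icc (-⌊B⌋) ⌊B⌋).card : ℝ) ≤ 6 * B := by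
  have h0 : 0 ≤ ⌊B⌋ := Int.floor_nonneg.2 (by linarith)
  rw [Int.card_Icc]
  have : ((⌊B⌋ + 1 - -⌊B⌋).toNat : ℝ) = 2 * ⌊B⌋ + 1 := by
    have h : ((⌊B⌋ + 1 - -⌊B⌋).toNat : ℤ) = 2 * ⌊B⌋ + 1 := by omega
    exact_mod_cast h
  rw [this]
  have := Int.floor_le B
  linarith

lemma mem_Icc_floor (n : ℤ) (B : ℝ) (h : |(n:ℝ)| ≤ B) : n ∈ Finset.Icc (-⌊B⌋) ⌊B⌋ := by
  rw [Finset.mem_Icc]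
  obtain ⟨h1, h2⟩ := abs_le.1 h
  exact ⟨by rw [neg_le]; exact Int.le_floor.2 (by push_cast; linarith), Int.le_floor.2 h2⟩

lemma one_le_of_ne (n : ℤ) (B : ℝ) (hn : n ≠ 0) (h : |(n:ℝ)| ≤ B) : 1 ≤ B := by
  have : (1:ℤ) ≤ |n| := Int.one_le_abs hn
  have h2 : (1:ℝ) ≤ |(n:ℝ)| := by exact_mod_cast this
  linarith

lemma fiber_m {I : Type*} (S : Finset I) (N : I → Matrix (Fin 3) (Fin 3) ℤ) (K L : ℕ) (hK : 0 < K) (hL : 0 < L)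
    (hinj : ∀ i ∈ S, ∀ j ∈ S, ∀ t t' : ℤ, N i = nZ t * N j * (nZ t')ᵀ → i = j) (B : ℝ) (hB : 0 ≤ B)
    (hb : ∀ i ∈ S, ∀ a b, |(N i a b : ℝ)| ≤ B * Wt K a * Wt L b)
    (hN : ∀ i ∈ S, N i 0 0 ≠ 0) : (S.card : ℝ) * (K * L) ≤ 64 * (6*(49*B))^9 := by
  rcases S.eq_empty_or_nonempty with rfl | ⟨i0, hi0⟩
  · simp; positivity
  have hK' : (1:ℝ) ≤ K := by exact_mod_cast hK
  have hL' : (1:ℝ) ≤ L := by exact_mod_cast hL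
  have h00 : 1 ≤ B * (2/K) * (2/L) := by
    have := one_le_of_ne _ _ (hN i0 hi0) (hb i0 hi0 0 0)
    simpa [Wt] using this
  have hwl : ∀ (K : ℕ) (a : Fin 3), 0 < K → 1/K ≤ Wt K a := by
    intro K a hK
    have hK' : (1:ℝ) ≤ K := by exact_mod_cast hK
    have : 1/(K:ℝ) ≤ 1 := by rw [div_le_one (by linarith)]; exact hK'
    fin_cases a
    · simp only [Wt]; show 1/(K:ℝ) ≤ 2/K; gcongr; norm_num
    · simpa [Wt] using this
    · show 1/(K:ℝ) ≤ K; linarith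
  set Bd : I9 → ℝ := fun ij => 49 * B * Wt K ij.1 * Wt L ij.2 with hBd
  have hBd4 : ∀ ij, 1/4 ≤ Bd ij := by
    intro ij
    have h1 := hwl K ij.1 hK
    have h2 := hwl L ij.2 hL
    calc (1/4 : ℝ) ≤ B * (1/K) * (1/L) := by
          have : B * (2/K) * (2/L) = 4 * (B * (1/K) * (1/L)) := by ring
          linarith
      _ ≤ 49 * B * (1/K) * (1/L) := by
          have : 0 ≤ B * (1/K) * (1/L) := by positivity
          linarith
      _ ≤ _ := by
          have : (0:ℝ) ≤ 1/K := by positivity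
          have : (0:ℝ) ≤ 1/L := by positivity
          simp only [hBd]
          gcongr
          exact mul_nonneg (by linarith) (by linarith)
  have hcard := shear_card S N K L hinj (fun i hi => Or.inl (hN i hi))
    (Fintype.piFinset fun ij : I9 => Finset.Icc (-⌊Bd ij⌋) ⌊Bd ij⌋) (by
      intro i hi t ht t' ht'
      rw [Fintype.mem_piFinset]
      intro ij
      exact mem_Icc_floor _ _ (shear_bound K L t t' hK ht hL ht' B hB (N i) (hb i hi) ij.1 ij.2))
  rw [Fintype.card_piFinset] at hcard
  have h2 : (S.card : ℝ) * (K * L) ≤ ∏ ij : I9, (6 * Bd ij) := by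
    have : (S.card : ℝ) * (K * L) ≤ ∏ ij : I9, ((Finset.Icc (-⌊Bd ij⌋) ⌊Bd ij⌋).card : ℝ) := by exact_mod_cast hcard
    exact this.trans (Finset.prod_le_prod (fun _ _ => by positivity) fun ij _ => Icc_card _ (hBd4 ij))
  refine h2.trans (le_of_eq ?_)
  rw [Fintype.prod_prod_type]
  simp only [Fin.prod_univ_three, hBd, Wt, Matrix.cons_val]
  field_simp
  norm_num

lemma fiber_0 {I : Type*} (S : Finset I) (N : I → Matrix (Fin 3) (Fin 3) ℤ) (K L : ℕ) (hK : 0 < K) (hL : 0 < L)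
    (hinj : ∀ i ∈ S, ∀ j ∈ S, ∀ t t' : ℤ, N i = nZ t * N j * (nZ t')ᵀ → i = j) (B : ℝ) (hB : 0 ≤ B)
    (hb : ∀ i ∈ S, ∀ a b, |(N i a b : ℝ)| ≤ B * Wt K a * Wt L b)
    (hN0 : ∀ i ∈ S, N i 0 0 = 0)
    (hN : ∀ i ∈ S, N i 0 1 ≠ 0 ∧ N i 1 0 ≠ 0) : (S.card : ℝ) ≤ 16 * (6*(49*B))^8 := by
  rcases S.eq_empty_or_nonempty with rfl | ⟨i0, hi0⟩
  · simp; positivity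
  have hK' : (1:ℝ) ≤ K := by exact_mod_cast hK
  have hL' : (1:ℝ) ≤ L := by exact_mod_cast hL
  have h01 : 1 ≤ B * (2/K) := by
    have := one_le_of_ne _ _ (hN i0 hi0).1 (hb i0 hi0 0 1)
    simpa [Wt] using this
  have h10 : 1 ≤ B * (2/L) := by
    have := one_le_of_ne _ _ (hN i0 hi0).2 (hb i0 hi0 1 0)
    simpa [Wt] using this
  have hBp : 0 < B := by
    rcases hB.eq_or_lt with h | h
    · rw [← h] at h01; norm_num at h01
    · exact h
  set Bd : I9 → ℝ := fun ij => 49 * B * Wt K ij.1 * Wt L ij.2 with hBd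
  set Bx : I9 → ℝ := fun ij => if ij = (0,0) then 1/6 else 6 * Bd ij with hBx
  have hBd4 : ∀ ij, ij ≠ (0,0) → 1/4 ≤ Bd ij := by
    have hB1 : 1/2 ≤ B := by
      have : B * (2/K) ≤ B * 2 := by gcongr; exact div_le_self (by norm_num) hK'
      linarith
    have e1 : B * (2/K) ≤ B * (2/K) * L := le_mul_of_one_le_right (by positivity) hL'
    have e2 : B * (2/L) ≤ B * (2/L) * K := le_mul_of_one_le_right (by positivity) hK'
    have e3 : B ≤ B * K := le_mul_of_one_le_right (by positivity) hK'
    have e4 : B ≤ B * L := le_mul_of_one_le_right (by positivity) hL'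
    have e5 : B ≤ B * K * L := e3.trans (le_mul_of_one_le_right (by positivity) hL')
    rintro ⟨i, j⟩ hij
    fin_cases i <;> fin_cases j <;> simp [hBd, Wt] at hij ⊢ <;> linarith
  set s : I9 → Finset ℤ := fun ij => if ij = (0,0) then {0} else Finset.Icc (-⌊Bd ij⌋) ⌊Bd ij⌋ with hs
  have hcard := shear_card S N K L hinj (fun i hi => Or.inr (hN i hi))
    (Fintype.piFinset s) (by
      intro i hi t ht t' ht'
      rw [Fintype.mem_piFinset]
      intro ij
      by_cases h : ij = (0,0)
      · simp only [hs, h, if_true, Finset.mem_singleton]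
        rw [shear_apply]
        simp [nZ, Fin.sum_univ_three, hN0 i hi]
      · simp only [hs, h, if_false]
        exact mem_Icc_floor _ _ (shear_bound K L t t' hK ht hL ht' B hB (N i) (hb i hi) ij.1 ij.2))
  rw [Fintype.card_piFinset] at hcard
  have h2 : (S.card : ℝ) * (K * L) ≤ ∏ ij : I9, (if ij = (0,0) then 1 else 6 * Bd ij) := by
    have : (S.card : ℝ) * (K * L) ≤ ∏ ij : I9, ((s ij).card : ℝ) := by exact_mod_cast hcard
    refine this.trans (Finset.prod_le_prod (fun _ _ => by positivity) fun ij _ => ?_)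
    by_cases h : ij = (0,0)
    · simp [hs, h]
    · simp only [hs, h, if_false]; exact Icc_card _ (hBd4 ij h)
  have h3 : ∏ ij : I9, (if ij = (0,0) then 1 else 6 * Bd ij) = 16 * (6*(49*B))^8 * (K * L) := by
    rw [Fintype.prod_prod_type]
    simp only [Fin.prod_univ_three, hBd, Wt, Matrix.cons_val, Prod.mk.injEq]
    simp
    field_simp
    norm_num
  rw [h3] at h2
  exact le_of_mul_le_mul_right h2 (by positivity)
end

section
open Matrix MeasureTheory

def Red0 (x q ψ : ℝ) : Prop := |x| ≤ 1 ∧ 0 < q ∧ q^2*(1-x^2/2) ≤ 1 ∧ 0 ≤ ψ ∧ ψ ≤ 2*Real.pi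

def D0 : Set (I9 → ℝ) := {p | (0 ≤ p (0,0) ∧ p (0,0) ≤ 1) ∧ (0 ≤ p (1,0) ∧ p (1,0) ≤ 1) ∧
  (1 ≤ p (2,0) ∧ p (2,0) ≤ 2) ∧ Red0 (p (0,1)) (p (1,1)) (p (2,1)) ∧ Red0 (p (0,2)) (p (1,2)) (p (2,2))}

lemma kM_le (ψ : ℝ) (i j : Fin 3) : |kM ψ i j| ≤ 1 := by
  have h := congrFun (congrFun (kM_orth ψ) i) i
  rw [Matrix.mul_apply] at h
  simp only [Matrix.transpose_apply, Matrix.one_apply_eq] at h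
  have h1 : kM ψ i j * kM ψ i j ≤ ∑ k, kM ψ i k * kM ψ i k :=
    Finset.single_le_sum (f := fun k => kM ψ i k * kM ψ i k) (fun k _ => mul_self_nonneg _) (Finset.mem_univ j)
  rw [h] at h1
  exact abs_le_one_iff_mul_self_le_one.2 h1

lemma nak_le (x q ψ : ℝ) (K : ℕ) (hx : |x| ≤ 1) (hq : 0 < q) (hq2 : q ≤ 2) (hK : 0 < K) (h1 : (K:ℝ) ≤ 2/q) (h2 : 2/q ≤ 2*K)
    (i j : Fin 3) : |nak x q ψ i j| ≤ 3 * Wt K i := by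
  have hK' : (1:ℝ) ≤ K := by exact_mod_cast hK
  have e1 : q ≤ 2/K := by
    rw [le_div_iff₀ hq] at h1; rw [le_div_iff₀ (by linarith)]; linarith
  have e2 : q⁻¹ ≤ K := by
    rw [div_eq_mul_inv] at h2; linarith
  have k0 := kM_le ψ 0 j
  have k1 := kM_le ψ 1 j
  have k2 := kM_le ψ 2 j
  have hx2 : x^2 ≤ 1 := (sq_le_one_iff_abs_le_one x).2 hx
  rw [nak, nM_aM x q hq.ne', Matrix.mul_apply, Fin.sum_univ_three]
  fin_cases i
  · simp [Wt, abs_mul, abs_of_pos hq]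
    have : q * |kM ψ 0 j| ≤ q * 1 := by gcongr
    linarith [show 0 ≤ 2/(K:ℝ) by positivity]
  · simp [Wt]
    refine (abs_add_le _ _).trans ?_
    rw [abs_mul, abs_mul, abs_of_pos hq]
    have : |x| * q * |kM ψ 0 j| ≤ 1 * 2 * 1 := by gcongr
    linarith
  · simp [Wt]
    refine (abs_add_three _ _ _).trans ?_
    rw [abs_mul, abs_neg, abs_mul, abs_mul, abs_of_pos (inv_pos.2 hq)]
    have i1 : |-(x^2*q)/2| * |kM ψ 0 j| ≤ 1 * 1 := by
      gcongr
      rw [neg_div, abs_neg, abs_of_nonneg (by positivity)]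
      nlinarith
    have i2 : |x| * |kM ψ 1 j| ≤ 1 * 1 := by gcongr
    have i3 : q⁻¹ * |kM ψ 2 j| ≤ K * 1 := by gcongr
    simp only [neg_div, abs_neg] at *
    linarith

lemma Psi_le (p : I9 → ℝ) (hp : p ∈ D0) (K L : ℕ) (hK : 0 < K) (h1 : (K:ℝ) ≤ 2/p (1,1)) (h2 : 2/p (1,1) ≤ 2*K)
    (hL : 0 < L) (h1' : (L:ℝ) ≤ 2/p (1,2)) (h2' : 2/p (1,2) ≤ 2*L) (i j : Fin 3) :
    |Psi p (i,j)| ≤ 162 * Wt K i * Wt L j := by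
  obtain ⟨⟨a1, a2⟩, ⟨b1, b2⟩, ⟨d1, d2⟩, ⟨x1, x2, x3, x4, x5⟩, ⟨y1, y2, y3, y4, y5⟩⟩ := hp
  have hg := nak_le _ _ (p (2,1)) K x1 x2 (q_le_of _ _ x1 x3) hK h1 h2
  have hg' := nak_le _ _ (p (2,2)) L y1 y2 (q_le_of _ _ y1 y3) hL h1' h2'
  have hS : ∀ k l, |Sm (p (0,0)) (p (1,0)) (p (2,0)) k l| ≤ 2 := by
    intro k l
    rw [abs_le]
    fin_cases k <;> fin_cases l <;> simp [Sm] <;> first | (constructor <;> linarith) | linarith | norm_num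
  have hw : ∀ (K : ℕ) i, 0 ≤ Wt K i := by intro K i; fin_cases i <;> simp [Wt] <;> positivity
  simp only [Psi, Matrix.mul_apply, Matrix.transpose_apply, Finset.sum_mul]
  calc _ ≤ ∑ l : Fin 3, ∑ k : Fin 3, (3 * Wt K i) * 2 * (3 * Wt L j) := by
        refine (Finset.abs_sum_le_sum_abs _ _).trans (Finset.sum_le_sum fun l _ =>
          (Finset.abs_sum_le_sum_abs _ _).trans (Finset.sum_le_sum fun k _ => ?_))
        rw [abs_mul, abs_mul]
        have := hw K i
        gcongr
        · exact hg i k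
        · exact hS k l
        · exact hg' j l
    _ = _ := by simp; ring

lemma dyadic (q : ℝ) (hq : 0 < q) (hq2 : q ≤ 2) : ∃ k : ℕ, ((2^k : ℕ) : ℝ) ≤ 2/q ∧ 2/q ≤ 2 * ((2^k : ℕ) : ℝ) := by
  have h1 : 1 ≤ 2/q := by rw [le_div_iff₀ hq]; linarith
  have h0 : ⌊2/q⌋₊ ≠ 0 := by rw [← Nat.one_le_iff_ne_zero, Nat.one_le_floor_iff]; exact h1
  refine ⟨Nat.log 2 ⌊2/q⌋₊, ?_, ?_⟩
  · have := Nat.pow_log_le_self 2 h0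
    exact (by exact_mod_cast this : ((2^(Nat.log 2 ⌊2/q⌋₊) : ℕ):ℝ) ≤ (⌊2/q⌋₊ : ℝ)).trans (Nat.floor_le (by positivity))
  · have := Nat.lt_pow_succ_log_self (b := 2) (by norm_num) ⌊2/q⌋₊
    have h3 : ⌊2/q⌋₊ + 1 ≤ 2 * 2^(Nat.log 2 ⌊2/q⌋₊) := by rw [Nat.succ_eq_add_one, pow_succ] at this; omega
    have h4 : ((⌊2/q⌋₊ : ℝ) + 1) ≤ 2 * ((2^(Nat.log 2 ⌊2/q⌋₊) : ℕ) : ℝ) := by exact_mod_cast h3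
    exact (Nat.lt_floor_add_one (2/q)).le.trans h4

lemma geom_tail_le (κ M : ℕ) : ∑ k ∈ (Finset.range M).filter (κ ≤ ·), (1/2:ℝ)^k ≤ 2 * (1/2)^κ := by
  have h : ∀ m, κ ≤ m → ∑ k ∈ (Finset.range m).filter (κ ≤ ·), (1/2:ℝ)^k = 2 * (1/2)^κ - 2 * (1/2)^m := by
    intro m hm
    induction m, hm using Nat.le_induction with
    | base =>
      rw [Finset.filter_false_of_mem]; · simp
      intro x hx; simp at hx; omega
    | succ m hm ih =>
      rw [Finset.range_add_one, Finset.filter_insert, if_pos hm, Finset.sum_insert (by simp), ih, pow_succ]; ring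
  rcases le_or_gt κ M with hM | hM
  · rw [h M hM]; linarith [show (0:ℝ) ≤ (1/2)^M by positivity]
  · rw [Finset.filter_false_of_mem]
    · simp
    · intro x hx; simp at hx; omega

lemma pow4_le (n : ℕ) : (n+1)^4 ≤ 256 * 2^n := by
  have h : ∀ n, (n+6)^4 ≤ 256 * 2^(n+5) := by
    intro n
    induction n with
    | zero => norm_num
    | succ n ih =>
      have : 2^(n+1+5) = 2 * 2^(n+5) := by ring
      rw [this]
      nlinarith [sq_nonneg (n:ℤ), Nat.zero_le n, Nat.zero_le (n^2), Nat.zero_le (n^3), Nat.zero_le (n^4)]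
  rcases Nat.lt_or_ge n 5 with h5 | h5
  · interval_cases n <;> norm_num
  · obtain ⟨m, rfl⟩ := Nat.exists_eq_add_of_le' h5
    exact h m

theorem tail_count (ε : ℝ) (hε : 0 < ε) : ∃ Y : ℝ, 0 < Y ∧ ∃ X0 : ℝ, 0 < X0 ∧ ∀ X : ℝ, X0 ≤ X →
    ∀ (I : Type) (S : Finset I) (N : I → Matrix (Fin 3) (Fin 3) ℤ) (p : I → I9 → ℝ), (∀ i ∈ S, p i ∈ D0) →
    (∀ i ∈ S, ∀ a b, (N i a b : ℝ) = X * Psi (p i) (a,b)) →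
    (∀ i ∈ S, ∀ j ∈ S, ∀ t t' : ℤ, N i = nZ t * N j * (nZ t')ᵀ → i = j) →
    (∀ i ∈ S, N i 0 0 ≠ 0 ∨ (N i 0 1 ≠ 0 ∧ N i 1 0 ≠ 0)) →
    (∀ i ∈ S, p i (1,1) < 1/Y ∨ p i (1,2) < 1/Y) → (S.card : ℝ) ≤ ε * X^9 := by
  classical
  set C1 : ℝ := 64 * (6*(49*162))^9 with hC1
  set C2 : ℝ := 16 * (6*(49*162))^8 with hC2
  have hC1p : 0 < C1 := by rw [hC1]; norm_num
  have hC2p : 0 < C2 := by rw [hC2]; norm_num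
  obtain ⟨κ, hκ⟩ := exists_pow_lt_of_lt_one (show 0 < ε/(16*C1) by positivity) (show (1/2:ℝ) < 1 by norm_num)
  set δ := ε/(2*C2) with hδ
  have hδp : 0 < δ := by positivity
  refine ⟨2^κ, by positivity, 256*324/δ^2 + 1, by positivity, ?_⟩
  intro X hX I S N p hp hN hinj hirr htail
  have hX1 : 1 ≤ X := le_trans (by have : 0 ≤ 256*324/δ^2 := by positivity
                                   linarith) hX
  have hX0 : 0 < X := by linarith
  have hXd : 256*324 ≤ δ^2 * X := by
    have : 256*324/δ^2 ≤ X := by linarith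
    rw [div_le_iff₀ (by positivity)] at this; linarith
  have hk : ∀ i, ∃ k : ℕ, i ∈ S → ((2^k : ℕ) : ℝ) ≤ 2/p i (1,1) ∧ 2/p i (1,1) ≤ 2 * ((2^k : ℕ) : ℝ) := by
    intro i
    by_cases hi : i ∈ S
    · obtain ⟨-, -, -, ⟨x1, x2, x3, -⟩, -⟩ := hp i hi
      obtain ⟨k, h⟩ := dyadic _ x2 (q_le_of _ _ x1 x3)
      exact ⟨k, fun _ => h⟩
    · exact ⟨0, fun h => absurd h hi⟩
  have hl : ∀ i, ∃ k : ℕ, i ∈ S → ((2^k : ℕ) : ℝ) ≤ 2/p i (1,2) ∧ 2/p i (1,2) ≤ 2 * ((2^k : ℕ) : ℝ) := by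
    intro i
    by_cases hi : i ∈ S
    · obtain ⟨-, -, -, -, ⟨x1, x2, x3, -⟩⟩ := hp i hi
      obtain ⟨k, h⟩ := dyadic _ x2 (q_le_of _ _ x1 x3)
      exact ⟨k, fun _ => h⟩
    · exact ⟨0, fun h => absurd h hi⟩
  choose k hk using hk
  choose l hl using hl
  have hbound : ∀ i ∈ S, ∀ a b, |(N i a b : ℝ)| ≤ 162 * X * Wt (2^k i : ℕ) a * Wt (2^l i : ℕ) b := by
    intro i hi a b
    rw [hN i hi, abs_mul, abs_of_pos hX0]
    have := Psi_le (p i) (hp i hi) (2^k i) (2^l i) (by positivity) (hk i hi).1 (hk i hi).2 (by positivity) (hl i hi).1 (hl i hi).2 a b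
    calc X * |Psi (p i) (a,b)| ≤ X * (162 * Wt (2^k i : ℕ) a * Wt (2^l i : ℕ) b) := by gcongr
      _ = _ := by ring
  have hkκ : ∀ i ∈ S, κ ≤ k i ∨ κ ≤ l i := by
    have aux : ∀ (q : ℝ) (n : ℕ), 0 < q → q < 1/2^κ → 2/q ≤ 2 * ((2^n : ℕ) : ℝ) → κ ≤ n := by
      intro q n h0 h1 h2
      have h3 : (2:ℝ)^κ < 2^n := by
        rw [lt_div_iff₀ (by positivity)] at h1
        rw [div_le_iff₀ h0] at h2
        push_cast at h2
        by_contra hc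
        push Not at hc
        nlinarith
      exact ((pow_lt_pow_iff_right₀ (by norm_num : (1:ℝ) < 2)).1 h3).le
    intro i hi
    obtain ⟨-, -, -, ⟨-, x2, -⟩, ⟨-, y2, -⟩⟩ := hp i hi
    rcases htail i hi with h | h
    · left; exact aux _ _ x2 h (hk i hi).2
    · right; exact aux _ _ y2 h (hl i hi).2
  set S1 := S.filter fun i => N i 0 0 ≠ 0 with hS1
  set S2 := S.filter fun i => ¬ (N i 0 0 ≠ 0) with hS2
  have hsplit : S.card = S1.card + S2.card := (Finset.card_filter_add_card_filter_not _).symm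
  -- first part
  obtain ⟨M, hM⟩ : ∃ M : ℕ, ∀ i ∈ S, k i < M ∧ l i < M := by
    refine ⟨(S.sup k) + (S.sup l) + 1, fun i hi => ?_⟩
    have h1 := Finset.le_sup (f := k) hi
    have h2 := Finset.le_sup (f := l) hi
    omega
  have hS1c : (S1.card : ℝ) ≤ ε/2 * X^9 := by
    set P := ((Finset.range M ×ˢ Finset.range M).filter fun kl => κ ≤ kl.1 ∨ κ ≤ kl.2) with hP
    have hsum : S1.card = ∑ kl ∈ P, (S1.filter fun i => (k i, l i) = kl).card := by
      apply Finset.card_eq_sum_card_fiberwise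
      intro i hi
      have hiS : i ∈ S := (Finset.mem_filter.1 hi).1
      simp only [hP, Finset.coe_filter, Finset.mem_product, Finset.mem_range, Set.mem_setOf_eq]
      exact ⟨hM i hiS, hkκ i hiS⟩
    have hf : ∀ kl ∈ P, ((S1.filter fun i => (k i, l i) = kl).card : ℝ) ≤ (C1 * X^9) * ((1/2)^kl.1 * (1/2)^kl.2) := by
      rintro ⟨k', l'⟩ -
      have hmem : ∀ i ∈ S1.filter (fun i => (k i, l i) = (k', l')), i ∈ S ∧ N i 0 0 ≠ 0 ∧ k i = k' ∧ l i = l' := by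
        intro i hi
        simp only [hS1, Finset.mem_filter, Prod.mk.injEq] at hi
        exact ⟨hi.1.1, hi.1.2, hi.2.1, hi.2.2⟩
      have := fiber_m (S1.filter fun i => (k i, l i) = (k', l')) N (2^k') (2^l') (by positivity) (by positivity)
        (fun i hi j hj => hinj i (hmem i hi).1 j (hmem j hj).1) (162*X) (by positivity)
        (fun i hi a b => by
          have h := hbound i (hmem i hi).1 a b
          rw [(hmem i hi).2.2.1, (hmem i hi).2.2.2] at h; exact h)
        (fun i hi => (hmem i hi).2.1)
      have e : 64 * (6*(49*(162*X)))^9 = C1 * X^9 := by rw [hC1]; ring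
      rw [e] at this
      push_cast at this
      rw [one_div, inv_pow, inv_pow, ← mul_inv, ← div_eq_mul_inv, le_div_iff₀ (by positivity)]
      exact this
    have hg : ∑ kl ∈ P, ((1/2:ℝ)^kl.1 * (1/2)^kl.2) ≤ 8 * (1/2)^κ := by
      have g0 : ∑ k ∈ Finset.range M, (1/2:ℝ)^k ≤ 2 := by
        have := geom_tail_le 0 M; simpa using this
      have g0' : 0 ≤ ∑ k ∈ Finset.range M, (1/2:ℝ)^k := Finset.sum_nonneg fun _ _ => by positivity
      have gk := geom_tail_le κ M
      have gk' : 0 ≤ ∑ k ∈ (Finset.range M).filter (κ ≤ ·), (1/2:ℝ)^k := Finset.sum_nonneg fun _ _ => by positivity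
      have hsub : P ⊆ ((Finset.range M).filter (κ ≤ ·)) ×ˢ Finset.range M ∪ Finset.range M ×ˢ ((Finset.range M).filter (κ ≤ ·)) := by
        rintro ⟨a, b⟩ h
        simp only [hP, Finset.mem_filter, Finset.mem_product, Finset.mem_union] at h ⊢
        tauto
      set A := ((Finset.range M).filter (κ ≤ ·)) ×ˢ Finset.range M with hA
      set B := Finset.range M ×ˢ ((Finset.range M).filter (κ ≤ ·)) with hB
      calc _ ≤ ∑ kl ∈ A ∪ B, ((1/2:ℝ)^kl.1 * (1/2)^kl.2) :=
            Finset.sum_le_sum_of_subset_of_nonneg hsub (fun _ _ _ => by positivity)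
        _ ≤ ∑ kl ∈ A, ((1/2:ℝ)^kl.1 * (1/2)^kl.2) + ∑ kl ∈ B, ((1/2:ℝ)^kl.1 * (1/2)^kl.2) := by
            rw [← Finset.sum_union_inter]
            exact le_add_of_nonneg_right (Finset.sum_nonneg fun _ _ => by positivity)
        _ = (∑ k ∈ (Finset.range M).filter (κ ≤ ·), (1/2:ℝ)^k) * (∑ k ∈ Finset.range M, (1/2:ℝ)^k) +
            (∑ k ∈ Finset.range M, (1/2:ℝ)^k) * (∑ k ∈ (Finset.range M).filter (κ ≤ ·), (1/2:ℝ)^k) := by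
            rw [hA, hB, Finset.sum_product, Finset.sum_product, Finset.sum_mul_sum, Finset.sum_mul_sum]
        _ ≤ (2 * (1/2)^κ) * 2 + 2 * (2 * (1/2)^κ) := by gcongr
        _ = _ := by ring
    rw [hsum]
    push_cast
    refine (Finset.sum_le_sum hf).trans ?_
    rw [← Finset.mul_sum]
    calc C1 * X^9 * ∑ kl ∈ P, ((1/2:ℝ)^kl.1 * (1/2)^kl.2) ≤ C1 * X^9 * (8 * (1/2)^κ) := by gcongr
      _ ≤ C1 * X^9 * (8 * (ε/(16*C1))) := by gcongr
      _ = _ := by field_simp; ring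
  have hS2c : (S2.card : ℝ) ≤ ε/2 * X^9 := by
    set n := Nat.log 2 ⌊324*X⌋₊ with hn
    have hn0 : ⌊324*X⌋₊ ≠ 0 := by
      rw [← Nat.one_le_iff_ne_zero, Nat.one_le_floor_iff]; linarith
    have h2n : ((2:ℝ)^n) ≤ 324*X := by
      have := Nat.pow_log_le_self 2 hn0
      exact (by exact_mod_cast this : ((2:ℝ)^n) ≤ (⌊324*X⌋₊ : ℝ)).trans (Nat.floor_le (by positivity))
    have aux : ∀ (z : ℤ) (m : ℕ), z ≠ 0 → |(z:ℝ)| ≤ 162*X*(2/((2^m : ℕ):ℝ)) → m < n + 1 := by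
      intro z m hz hb
      have h1 := one_le_of_ne z _ hz hb
      rw [mul_div_assoc', le_div_iff₀ (by positivity)] at h1
      have h2 : (2^m : ℕ) ≤ ⌊324*X⌋₊ := Nat.le_floor (by linarith)
      have := Nat.le_log_of_pow_le (by norm_num) h2
      omega
    set P := Finset.range (n+1) ×ˢ Finset.range (n+1) with hP
    have hmem2 : ∀ i ∈ S2, i ∈ S ∧ N i 0 0 = 0 ∧ N i 0 1 ≠ 0 ∧ N i 1 0 ≠ 0 := by
      intro i hi
      simp only [hS2, Finset.mem_filter, not_not] at hi
      refine ⟨hi.1, hi.2, ?_⟩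
      rcases hirr i hi.1 with h | h
      · exact absurd hi.2 h
      · exact h
    have hsum : S2.card = ∑ kl ∈ P, (S2.filter fun i => (k i, l i) = kl).card := by
      apply Finset.card_eq_sum_card_fiberwise
      intro i hi
      obtain ⟨hiS, -, h01, h10⟩ := hmem2 i hi
      simp only [hP, Finset.coe_product, Set.mem_prod, Finset.mem_coe, Finset.mem_range]
      have b1 := hbound i hiS 0 1
      have b2 := hbound i hiS 1 0
      simp only [Wt, Matrix.cons_val] at b1 b2
      rw [mul_one] at b1 b2
      exact ⟨aux _ _ h01 b1, aux _ _ h10 b2⟩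
    have hf : ∀ kl ∈ P, ((S2.filter fun i => (k i, l i) = kl).card : ℝ) ≤ C2 * X^8 := by
      rintro ⟨k', l'⟩ -
      have hmem : ∀ i ∈ S2.filter (fun i => (k i, l i) = (k', l')), i ∈ S2 ∧ k i = k' ∧ l i = l' := by
        intro i hi
        simp only [Finset.mem_filter, Prod.mk.injEq] at hi
        exact hi
      have := fiber_0 (S2.filter fun i => (k i, l i) = (k', l')) N (2^k') (2^l') (by positivity) (by positivity)
        (fun i hi j hj => hinj i (hmem2 i (hmem i hi).1).1 j (hmem2 j (hmem j hj).1).1) (162*X) (by positivity)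
        (fun i hi a b => by
          have h := hbound i (hmem2 i (hmem i hi).1).1 a b
          rw [(hmem i hi).2.1, (hmem i hi).2.2] at h; exact h)
        (fun i hi => (hmem2 i (hmem i hi).1).2.1)
        (fun i hi => (hmem2 i (hmem i hi).1).2.2)
      have e : 16 * (6*(49*(162*X)))^8 = C2 * X^8 := by rw [hC2]; ring
      rwa [e] at this
    rw [hsum]
    push_cast
    refine (Finset.sum_le_card_nsmul _ _ _ hf).trans ?_
    rw [nsmul_eq_mul, hP, Finset.card_product, Finset.card_range]
    push_cast
    have h4 : (((n:ℝ)+1)^2)^2 ≤ (δ*X)^2 := by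
      have : ((n:ℝ)+1)^4 ≤ 256 * 2^n := by exact_mod_cast pow4_le n
      calc (((n:ℝ)+1)^2)^2 = ((n:ℝ)+1)^4 := by ring
        _ ≤ 256 * (324*X) := this.trans (by gcongr)
        _ ≤ δ^2*X*X := by nlinarith
        _ = _ := by ring
    have h5 : ((n:ℝ)+1)^2 ≤ δ*X := (sq_le_sq₀ (by positivity) (by positivity)).1 h4
    calc ((n:ℝ)+1)*((n:ℝ)+1)*(C2*X^8) = ((n:ℝ)+1)^2*(C2*X^8) := by ring
      _ ≤ δ*X*(C2*X^8) := by gcongr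
      _ = _ := by rw [hδ]; field_simp
  rw [hsplit]
  push_cast
  linarith
end

section
open Matrix MeasureTheory

/-- values of the standard basis at the roots -/
noncomputable def Fe (a b : ℂ) (s : Fin 3 → ℂ) : Matrix (Fin 3) (Fin 3) ℂ :=
  Matrix.of ![fun _ => 1, s, fun m => s m ^ 2 + a * s m + b / 2]
noncomputable def Fp (a d : ℂ) (s : Fin 3 → ℂ) : Matrix (Fin 3) (Fin 3) ℂ :=
  Matrix.of ![s, fun _ => d, fun m => s m ^ 2 + a / 2 * s m]
noncomputable def wr (a b : ℂ) (s : Fin 3 → ℂ) (m : Fin 3) : ℂ := 3 * s m ^ 2 + 2 * a * s m + b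
noncomputable def SmC (a b d : ℂ) : Matrix (Fin 3) (Fin 3) ℂ := !![0,0,1; 1,0,-a/2; 0,d,-b/2]

def Vieta (a b d : ℂ) (s : Fin 3 → ℂ) : Prop :=
  a = -(s 0 + s 1 + s 2) ∧ b = s 0 * s 1 + s 0 * s 2 + s 1 * s 2 ∧ d ^ 2 = s 0 * s 1 * s 2

lemma Fe_orth (a b d : ℂ) (s : Fin 3 → ℂ) (h : Vieta a b d s) :
    (Fe a b s)ᵀ * Gm ℂ * Fe a b s = diagonal (wr a b s) := by
  obtain ⟨rfl, rfl, -⟩ := h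
  ext i j
  fin_cases i <;> fin_cases j <;> simp [Fe, Gm, wr, Matrix.mul_apply, Fin.sum_univ_three] <;> ring

lemma Fp_orth (a b d : ℂ) (s : Fin 3 → ℂ) (h : Vieta a b d s) :
    (Fp a d s)ᵀ * Gm ℂ * Fp a d s = diagonal (fun m => s m * wr a b s m) := by
  obtain ⟨rfl, rfl, h⟩ := h
  ext i j
  fin_cases i <;> fin_cases j <;> simp [Fp, Gm, wr, Matrix.mul_apply, Fin.sum_univ_three] <;> linear_combination h

lemma Fp_eq (a b d : ℂ) (s : Fin 3 → ℂ) : (Fe a b s)ᵀ * Gm ℂ * SmC a b d = (Fp a d s)ᵀ := by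
  ext i j
  fin_cases i <;> fin_cases j <;> simp [Fe, Fp, SmC, Gm, Matrix.mul_apply, Fin.sum_univ_three] <;> ring

noncomputable def hC (a b : ℂ) (s : Fin 3 → ℂ) (Y : Matrix (Fin 3) (Fin 3) ℂ) : Matrix (Fin 3) (Fin 3) ℂ :=
  Y * diagonal (fun m => (wr a b s m)⁻¹) * ((Fe a b s)ᵀ * Gm ℂ)
noncomputable def hC' (a b d : ℂ) (s : Fin 3 → ℂ) (Y : Matrix (Fin 3) (Fin 3) ℂ) : Matrix (Fin 3) (Fin 3) ℂ :=
  Y * diagonal (fun m => (s m * wr a b s m)⁻¹) * ((Fp a d s)ᵀ * Gm ℂ)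

lemma hC_gram (a b d : ℂ) (s : Fin 3 → ℂ) (h : Vieta a b d s) (hw : ∀ m, wr a b s m ≠ 0) (Y : Matrix (Fin 3) (Fin 3) ℂ) :
    hC a b s Y * Gm ℂ * (hC a b s Y)ᵀ = Y * diagonal (fun m => (wr a b s m)⁻¹) * Yᵀ := by
  set D := diagonal (fun m => (wr a b s m)⁻¹) with hD
  have h1 : diagonal (wr a b s) * D = 1 := by
    rw [hD, diagonal_mul_diagonal, ← diagonal_one]; congr 1; ext m; exact mul_inv_cancel₀ (hw m)
  have h2 : Dᵀ = D := by rw [hD, diagonal_transpose]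
  calc _ = Y * D * ((Fe a b s)ᵀ * (Gm ℂ * Gm ℂ) * Gm ℂ * Fe a b s) * D * Yᵀ := by
        simp only [hC, Matrix.transpose_mul, Matrix.transpose_transpose, Gm_transpose, h2, Matrix.mul_assoc, ← hD]
    _ = Y * D * (diagonal (wr a b s) * D) * Yᵀ := by
        rw [Gm_sq, Matrix.mul_one, Fe_orth a b d s h]; simp only [Matrix.mul_assoc]
    _ = _ := by rw [h1, Matrix.mul_one]

lemma hC'_F (a b d : ℂ) (s : Fin 3 → ℂ) (h : Vieta a b d s) (hw : ∀ m, wr a b s m ≠ 0) (hs : ∀ m, s m ≠ 0)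
    (Y : Matrix (Fin 3) (Fin 3) ℂ) : hC' a b d s Y * Fp a d s = Y := by
  set D := diagonal (fun m => (s m * wr a b s m)⁻¹) with hD
  have h1 : D * diagonal (fun m => s m * wr a b s m) = 1 := by
    rw [hD, diagonal_mul_diagonal, ← diagonal_one]; congr 1; ext m
    exact inv_mul_cancel₀ (mul_ne_zero (hs m) (hw m))
  calc _ = Y * D * ((Fp a d s)ᵀ * Gm ℂ * Fp a d s) := by
        simp only [hC', Matrix.mul_assoc, ← hD]
    _ = _ := by rw [Fp_orth a b d s h, Matrix.mul_assoc, h1, Matrix.mul_one]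

lemma hC'_gram (a b d : ℂ) (s : Fin 3 → ℂ) (h : Vieta a b d s) (hw : ∀ m, wr a b s m ≠ 0) (hs : ∀ m, s m ≠ 0)
    (Y : Matrix (Fin 3) (Fin 3) ℂ) :
    hC' a b d s Y * Gm ℂ * (hC' a b d s Y)ᵀ = Y * diagonal (fun m => (s m * wr a b s m)⁻¹) * Yᵀ := by
  have h0 := hC'_F a b d s h hw hs Y
  set D := diagonal (fun m => (s m * wr a b s m)⁻¹) with hD
  have h2 : Dᵀ = D := by rw [hD, diagonal_transpose]
  calc _ = hC' a b d s Y * (Gm ℂ * Gm ℂ) * Fp a d s * D * Yᵀ := by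
        conv_lhs => rw [show (hC' a b d s Y)ᵀ = Gm ℂ * Fp a d s * D * Yᵀ by
          simp only [hC', Matrix.transpose_mul, Matrix.transpose_transpose, Gm_transpose, h2, Matrix.mul_assoc, ← hD]]
        simp only [Matrix.mul_assoc]
    _ = _ := by rw [Gm_sq, Matrix.mul_one, h0]

lemma hC_N (a b d : ℂ) (s : Fin 3 → ℂ) (h : Vieta a b d s) (hw : ∀ m, wr a b s m ≠ 0) (hs : ∀ m, s m ≠ 0)
    (Y Y' : Matrix (Fin 3) (Fin 3) ℂ) :
    hC a b s Y * SmC a b d * (hC' a b d s Y')ᵀ = Y * diagonal (fun m => (wr a b s m)⁻¹) * Y'ᵀ := by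
  have h0 := congrArg Matrix.transpose (hC'_F a b d s h hw hs Y')
  rw [Matrix.transpose_mul] at h0
  calc _ = Y * diagonal (fun m => (wr a b s m)⁻¹) * ((Fe a b s)ᵀ * Gm ℂ * SmC a b d) * (hC' a b d s Y')ᵀ := by
        simp only [hC, Matrix.mul_assoc]
    _ = _ := by rw [Fp_eq, Matrix.mul_assoc, h0]

lemma cj2 : (starRingEnd ℂ) 2 = 2 := map_ofNat _ 2
lemma cj3 : (starRingEnd ℂ) 3 = 3 := map_ofNat _ 3

/-- roots vector and value matrix -/
noncomputable def sv (r : ℝ) (z : ℂ) : Fin 3 → ℂ := ![(r:ℂ), z, (starRingEnd ℂ) z]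
noncomputable def Ym (u : Fin 3 → ℝ) (v : Fin 3 → ℂ) : Matrix (Fin 3) (Fin 3) ℂ :=
  Matrix.of fun i => ![(u i : ℂ), v i, (starRingEnd ℂ) (v i)]

lemma re_sum (x : ℝ) (w : ℂ) : ((x + 2 * w.re : ℝ) : ℂ) = x + w + (starRingEnd ℂ) w := by
  rw [add_assoc, Complex.add_conj]; push_cast; ring

lemma Ym_D (u u' : Fin 3 → ℝ) (v v' : Fin 3 → ℂ) (g : Fin 3 → ℂ) (x : ℝ) (w : ℂ) (hg : g = sv x w) (i j : Fin 3) :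
    (Ym u v * diagonal g * (Ym u' v')ᵀ) i j = ((u i * u' j * x + 2 * (v i * v' j * w).re : ℝ) : ℂ) := by
  rw [re_sum, hg]
  simp [Matrix.mul_apply, Fin.sum_univ_three, Ym, diagonal, sv]
  ring

noncomputable def hR (a b r : ℝ) (z : ℂ) (u : Fin 3 → ℝ) (v : Fin 3 → ℂ) : Matrix (Fin 3) (Fin 3) ℝ :=
  (hC a b (sv r z) (Ym u v)).map Complex.re
noncomputable def hR' (a b d r : ℝ) (z : ℂ) (u : Fin 3 → ℝ) (v : Fin 3 → ℂ) : Matrix (Fin 3) (Fin 3) ℝ :=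
  (hC' a b d (sv r z) (Ym u v)).map Complex.re

lemma conj_three (x : ℝ) (w c : ℂ) (h : c = x + w + (starRingEnd ℂ) w) : (c.re : ℂ) = c := by
  rw [h, ← re_sum, Complex.ofReal_re]

lemma hR_map (a b r : ℝ) (z : ℂ) (u : Fin 3 → ℝ) (v : Fin 3 → ℂ) :
    (hR a b r z u v).map (Complex.ofReal) = hC a b (sv r z) (Ym u v) := by
  ext i j
  simp only [hR, Matrix.map_apply]
  have key : ∀ k : Fin 3, hC a b (sv r z) (Ym u v) i k =
    ((u i * (3*r^2+2*a*r+b)⁻¹ * (![r^2+a*r+b/2, r, 1] : Fin 3 → ℝ) k : ℝ) : ℂ) +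
    (v i * (3*z^2+2*a*z+b)⁻¹ * (![z^2+a*z+b/2, z, 1] : Fin 3 → ℂ) k) +
    (starRingEnd ℂ) (v i * (3*z^2+2*a*z+b)⁻¹ * (![z^2+a*z+b/2, z, 1] : Fin 3 → ℂ) k) := by
    intro k
    fin_cases k <;> simp [hC, Fe, Gm, Ym, wr, sv, Matrix.mul_apply, Fin.sum_univ_three, diagonal, cj2, cj3] <;> try ring
  exact conj_three _ _ _ (key j)

lemma hR'_map (a b d r : ℝ) (z : ℂ) (u : Fin 3 → ℝ) (v : Fin 3 → ℂ) :
    (hR' a b d r z u v).map (Complex.ofReal) = hC' a b d (sv r z) (Ym u v) := by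
  ext i j
  simp only [hR', Matrix.map_apply]
  have key : ∀ k : Fin 3, hC' a b d (sv r z) (Ym u v) i k =
    ((u i * (r * (3*r^2+2*a*r+b))⁻¹ * (![r^2+a/2*r, d, r] : Fin 3 → ℝ) k : ℝ) : ℂ) +
    (v i * (z*(3*z^2+2*a*z+b))⁻¹ * (![z^2+a/2*z, (d:ℂ), z] : Fin 3 → ℂ) k) +
    (starRingEnd ℂ) (v i * (z*(3*z^2+2*a*z+b))⁻¹ * (![z^2+a/2*z, (d:ℂ), z] : Fin 3 → ℂ) k) := by
    intro k
    fin_cases k <;> simp [hC', Fp, Gm, Ym, wr, sv, Matrix.mul_apply, Fin.sum_univ_three, diagonal, cj2, cj3] <;> try ring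
  exact conj_three _ _ _ (key j)

lemma map_ofReal_inj {A B : Matrix (Fin 3) (Fin 3) ℝ} (h : A.map Complex.ofReal = B.map Complex.ofReal) : A = B := by
  ext i j
  have := congrFun (congrFun h i) j
  simpa using this

lemma Gm_map : (Gm ℝ).map Complex.ofReal = Gm ℂ := by
  ext i j; fin_cases i <;> fin_cases j <;> simp [Gm]
lemma Sm_map (a b d : ℝ) : (Sm a b d).map Complex.ofReal = SmC a b d := by
  ext i j; fin_cases i <;> fin_cases j <;> simp [Sm, SmC]

lemma map_mul_ofReal (A B : Matrix (Fin 3) (Fin 3) ℝ) :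
    (A * B).map Complex.ofReal = A.map Complex.ofReal * B.map Complex.ofReal :=
  Matrix.map_mul (f := Complex.ofRealHom)

theorem coord (a b d r : ℝ) (z : ℂ) (hV : Vieta a b d (sv r z)) (hw : ∀ m, wr a b (sv r z) m ≠ 0)
    (hs : ∀ m, sv r z m ≠ 0) (u u' : Fin 3 → ℝ) (v v' : Fin 3 → ℂ) :
    (∀ i j, (hR a b r z u v * Gm ℝ * (hR a b r z u v)ᵀ) i j =
      u i * u j * (3*r^2+2*a*r+b)⁻¹ + 2 * (v i * v j * (3*z^2+2*a*z+b)⁻¹).re) ∧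
    (∀ i j, (hR' a b d r z u' v' * Gm ℝ * (hR' a b d r z u' v')ᵀ) i j =
      u' i * u' j * (r*(3*r^2+2*a*r+b))⁻¹ + 2 * (v' i * v' j * (z*(3*z^2+2*a*z+b))⁻¹).re) ∧
    (∀ i j, (hR a b r z u v * Sm a b d * (hR' a b d r z u' v')ᵀ) i j =
      u i * u' j * (3*r^2+2*a*r+b)⁻¹ + 2 * (v i * v' j * (3*z^2+2*a*z+b)⁻¹).re) := by
  refine ⟨fun i j => ?_, fun i j => ?_, fun i j => ?_⟩
  · have h := hC_gram a b d _ hV hw (Ym u v)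
    rw [← hR_map, ← Gm_map, ← Matrix.transpose_map, ← map_mul_ofReal, ← map_mul_ofReal] at h
    have h1 := congrFun (congrFun h i) j
    rw [Ym_D u u v v _ ((3*r^2+2*a*r+b)⁻¹) ((3*z^2+2*a*z+b)⁻¹) (by
      ext m; fin_cases m <;> simp [wr, sv, cj2, cj3])] at h1
    exact Complex.ofReal_injective h1
  · have h := hC'_gram a b d _ hV hw hs (Ym u' v')
    rw [← hR'_map, ← Gm_map, ← Matrix.transpose_map, ← map_mul_ofReal, ← map_mul_ofReal] at h
    have h1 := congrFun (congrFun h i) j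
    rw [Ym_D u' u' v' v' _ ((r*(3*r^2+2*a*r+b))⁻¹) ((z*(3*z^2+2*a*z+b))⁻¹) (by
      ext m; fin_cases m <;> simp [wr, sv, cj2, cj3])] at h1
    exact Complex.ofReal_injective h1
  · have h := hC_N a b d _ hV hw hs (Ym u v) (Ym u' v')
    rw [← hR_map, ← hR'_map, ← Sm_map, ← Matrix.transpose_map, ← map_mul_ofReal, ← map_mul_ofReal] at h
    have h1 := congrFun (congrFun h i) j
    rw [Ym_D u u' v v' _ ((3*r^2+2*a*r+b)⁻¹) ((3*z^2+2*a*z+b)⁻¹) (by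
      ext m; fin_cases m <;> simp [wr, sv, cj2, cj3])] at h1
    exact Complex.ofReal_injective h1

lemma hR_det_neg (a b r : ℝ) (z : ℂ) (u : Fin 3 → ℝ) (v : Fin 3 → ℂ) :
    (hR a b r z u (-v)).det = (hR a b r z u v).det := by
  have h : ∀ v, ((hR a b r z u v).det : ℂ) = (hC a b (sv r z) (Ym u v)).det := by
    intro v
    rw [← hR_map]
    exact RingHom.map_det Complex.ofRealHom _
  apply Complex.ofReal_injective
  have e : Ym u (-v) = Ym u v * diagonal ![1,-1,-1] := by
    ext i j; fin_cases j <;> simp [Ym, diagonal, Matrix.mul_apply, Fin.sum_univ_three]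
  rw [h, h, e]
  simp [hC, Matrix.det_mul, Matrix.det_diagonal, Fin.prod_univ_three]

lemma hR_add (a b r : ℝ) (z : ℂ) (u u' : Fin 3 → ℝ) (v v' : Fin 3 → ℂ) :
    hR a b r z u v + hR a b r z u' v' = hR a b r z (u + u') (v + v') := by
  have e : Ym (u + u') (v + v') = Ym u v + Ym u' v' := by
    ext i j; fin_cases j <;> simp [Ym]
  ext i j
  simp only [hR, hC, e, Matrix.add_mul, Matrix.map_apply, Matrix.add_apply, Complex.add_re]
end

section
open Matrix MeasureTheory

/-- A cubic field `K = ℚ(θ)` with `θ³ + aθ² + bθ - d² = 0` and the functional `φ` reading off the coefficient of `θ²`. -/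
structure CD (K : Type*) [Field K] [CharZero K] where
  a : ℤ
  b : ℤ
  d : ℤ
  θ : K
  φ : K →+ ℚ
  hθ : θ^3 + a*θ^2 + b*θ - d^2 = 0
  φ0 : φ 1 = 0
  φ1 : φ θ = 0
  φ2 : φ (θ^2) = 1
  span : ∀ x, ∃ c0 c1 c2 : ℚ, x = c0 + c1*θ + c2*θ^2
  hd : d ≠ 0

namespace CD
variable {K : Type*} [Field K] [CharZero K] (C : CD K)

lemma φ_mul (c : ℚ) (x : K) : C.φ ((c:K) * x) = c * C.φ x := by
  have h := map_rat_smul C.φ c x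
  rwa [Rat.smul_def, smul_eq_mul] at h

lemma φ_mul' (c : ℚ) (x : K) : C.φ (x * (c:K)) = c * C.φ x := by rw [mul_comm, φ_mul]

lemma φ_int (c : ℤ) (x : K) : C.φ ((c:K) * x) = c * C.φ x := by
  have := C.φ_mul c x; simpa using this

lemma φ_coef (c0 c1 c2 : ℚ) : C.φ (c0 + c1*C.θ + c2*C.θ^2) = c2 := by
  have h := C.φ_mul c0 1
  rw [mul_one] at h
  rw [map_add, map_add, h, φ_mul, φ_mul, C.φ0, C.φ1, C.φ2]; ring

lemma θ_ne : C.θ ≠ 0 := by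
  intro h
  have := C.φ2
  rw [h] at this; simp at this

lemma nondeg (x : K) (h0 : C.φ x = 0) (h1 : C.φ (x * C.θ) = 0) (h2 : C.φ (x * C.θ^2) = 0) : x = 0 := by
  obtain ⟨c0, c1, c2, rfl⟩ := C.span x
  rw [φ_coef] at h0
  subst h0
  have e1 : ((c0:K) + c1*C.θ + ((0:ℚ):K)*C.θ^2) * C.θ = ((0:ℚ):K) + c0 * C.θ + c1 * C.θ^2 := by push_cast; ring
  rw [e1, φ_coef] at h1
  subst h1
  have e2 : ((c0:K) + ((0:ℚ):K)*C.θ + ((0:ℚ):K)*C.θ^2) * C.θ^2 = ((0:ℚ):K) + ((0:ℚ):K) * C.θ + c0 * C.θ^2 := by push_cast; ring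
  rw [e2, φ_coef] at h2
  subst h2
  simp

lemma nondeg' (x : K) (h : ∀ y, C.φ (x * y) = 0) : x = 0 :=
  C.nondeg x (by simpa using h 1) (h _) (h _)

/-- uniqueness of coordinates -/
lemma coef_zero (c0 c1 c2 : ℚ) (h : (c0:K) + c1*C.θ + c2*C.θ^2 = 0) : c0 = 0 ∧ c1 = 0 ∧ c2 = 0 := by
  have h2 : c2 = 0 := by rw [← C.φ_coef c0 c1 c2, h, map_zero]
  subst h2
  have h1 : c1 = 0 := by
    have e : ((0:ℚ):K) + c0 * C.θ + c1 * C.θ^2 = 0 := by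
      have := congrArg (· * C.θ) h
      simp only [zero_mul] at this
      rw [← this]; push_cast; ring
    rw [← C.φ_coef 0 c0 c1, e, map_zero]
  subst h1
  refine ⟨?_, rfl, rfl⟩
  have : (c0:K) = 0 := by simpa using h
  exact_mod_cast this

lemma gram_span (α : K) (b : Fin 3 → K) (S : Matrix (Fin 3) (Fin 3) ℚ) (hS : ∀ i j, C.φ (b i * b j / α) = S i j)
    (hd : S.det ≠ 0) (x : K) : ∃ c : Fin 3 → ℚ, x = ∑ i, (c i : K) * b i := by
  choose c0 c1 c2 hc using fun i => C.span (b i)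
  set P : Matrix (Fin 3) (Fin 3) ℚ := Matrix.of fun i => ![c0 i, c1 i, c2 i] with hP
  set t : Fin 3 → K := ![1, C.θ, C.θ^2] with ht
  have hb : ∀ i, b i = ∑ k, (P i k : K) * t k := by
    intro i; rw [hc i]; simp [hP, ht, Fin.sum_univ_three]
  set H : Matrix (Fin 3) (Fin 3) ℚ := Matrix.of fun k l => C.φ (t k * t l / α) with hH
  have hSP : S = P * H * Pᵀ := by
    ext i j
    rw [← hS, hb i, hb j]
    have : (∑ k, (P i k : K) * t k) * (∑ k, (P j k : K) * t k) / α =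
      ∑ l, ∑ k, ((P i k * P j l : ℚ) : K) * (t k * t l / α) := by
      simp only [Fin.sum_univ_three]; push_cast; ring
    rw [this]
    simp only [map_sum, φ_mul, Matrix.mul_apply, hH, Matrix.transpose_apply, Finset.sum_mul, Matrix.of_apply]
    exact Finset.sum_congr rfl fun l _ => Finset.sum_congr rfl fun k _ => by ring
  have hPd : IsUnit P.det := by
    rw [isUnit_iff_ne_zero]; intro h0
    apply hd; rw [hSP, Matrix.det_mul, Matrix.det_mul, h0]; ring
  have hinv := Matrix.nonsing_inv_mul P hPd
  have ht' : ∀ k, t k = ∑ i, ((P⁻¹ k i : ℚ) : K) * b i := by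
    intro k
    have h1 : ∀ l, ∑ i, P⁻¹ k i * P i l = if k = l then 1 else 0 := by
      intro l
      have := congrFun (congrFun hinv k) l
      rwa [Matrix.mul_apply, Matrix.one_apply] at this
    have : ∑ i, ((P⁻¹ k i : ℚ) : K) * b i = ∑ l, ((∑ i, P⁻¹ k i * P i l : ℚ) : K) * t l := by
      simp only [hb, Fin.sum_univ_three]; push_cast; ring
    rw [this]
    simp only [h1]
    fin_cases k <;> simp [Fin.sum_univ_three]
  obtain ⟨x0, x1, x2, hx⟩ := C.span x
  refine ⟨fun i => x0 * P⁻¹ 0 i + x1 * P⁻¹ 1 i + x2 * P⁻¹ 2 i, ?_⟩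
  have hx' : x = x0 * t 0 + x1 * t 1 + x2 * t 2 := by rw [hx]; simp [ht]
  rw [hx', ht' 0, ht' 1, ht' 2]
  simp only [Fin.sum_univ_three]; push_cast; ring

lemma gram_zero (α : K) (hα : α ≠ 0) (b : Fin 3 → K) (S : Matrix (Fin 3) (Fin 3) ℚ) (hS : ∀ i j, C.φ (b i * b j / α) = S i j)
    (hd : S.det ≠ 0) (x : K) (hx : ∀ k, C.φ (x * b k / α) = 0) : x = 0 := by
  apply C.nondeg'
  intro y
  obtain ⟨c, hc⟩ := C.gram_span α b S hS hd (α * y)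
  have : x * y = ∑ i, ((c i : ℚ) : K) * (x * b i / α) := by
    have : y = (∑ i, (c i : K) * b i) / α := by rw [← hc]; field_simp
    rw [this, Finset.sum_div, Finset.mul_sum]
    exact Finset.sum_congr rfl fun i _ => by ring
  rw [this, map_sum]
  exact Finset.sum_eq_zero fun i _ => by rw [φ_mul, hx, mul_zero]

lemma gram_lin {b : Fin 3 → K} {α : K} {S : Matrix (Fin 3) (Fin 3) ℚ} (hS : ∀ i j, C.φ (b i * b j / α) = S i j)
    (hd : S.det ≠ 0) (c : Fin 3 → ℚ) (h : ∑ i, (c i : K) * b i = 0) : c = 0 := by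
  have h1 : c ᵥ* S = 0 := by
    ext j
    have : C.φ ((∑ i, (c i : K) * b i) * b j / α) = ∑ i, c i * S i j := by
      simp only [← hS, ← φ_mul, ← map_sum]
      congr 1
      rw [Finset.sum_mul, Finset.sum_div]
      exact Finset.sum_congr rfl fun i _ => by ring
    rw [h] at this
    simp only [zero_mul, zero_div, map_zero] at this
    simp [Matrix.vecMul, dotProduct, ← this]
  by_contra hc
  exact hd (Matrix.exists_vecMul_eq_zero_iff.1 ⟨c, hc, h1⟩)

/-- `b` is `θ`-cyclic through `T` -/
def Eig (T : Matrix (Fin 3) (Fin 3) ℤ) (b : Fin 3 → K) : Prop := ∀ i, C.θ * b i = ∑ j, (T i j : K) * b j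

theorem inj (T : Matrix (Fin 3) (Fin 3) ℤ) (b c : Fin 3 → K) (α γ : K) (hα : α ≠ 0) (hγ : γ ≠ 0)
    (hb : C.Eig T b) (hc : C.Eig T c) (S : Matrix (Fin 3) (Fin 3) ℚ) (hd : S.det ≠ 0)
    (hSb : ∀ i j, C.φ (b i * b j / α) = S i j) (hSc : ∀ i j, C.φ (c i * c j / γ) = S i j) :
    ∃ κ : K, κ ≠ 0 ∧ (∀ i, c i = κ * b i) ∧ γ = κ^2 * α := by
  classical
  -- the linear map sending b to c
  have hlin : ∀ x : Fin 3 → ℚ, ∑ i, (x i : K) * b i = 0 → ∑ i, (x i : K) * c i = 0 := by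
    intro x hx
    rw [C.gram_lin hSb hd x hx]; simp
  choose g hg using C.gram_span α b S hSb hd
  let ℓ : K → K := fun x => ∑ i, (g x i : K) * c i
  have hℓ : ∀ (x : K) (y : Fin 3 → ℚ), x = ∑ i, (y i : K) * b i → ℓ x = ∑ i, (y i : K) * c i := by
    intro x y hxy
    have := hlin (g x - y) (by
      simp only [Pi.sub_apply]; push_cast
      simp only [sub_mul, Finset.sum_sub_distrib]
      rw [← hg x, ← hxy, sub_self])
    simp only [Pi.sub_apply] at this; push_cast at this
    simp only [sub_mul, Finset.sum_sub_distrib] at this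
    exact sub_eq_zero.1 this
  have hadd : ∀ x y, ℓ (x + y) = ℓ x + ℓ y := by
    intro x y
    rw [hℓ (x+y) (g x + g y) (by
      simp only [Pi.add_apply]; push_cast
      simp only [add_mul, Finset.sum_add_distrib]; rw [← hg x, ← hg y])]
    simp only [Pi.add_apply]; push_cast
    simp only [add_mul, Finset.sum_add_distrib, ℓ]
  have hsm : ∀ (q : ℚ) x, ℓ ((q:K) * x) = q * ℓ x := by
    intro q x
    rw [hℓ (q*x) (fun i => q * g x i) (by
      conv_lhs => rw [hg x, Finset.mul_sum]
      exact Finset.sum_congr rfl fun i _ => by push_cast; ring)]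
    simp only [ℓ, Finset.mul_sum]
    exact Finset.sum_congr rfl fun i _ => by push_cast; ring
  have hb' : ∀ i, ℓ (b i) = c i := by
    intro i
    have hs : ∀ e : Fin 3 → K, ∑ j, ((Pi.single i 1 : Fin 3 → ℚ) j : K) * e j = e i := by
      intro e
      rw [Finset.sum_eq_single i (fun j _ hj => by simp [Pi.single_eq_of_ne hj]) (by simp)]
      simp
    rw [hℓ (b i) (Pi.single i 1) (hs b).symm, hs c]
  have hsum : ∀ (q : Fin 3 → ℚ) , ℓ (∑ i, (q i : K) * b i) = ∑ i, (q i : K) * c i := fun q => hℓ _ q rfl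
  have hθ : ∀ x, ℓ (C.θ * x) = C.θ * ℓ x := by
    intro x
    have e1 : C.θ * x = ∑ j, ((∑ i, g x i * (T i j : ℚ) : ℚ) : K) * b j := by
      conv_lhs => rw [hg x, Finset.mul_sum]
      have : ∀ i, C.θ * ((g x i : K) * b i) = ∑ j, ((g x i * (T i j : ℚ) : ℚ) : K) * b j := by
        intro i
        rw [mul_left_comm, hb i, Finset.mul_sum]
        exact Finset.sum_congr rfl fun j _ => by push_cast; ring
      simp only [this]
      rw [Finset.sum_comm]
      refine Finset.sum_congr rfl fun j _ => ?_
      rw [← Finset.sum_mul]; push_cast; rfl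
    rw [e1, hsum]
    have : ∀ i, C.θ * ((g x i : K) * c i) = ∑ j, ((g x i * (T i j : ℚ) : ℚ) : K) * c j := by
      intro i
      rw [mul_left_comm, hc i, Finset.mul_sum]
      exact Finset.sum_congr rfl fun j _ => by push_cast; ring
    simp only [ℓ, Finset.mul_sum, this]
    rw [Finset.sum_comm]
    refine Finset.sum_congr rfl fun j _ => ?_
    rw [← Finset.sum_mul]; push_cast; rfl
  have hmul : ∀ x, ℓ x = x * ℓ 1 := by
    intro x
    obtain ⟨x0, x1, x2, rfl⟩ := C.span x
    have e : (x0 + x1*C.θ + x2*C.θ^2 : K) = (x0:K) * 1 + ((x1:K) * (C.θ * 1) + (x2:K) * (C.θ * (C.θ * 1))) := by ring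
    rw [e, hadd, hadd, hsm, hsm, hsm, hθ, hθ, hθ]; ring
  set κ := ℓ 1 with hκ
  have hcb : ∀ i, c i = κ * b i := fun i => by rw [← hb', hmul, mul_comm]
  have hkey : κ^2 / γ - 1/α = 0 := by
    apply C.nondeg'
    have step : ∀ i y, C.φ ((κ^2/γ - 1/α) * b i * y) = 0 := by
      intro i y
      obtain ⟨q, rfl⟩ := C.gram_span α b S hSb hd y
      have : (κ^2/γ - 1/α) * b i * ∑ j, (q j : K) * b j =
        ∑ j, ((q j : ℚ):K) * (c i * c j / γ - b i * b j / α) := by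
        rw [Finset.mul_sum]
        exact Finset.sum_congr rfl fun j _ => by rw [hcb i, hcb j]; ring
      rw [this, map_sum]
      exact Finset.sum_eq_zero fun j _ => by rw [φ_mul, map_sub, hSb, hSc, sub_self, mul_zero]
    intro y
    have h0 : ∃ i, b i ≠ 0 := by
      by_contra hcon
      push Not at hcon
      apply hd
      have : S = 0 := by ext i j; rw [← hSb]; simp [hcon]
      rw [this, Matrix.det_zero]
    obtain ⟨i, hi⟩ := h0
    have := step i (y / b i)
    rwa [mul_assoc, mul_div_cancel₀ _ hi] at this
  have hk : γ = κ^2 * α := by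
    field_simp at hkey
    linear_combination -hkey
  refine ⟨κ, ?_, hcb, hk⟩
  rintro h0
  rw [h0] at hk
  apply hγ; rw [hk]; ring

end CD
end

section
open Matrix MeasureTheory

namespace CD
variable {K : Type*} [Field K] [CharZero K] (C : CD K)

/-- normalized quintuple -/
structure NQ (α : K) (b b' : Fin 3 → K) (N : Matrix (Fin 3) (Fin 3) ℤ) : Prop where
  hα : α ≠ 0
  hb : ∀ i j, C.φ (b i * b j / α) = Gm ℚ i j
  hb' : ∀ i j, C.φ (b' i * b' j / (α * C.θ)) = Gm ℚ i j
  hN : ∀ i j, C.φ (b i * b' j / α) = (N i j : ℚ)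

variable {C}
lemma GmQ_det : (Gm ℚ).det ≠ 0 := by rw [Gm_det]; norm_num

lemma expand {α : K} (hα : α ≠ 0) {b : Fin 3 → K} (hb : ∀ i j, C.φ (b i * b j / α) = Gm ℚ i j) (x : K) :
    x = (C.φ (x * b 0 / α) : K) * b 2 + (C.φ (x * b 1 / α) : K) * b 1 + (C.φ (x * b 2 / α) : K) * b 0 := by
  rw [← sub_eq_zero]
  apply C.gram_zero α hα b _ hb GmQ_det
  intro k
  set p := C.φ (x * b 0 / α)
  set q := C.φ (x * b 1 / α)
  set r := C.φ (x * b 2 / α)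
  have : (x - ((p:K) * b 2 + (q:K) * b 1 + (r:K) * b 0)) * b k / α =
    x * b k / α - ((p:K) * (b 2 * b k / α) + (q:K) * (b 1 * b k / α) + (r:K) * (b 0 * b k / α)) := by ring
  rw [this, map_sub, map_add, map_add, φ_mul, φ_mul, φ_mul, hb, hb, hb]
  fin_cases k <;> simp [Gm, p, q, r]

lemma NQ.b'_eq {α : K} {b b' : Fin 3 → K} {N} (h : C.NQ α b b' N) (j : Fin 3) :
    b' j = (N 0 j : K) * b 2 + (N 1 j : K) * b 1 + (N 2 j : K) * b 0 := by
  have := expand h.hα h.hb (b' j)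
  rw [mul_comm (b' j), mul_comm (b' j), mul_comm (b' j), h.hN, h.hN, h.hN] at this
  simpa using this

lemma NQ.θb_eq {α : K} {b b' : Fin 3 → K} {N} (h : C.NQ α b b' N) (i : Fin 3) :
    C.θ * b i = (N i 0 : K) * b' 2 + (N i 1 : K) * b' 1 + (N i 2 : K) * b' 0 := by
  have := expand (mul_ne_zero h.hα C.θ_ne) h.hb' (C.θ * b i)
  have e : ∀ j, C.θ * b i * b' j / (α * C.θ) = b i * b' j / α := by
    intro j
    have := h.hα; have := C.θ_ne
    field_simp
  rw [e, e, e, h.hN, h.hN, h.hN] at this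
  simpa using this

def Tm (N : Matrix (Fin 3) (Fin 3) ℤ) : Matrix (Fin 3) (Fin 3) ℤ := N * Gm ℤ * Nᵀ * Gm ℤ

lemma NQ.eig {α : K} {b b' : Fin 3 → K} {N} (h : C.NQ α b b' N) : C.Eig (Tm N) b := by
  intro i
  rw [h.θb_eq, h.b'_eq, h.b'_eq, h.b'_eq]
  simp [Tm, Gm, Matrix.mul_apply, Fin.sum_univ_three]
  ring

lemma NQ.swap {α : K} {b b' : Fin 3 → K} {N} (h : C.NQ α b b' N) :
    C.NQ (α * C.θ) b' (fun i => C.θ * b i) Nᵀ := by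
  have h1 := h.hα; have h2 := C.θ_ne
  refine ⟨mul_ne_zero h1 h2, h.hb', fun i j => ?_, fun i j => ?_⟩
  · rw [← h.hb i j]; congr 1; field_simp
  · rw [Matrix.transpose_apply, ← h.hN]; congr 1; field_simp

lemma Tm_tr (N) : (Tm N) 0 0 + (Tm N) 1 1 + (Tm N) 2 2 = - aN N := by
  simp [Tm, aN, Gm, Matrix.mul_apply, Fin.sum_univ_three]; ring
lemma Tm_e2 (N) : (Tm N) 0 0 * (Tm N) 1 1 - (Tm N) 0 1 * (Tm N) 1 0 + ((Tm N) 0 0 * (Tm N) 2 2 - (Tm N) 0 2 * (Tm N) 2 0)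
    + ((Tm N) 1 1 * (Tm N) 2 2 - (Tm N) 1 2 * (Tm N) 2 1) = bN N := by
  simp [Tm, bN, Gm, Matrix.mul_apply, Fin.sum_univ_three]; ring
lemma Tm_det (N) : (Tm N).det = N.det^2 := by
  simp only [Tm, Matrix.det_mul, Gm_det, Matrix.det_transpose]; ring

lemma b_ne {α : K} {b : Fin 3 → K} (hb : ∀ i j, C.φ (b i * b j / α) = Gm ℚ i j) : b 0 ≠ 0 := by
  intro h
  have := hb 0 2
  rw [h] at this
  simp [Gm] at this

lemma NQ.coef {α : K} {b b' : Fin 3 → K} {N} (h : C.NQ α b b' N) :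
    aN N = C.a ∧ bN N = C.b ∧ N.det^2 = C.d^2 := by
  have he := h.eig
  obtain ⟨D, hD⟩ : ∃ D, N.det = D := ⟨_, rfl⟩
  rw [hD]
  set M : Matrix (Fin 3) (Fin 3) K := C.θ • (1 : Matrix (Fin 3) (Fin 3) K) - (Tm N).map (Int.cast) with hM
  have hz : M *ᵥ b = 0 := by
    ext i
    have := he i
    rw [hM, Matrix.sub_mulVec, Matrix.smul_mulVec, Matrix.one_mulVec]
    simp only [Pi.sub_apply, Pi.smul_apply, smul_eq_mul, this, Matrix.mulVec, dotProduct, Matrix.map_apply, Pi.zero_apply, sub_self]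
  have hdet : M.det = 0 := by
    rw [← Matrix.exists_mulVec_eq_zero_iff]
    exact ⟨b, fun h0 => b_ne h.hb (by rw [h0]; rfl), hz⟩
  have hdet2 : M.det = C.θ^3 + (aN N : K) * C.θ^2 + (bN N : K) * C.θ - (D : K)^2 := by
    have h3 := congrArg (Int.cast : ℤ → K) (Tm_det N)
    have h2 := congrArg (Int.cast : ℤ → K) (Tm_e2 N)
    have h1 := congrArg (Int.cast : ℤ → K) (Tm_tr N)
    rw [hD, Matrix.det_fin_three] at h3
    push_cast at h1 h2 h3
    rw [Matrix.det_fin_three]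
    simp [hM]
    linear_combination (-C.θ^2) * h1 + C.θ * h2 - h3
  have hθ := C.hθ
  rw [hdet] at hdet2
  have key := C.coef_zero ((C.d^2 : ℤ) - (D^2 : ℤ)) (bN N - C.b) (aN N - C.a) (by
    push_cast
    linear_combination -hdet2 - hθ)
  obtain ⟨k0, k1, k2⟩ := key
  refine ⟨?_, ?_, ?_⟩
  · have : (aN N : ℚ) = C.a := by linarith
    exact_mod_cast this
  · have : (bN N : ℚ) = C.b := by linarith
    exact_mod_cast this
  · have : ((D^2 : ℤ) : ℚ) = (C.d^2 : ℤ) := by linarith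
    exact_mod_cast this

/-- normalized quintuples with the same `N` are proportional -/
lemma NQ.inj {α γ : K} {b b' c c' : Fin 3 → K} {N} (h : C.NQ α b b' N) (h2 : C.NQ γ c c' N) :
    ∃ κ : K, κ ≠ 0 ∧ (∀ i, c i = κ * b i) ∧ γ = κ^2 * α :=
  C.inj (Tm N) b c α γ h.hα h2.hα h.eig h2.eig (Gm ℚ) GmQ_det h.hb h2.hb

/-- integral change of basis -/
def vb (U : Matrix (Fin 3) (Fin 3) ℤ) (b : Fin 3 → K) : Fin 3 → K := fun i => ∑ k, (U i k : K) * b k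

lemma gram_trans (U V : Matrix (Fin 3) (Fin 3) ℤ) (b c : Fin 3 → K) (α : K) (S : Matrix (Fin 3) (Fin 3) ℤ)
    (h : ∀ i j, C.φ (b i * c j / α) = (S i j : ℚ)) (i j : Fin 3) :
    C.φ (vb U b i * vb V c j / α) = ((U * S * Vᵀ) i j : ℤ) := by
  have : vb U b i * vb V c j / α = ∑ l, ∑ k, ((U i k * V j l : ℤ) : K) * (b k * c l / α) := by
    simp only [vb, Fin.sum_univ_three]; push_cast; ring
  rw [this]
  simp only [map_sum, φ_int, h, Matrix.mul_apply, Matrix.transpose_apply, Finset.sum_mul, Int.cast_sum]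
  exact Finset.sum_congr rfl fun l _ => Finset.sum_congr rfl fun k _ => by push_cast; ring

lemma GmQ (i j : Fin 3) : Gm ℚ i j = ((Gm ℤ i j : ℤ) : ℚ) := by
  fin_cases i <;> fin_cases j <;> simp [Gm]

lemma NQ.trans {α : K} {b b' : Fin 3 → K} {N} (h : C.NQ α b b' N) (U U' : Matrix (Fin 3) (Fin 3) ℤ)
    (hU : U * Gm ℤ * Uᵀ = Gm ℤ) (hU' : U' * Gm ℤ * U'ᵀ = Gm ℤ) : C.NQ α (vb U b) (vb U' b') (U * N * U'ᵀ) := by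
  refine ⟨h.hα, fun i j => ?_, fun i j => ?_, fun i j => ?_⟩
  · rw [gram_trans U U b b α (Gm ℤ) (fun i j => by rw [h.hb, GmQ]), hU, GmQ]
  · rw [gram_trans U' U' b' b' _ (Gm ℤ) (fun i j => by rw [h.hb', GmQ]), hU', GmQ]
  · rw [gram_trans U U' b b' _ N h.hN]

lemma nZ_G (t : ℤ) : nZ t * Gm ℤ * (nZ t)ᵀ = Gm ℤ := by
  ext i j; fin_cases i <;> fin_cases j <;> simp [nZ, Gm, Matrix.mul_apply, Fin.sum_univ_three] <;> ring

/-- the structure of a normalized quintuple with `N` of row type -/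
lemma NQ.row {α : K} {b b' : Fin 3 → K} {N} (h : C.NQ α b b' N) (h0 : N 0 0 = 0) (h1 : N 0 1 = 0)
    (s u : ℤ) (hs : s = N 0 2 * N 1 0) (hu : u = N 0 2 * N 2 0) :
    s ≠ 0 ∧ α = (b 0 / s)^2 ∧ b 1 = b 0 / s * (C.θ - u) ∧
    b 2 = b 0 / s * ((C.θ^2 + (C.a + u) * C.θ + (C.b - u^2)/2) / s) ∧
    2 * s ∣ 3*u^2 + 2*C.a*u + C.b ∧ s^2 ∣ u^3 + C.a*u^2 + C.b*u - C.d^2 := by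
  obtain ⟨ha, hb, hd⟩ := h.coef
  have hα := h.hα
  have b0 := b_ne h.hb
  set w := N 1 0 * N 2 2 + N 1 1 * N 2 1 + N 1 2 * N 2 0 with hw
  set v := 2 * N 1 0 * N 1 2 + N 1 1 ^ 2 with hv
  set z := 2 * N 2 0 * N 2 2 + N 2 1 ^ 2 with hz
  have e0 : C.θ * b 0 = u * b 0 + s * b 1 := by
    rw [h.eig 0]
    simp [Tm, Gm, Matrix.mul_apply, Fin.sum_univ_three, h0, h1, hs, hu]
  have e1 : C.θ * b 1 = w * b 0 + v * b 1 + s * b 2 := by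
    rw [h.eig 1]
    simp [Tm, Gm, Matrix.mul_apply, Fin.sum_univ_three, h0, h1, hs, hw, hv]
    ring
  have i1 : C.a = -(2*u+v) := by rw [← ha, aN, h0, h1, hu, hv]; ring
  have i2 : C.b = u^2 + 2*u*v - 2*s*w := by rw [← hb, bN, h0, h1, hu, hv, hs, hw]; ring
  have i3 : C.d^2 = u^2*v - 2*u*s*w + s^2*z := by
    rw [← hd, Matrix.det_fin_three, h0, h1, hu, hv, hs, hw, hz]; ring
  have hs0 : s ≠ 0 := by
    intro h0
    rw [h0] at e0
    have : C.θ - u = 0 := by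
      have : (C.θ - u) * b 0 = 0 := by linear_combination e0
      exact (mul_eq_zero.1 this).resolve_right b0
    have := C.coef_zero (-u) 1 0 (by push_cast; linear_combination this)
    exact one_ne_zero this.2.1
  have hs' : (s:K) ≠ 0 := by exact_mod_cast hs0
  have f1 : b 1 = b 0 / s * (C.θ - u) := by
    field_simp; linear_combination -e0
  have f2 : b 2 = b 0 / s * ((C.θ^2 + (C.a + u) * C.θ + (C.b - u^2)/2) / s) := by
    have k1 : (C.a : K) = -(2*u+v) := by rw [i1]; push_cast; ring
    have k2 : (C.b : K) = u^2 + 2*u*v - 2*s*w := by rw [i2]; push_cast; ring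
    rw [k1, k2]
    rw [f1] at e1
    field_simp at e1 ⊢
    linear_combination -2 * e1
  have hω : b 0 * b 0 / α - (s:K)^2 = 0 := by
    set ω := b 0 * b 0 / α with hω
    have p0 : C.φ ω = 0 := by have := h.hb 0 0; simpa [Gm] using this
    have p1 : C.φ (ω * C.θ) = 0 := by
      have h01 := h.hb 0 1
      have e : ω * C.θ = (u:K) * ω + (s:K) * (b 0 * b 1 / α) := by
        rw [f1, hω]; field_simp; ring
      rw [e, map_add, φ_int, φ_int, p0, h01]; simp [Gm]
    have p2 : C.φ (ω * C.θ^2) = s^2 := by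
      have h11 := h.hb 1 1
      have e : ω * C.θ^2 = ((2*u : ℤ):K) * (ω * C.θ) + ((-u^2:ℤ):K) * ω + ((s^2 : ℤ):K) * (b 1 * b 1 / α) := by
        rw [f1, hω]; push_cast; field_simp; ring
      rw [e, map_add, map_add, φ_int, φ_int, φ_int, p0, p1, h11]; simp [Gm]
    have q0 : C.φ ((s:K)^2) = 0 := by
      have := C.φ_int (s^2) 1; rw [C.φ0, mul_zero, mul_one] at this; push_cast at this; exact this
    have q1 : C.φ ((s:K)^2 * C.θ) = 0 := by
      have := C.φ_int (s^2) C.θ; rw [C.φ1, mul_zero] at this; push_cast at this; exact this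
    have q2 : C.φ ((s:K)^2 * C.θ^2) = s^2 := by
      have := C.φ_int (s^2) (C.θ^2); rw [C.φ2, mul_one] at this; push_cast at this; exact this
    apply C.nondeg
    · rw [map_sub, p0, q0, sub_zero]
    · rw [sub_mul, map_sub, p1, q1, sub_zero]
    · rw [sub_mul, map_sub, p2, q2, sub_self]
  refine ⟨hs0, ?_, f1, f2, ⟨-w, ?_⟩, ⟨-z, ?_⟩⟩
  · field_simp at hω ⊢; linear_combination -hω
  · rw [i1, i2]; ring
  · rw [i1, i2, i3]; ring

/-- span comparison for the explicit reducible lattices -/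
lemma row_span (s u s' u' t : ℤ) (hs : s ≠ 0) (hss : s' = s ∨ s' = -s) (hu : u' = u + 2 * s * t) (κ κ' : K)
    (b c : Fin 3 → K) (hκ : κ ≠ 0)
    (hb0 : b 0 = κ * s) (hb1 : b 1 = κ * (C.θ - u)) (hb2 : b 2 = κ * ((C.θ^2 + (C.a + u) * C.θ + (C.b - u^2)/2) / s))
    (hc0 : c 0 = κ' * s') (hc1 : c 1 = κ' * (C.θ - u')) (hc2 : c 2 = κ' * ((C.θ^2 + (C.a + u') * C.θ + (C.b - u'^2)/2) / s')) :
    ∀ i, κ / κ' * c i ∈ Submodule.span ℤ (Set.range b) ∨ κ' = 0 := by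
  intro i
  by_cases hκ' : κ' = 0
  · exact Or.inr hκ'
  left
  have hs' : (s:K) ≠ 0 := by exact_mod_cast hs
  have hmem : ∀ x y w : ℤ, (x:K) * b 0 + y * b 1 + w * b 2 ∈ Submodule.span ℤ (Set.range b) := by
    intro x y w
    have hi : ∀ i, b i ∈ Submodule.span ℤ (Set.range b) := fun i => Submodule.subset_span ⟨i, rfl⟩
    simp only [← zsmul_eq_mul]
    exact add_mem (add_mem (zsmul_mem (hi 0) x) (zsmul_mem (hi 1) y)) (zsmul_mem (hi 2) w)
  subst hu
  rcases hss with rfl | rfl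
  · fin_cases i
    · convert hmem 1 0 0 using 1
      simp [hb0, hc0]; field_simp
    · convert hmem (-2*t) 1 0 using 1
      simp [hb0, hb1, hc1]; field_simp; ring
    · convert hmem (-2*t^2) (2*t) 1 using 1
      simp [hb0, hb1, hb2, hc2]; field_simp; ring
  · fin_cases i
    · convert hmem (-1) 0 0 using 1
      simp [hb0, hc0]; field_simp
    · convert hmem (-2*t) 1 0 using 1
      simp [hb0, hb1, hc1]; field_simp; ring
    · convert hmem (2*t^2) (-2*t) (-1) using 1
      simp [hb0, hb1, hb2, hc2]; field_simp; ring

end CD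
end

section
open Matrix MeasureTheory

namespace CD
variable {K : Type*} [Field K] [CharZero K] (C : CD K)

/-- the order `ℤ[θ]` -/
def R : Subalgebra ℤ K := Algebra.adjoin ℤ {C.θ}

lemma mem_R {x : K} : x ∈ C.R ↔ ∃ c0 c1 c2 : ℤ, x = c0 + c1 * C.θ + c2 * C.θ^2 := by
  constructor
  · intro h
    induction h using Algebra.adjoin_induction with
    | mem x hx => exact ⟨0, 1, 0, by rw [Set.mem_singleton_iff.1 hx]; push_cast; ring⟩
    | algebraMap r => exact ⟨r, 0, 0, by simp⟩
    | add x y _ _ hx hy =>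
      obtain ⟨p, q, r, rfl⟩ := hx
      obtain ⟨p', q', r', rfl⟩ := hy
      exact ⟨p+p', q+q', r+r', by push_cast; ring⟩
    | mul x y _ _ hx hy =>
      obtain ⟨p, q, r, rfl⟩ := hx
      obtain ⟨p', q', r', rfl⟩ := hy
      have h := C.hθ
      refine ⟨p*p' + (q*r'+r*q') * C.d^2 + r*r' * (-C.a*C.d^2), p*q'+q*p' + (q*r'+r*q') * (-C.b) + r*r'*(C.a*C.b + C.d^2),
        p*r'+q*q'+r*p' + (q*r'+r*q')*(-C.a) + r*r'*(C.a^2-C.b), ?_⟩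
      push_cast
      linear_combination ((q*r'+r*q' : K) + r*r'*(C.θ - C.a)) * h
  · rintro ⟨p, q, r, rfl⟩
    have hθ : C.θ ∈ C.R := Algebra.subset_adjoin rfl
    exact add_mem (add_mem (intCast_mem _ _) (mul_mem (intCast_mem _ _) hθ)) (mul_mem (intCast_mem _ _) (pow_mem hθ 2))

lemma θ_mem : C.θ ∈ C.R := Algebra.subset_adjoin rfl

lemma φ_R {x : K} (h : x ∈ C.R) : ∃ n : ℤ, C.φ x = n := by
  obtain ⟨p, q, r, rfl⟩ := C.mem_R.1 h
  exact ⟨r, by have := C.φ_coef p q r; push_cast at this; exact this⟩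

lemma R_of_φ {x : K} (h : ∀ k : ℕ, ∃ n : ℤ, C.φ (x * C.θ^k) = n) : x ∈ C.R := by
  obtain ⟨c0, c1, c2, hx⟩ := C.span x
  obtain ⟨n0, h0⟩ := h 0
  obtain ⟨n1, h1⟩ := h 1
  obtain ⟨n2, h2⟩ := h 2
  have hθ := C.hθ
  have e0 : c2 = n0 := by
    rw [← h0, pow_zero, mul_one, hx, C.φ_coef]
  have e1 : c1 - C.a * c2 = n1 := by
    rw [← h1]
    have : x * C.θ^1 = ((c2 * C.d^2 : ℚ):K) + ((c0 - C.b*c2 : ℚ):K) * C.θ + ((c1 - C.a * c2 : ℚ):K) * C.θ^2 := by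
      rw [hx]; push_cast; linear_combination (c2:K) * hθ
    rw [this, C.φ_coef]
  have e2 : c0 - C.b*c2 - C.a * (c1 - C.a*c2) = n2 := by
    rw [← h2]
    have : x * C.θ^2 = (((c1 - C.a*c2) * C.d^2 : ℚ):K) + ((c2 * C.d^2 - C.b*(c1 - C.a*c2) : ℚ):K) * C.θ
        + ((c0 - C.b*c2 - C.a * (c1 - C.a*c2) : ℚ):K) * C.θ^2 := by
      rw [hx]; push_cast; linear_combination ((c2:K) * C.θ + c1 - C.a * c2) * hθ
    rw [this, C.φ_coef]
  refine C.mem_R.2 ⟨n2 + C.b * n0 + C.a * n1, n1 + C.a * n0, n0, ?_⟩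
  rw [hx]
  have a1 : (c1:K) = ((n1 + C.a * n0 : ℚ) : K) := by congr 1; rw [← e1, ← e0]; ring
  have a0 : (c0:K) = ((n2 + C.b * n0 + C.a * n1 : ℚ) : K) := by congr 1; rw [← e2, ← e1, ← e0]; ring
  rw [a0, a1, e0]; push_cast; ring

/-- square-root pair -/
structure Pr (I : Submodule ℤ K) (α : K) : Prop where
  hα : α ≠ 0
  hθ : ∀ x ∈ I, C.θ * x ∈ I
  h2 : ∀ x ∈ I, ∀ y ∈ I, x * y / α ∈ C.R
  h3 : α ∈ I * I

variable {C}
namespace Pr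
variable {I : Submodule ℤ K} {α : K}

lemma smul_mem (h : C.Pr I α) {x y : K} (hx : x ∈ C.R) (hy : y ∈ I) : x * y ∈ I := by
  obtain ⟨p, q, r, rfl⟩ := C.mem_R.1 hx
  have e : (p + q * C.θ + r * C.θ^2) * y = p • y + q • (C.θ * y) + r • (C.θ * (C.θ * y)) := by
    simp only [zsmul_eq_mul]; ring
  rw [e]
  exact add_mem (add_mem (zsmul_mem hy _) (zsmul_mem (h.hθ _ hy) _)) (zsmul_mem (h.hθ _ (h.hθ _ hy)) _)

lemma dual (h : C.Pr I α) {y : K} (hy : ∀ x ∈ I, y * x / α ∈ C.R) : y ∈ I := by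
  have key : ∀ w ∈ I * I, y * w / α ∈ I := by
    intro w hw
    induction hw using Submodule.mul_induction_on' with
    | mem_mul_mem m hm n hn =>
      have := h.smul_mem (hy m hm) hn
      rwa [show y * (m * n) / α = y * m / α * n by ring]
    | add m _ n _ hm hn =>
      rw [show y * (m + n) / α = y * m / α + y * n / α by ring]; exact add_mem hm hn
  have := key α h.h3
  rwa [mul_div_assoc, div_self h.hα, mul_one] at this

lemma exists_ne (h : C.Pr I α) : ∃ x ∈ I, x ≠ 0 := by
  by_contra hh
  push Not at hh
  have : I = ⊥ := by rw [Submodule.eq_bot_iff]; exact hh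
  have h3 := h.h3
  rw [this] at h3
  simp at h3
  exact h.hα h3

lemma basis (h : C.Pr I α) : ∃ b : Fin 3 → K, LinearIndependent ℤ b ∧ Submodule.span ℤ (Set.range b) = I := by
  obtain ⟨x0, hx0, hne⟩ := h.exists_ne
  -- standard lattice
  let L : (Fin 3 → ℤ) →ₗ[ℤ] K := 
    { toFun := fun c => c 0 + c 1 * C.θ + c 2 * C.θ^2
      map_add' := by intro c c'; simp; ring
      map_smul' := by intro m c; simp; ring }
  have hL : Function.Injective L := by
    rw [injective_iff_map_eq_zero]
    intro c hc
    have hc' : (c 0 : K) + c 1 * C.θ + c 2 * C.θ^2 = 0 := hc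
    have := C.coef_zero (c 0) (c 1) (c 2) (by push_cast; exact hc')
    obtain ⟨p, q, r⟩ := this
    ext i; fin_cases i
    · exact_mod_cast p
    · exact_mod_cast q
    · exact_mod_cast r
  have hr : LinearMap.range L = Subalgebra.toSubmodule C.R := by
    ext x
    rw [Subalgebra.mem_toSubmodule, C.mem_R]
    constructor
    · rintro ⟨c, rfl⟩; exact ⟨c 0, c 1, c 2, rfl⟩
    · rintro ⟨c0, c1, c2, rfl⟩; exact ⟨![c0,c1,c2], rfl⟩
  let e := LinearEquiv.ofInjective L hL
  let m1 : I →ₗ[ℤ] LinearMap.range L :=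
    LinearMap.codRestrict _ ((LinearMap.mulLeft ℤ (x0 / α)).comp I.subtype) (by
      intro x
      rw [hr]
      have := h.h2 x0 hx0 x x.2
      simp only [LinearMap.comp_apply, LinearMap.mulLeft_apply, Submodule.subtype_apply, Subalgebra.mem_toSubmodule]
      rwa [show x0 / α * (x:K) = x0 * x / α by ring])
  have hm1 : Function.Injective m1 := by
    intro x y hxy
    have := congrArg Subtype.val hxy
    simp only [m1, LinearMap.codRestrict_apply, LinearMap.comp_apply, LinearMap.mulLeft_apply, Submodule.subtype_apply] at this
    exact Subtype.ext (mul_left_cancel₀ (div_ne_zero hne h.hα) this)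
  let f1 : I →ₗ[ℤ] (Fin 3 → ℤ) := e.symm.toLinearMap.comp m1
  have hf1 : Function.Injective f1 := e.symm.injective.comp hm1
  let f2 : (Fin 3 → ℤ) →ₗ[ℤ] I := LinearMap.codRestrict _ ((LinearMap.mulRight ℤ x0).comp L) (by
    intro c
    have : L c ∈ C.R := by rw [← Subalgebra.mem_toSubmodule, ← hr]; exact ⟨c, rfl⟩
    exact h.smul_mem this hx0)
  have hf2 : Function.Injective f2 := by
    intro x y hxy
    have := congrArg Subtype.val hxy
    simp only [f2, LinearMap.codRestrict_apply, LinearMap.comp_apply, LinearMap.mulRight_apply] at this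
    exact hL (mul_right_cancel₀ hne this)
  have hfin : Module.Finite ℤ I := Module.Finite.of_injective f1 hf1
  have hfree : Module.Free ℤ I := inferInstance
  have hrank : Module.finrank ℤ I = 3 := by
    apply le_antisymm
    · simpa using LinearMap.finrank_le_finrank_of_injective hf1
    · simpa using LinearMap.finrank_le_finrank_of_injective hf2
  let B : Module.Basis (Fin 3) ℤ I := Module.finBasisOfFinrankEq ℤ I hrank
  refine ⟨fun i => B i, ?_, ?_⟩
  · exact B.linearIndependent.map' I.subtype (Submodule.ker_subtype I)
  · have := congrArg (Submodule.map I.subtype) B.span_eq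
    rw [Submodule.map_span, ← Set.range_comp, Submodule.map_top, Submodule.range_subtype] at this
    exact this

lemma mem_span3 {b : Fin 3 → K} {x : K} : x ∈ Submodule.span ℤ (Set.range b) ↔ ∃ c : Fin 3 → ℤ, x = ∑ i, (c i : K) * b i := by
  rw [Submodule.mem_span_range_iff_exists_fun]
  simp only [zsmul_eq_mul, eq_comm]

lemma gram (h : C.Pr I α) {b : Fin 3 → K} (hli : LinearIndependent ℤ b) (hsp : Submodule.span ℤ (Set.range b) = I) :
    ∃ S : Matrix (Fin 3) (Fin 3) ℤ, (∀ i j, C.φ (b i * b j / α) = (S i j : ℚ)) ∧ IsUnit S.det := by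
  have hbI : ∀ i, b i ∈ I := fun i => hsp ▸ Submodule.subset_span ⟨i, rfl⟩
  choose S hS using fun i j => C.φ_R (h.h2 (b i) (hbI i) (b j) (hbI j))
  refine ⟨S, hS, ?_⟩
  obtain ⟨x0, hx0, hne⟩ := h.exists_ne
  have hmem : ∀ x, x ∈ I ↔ ∃ c : Fin 3 → ℤ, x = ∑ i, (c i : K) * b i := by
    intro x; rw [← hsp, mem_span3]
  have hdet : (Matrix.of S).det ≠ 0 := by
    intro h0
    obtain ⟨v, hv, hvS⟩ := Matrix.exists_vecMul_eq_zero_iff.2 h0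
    set x := ∑ i, (v i : K) * b i with hx
    have hj : ∀ j, C.φ (x * b j / α) = 0 := by
      intro j
      have e : x * b j / α = ∑ i, (v i : K) * (b i * b j / α) := by
        rw [hx, Finset.sum_mul, Finset.sum_div]; exact Finset.sum_congr rfl fun i _ => by ring
      rw [e, map_sum]
      simp only [φ_int, hS]
      have := congrFun hvS j
      simp only [Matrix.vecMul, dotProduct, Matrix.of_apply, Pi.zero_apply] at this
      exact_mod_cast this
    have hy : ∀ y ∈ I, C.φ (x * y / α) = 0 := by
      intro y hy
      obtain ⟨c, rfl⟩ := (hmem y).1 hy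
      have e : x * (∑ i, (c i : K) * b i) / α = ∑ i, (c i : K) * (x * b i / α) := by
        rw [Finset.mul_sum, Finset.sum_div]; exact Finset.sum_congr rfl fun i _ => by ring
      rw [e, map_sum]
      simp [φ_int, hj]
    have hz : x * x0 / α = 0 := by
      apply C.nondeg
      · exact hy _ hx0
      · have := hy _ (h.hθ _ hx0)
        rwa [show x * x0 / α * C.θ = x * (C.θ * x0) / α by ring]
      · have := hy _ (h.hθ _ (h.hθ _ hx0))
        rwa [show x * x0 / α * C.θ^2 = x * (C.θ * (C.θ * x0)) / α by ring]
    have hx0' : x = 0 := by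
      have := h.hα
      field_simp at hz
      simpa [hne] using hz
    apply hv
    have := Fintype.linearIndependent_iff.1 hli v (by simp only [zsmul_eq_mul]; rw [← hx0', hx])
    ext i; exact this i
  set SQ : Matrix (Fin 3) (Fin 3) ℚ := (Matrix.of S).map Int.cast with hSQ
  have hdQ : SQ.det ≠ 0 := by
    have : SQ.det = (((Matrix.of S).det : ℤ) : ℚ) := by
      rw [hSQ, Int.cast_det]
    rw [this]; exact_mod_cast hdet
  have hinv : SQ⁻¹ * SQ = 1 := Matrix.nonsing_inv_mul _ (isUnit_iff_ne_zero.2 hdQ)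
  set y : Fin 3 → K := fun k => ∑ j, ((SQ⁻¹ k j : ℚ) : K) * b j with hy
  have hφy : ∀ k i, C.φ (y k * b i / α) = (1 : Matrix (Fin 3) (Fin 3) ℚ) k i := by
    intro k i
    have e : y k * b i / α = ∑ j, ((SQ⁻¹ k j : ℚ) : K) * (b j * b i / α) := by
      rw [hy, Finset.sum_mul, Finset.sum_div]; exact Finset.sum_congr rfl fun i _ => by ring
    rw [e, map_sum, ← hinv, Matrix.mul_apply]
    simp only [φ_mul, hS]
    rfl
  have hφI : ∀ k, ∀ x ∈ I, ∃ n : ℤ, C.φ (y k * x / α) = n := by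
    intro k x hx
    obtain ⟨c, rfl⟩ := (hmem x).1 hx
    refine ⟨c k, ?_⟩
    have e : y k * (∑ i, (c i : K) * b i) / α = ∑ i, (c i : K) * (y k * b i / α) := by
      rw [Finset.mul_sum, Finset.sum_div]; exact Finset.sum_congr rfl fun i _ => by ring
    rw [e, map_sum]
    simp [φ_int, hφy, Matrix.one_apply]
  have hyI : ∀ k, y k ∈ I := by
    intro k
    apply h.dual
    intro x hx
    apply C.R_of_φ
    intro n
    have : C.θ^n * x ∈ I := h.smul_mem (pow_mem C.θ_mem n) hx
    obtain ⟨m, hm⟩ := hφI k _ this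
    exact ⟨m, by rw [← hm]; congr 1; ring⟩
  choose V hV using fun k => (hmem _).1 (hyI k)
  have hVS : Matrix.of V * Matrix.of S = 1 := by
    ext k i
    have h1 := hφy k i
    rw [hV k, Finset.sum_mul, Finset.sum_div, map_sum] at h1
    have e : ∀ j, C.φ ((V k j : K) * b j * b i / α) = V k j * S j i := by
      intro j
      rw [← hS, ← φ_int]; congr 1; ring
    simp only [e] at h1
    rw [Matrix.mul_apply]
    simp only [Matrix.of_apply]
    have h2 : ((∑ j, V k j * S j i : ℤ) : ℚ) = (((1 : Matrix (Fin 3) (Fin 3) ℤ) k i : ℤ) : ℚ) := by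
      push_cast
      rw [h1]
      simp only [Matrix.one_apply]
      split_ifs <;> simp
    exact_mod_cast h2
  have := congrArg Matrix.det hVS
  rw [Matrix.det_mul, Matrix.det_one] at this
  exact IsUnit.of_mul_eq_one_right _ this

end Pr

/-- the companion lattice `I·J`, `J = (θ, d)` -/
def comp (C : CD K) (I : Submodule ℤ K) : Submodule ℤ K :=
  I.map (LinearMap.mulLeft ℤ C.θ) ⊔ I.map (LinearMap.mulLeft ℤ (C.d : K))

lemma mem_comp {I : Submodule ℤ K} {w : K} : w ∈ C.comp I ↔ ∃ x ∈ I, ∃ y ∈ I, w = C.θ * x + C.d * y := by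
  rw [comp, Submodule.mem_sup]
  constructor
  · rintro ⟨_, ⟨x, hx, rfl⟩, _, ⟨y, hy, rfl⟩, rfl⟩
    exact ⟨x, hx, y, hy, rfl⟩
  · rintro ⟨x, hx, y, hy, rfl⟩
    exact ⟨_, ⟨x, hx, rfl⟩, _, ⟨y, hy, rfl⟩, rfl⟩

lemma Pr.comp {I : Submodule ℤ K} {α : K} (h : C.Pr I α) (hcop : IsCoprime C.b C.d) : C.Pr (C.comp I) (α * C.θ) := by
  have hα := h.hα
  have hθ0 := C.θ_ne
  have hθ := C.hθ
  have hmul : ∀ w ∈ I * I, C.θ^2 * w ∈ C.comp I * C.comp I ∧ C.d * C.θ * w ∈ C.comp I * C.comp I ∧ C.d^2 * w ∈ C.comp I * C.comp I := by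
    intro w hw
    induction hw using Submodule.mul_induction_on' with
    | mem_mul_mem m hm n hn =>
      have m1 : C.θ * m ∈ C.comp I := mem_comp.2 ⟨m, hm, 0, zero_mem _, by ring⟩
      have m2 : C.d * m ∈ C.comp I := mem_comp.2 ⟨0, zero_mem _, m, hm, by ring⟩
      have n1 : C.θ * n ∈ C.comp I := mem_comp.2 ⟨n, hn, 0, zero_mem _, by ring⟩
      have n2 : C.d * n ∈ C.comp I := mem_comp.2 ⟨0, zero_mem _, n, hn, by ring⟩
      refine ⟨?_, ?_, ?_⟩
      · convert Submodule.mul_mem_mul m1 n1 using 1; ring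
      · convert Submodule.mul_mem_mul m2 n1 using 1; ring
      · convert Submodule.mul_mem_mul m2 n2 using 1; ring
    | add m _ n _ hm hn =>
      refine ⟨?_, ?_, ?_⟩
      · rw [mul_add]; exact add_mem hm.1 hn.1
      · rw [mul_add]; exact add_mem hm.2.1 hn.2.1
      · rw [mul_add]; exact add_mem hm.2.2 hn.2.2
  have hθI : ∀ w ∈ I * I, C.θ * w ∈ I * I := by
    intro w hw
    induction hw using Submodule.mul_induction_on' with
    | mem_mul_mem m hm n hn => rw [← mul_assoc]; exact Submodule.mul_mem_mul (h.hθ _ hm) hn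
    | add m _ n _ hm hn => rw [mul_add]; exact add_mem hm hn
  refine ⟨mul_ne_zero hα hθ0, ?_, ?_, ?_⟩
  · intro w hw
    obtain ⟨x, hx, y, hy, rfl⟩ := mem_comp.1 hw
    exact mem_comp.2 ⟨_, h.hθ _ hx, _, h.hθ _ hy, by ring⟩
  · intro w hw w' hw'
    obtain ⟨x, hx, y, hy, rfl⟩ := mem_comp.1 hw
    obtain ⟨x', hx', y', hy', rfl⟩ := mem_comp.1 hw'
    have e : (C.θ * x + C.d * y) * (C.θ * x' + C.d * y') / (α * C.θ) =
      C.θ * (x * x' / α) + C.d * (x * y' / α) + C.d * (y * x' / α) + (C.θ^2 + C.a * C.θ + C.b) * (y * y' / α) := by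
      field_simp
      linear_combination (- y * y') * hθ
    rw [e]
    have t := C.θ_mem
    have hd : (C.d : K) ∈ C.R := intCast_mem _ _
    refine add_mem (add_mem (add_mem ?_ ?_) ?_) ?_
    · exact mul_mem t (h.h2 _ hx _ hx')
    · exact mul_mem hd (h.h2 _ hx _ hy')
    · exact mul_mem hd (h.h2 _ hy _ hx')
    · exact mul_mem (add_mem (add_mem (pow_mem t 2) (mul_mem (intCast_mem _ _) t)) (intCast_mem _ _)) (h.h2 _ hy _ hy')
  · obtain ⟨p, q, hpq⟩ := hcop
    have hpq' : (p:K) * C.b + q * C.d = 1 := by exact_mod_cast hpq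
    have e : α * C.θ = p • (C.d^2 * α) + (-p) • (C.θ^2 * (C.θ * α)) + (-(p*C.a)) • (C.θ^2 * α) + q • (C.d * C.θ * α) := by
      simp only [zsmul_eq_mul]
      push_cast
      linear_combination (-α * C.θ) * hpq' + p * α * hθ
    rw [e]
    have h3 := h.h3
    exact add_mem (add_mem (add_mem (zsmul_mem (hmul _ h3).2.2 _) (zsmul_mem (hmul _ (hθI _ h3)).1 _)) (zsmul_mem (hmul _ h3).1 _))
      (zsmul_mem (hmul _ h3).2.1 _)

end CD
end

section
open Matrix MeasureTheory

lemma kM_det (ψ : ℝ) : (kM ψ).det = 1 := by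
  have h2 : (Real.sin ψ / √2)^2 = (Real.sin ψ)^2/2 := by rw [div_pow, Real.sq_sqrt (by norm_num)]
  have h1 := Real.sin_sq_add_cos_sq ψ
  set s := Real.sin ψ / √2 with hs
  rw [Matrix.det_fin_three]
  simp [kM, ← hs]
  have : s^2 = (1 - Real.cos ψ^2)/2 := by rw [h2]; linarith
  linear_combination 2 * this

lemma nak_det (x q ψ : ℝ) (hq : 0 < q) : (nak x q ψ).det = 1 := by
  rw [nak, Matrix.det_mul, Matrix.det_mul, kM_det, Matrix.det_fin_three, Matrix.det_fin_three]
  simp [nM, aM, hq.ne']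

lemma nak_row0_apply (x q ψ : ℝ) (hq : 0 < q) (j : Fin 3) : nak x q ψ 0 j = q * kM ψ 0 j := by
  rw [nak, nM_aM _ _ hq.ne', Matrix.mul_apply, Fin.sum_univ_three]; simp

lemma nak_sum_nonpos (x q ψ x' q' ψ' : ℝ) (hq : 0 < q) (hq' : 0 < q') :
    ((nak x q ψ + nak x' q' ψ') * Gm ℝ * (nak x q ψ + nak x' q' ψ')ᵀ) 0 0 ≤ 0 := by
  have h2 : ((√2:ℝ)⁻¹)^2 = 1/2 := by rw [inv_pow, Real.sq_sqrt (by norm_num)]; norm_num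
  have h1 := Real.sin_sq_add_cos_sq ψ
  have h1' := Real.sin_sq_add_cos_sq ψ'
  have hc := Real.cos_le_one (ψ - ψ')
  rw [Real.cos_sub] at hc
  have : ((nak x q ψ + nak x' q' ψ') * Gm ℝ * (nak x q ψ + nak x' q' ψ')ᵀ) 0 0 =
    q * q' * (Real.cos ψ * Real.cos ψ' + Real.sin ψ * Real.sin ψ' - 1) := by
    simp [Matrix.mul_apply, Fin.sum_univ_three, nak_row0_apply _ _ _ hq, nak_row0_apply _ _ _ hq', Gm, kM, div_eq_mul_inv]
    linear_combination (q*Real.sin ψ + q'*Real.sin ψ')^2 * h2 + q^2/2 * h1 + q'^2/2 * h1'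
  rw [this]
  have := mul_pos hq hq'
  nlinarith

lemma norm_split (x : ℝ) (z : ℂ) : (((x - z.re)^2 + z.im^2 : ℝ) : ℂ) = (x - z) * (x - (starRingEnd ℂ) z) := by
  apply Complex.ext
  · rw [Complex.ofReal_re]; simp; ring
  · rw [Complex.ofReal_im]; simp; ring

namespace CD
variable {K : Type*} [Field K] [CharZero K]

/-- the real and the complex embedding -/
structure Emb (C : CD K) where
  τ : K →+* ℝ
  ρ : K →+* ℂ
  hV : Vieta C.a C.b C.d (sv (τ C.θ) (ρ C.θ))
  hz : (ρ C.θ).im ≠ 0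

namespace Emb
variable {C : CD K} (E : C.Emb)

noncomputable def fr : ℝ := 3 * (E.τ C.θ)^2 + 2 * C.a * E.τ C.θ + C.b
noncomputable def fz : ℂ := 3 * (E.ρ C.θ)^2 + 2 * C.a * E.ρ C.θ + C.b

lemma fr_eq : E.fr = (E.τ C.θ - (E.ρ C.θ).re)^2 + (E.ρ C.θ).im^2 := by
  obtain ⟨h1, h2, -⟩ := E.hV
  have : (E.fr : ℂ) = (((E.τ C.θ - (E.ρ C.θ).re)^2 + (E.ρ C.θ).im^2 : ℝ) : ℂ) := by
    have e : (((E.τ C.θ - (E.ρ C.θ).re)^2 + (E.ρ C.θ).im^2 : ℝ) : ℂ) = (E.τ C.θ - E.ρ C.θ) * (E.τ C.θ - (starRingEnd ℂ) (E.ρ C.θ)) :=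
      norm_split _ _
    rw [e, fr]
    push_cast
    rw [show ((C.a : ℂ)) = ((C.a:ℝ):ℂ) by push_cast; rfl, show ((C.b : ℂ)) = ((C.b:ℝ):ℂ) by push_cast; rfl]
    simp only [Complex.ofReal_intCast]
    rw [h1, h2]
    simp [sv]
    ring
  exact_mod_cast this

lemma fr_pos : 0 < E.fr := by
  rw [fr_eq]
  have := E.hz
  positivity

lemma fz_eq : E.fz = (E.ρ C.θ - E.τ C.θ) * (E.ρ C.θ - (starRingEnd ℂ) (E.ρ C.θ)) := by
  obtain ⟨h1, h2, -⟩ := E.hV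
  rw [fz]
  rw [h1, h2]
  simp [sv]
  ring

lemma fz_ne : E.fz ≠ 0 := by
  rw [fz_eq]
  have hz := E.hz
  apply mul_ne_zero
  · intro h
    have := congrArg Complex.im h
    simp at this; exact hz this
  · intro h
    have := congrArg Complex.im h
    simp at this; exact hz this

lemma hw (m : Fin 3) : wr C.a C.b (sv (E.τ C.θ) (E.ρ C.θ)) m ≠ 0 := by
  have h1 := E.fr_pos.ne'
  have h2 := E.fz_ne
  fin_cases m
  · intro h
    apply h1
    simp [wr, sv] at h
    have : ((E.fr : ℝ) : ℂ) = 0 := by rw [← h, fr]; push_cast; rfl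
    exact_mod_cast this
  · intro h
    simp [wr, sv] at h
    exact h2 h
  · intro h
    simp [wr, sv] at h
    apply h2
    apply (map_eq_zero (starRingEnd ℂ)).1
    rw [← h, fz]
    simp [cj2, cj3]

lemma hs (m : Fin 3) : sv (E.τ C.θ) (E.ρ C.θ) m ≠ 0 := by
  have h1 : E.τ C.θ ≠ 0 := by rw [Ne, map_eq_zero]; exact C.θ_ne
  have h2 : E.ρ C.θ ≠ 0 := by rw [Ne, map_eq_zero]; exact C.θ_ne
  fin_cases m <;> simp [sv, h1, h2]

lemma τ_pos : 0 < E.τ C.θ := by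
  obtain ⟨-, -, h3⟩ := E.hV
  have h : ((C.d^2 : ℝ)) = E.τ C.θ * Complex.normSq (E.ρ C.θ) := by
    have : ((C.d^2 : ℝ) : ℂ) = ((E.τ C.θ * Complex.normSq (E.ρ C.θ) : ℝ) : ℂ) := by
      push_cast
      rw [Complex.normSq_eq_conj_mul_self]
      rw [h3]; simp [sv]; ring
    exact_mod_cast this
  have hd : (0:ℝ) < (C.d:ℝ)^2 := by
    have : (C.d:ℝ) ≠ 0 := by exact_mod_cast C.hd
    positivity
  rw [h] at hd
  exact pos_of_mul_pos_left hd (Complex.normSq_nonneg _)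

lemma φ_eq (x : K) : (C.φ x : ℝ) = E.τ x * E.fr⁻¹ + 2 * (E.ρ x * E.fz⁻¹).re := by
  obtain ⟨c0, c1, c2, rfl⟩ := C.span x
  rw [C.φ_coef]
  apply Complex.ofReal_injective
  rw [re_sum]
  have hfr : ((E.fr : ℝ) : ℂ) = (E.τ C.θ - E.ρ C.θ) * (E.τ C.θ - (starRingEnd ℂ) (E.ρ C.θ)) := by
    rw [fr_eq, norm_split]
  have k1 : (E.τ C.θ : ℂ) - E.ρ C.θ ≠ 0 := by
    intro h
    have := congrArg Complex.im h
    simp at this; exact E.hz this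
  have k2 : (E.τ C.θ : ℂ) - (starRingEnd ℂ) (E.ρ C.θ) ≠ 0 := by
    intro h
    have := congrArg Complex.im h
    simp at this; exact E.hz this
  have k3 : E.ρ C.θ - (starRingEnd ℂ) (E.ρ C.θ) ≠ 0 := by
    intro h
    have := congrArg Complex.im h
    simp at this; exact E.hz this
  rw [fz_eq]
  push_cast
  rw [hfr]
  simp only [map_add, map_mul, map_pow, map_ratCast, map_inv₀, map_sub, Complex.conj_conj, Complex.conj_ofReal]
  push_cast
  set r := (E.τ C.θ : ℂ)
  set z := E.ρ C.θ
  set z' := (starRingEnd ℂ) z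
  have k1' : z - r ≠ 0 := fun h => k1 (by linear_combination -h)
  have k2' : z' - r ≠ 0 := fun h => k2 (by linear_combination -h)
  have k3' : z' - z ≠ 0 := fun h => k3 (by linear_combination -h)
  rw [show z - r = -(r - z) by ring, show z' - r = -(r - z') by ring, show z' - z = -(z - z') by ring]
  field_simp
  ring

end Emb
end CD
end

section
open Matrix MeasureTheory

noncomputable def dg (x : ℝ) : Matrix (Fin 3) (Fin 3) ℝ := !![x⁻¹,0,0;0,1,0;0,0,x]

lemma dg_G (x : ℝ) (hx : x ≠ 0) : dg x * Gm ℝ * (dg x)ᵀ = Gm ℝ := by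
  ext i j; fin_cases i <;> fin_cases j <;> simp [dg, Gm, Matrix.mul_apply, Fin.sum_univ_three, hx]

lemma dg_det (x : ℝ) (hx : x ≠ 0) : (dg x).det = 1 := by
  rw [Matrix.det_fin_three]; simp [dg, hx]

lemma Sm_scale (a b d X : ℝ) (hX : X ≠ 0) : Sm a b d = X • (dg (X^2) * Sm (a/X^2) (b/X^4) (d/X^3) * (dg X)ᵀ) := by
  ext i j
  rw [Matrix.smul_apply, Matrix.mul_apply, Fin.sum_univ_three]
  simp only [Matrix.mul_apply, Fin.sum_univ_three, Matrix.transpose_apply]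
  fin_cases i <;> fin_cases j <;> simp [dg, Sm] <;> field_simp

lemma gram_dg (h : Matrix (Fin 3) (Fin 3) ℝ) (x : ℝ) (hx : x ≠ 0) : (h * dg x) * Gm ℝ * (h * dg x)ᵀ = h * Gm ℝ * hᵀ := by
  rw [Matrix.transpose_mul]
  calc _ = h * (dg x * Gm ℝ * (dg x)ᵀ) * hᵀ := by simp only [Matrix.mul_assoc]
    _ = _ := by rw [dg_G x hx]

namespace CD
variable {K : Type*} [Field K] [CharZero K] {C : CD K}

lemma det_of_gram {h : Matrix (Fin 3) (Fin 3) ℝ} {S : Matrix (Fin 3) (Fin 3) ℤ} (hG : h * Gm ℝ * hᵀ = S.map Int.cast)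
    (hu : IsUnit S.det) : S.det = -1 := by
  rcases Int.isUnit_iff.1 hu with h1 | h1
  · exfalso
    have := congrArg Matrix.det hG
    rw [det_map_cast, h1, Matrix.det_mul, Matrix.det_mul, Matrix.det_transpose, Gm_det] at this
    push_cast at this
    nlinarith [sq_nonneg h.det]
  · exact h1

/-- real coordinates of a basis -/
structure RC (E : C.Emb) (α : K) where
  βr : ℝ
  βc : ℂ
  hr : βr^2 = E.τ α
  hr0 : 0 < βr
  hc : βc^2 = E.ρ α
  hc0 : βc ≠ 0

noncomputable def RC.u {E : C.Emb} {α : K} (B : RC E α) (b : Fin 3 → K) : Fin 3 → ℝ := fun i => E.τ (b i) / B.βr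
noncomputable def RC.v {E : C.Emb} {α : K} (B : RC E α) (b : Fin 3 → K) : Fin 3 → ℂ := fun i => E.ρ (b i) / B.βc

lemma RC.exists (E : C.Emb) (α : K) (h : 0 < E.τ α) : Nonempty (RC E α) := by
  obtain ⟨w, hw⟩ := IsAlgClosed.exists_pow_nat_eq (E.ρ α) (n := 2) (by norm_num)
  refine ⟨⟨√(E.τ α), w, Real.sq_sqrt h.le, Real.sqrt_pos.2 h, hw, ?_⟩⟩
  rintro rfl
  have h0 : E.ρ α = 0 := by rw [← hw]; simp
  rw [map_eq_zero] at h0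
  rw [h0] at h; simp at h

def RC.neg {E : C.Emb} {α : K} (B : RC E α) : RC E α :=
  ⟨B.βr, -B.βc, B.hr, B.hr0, by rw [neg_sq]; exact B.hc, neg_ne_zero.2 B.hc0⟩

noncomputable def RC.h {E : C.Emb} {α : K} (B : RC E α) (b : Fin 3 → K) : Matrix (Fin 3) (Fin 3) ℝ :=
  hR C.a C.b (E.τ C.θ) (E.ρ C.θ) (B.u b) (B.v b)
noncomputable def RC.h' {E : C.Emb} {α : K} (B : RC E α) (b : Fin 3 → K) : Matrix (Fin 3) (Fin 3) ℝ :=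
  hR' C.a C.b C.d (E.τ C.θ) (E.ρ C.θ) (B.u b) (B.v b)

lemma RC.grams {E : C.Emb} {α : K} (B : RC E α) (b b' : Fin 3 → K) :
    (∀ i j, (B.h b * Gm ℝ * (B.h b)ᵀ) i j = (C.φ (b i * b j / α) : ℝ)) ∧
    (∀ i j, (B.h' b' * Gm ℝ * (B.h' b')ᵀ) i j = (C.φ (b' i * b' j / (α * C.θ)) : ℝ)) ∧
    (∀ i j, (B.h b * Sm C.a C.b C.d * (B.h' b')ᵀ) i j = (C.φ (b i * b' j / α) : ℝ)) := by
  obtain ⟨h1, h2, h3⟩ := coord C.a C.b C.d (E.τ C.θ) (E.ρ C.θ) (by simpa using E.hV) (by simpa using E.hw) E.hs (B.u b) (B.u b') (B.v b) (B.v b')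
  have e1 : (3 * (E.τ C.θ)^2 + 2 * C.a * E.τ C.θ + C.b : ℝ) = E.fr := rfl
  have e2 : (3 * (E.ρ C.θ)^2 + 2 * (C.a : ℝ) * E.ρ C.θ + (C.b : ℝ) : ℂ) = E.fz := by simp [Emb.fz]
  rw [e1, e2] at h1 h2 h3
  have hα : E.τ α ≠ 0 := by rw [← B.hr]; exact pow_ne_zero _ B.hr0.ne'
  have hα' : E.ρ α ≠ 0 := by rw [← B.hc]; exact pow_ne_zero _ B.hc0
  refine ⟨fun i j => ?_, fun i j => ?_, fun i j => ?_⟩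
  · rw [RC.h, h1, E.φ_eq]
    simp only [map_div₀, map_mul, ← B.hr, ← B.hc, RC.u, RC.v]
    congr 1
    · ring
    · congr 2; ring
  · rw [RC.h', h2, E.φ_eq]
    simp only [map_div₀, map_mul, ← B.hr, ← B.hc, RC.u, RC.v]
    congr 1
    · simp only [mul_inv, div_eq_mul_inv, inv_pow]; ring
    · congr 2; simp only [mul_inv, div_eq_mul_inv, inv_pow]; ring
  · rw [RC.h, RC.h', h3, E.φ_eq]
    simp only [map_div₀, map_mul, ← B.hr, ← B.hc, RC.u, RC.v]
    congr 1
    · ring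
    · congr 2; ring

/-- result of the reduction process -/
structure Out {E : C.Emb} {α : K} (B : RC E α) (X : ℝ) (b b' : Fin 3 → K) (U U' N : Matrix (Fin 3) (Fin 3) ℤ) (p : I9 → ℝ) : Prop where
  hp : p ∈ D0
  hN : ∀ i j, (N i j : ℝ) = X * Psi p (i, j)
  nq : C.NQ α (vb U b) (vb U' b') N
  hU : IsUnit U.det
  hU' : IsUnit U'.det
  hn : ∃ x q ψ, 0 < q ∧ U.map (Int.cast : ℤ → ℝ) * (B.h b * dg (X^2)) = nak x q ψ

lemma isUnit_of_gram {U S : Matrix (Fin 3) (Fin 3) ℤ} (h : U * S * Uᵀ = Gm ℤ) : IsUnit U.det := by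
  have := congrArg Matrix.det h
  rw [Matrix.det_mul, Matrix.det_mul, Matrix.det_transpose, Gm_det] at this
  have h2 : U.det * (-(S.det * U.det)) = 1 := by linarith
  exact IsUnit.of_mul_eq_one _ h2

lemma out_exists {E : C.Emb} {α : K} {I : Submodule ℤ K} (hP : C.Pr I α) (hP' : C.Pr (C.comp I) (α * C.θ))
    (B : RC E α) (X : ℝ) (hX : 0 < X) (ha : 0 ≤ (C.a:ℝ) ∧ C.a ≤ X^2) (hb : 0 ≤ (C.b:ℝ) ∧ C.b ≤ X^4)
    (hd : X^3 ≤ (C.d:ℝ) ∧ C.d ≤ 2*X^3) {b b' : Fin 3 → K} 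
    (hli : LinearIndependent ℤ b) (hsp : Submodule.span ℤ (Set.range b) = I)
    (hli' : LinearIndependent ℤ b') (hsp' : Submodule.span ℤ (Set.range b') = C.comp I) :
    ∃ U U' N p, Out B X b b' U U' N p := by
  obtain ⟨S, hS, hSu⟩ := hP.gram hli hsp
  obtain ⟨S', hS', hSu'⟩ := hP'.gram hli' hsp'
  have hbI : ∀ i, b i ∈ I := fun i => hsp ▸ Submodule.subset_span ⟨i, rfl⟩
  have hbI' : ∀ i, b' i ∈ C.comp I := fun i => hsp' ▸ Submodule.subset_span ⟨i, rfl⟩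
  have hN0 : ∀ i j, ∃ n : ℤ, C.φ (b i * b' j / α) = n := by
    intro i j
    apply C.φ_R
    obtain ⟨x, hx, y, hy, e⟩ := mem_comp.1 (hbI' j)
    rw [e, show b i * (C.θ * x + C.d * y) / α = C.θ * (b i * x / α) + C.d * (b i * y / α) by ring]
    exact add_mem (mul_mem C.θ_mem (hP.h2 _ (hbI i) _ hx)) (mul_mem (intCast_mem _ _) (hP.h2 _ (hbI i) _ hy))
  choose N0 hN0 using hN0
  obtain ⟨g1, g2, g3⟩ := B.grams b b'
  have hX2 : X^2 ≠ 0 := by positivity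
  have G1 : (B.h b * dg (X^2)) * Gm ℝ * (B.h b * dg (X^2))ᵀ = S.map Int.cast := by
    rw [gram_dg _ _ hX2]; ext i j; rw [g1, hS]; simp
  have G2 : (B.h' b' * dg X) * Gm ℝ * (B.h' b' * dg X)ᵀ = S'.map Int.cast := by
    rw [gram_dg _ _ hX.ne']; ext i j; rw [g2, hS']; simp
  have G3 : B.h b * Sm C.a C.b C.d * (B.h' b')ᵀ = (Matrix.of N0).map Int.cast := by
    ext i j; rw [g3, hN0]; simp
  obtain ⟨U, hU, x, q, ψ, r1, r2, r3, r4, r5, r6⟩ := red _ S G1 (det_of_gram G1 hSu)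
  obtain ⟨U', hU', x', q', ψ', r1', r2', r3', r4', r5', r6'⟩ := red _ S' G2 (det_of_gram G2 hSu')
  set p : I9 → ℝ := fun ij => (![![C.a/X^2, x, x'], ![C.b/X^4, q, q'], ![C.d/X^3, ψ, ψ']] : Fin 3 → Fin 3 → ℝ) ij.1 ij.2 with hp
  refine ⟨U, U', U * Matrix.of N0 * U'ᵀ, p, ?_, ?_, ?_, isUnit_of_gram hU, isUnit_of_gram hU', ⟨x, q, ψ, r1, r6⟩⟩
  · simp only [D0, Red0, Set.mem_setOf_eq, hp]
    simp
    refine ⟨⟨div_nonneg ha.1 (by positivity), div_le_one_of_le₀ ha.2 (by positivity)⟩,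
      ⟨div_nonneg hb.1 (by positivity), div_le_one_of_le₀ hb.2 (by positivity)⟩,
      ⟨(one_le_div (by positivity)).2 hd.1, (div_le_iff₀ (by positivity)).2 hd.2⟩, ⟨r2, r1, r3, r4, r5⟩, ⟨r2', r1', r3', r4', r5'⟩⟩
  · intro i j
    have key : (U * Matrix.of N0 * U'ᵀ).map (Int.cast : ℤ → ℝ) = 
      X • (nak x q ψ * Sm (C.a/X^2) (C.b/X^4) (C.d/X^3) * (nak x' q' ψ')ᵀ) := by
      rw [map_cast_mul, map_cast_mul, ← G3, ← r6, ← r6', Sm_scale C.a C.b C.d X hX.ne']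
      simp only [Matrix.transpose_mul, Matrix.mul_assoc, Matrix.smul_mul, Matrix.mul_smul, Matrix.transpose_map]
    have := congrFun (congrFun key i) j
    rw [Matrix.map_apply] at this
    rw [this]
    simp [Psi, hp]
  · refine ⟨hP.hα, fun i j => ?_, fun i j => ?_, fun i j => ?_⟩
    · rw [gram_trans U U b b α S hS, hU, GmQ]
    · rw [gram_trans U' U' b' b' _ S' hS', hU', GmQ]
    · rw [gram_trans U U' b b' _ (Matrix.of N0) hN0]

lemma vb_neg (U : Matrix (Fin 3) (Fin 3) ℤ) (b : Fin 3 → K) (i : Fin 3) : vb (-U) b i = - vb U b i := by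
  simp [vb]

lemma vb_inj {b : Fin 3 → K} (hli : LinearIndependent ℤ b) {U V : Matrix (Fin 3) (Fin 3) ℤ} (h : ∀ i, vb U b i = vb V b i) : U = V := by
  ext i j
  have := Fintype.linearIndependent_iff.1 hli (fun j => U i j - V i j) (by
    have := h i
    simp only [vb] at this
    simp only [zsmul_eq_mul]; push_cast
    simp only [sub_mul, Finset.sum_sub_distrib, this, sub_self]) j
  simpa [sub_eq_zero] using this

lemma sign_ne {E : C.Emb} {α : K} (B : RC E α) (X : ℝ) (hX : 0 < X) {b b' : Fin 3 → K} (hli : LinearIndependent ℤ b)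
    {U U' V V' N p p'} (h1 : Out B X b b' U U' N p) (h2 : Out B.neg X b b' V V' N p') : False := by
  obtain ⟨κ, hκ, hc, hk⟩ := h1.nq.inj h2.nq
  have hα := h1.nq.hα
  have hκ1 : κ = 1 ∨ κ = -1 := by
    have : κ^2 = 1 := by
      apply mul_right_cancel₀ hα; rw [← hk, one_mul]
    rw [← one_pow 2] at this
    exact sq_eq_sq_iff_eq_or_eq_neg.1 this
  obtain ⟨x, q, ψ, hq, e1⟩ := h1.hn
  obtain ⟨x', q', ψ', hq', e2⟩ := h2.hn
  have hX2 : X^2 ≠ 0 := by positivity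
  have hv : B.neg.v b = - B.v b := by ext i; simp only [RC.v, RC.neg, Pi.neg_apply, div_neg]
  have hu : B.neg.u b = B.u b := rfl
  have hdet : (U.det : ℝ) = V.det := by
    have d1 := congrArg Matrix.det e1
    have d2 := congrArg Matrix.det e2
    rw [nak_det _ _ _ hq, Matrix.det_mul, Matrix.det_mul, dg_det _ hX2, det_map_cast] at d1
    rw [nak_det _ _ _ hq', Matrix.det_mul, Matrix.det_mul, dg_det _ hX2, det_map_cast, RC.h, hv, hu, hR_det_neg] at d2
    have hne : (B.h b).det ≠ 0 := by rintro h; rw [h] at d1; norm_num at d1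
    apply mul_right_cancel₀ hne
    rw [mul_one] at d1 d2
    rw [d1]; exact d2.symm
  have hdet' : U.det = V.det := by exact_mod_cast hdet
  have hUV : V = U := by
    rcases hκ1 with rfl | rfl
    · exact vb_inj hli fun i => by rw [hc i, one_mul]
    · exfalso
      have : V = -U := vb_inj hli fun i => by rw [hc i, vb_neg]; ring
      rw [this, Matrix.det_neg] at hdet'
      simp at hdet'
      have h0 : U.det = 0 := by omega
      have := h1.hU
      rw [h0] at this
      simp at this
  subst hUV
  have hsum : nak x q ψ + nak x' q' ψ' = V.map (Int.cast : ℤ → ℝ) * (hR C.a C.b (E.τ C.θ) (E.ρ C.θ) (B.u b + B.u b) 0 * dg (X^2)) := by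
    rw [← e1, ← e2, ← Matrix.mul_add, ← Matrix.add_mul, RC.h, RC.h, hR_add, hv, hu, add_neg_cancel]
  have hle := nak_sum_nonpos x q ψ x' q' ψ' hq hq'
  rw [hsum] at hle
  set H := hR C.a C.b (E.τ C.θ) (E.ρ C.θ) (B.u b + B.u b) 0 with hH
  obtain ⟨h1', -, -⟩ := coord C.a C.b C.d (E.τ C.θ) (E.ρ C.θ) (by simpa using E.hV) (by simpa using E.hw) E.hs (B.u b + B.u b) 0 0 0
  have e3 : (V.map (Int.cast : ℤ → ℝ) * (H * dg (X^2))) * Gm ℝ * (V.map (Int.cast : ℤ → ℝ) * (H * dg (X^2)))ᵀ =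
    V.map (Int.cast : ℤ → ℝ) * (H * Gm ℝ * Hᵀ) * (V.map (Int.cast : ℤ → ℝ))ᵀ := by
    rw [← gram_dg H _ hX2]
    simp only [Matrix.transpose_mul, Matrix.mul_assoc]
  rw [e3] at hle
  have hval : (V.map (Int.cast : ℤ → ℝ) * (H * Gm ℝ * Hᵀ) * (V.map (Int.cast : ℤ → ℝ))ᵀ) 0 0 = 
     4 * (E.τ (vb V b 0) / B.βr)^2 * E.fr⁻¹ := by
    have hf : ∀ i j, (H * Gm ℝ * Hᵀ) i j = 4 * (B.u b i * B.u b j) * E.fr⁻¹ := by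
      intro i j; rw [hH, h1']; simp only [Emb.fr, Pi.add_apply, Pi.zero_apply, zero_mul, Complex.zero_re, mul_zero, add_zero]; ring
    generalize H * Gm ℝ * Hᵀ = Q at hf
    simp only [Matrix.mul_apply, hf, Fin.sum_univ_three, vb, map_add, map_mul, map_intCast, RC.u, Matrix.transpose_apply, Matrix.map_apply]
    ring
  rw [hval] at hle
  have hb0 : vb V b 0 ≠ 0 := b_ne h1.nq.hb
  have : E.τ (vb V b 0) ≠ 0 := by rwa [Ne, map_eq_zero]
  have h3 := B.hr0
  have h4 := E.fr_pos
  have : 0 < 4 * (E.τ (vb V b 0) / B.βr)^2 * E.fr⁻¹ := by positivity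
  linarith

end CD
end

section
open Matrix MeasureTheory

/-- the invariants of a row-type matrix -/
def sN (M : Matrix (Fin 3) (Fin 3) ℤ) : ℤ := M 0 2 * M 1 0
def uN (M : Matrix (Fin 3) (Fin 3) ℤ) : ℤ := M 0 2 * M 2 0
def RowT (M : Matrix (Fin 3) (Fin 3) ℤ) : Prop := M 0 0 = 0 ∧ M 0 1 = 0

namespace CD
variable {K : Type*} [Field K] [CharZero K] {C : CD K}

def Eqv (I : Submodule ℤ K) (α : K) (J : Submodule ℤ K) (β : K) : Prop :=
  ∃ κ : K, κ ≠ 0 ∧ β = κ^2 * α ∧ ∀ x, x ∈ I ↔ κ * x ∈ J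

lemma eqv_of_span {b c : Fin 3 → K} {I J : Submodule ℤ K} (hb : Submodule.span ℤ (Set.range b) = I)
    (hc : Submodule.span ℤ (Set.range c) = J) {α β κ : K} (hκ : κ ≠ 0) (hαβ : β = κ^2 * α)
    (h1 : ∀ i, κ * b i ∈ J) (h2 : ∀ i, κ⁻¹ * c i ∈ I) : Eqv I α J β := by
  refine ⟨κ, hκ, hαβ, fun x => ⟨fun hx => ?_, fun hx => ?_⟩⟩
  · rw [← hb] at hx
    obtain ⟨t, rfl⟩ := Pr.mem_span3.1 hx
    rw [Finset.mul_sum]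
    refine sum_mem fun i _ => ?_
    rw [show κ * (t i * b i) = t i • (κ * b i) by rw [zsmul_eq_mul]; ring]
    exact zsmul_mem (h1 i) _
  · rw [← hc] at hx
    obtain ⟨t, ht⟩ := Pr.mem_span3.1 hx
    have : x = κ⁻¹ * ∑ i, (t i : K) * c i := by rw [← ht]; field_simp
    rw [this, Finset.mul_sum]
    refine sum_mem fun i _ => ?_
    rw [show κ⁻¹ * (t i * c i) = t i • (κ⁻¹ * c i) by rw [zsmul_eq_mul]; ring]
    exact zsmul_mem (h2 i) _

lemma span_vb {b : Fin 3 → K} {U : Matrix (Fin 3) (Fin 3) ℤ} (hU : IsUnit U.det) :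
    Submodule.span ℤ (Set.range (vb U b)) = Submodule.span ℤ (Set.range b) := by
  have hle : ∀ (V : Matrix (Fin 3) (Fin 3) ℤ) (c : Fin 3 → K), Submodule.span ℤ (Set.range (vb V c)) ≤ Submodule.span ℤ (Set.range c) := by
    intro V c
    rw [Submodule.span_le]
    rintro _ ⟨i, rfl⟩
    exact Pr.mem_span3.2 ⟨V i, rfl⟩
  apply le_antisymm (hle _ _)
  have hcomp : vb U⁻¹ (vb U b) = b := by
    have h1 : U⁻¹ * U = 1 := Matrix.nonsing_inv_mul _ hU
    ext i
    have e : vb U⁻¹ (vb U b) i = vb (U⁻¹ * U) b i := by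
      generalize U⁻¹ = W
      simp only [vb, Matrix.mul_apply, Fin.sum_univ_three]; push_cast; ring
    rw [e, h1]
    fin_cases i <;> simp [vb, Matrix.one_apply]
  conv_lhs => rw [← hcomp]
  exact hle _ _

lemma comp_comp {I : Submodule ℤ K} (hθI : ∀ x ∈ I, C.θ * x ∈ I) (hcop : IsCoprime C.b C.d) (y : K) :
    C.θ * y ∈ C.comp (C.comp I) ↔ y ∈ I := by
  have hθ := C.hθ
  constructor
  · intro h
    obtain ⟨x, hx, w, hw, e⟩ := mem_comp.1 h
    obtain ⟨x1, hx1, x2, hx2, rfl⟩ := mem_comp.1 hx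
    obtain ⟨w1, hw1, w2, hw2, rfl⟩ := mem_comp.1 hw
    have : y = C.θ * x1 + C.d • x2 + C.d • w1 + (C.θ * (C.θ * w2) + C.a • (C.θ * w2) + C.b • w2) := by
      apply mul_left_cancel₀ C.θ_ne
      rw [e]
      simp only [zsmul_eq_mul]
      linear_combination (-w2) * hθ
    rw [this]
    exact add_mem (add_mem (add_mem (hθI _ hx1) (zsmul_mem hx2 _)) (zsmul_mem hw1 _))
      (add_mem (add_mem (hθI _ (hθI _ hw2)) (zsmul_mem (hθI _ hw2) _)) (zsmul_mem hw2 _))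
  · intro hy
    obtain ⟨p, q, hpq⟩ := hcop
    have hpq' : (p:K) * C.b + q * C.d = 1 := by exact_mod_cast hpq
    have e : C.θ * y = C.θ * (C.θ * ((-p) • (C.θ * y) + (-(p * C.a)) • y) + C.d * (q • y)) + C.d * (C.θ * 0 + C.d * (p • y)) := by
      simp only [zsmul_eq_mul]
      push_cast
      linear_combination (-y * C.θ) * hpq' + p * y * hθ
    rw [e]
    refine mem_comp.2 ⟨_, mem_comp.2 ⟨_, ?_, _, zsmul_mem hy _, rfl⟩, _, mem_comp.2 ⟨_, zero_mem _, _, zsmul_mem hy _, rfl⟩, rfl⟩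
    exact add_mem (zsmul_mem (hθI _ hy) _) (zsmul_mem hy _)

lemma comp_eqv {I J : Submodule ℤ K} {κ : K} (hκ : κ ≠ 0) (h : ∀ x, x ∈ I ↔ κ * x ∈ J) (x : K) : x ∈ C.comp I ↔ κ * x ∈ C.comp J := by
  rw [mem_comp, mem_comp]
  constructor
  · rintro ⟨y, hy, w, hw, rfl⟩
    exact ⟨_, (h y).1 hy, _, (h w).1 hw, by ring⟩
  · rintro ⟨y, hy, w, hw, e⟩
    refine ⟨κ⁻¹ * y, (h _).2 (by rwa [mul_inv_cancel_left₀ hκ]), κ⁻¹ * w, (h _).2 (by rwa [mul_inv_cancel_left₀ hκ]), ?_⟩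
    apply mul_left_cancel₀ hκ
    rw [e]; field_simp

lemma eqv_of_comp {I J : Submodule ℤ K} {α β : K} (hI : ∀ x ∈ I, C.θ * x ∈ I) (hJ : ∀ x ∈ J, C.θ * x ∈ J) (hcop : IsCoprime C.b C.d)
    (h : Eqv (C.comp I) (α * C.θ) (C.comp J) (β * C.θ)) : Eqv I α J β := by
  obtain ⟨κ, hκ, e, h⟩ := h
  refine ⟨κ, hκ, ?_, fun x => ?_⟩
  · apply mul_right_cancel₀ C.θ_ne; rw [e]; ring
  · rw [← comp_comp hI hcop x, ← comp_comp hJ hcop (κ * x), comp_eqv hκ h, show κ * (C.θ * x) = C.θ * (κ * x) by ring]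

lemma row_eqv {α β : K} {b b' c c' : Fin 3 → K} {M N} {I J : Submodule ℤ K} (h1 : C.NQ α b b' M) (h2 : C.NQ β c c' N)
    (hb : Submodule.span ℤ (Set.range b) = I) (hc : Submodule.span ℤ (Set.range c) = J)
    (r1 : RowT M) (r2 : RowT N) (hs : sN N = sN M ∨ sN N = - sN M) (hu : 2 * sN M ∣ uN N - uN M) : Eqv I α J β := by
  obtain ⟨s1, a1, b1, b2, -, -⟩ := h1.row r1.1 r1.2 (sN M) (uN M) rfl rfl
  obtain ⟨s2, a2, c1, c2, -, -⟩ := h2.row r2.1 r2.2 (sN N) (uN N) rfl rfl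
  have s1' : (sN M : K) ≠ 0 := by exact_mod_cast s1
  have s2' : (sN N : K) ≠ 0 := by exact_mod_cast s2
  set κ := b 0 / sN M with hκ
  set κ' := c 0 / sN N with hκ'
  have k1 : κ ≠ 0 := div_ne_zero (b_ne h1.hb) s1'
  have k2 : κ' ≠ 0 := div_ne_zero (b_ne h2.hb) s2'
  have hb0 : b 0 = κ * sN M := by rw [hκ]; field_simp
  have hc0 : c 0 = κ' * sN N := by rw [hκ']; field_simp
  obtain ⟨t, ht⟩ := hu
  have g1 := row_span (C := C) (sN M) (uN M) (sN N) (uN N) t s1 hs (by linarith) κ κ' b c k1 hb0 b1 b2 hc0 c1 c2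
  obtain ⟨t', ht'⟩ : 2 * sN N ∣ uN M - uN N := by
    rcases hs with hs | hs
    · exact ⟨-t, by rw [hs]; linarith⟩
    · exact ⟨t, by rw [hs]; linarith⟩
  have g2 := row_span (C := C) (sN N) (uN N) (sN M) (uN M) t' s2 (by rcases hs with hs | hs <;> [left; right] <;> linarith)
    (by linarith) κ' κ c b k2 hc0 c1 c2 hb0 b1 b2
  rw [hb] at g1
  rw [hc] at g2
  refine eqv_of_span hb hc (κ := κ' / κ) (div_ne_zero k2 k1) ?_ (fun i => (g2 i).resolve_right k1) (fun i => ?_)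
  · rw [a1, a2]; field_simp
  · rw [inv_div]; exact (g1 i).resolve_right k2

/-- The integral data attached to a family of inequivalent pairs. -/
structure Data (ι : Type) (X : ℝ) (a b d : ℤ) (N : ι → Bool → Matrix (Fin 3) (Fin 3) ℤ) (p : ι → Bool → I9 → ℝ) : Prop where
  hp : ∀ i s, p i s ∈ D0
  hN : ∀ i s k l, (N i s k l : ℝ) = X * Psi (p i s) (k, l)
  coef : ∀ i s, aN (N i s) = a ∧ bN (N i s) = b ∧ (N i s).det^2 = d^2
  inj : ∀ i s j t, N i s = N j t → i = j ∧ s = t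
  shear : ∀ i j s t t', N i s = nZ t * N j s * (nZ t')ᵀ → i = j
  row : ∀ i s, RowT (N i s) → sN (N i s) ≠ 0 ∧ 2 * sN (N i s) ∣ 3*(uN (N i s))^2 + 2*a*(uN (N i s)) + b ∧
    (sN (N i s))^2 ∣ (uN (N i s))^3 + a*(uN (N i s))^2 + b*(uN (N i s)) - d^2
  col : ∀ i s, RowT (N i s)ᵀ → sN (N i s)ᵀ ≠ 0 ∧ 2 * sN (N i s)ᵀ ∣ 3*(uN (N i s)ᵀ)^2 + 2*a*(uN (N i s)ᵀ) + b ∧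
    (sN (N i s)ᵀ)^2 ∣ (uN (N i s)ᵀ)^3 + a*(uN (N i s)ᵀ)^2 + b*(uN (N i s)ᵀ) - d^2
  row_inj : ∀ i j s t, RowT (N i s) → RowT (N j t) → (sN (N j t) = sN (N i s) ∨ sN (N j t) = - sN (N i s)) →
    2 * sN (N i s) ∣ uN (N j t) - uN (N i s) → i = j
  col_inj : ∀ i j s t, RowT (N i s)ᵀ → RowT (N j t)ᵀ → (sN (N j t)ᵀ = sN (N i s)ᵀ ∨ sN (N j t)ᵀ = - sN (N i s)ᵀ) →
    2 * sN (N i s)ᵀ ∣ uN (N j t)ᵀ - uN (N i s)ᵀ → i = j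

theorem data_exists (E : C.Emb) (hcop : IsCoprime C.b C.d) (X : ℝ) (hX : 0 < X) (ha : 0 ≤ (C.a:ℝ) ∧ C.a ≤ X^2)
    (hb : 0 ≤ (C.b:ℝ) ∧ C.b ≤ X^4) (hd : X^3 ≤ (C.d:ℝ) ∧ C.d ≤ 2*X^3) {ι : Type} (I : ι → Submodule ℤ K) (α : ι → K)
    (hP : ∀ i, C.Pr (I i) (α i)) (hpos : ∀ i, 0 < E.τ (α i)) (hne : ∀ i j, Eqv (I i) (α i) (I j) (α j) → i = j) :
    ∃ N p, Data ι X C.a C.b C.d N p := by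
  have hP' := fun i => (hP i).comp hcop
  choose b hli hsp using fun i => (hP i).basis
  choose b' hli' hsp' using fun i => (hP' i).basis
  have B : ∀ i, RC E (α i) := fun i => Classical.choice (RC.exists E (α i) (hpos i))
  let BB : ∀ i, Bool → RC E (α i) := fun i s => if s then B i else (B i).neg
  choose U U' N p ho using fun i s => out_exists (hP i) (hP' i) (BB i s) X hX ha hb hd (hli i) (hsp i) (hli' i) (hsp' i)
  have hs1 : ∀ i s, Submodule.span ℤ (Set.range (vb (U i s) (b i))) = I i := fun i s => by rw [span_vb (ho i s).hU, hsp]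
  have hs2 : ∀ i s, Submodule.span ℤ (Set.range (vb (U' i s) (b' i))) = C.comp (I i) := fun i s => by rw [span_vb (ho i s).hU', hsp']
  have inj0 : ∀ {i j : ι} {γ δ : K} {c c' e e' : Fin 3 → K} {M} , C.NQ γ c c' M → C.NQ δ e e' M → γ = α i → δ = α j →
      Submodule.span ℤ (Set.range c) = I i → Submodule.span ℤ (Set.range e) = I j → i = j := by
    rintro i j γ δ c c' e e' M n1 n2 rfl rfl s1 s2
    obtain ⟨κ, hκ, hc, hk⟩ := n1.inj n2
    refine hne i j (eqv_of_span s1 s2 hκ hk (fun k => ?_) (fun k => ?_))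
    · rw [← hc, ← s2]; exact Submodule.subset_span ⟨k, rfl⟩
    · rw [hc, inv_mul_cancel_left₀ hκ, ← s1]; exact Submodule.subset_span ⟨k, rfl⟩
  refine ⟨N, p, fun i s => (ho i s).hp, fun i s => (ho i s).hN, fun i s => (ho i s).nq.coef, ?_, ?_, ?_, ?_, ?_, ?_⟩
  · intro i s j t h
    have hij : i = j := inj0 (ho i s).nq (h ▸ (ho j t).nq) rfl rfl (hs1 i s) (hs1 j t)
    subst hij
    refine ⟨rfl, ?_⟩
    cases s <;> cases t
    · rfl
    · exfalso
      have h1 := ho i true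
      have h2 := ho i false
      rw [h] at h2
      simp only [BB, if_true] at h1
      simp only [BB, Bool.false_eq_true, if_false] at h2
      exact sign_ne (B i) X hX (hli i) h1 h2
    · exfalso
      have h1 := ho i true
      have h2 := ho i false
      rw [← h] at h2
      simp only [BB, if_true] at h1
      simp only [BB, Bool.false_eq_true, if_false] at h2
      exact sign_ne (B i) X hX (hli i) h1 h2
    · rfl
  · intro i j s t t' h
    have h2 := (ho j s).nq.trans (nZ t) (nZ t') (nZ_G t) (nZ_G t')
    rw [← h] at h2
    refine inj0 (ho i s).nq h2 rfl rfl (hs1 i s) ?_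
    rw [span_vb, hs1]
    exact isUnit_of_gram (nZ_G t)
  · intro i s hr
    obtain ⟨h1, -, -, -, h2, h3⟩ := (ho i s).nq.row hr.1 hr.2 _ _ rfl rfl
    exact ⟨h1, h2, h3⟩
  · intro i s hr
    obtain ⟨h1, -, -, -, h2, h3⟩ := (ho i s).nq.swap.row hr.1 hr.2 _ _ rfl rfl
    exact ⟨h1, h2, h3⟩
  · intro i j s t r1 r2 h1 h2
    exact hne i j (row_eqv (ho i s).nq (ho j t).nq (hs1 i s) (hs1 j t) r1 r2 h1 h2)
  · intro i j s t r1 r2 h1 h2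
    exact hne i j (eqv_of_comp (hP i).hθ (hP j).hθ hcop
      (row_eqv (ho i s).nq.swap (ho j t).nq.swap (hs2 i s) (hs2 j t) r1 r2 h1 h2))

end CD
end

section
open Matrix MeasureTheory
open NumberField NumberField.Units

lemma unit_exp (K : Type*) [Field K] [NumberField K] : ∃ E : (𝓞 K)ˣ → Fin (Units.rank K) → ℤ,
    (∀ u v, E (u*v) = E u + E v) ∧ (∀ f, ∃ u, E u = f) ∧ (∀ u, E u = 0 ↔ u ∈ torsion K) := by
  choose ze h1 h2 using fun u : (𝓞 K)ˣ => exist_unique_eq_mul_prod K u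
  have huniq : ∀ u (z : torsion K) (f : Fin (Units.rank K) → ℤ), u = z * ∏ i, (fundSystem K i) ^ (f i) → (ze u).2 = f := by
    intro u z f h
    have := h2 u (z, f) h
    rw [← this]
  refine ⟨fun u => (ze u).2, ?_, ?_, ?_⟩
  · intro u v
    refine huniq _ ((ze u).1 * (ze v).1) _ ?_
    simp only [Pi.add_apply, _root_.zpow_add, Finset.prod_mul_distrib, Subgroup.coe_mul]
    conv_lhs => rw [h1 u, h1 v]
    exact mul_mul_mul_comm _ _ _ _
  · intro f
    exact ⟨_, huniq _ 1 f rfl⟩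
  · intro u
    constructor
    · intro h
      rw [h1 u]
      simp only at h
      simp [h]
    · intro h
      exact huniq u ⟨u, h⟩ 0 (by simp)

lemma rank_cubic (K : Type*) [Field K] [NumberField K] (h3 : Module.finrank ℚ K = 3) (ρ : K →+* ℂ) (hρ : ¬ ComplexEmbedding.IsReal ρ) :
    InfinitePlace.nrComplexPlaces K = 1 ∧ Units.rank K = 1 := by
  have h := InfinitePlace.card_add_two_mul_card_eq_rank K
  have h' := InfinitePlace.card_eq_nrRealPlaces_add_nrComplexPlaces K
  have hc : 0 < InfinitePlace.nrComplexPlaces K := by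
    classical
    unfold InfinitePlace.nrComplexPlaces
    apply Fintype.card_pos_iff.mpr
    exact ⟨InfinitePlace.mkComplex ⟨ρ, hρ⟩⟩
  rw [h3] at h
  unfold Units.rank
  omega

lemma rank_sextic (L : Type*) [Field L] [NumberField L] (h6 : Module.finrank ℚ L = 6) (τ : L →+* ℝ) :
    3 ≤ Units.rank L := by
  have h := InfinitePlace.card_add_two_mul_card_eq_rank L
  have h' := InfinitePlace.card_eq_nrRealPlaces_add_nrComplexPlaces L
  have hc : 0 < InfinitePlace.nrRealPlaces L := by
    classical
    unfold InfinitePlace.nrRealPlaces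
    apply Fintype.card_pos_iff.mpr
    refine ⟨InfinitePlace.mkReal ⟨Complex.ofRealHom.comp τ, ?_⟩⟩
    rw [ComplexEmbedding.isReal_iff]
    ext x
    simp
  rw [h6] at h
  unfold Units.rank
  omega

/-- Units of a complex cubic field modulo squares. -/
lemma unit_sq (K : Type*) [Field K] [NumberField K] (h3 : Module.finrank ℚ K = 3) (ρ : K →+* ℂ) (hρ : ¬ ComplexEmbedding.IsReal ρ)
    : ∃ e : (𝓞 K)ˣ → ℤ, (∀ u v, e (u*v) = e u + e v) ∧ (∃ u, e u = 1) ∧ (∀ u, e u = 0 ↔ u = 1 ∨ u = -1) := by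
  obtain ⟨E, hE, hs, ht⟩ := unit_exp K
  have hr := (rank_cubic K h3 ρ hρ).2
  let i : Fin (Units.rank K) := ⟨0, by omega⟩
  have hi : ∀ j : Fin (Units.rank K), j = i := fun j => Fin.ext (by have := j.2; simp [i]; omega)
  refine ⟨fun u => E u i, fun u v => by simp [hE], ?_, fun u => ?_⟩
  · obtain ⟨u, hu⟩ := hs (fun _ => 1)
    exact ⟨u, by simp [hu]⟩
  · have h1 : E u i = 0 ↔ E u = 0 := ⟨fun h => funext fun j => by rw [hi j, h]; rfl, fun h => by rw [h]; rfl⟩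
    rw [h1, ht]
    constructor
    · intro h
      have := torsion_eq_one_or_neg_one_of_odd_finrank (K := K) (by rw [h3]; decide) ⟨u, h⟩
      rcases this with h | h
      · left; exact h
      · right; exact h
    · rintro (rfl | rfl)
      · exact one_mem _
      · exact (CommGroup.mem_torsion _).2 (isOfFinOrder_iff_pow_eq_one.2 ⟨2, by norm_num, by simp⟩)


/-- The key step of Hilbert's Theorem 94 for a quadratic extension unramified everywhere. -/
lemma h94_core {A B : Type*} [CommRing A] [CommRing B] [IsDomain B] [Algebra A B] [Module.FaithfullyFlat A B]
    (σ : B →+* B) (hσσ : ∀ x, σ (σ x) = x) (hσA : ∀ a : A, σ (algebraMap A B a) = algebraMap A B a)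
    (hfix : ∀ x, σ x = x → ∃ a : A, algebraMap A B a = x) (s : Bˣ) (hs : σ s = -s)
    (z : B) (k m : A) (D : ℤ) (hD : Odd D) (hk : k * m = D) (hz : z - σ z = algebraMap A B k * s)
    (hcl : ∀ (I : Ideal A) (n : A), I^2 = Ideal.span {n} → n ≠ 0 → ∃ c, I = Ideal.span {c})
    (η : Bˣ) (hη : (η : B) * σ η = 1) : ∃ w : Bˣ, (η : B) * σ w = w := by
  by_cases hx0 : (1 : B) + η = 0
  · refine ⟨s, ?_⟩
    have : (η : B) = -1 := by linear_combination hx0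
    rw [this, hs]; ring
  set x : B := 1 + η with hx
  have hxη : (η : B) * σ x = x := by
    rw [hx, map_add, map_one, mul_add, hη]; ring
  have hinj : Function.Injective (algebraMap A B) := FaithfulSMul.algebraMap_injective A B
  set I : Ideal A := (Ideal.span {x}).comap (algebraMap A B) with hI
  have hσM : ∀ w, w ∈ Ideal.span {x} → σ w ∈ Ideal.span {x} := by
    intro w hw
    obtain ⟨c, rfl⟩ := Ideal.mem_span_singleton'.1 hw
    rw [map_mul]
    refine Ideal.mul_mem_left _ _ ?_
    have : σ x = (↑η⁻¹ : B) * x := by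
      linear_combination (-σ x)*η.inv_mul + (↑η⁻¹ : B) * hxη
    rw [this]
    exact Ideal.mul_mem_left _ _ (Ideal.mem_span_singleton_self x)
  have htr : ∀ w, w ∈ Ideal.span {x} → w + σ w ∈ I.map (algebraMap A B) := by
    intro w hw
    obtain ⟨a, ha⟩ := hfix (w + σ w) (by rw [map_add, hσσ, add_comm])
    rw [← ha]
    refine Ideal.mem_map_of_mem _ ?_
    rw [hI, Ideal.mem_comap, ha]
    exact Ideal.add_mem _ hw (hσM w hw)
  have hdiff : ∀ y w, w ∈ Ideal.span {x} → (y - σ y) * w ∈ I.map (algebraMap A B) := by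
    intro y w hw
    have : (y - σ y) * w = (y * w + σ (y * w)) - σ y * (w + σ w) := by rw [map_mul]; ring
    rw [this]
    exact Ideal.sub_mem _ (htr _ (Ideal.mul_mem_left _ _ hw)) (Ideal.mul_mem_left _ _ (htr _ hw))
  have hmap : I.map (algebraMap A B) = Ideal.span {x} := by
    apply le_antisymm
    · exact Ideal.map_comap_le
    · intro w hw
      have h1 := Ideal.mul_mem_left _ (↑s⁻¹ : B) (hdiff s w hw)
      have h2 := Ideal.mul_mem_left _ ((↑s⁻¹ : B) * algebraMap A B m) (hdiff z w hw)
      rw [hs] at h1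
      rw [hz] at h2
      have e1 : (↑s⁻¹ : B) * ((↑s - -↑s) * w) = 2 * w := by
        linear_combination (2*w) * (s.inv_mul)
      have e2 : (↑s⁻¹ : B) * algebraMap A B m * (algebraMap A B k * ↑s * w) = (D:B) * w := by
        have : algebraMap A B k * algebraMap A B m = D := by rw [← map_mul, hk]; simp
        linear_combination (algebraMap A B m * algebraMap A B k*w) * (s.inv_mul) + w * this
      rw [e1] at h1
      rw [e2] at h2
      obtain ⟨t, ht⟩ := hD
      have : w = (D:B) * w - (t:B) * (2 * w) := by rw [ht]; push_cast; ring
      rw [this]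
      exact Ideal.sub_mem _ h2 (Ideal.mul_mem_left _ _ h1)
  obtain ⟨n, hn⟩ := hfix (x * σ x) (by rw [map_mul, hσσ, mul_comm])
  have hσx0 : σ x ≠ 0 := fun h => hx0 (by rw [← hxη, h, mul_zero])
  have hn0 : n ≠ 0 := by
    rintro rfl
    rw [map_zero] at hn
    exact mul_ne_zero hx0 hσx0 hn.symm
  have hI2 : I^2 = Ideal.span {n} := by
    have : (I^2).map (algebraMap A B) = (Ideal.span {n}).map (algebraMap A B) := by
      rw [Ideal.map_pow, hmap, Ideal.map_span, Set.image_singleton, hn, Ideal.span_singleton_pow, Ideal.span_singleton_eq_span_singleton]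
      refine ⟨η⁻¹, ?_⟩
      rw [sq]
      nth_rewrite 2 [← hxη]
      rw [mul_assoc, mul_comm (η:B), mul_assoc, Units.mul_inv, mul_one]
    rw [← Ideal.comap_map_eq_self_of_faithfullyFlat (B := B) (I^2), this, Ideal.comap_map_eq_self_of_faithfullyFlat]
  obtain ⟨c, hc⟩ := hcl I n hI2 hn0
  rw [hc, Ideal.map_span, Set.image_singleton, Ideal.span_singleton_eq_span_singleton] at hmap
  obtain ⟨w, hw⟩ := hmap
  refine ⟨w, ?_⟩
  have hc0 : algebraMap A B c ≠ 0 := by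
    intro h; rw [h, zero_mul] at hw; exact hx0 hw.symm
  apply mul_left_cancel₀ hc0
  rw [hw]
  conv_rhs => rw [← hxη, ← hw, map_mul, hσA]
  ring

lemma h94_count {A B : Type*} [CommRing A] [CommRing B] [IsDomain B] [Algebra A B] [FaithfulSMul A B]
    (σ : B →+* B) (hσσ : ∀ x, σ (σ x) = x) (hσA : ∀ a : A, σ (algebraMap A B a) = algebraMap A B a)
    (hfix : ∀ x, σ x = x → ∃ a : A, algebraMap A B a = x) (s : Bˣ) (ε : Aˣ) (hs : (s:B)^2 = algebraMap A B ε)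
    (h90 : ∀ η : Bˣ, (η : B) * σ η = 1 → ∃ w : Bˣ, (η : B) * σ w = w)
    (cl : Aˣ → Bool × Bool) (hcl : ∀ u v, cl u = cl v → ∃ w, u = v * w^2)
    (hA : ∀ v : Aˣ, ∃ w : Aˣ, v = w^2 ∨ v = -w^2 ∨ v = ε * w^2 ∨ v = -(ε*w^2))
    (r : ℕ) (hr : 3 ≤ r) (E : Bˣ → Fin r → ℤ) (hE : ∀ u v, E (u*v) = E u + E v) (hEs : ∀ f, ∃ u, E u = f) : False := by
  have hinj : Function.Injective (algebraMap A B) := FaithfulSMul.algebraMap_injective A B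
  have hN : ∀ u : Bˣ, ∃ n : Aˣ, algebraMap A B n = u * σ u := by
    intro u
    obtain ⟨n, hn⟩ := hfix (u * σ u) (by rw [map_mul, hσσ, mul_comm])
    obtain ⟨n', hn'⟩ := hfix (↑u⁻¹ * σ ↑u⁻¹) (by rw [map_mul, hσσ, mul_comm])
    have e : n * n' = 1 := by
      apply hinj
      rw [map_mul, hn, hn', map_one]
      have : σ u * σ ↑u⁻¹ = 1 := by rw [← map_mul, Units.mul_inv, map_one]
      linear_combination (σ ↑u * σ ↑u⁻¹) * u.mul_inv + this
    exact ⟨⟨n, n', e, by rw [mul_comm, e]⟩, hn⟩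
  choose N hN using hN
  have hE1 : E 1 = 0 := by have := hE 1 1; rw [mul_one] at this; simpa using this
  have hEn : E (-1) = 0 := by
    have := hE (-1) (-1)
    rw [neg_one_mul, neg_neg, hE1] at this
    ext i
    have := congrFun this i
    simp at this ⊢
    omega
  have hEinv : ∀ u, E u⁻¹ = - E u := by
    intro u
    have := hE u u⁻¹
    rw [mul_inv_cancel, hE1] at this
    exact (neg_eq_of_add_eq_zero_right this.symm).symm
  have hAB : ∀ v : Aˣ, ∃ w : Bˣ, (algebraMap A B v = w^2 ∨ algebraMap A B v = -w^2) := by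
    intro v
    obtain ⟨w, hw⟩ := hA v
    set w' : Bˣ := Units.map (algebraMap A B).toMonoidHom w with hw'
    have hw'' : algebraMap A B w = (w':B) := rfl
    rcases hw with h | h | h | h
    · exact ⟨w', Or.inl (by rw [h]; simp only [Units.val_neg, Units.val_mul, Units.val_pow_eq_pow_val, Units.val_one]; rw [map_pow, hw''])⟩
    · exact ⟨w', Or.inr (by rw [h]; simp only [Units.val_neg, Units.val_mul, Units.val_pow_eq_pow_val, Units.val_one]; rw [map_neg, map_pow, hw''])⟩
    · exact ⟨s * w', Or.inl (by rw [h]; simp only [Units.val_neg, Units.val_mul, Units.val_pow_eq_pow_val, Units.val_one]; rw [map_mul, map_pow, ← hs, hw'']; ring)⟩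
    · exact ⟨s * w', Or.inr (by rw [h]; simp only [Units.val_neg, Units.val_mul, Units.val_pow_eq_pow_val, Units.val_one]; rw [map_neg, map_mul, map_pow, ← hs, hw'']; ring)⟩
  -- units of relative norm a square have even exponents
  have key : ∀ u : Bˣ, (∃ v, N u = v^2) → ∀ i, Even (E u i) := by
    rintro u ⟨v, hv⟩ i
    set v' : Bˣ := Units.map (algebraMap A B).toMonoidHom v with hv'
    have hv'' : algebraMap A B v = (v':B) := rfl
    have hσv : σ (↑v'⁻¹) = ↑v'⁻¹ := by
      have : (↑v'⁻¹ : B) = algebraMap A B ↑v⁻¹ := rfl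
      rw [this, hσA]
    have hu : (u:B) * σ u = v'^2 := by rw [← hN, hv]; simp only [Units.val_neg, Units.val_mul, Units.val_pow_eq_pow_val, Units.val_one]; rw [map_pow, hv'']
    obtain ⟨w, hw⟩ := h90 (u * v'⁻¹) (by
      simp only [Units.val_neg, Units.val_mul, Units.val_pow_eq_pow_val, Units.val_one]
      rw [map_mul, hσv]
      linear_combination (↑v'⁻¹ * ↑v'⁻¹) * hu + (v' * ↑v'⁻¹ + 1) * v'.mul_inv)
    -- express the unit as a square
    obtain ⟨y, hy⟩ := hAB (N w)
    have e1 : (u : B) * ↑v'⁻¹ * algebraMap A B (N w) = w^2 := by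
      rw [hN]; simp only [Units.val_mul] at hw; linear_combination (w:B) * hw
    have e2 : u * v'⁻¹ * y^2 = w^2 ∨ u * v'⁻¹ * y^2 = -1 * w^2 := by
      rcases hy with h | h
      · left; ext; simp only [Units.val_neg, Units.val_mul, Units.val_pow_eq_pow_val, Units.val_one]; rw [← h, e1]
      · right; ext; simp only [Units.val_neg, Units.val_mul, Units.val_pow_eq_pow_val, Units.val_one]; rw [← e1, h]; ring
    obtain ⟨y', hy'⟩ := hAB v
    have e3 : v' = y'^2 ∨ v' = -1 * y'^2 := by
      rcases hy' with h | h
      · left; ext; simp only [Units.val_neg, Units.val_mul, Units.val_pow_eq_pow_val, Units.val_one]; rw [← h, hv'']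
      · right; ext; simp only [Units.val_neg, Units.val_mul, Units.val_pow_eq_pow_val, Units.val_one]; rw [← hv'', h]; ring
    have f3 : E v' = E (y'^2) := by
      rcases e3 with h | h
      · rw [h]
      · rw [h, hE, hEn, zero_add]
    have f2 : E (u * v'⁻¹ * y^2) = E (w^2) := by
      rcases e2 with h | h
      · rw [h]
      · rw [h, hE, hEn, zero_add]
    rw [hE, hE, hEinv, f3, sq, sq, sq, hE, hE, hE] at f2
    have := congrFun f2 i
    simp at this
    exact ⟨E w i + E y' i - E y i, by linarith⟩
  -- pigeonhole
  choose g hg using fun e : Fin 3 → Bool => hEs (fun i : Fin r => if h : (i:ℕ) < 3 then (if e ⟨i, h⟩ then 1 else 0) else 0)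
  obtain ⟨e, e', hne, hee⟩ := Fintype.exists_ne_map_eq_of_card_lt (fun e => cl (N (g e))) (by simp)
  obtain ⟨v, hv⟩ := hcl _ _ hee
  have hk := key (g e * (g e')⁻¹) ⟨v, by
    have h1 : N (g e * (g e')⁻¹) * N (g e') = N (g e) := by
      ext; apply hinj
      simp only [Units.val_neg, Units.val_mul, Units.val_pow_eq_pow_val, Units.val_one]
      rw [map_mul, hN, hN, hN]; simp only [Units.val_neg, Units.val_mul, Units.val_pow_eq_pow_val, Units.val_one]; rw [map_mul]
      have : σ ↑(g e') * σ ↑(g e')⁻¹ = 1 := by rw [← map_mul, Units.mul_inv, map_one]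
      linear_combination (g e * σ (g e) * σ ↑(g e') * σ ↑(g e')⁻¹) * (g e').mul_inv + (g e * σ (g e)) * this
    rw [hv, mul_comm] at h1
    exact mul_left_cancel h1⟩
  apply hne
  funext i
  have := hk ⟨i, by omega⟩
  rw [hE, hEinv, hg, hg] at this
  simp at this
  cases h1 : e i <;> cases h2 : e' i <;> simp_all
end

section
open Matrix MeasureTheory
open NumberField NumberField.Units

lemma principal_of_sq {A : Type*} [CommRing A] [IsDedekindDomain A] (h : ∀ c : ClassGroup A, c^2 = 1 → c = 1)
    (I : Ideal A) (n : A) (hI : I^2 = Ideal.span {n}) (hn : n ≠ 0) : ∃ c, I = Ideal.span {c} := by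
  have hI0 : I ∈ nonZeroDivisors (Ideal A) := by
    rw [mem_nonZeroDivisors_iff_ne_zero]
    rintro rfl
    rw [sq, zero_mul, eq_comm, Ideal.zero_eq_bot, Ideal.span_singleton_eq_bot] at hI
    exact hn hI
  have h1 : (ClassGroup.mk0 ⟨I, hI0⟩)^2 = 1 := by
    rw [← map_pow]
    have := (ClassGroup.mk0_eq_one_iff (I := I^2) (by exact pow_mem hI0 2)).2 ⟨⟨n, hI⟩⟩
    exact this
  obtain ⟨c, hc⟩ := ((ClassGroup.mk0_eq_one_iff hI0).1 (h _ h1)).principal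
  exact ⟨c, hc⟩

lemma fix_lift {K L : Type*} [Field K] [Field L] [NumberField K] [NumberField L] [Algebra K L] (σ : L →+* L)
    (hfix : ∀ x, σ x = x → ∃ a : K, algebraMap K L a = x) (x : 𝓞 L) (hx : RingOfIntegers.mapRingHom σ x = x) :
    ∃ a : 𝓞 K, algebraMap (𝓞 K) (𝓞 L) a = x := by
  obtain ⟨a, ha⟩ := hfix x (by rw [← RingOfIntegers.mapRingHom_apply, hx])
  have hIntg : IsIntegral ℤ a := by
    have h2 : IsIntegral ℤ (algebraMap K L a) := by rw [ha]; exact RingOfIntegers.isIntegral_coe x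
    exact (isIntegral_algebraMap_iff (FaithfulSMul.algebraMap_injective K L)).1 h2
  refine ⟨⟨a, hIntg⟩, ?_⟩
  apply RingOfIntegers.ext
  exact ha

theorem hilbert94_abs {K L : Type*} [Field K] [Field L] [NumberField K] [NumberField L] [Algebra K L]
    (h3 : Module.finrank ℚ K = 3) (h6 : Module.finrank ℚ L = 6) (τ : K →+* ℝ) (τL : L →+* ℝ) (ρ : K →+* ℂ)
    (hρ : ¬ ComplexEmbedding.IsReal ρ) (hcl : ∀ c : ClassGroup (𝓞 K), c^2 = 1 → c = 1)
    (σ : L →+* L) (hσσ : ∀ x, σ (σ x) = x) (hσK : ∀ a : K, σ (algebraMap K L a) = algebraMap K L a)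
    (hfix : ∀ x, σ x = x → ∃ a : K, algebraMap K L a = x) (s : L) (ε : (𝓞 K)ˣ)
    (hs : s^2 = algebraMap K L (ε : 𝓞 K)) (hσs : σ s = -s) (hε : 0 < τ ((ε : 𝓞 K) : K)) (hns : ¬ ∃ v : (𝓞 K)ˣ, ε = v^2)
    (z : L) (hz : IsIntegral ℤ z) (k m : 𝓞 K) (D : ℤ) (hD : Odd D) (hk : k * m = D) (hzz : z - σ z = algebraMap K L k * s) : False := by
  obtain ⟨e, he, ⟨u1, hu1⟩, ht⟩ := unit_sq K h3 ρ hρ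
  obtain ⟨E, hE, hEs, -⟩ := unit_exp L
  have hsint : IsIntegral ℤ s := by
    refine IsIntegral.of_pow (n := 2) (by norm_num) ?_
    rw [hs]
    exact (RingOfIntegers.isIntegral_coe (ε : 𝓞 K)).map (algebraMap K L).toIntAlgHom
  let sO : 𝓞 L := ⟨s, hsint⟩
  have hsO : sO^2 = algebraMap (𝓞 K) (𝓞 L) ε := RingOfIntegers.ext hs
  have hinvs : sO * (sO * algebraMap (𝓞 K) (𝓞 L) (↑ε⁻¹ : 𝓞 K)) = 1 := by
    rw [← mul_assoc, ← sq, hsO, ← map_mul, Units.mul_inv, map_one]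
  let su : (𝓞 L)ˣ := ⟨sO, _, hinvs, by rw [mul_comm, hinvs]⟩
  let σO := RingOfIntegers.mapRingHom σ
  have hσσO : ∀ x, σO (σO x) = x := fun x => RingOfIntegers.ext (hσσ x)
  have hσA : ∀ a : 𝓞 K, σO (algebraMap (𝓞 K) (𝓞 L) a) = algebraMap (𝓞 K) (𝓞 L) a := fun a => RingOfIntegers.ext (hσK a)
  have hfixO : ∀ x, σO x = x → ∃ a : 𝓞 K, algebraMap (𝓞 K) (𝓞 L) a = x := fun x hx => fix_lift σ hfix x hx
  have hp : ∀ u : (𝓞 K)ˣ, τ ((u : 𝓞 K) : K) ≠ 0 := by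
    intro u
    rw [map_ne_zero]
    exact coe_ne_zero u
  -- structure of units of K
  have he1 : e 1 = 0 := (ht 1).2 (Or.inl rfl)
  have hen : e (-1) = 0 := (ht (-1)).2 (Or.inr rfl)
  have heinv : ∀ u, e u⁻¹ = - e u := by
    intro u; have := he u u⁻¹; rw [mul_inv_cancel, he1] at this; omega
  have heven : ∀ u, Even (e u) → ∃ v, u = v^2 ∨ u = -v^2 := by
    rintro u ⟨t, ht'⟩
    have hz1 : ∀ n : ℕ, e (u1^n) = n := by
      intro n
      induction n with
      | zero => simpa using he1
      | succ n ih => rw [pow_succ, he, ih, hu1]; push_cast; ring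
    have hz2 : e (u1^t) = t := by
      obtain ⟨n, rfl | rfl⟩ := t.eq_nat_or_neg
      · rw [zpow_natCast, hz1]
      · rw [_root_.zpow_neg, heinv, zpow_natCast, hz1]
    refine ⟨u1^t, ?_⟩
    have h0 : e (u * (u1^t * u1^t)⁻¹) = 0 := by rw [he, heinv, he, hz2]; omega
    rcases (ht _).1 h0 with h | h
    · left; rw [sq]; exact mul_inv_eq_one.1 h
    · right; rw [sq]; rw [mul_inv_eq_iff_eq_mul] at h; rw [h, neg_one_mul]
  have hposeven : ∀ u, Even (e u) → 0 < τ ((u : 𝓞 K) : K) → ∃ v, u = v^2 := by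
    intro u h1 h2
    obtain ⟨v, h | h⟩ := heven u h1
    · exact ⟨v, h⟩
    · exfalso
      rw [h] at h2
      simp only [Units.val_neg, Units.val_pow_eq_pow_val, map_neg, map_pow] at h2
      nlinarith [sq_nonneg (τ ((v : 𝓞 K) : K))]
  have hεodd : Odd (e ε) := by
    rw [← Int.not_even_iff_odd]
    intro h
    exact hns (hposeven ε h hε)
  refine h94_count (A := 𝓞 K) (B := 𝓞 L) σO hσσO hσA hfixO su ε hsO ?_ (fun u => (decide (0 < τ ((u : 𝓞 K) : K)), decide (Even (e u)))) ?_ ?_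
    (Units.rank L) (rank_sextic L h6 τL) E hE hEs
  · intro η hη
    exact h94_core (A := 𝓞 K) (B := 𝓞 L) σO hσσO hσA hfixO su (RingOfIntegers.ext hσs) ⟨z, hz⟩ k m D hD hk (RingOfIntegers.ext hzz)
      (principal_of_sq hcl) η hη
  · intro u v h
    simp only [Prod.mk.injEq, decide_eq_decide] at h
    have h2 : Even (e (u * v⁻¹)) := by
      rw [he, heinv, ← sub_eq_add_neg, Int.even_sub]; exact h.2
    obtain ⟨w, hw⟩ := hposeven (u * v⁻¹) h2 (by
      have e1 : τ (((u * v⁻¹ : (𝓞 K)ˣ) : 𝓞 K) : K) * τ ((v : 𝓞 K) : K) = τ ((u : 𝓞 K) : K) := by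
        rw [← map_mul, ← map_mul, ← Units.val_mul, inv_mul_cancel_right]
      rcases lt_or_gt_of_ne (hp v) with hv | hv
      · have hu : τ ((u : 𝓞 K) : K) < 0 := lt_of_le_of_ne (not_lt.1 (fun h' => absurd (h.1.1 h') (not_lt.2 hv.le))) (hp u)
        by_contra hc
        nlinarith
      · have hu := h.1.2 hv
        by_contra hc
        nlinarith)
    exact ⟨w, by rw [← hw, mul_comm, inv_mul_cancel_right]⟩
  · intro v
    by_cases h : Even (e v)
    · obtain ⟨w, hw | hw⟩ := heven v h
      · exact ⟨w, Or.inl hw⟩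
      · exact ⟨w, Or.inr (Or.inl hw)⟩
    · have : Even (e (v * ε⁻¹)) := by
        rw [he, heinv, ← sub_eq_add_neg]
        exact Odd.sub_odd (Int.not_even_iff_odd.1 h) hεodd
      obtain ⟨w, hw | hw⟩ := heven _ this
      · exact ⟨w, Or.inr (Or.inr (Or.inl (by rw [← hw, mul_comm, inv_mul_cancel_right])))⟩
      · exact ⟨w, Or.inr (Or.inr (Or.inr (by rw [← mul_neg, ← hw, mul_comm, inv_mul_cancel_right])))⟩

lemma J_sq {A : Type*} [CommRing A] (a b d : ℤ) (t : A) (ht : t^3 + a*t^2 + b*t - d^2 = 0) (hcop : IsCoprime b d) :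
    (Ideal.span {t, (d : A)})^2 = Ideal.span {t} := by
  rw [sq, Ideal.span_pair_mul_span_pair]
  apply le_antisymm
  · rw [Ideal.span_le]
    intro x hx
    simp only [Set.mem_insert_iff, Set.mem_singleton_iff] at hx
    rw [SetLike.mem_coe, Ideal.mem_span_singleton]
    rcases hx with rfl | rfl | rfl | rfl
    · exact ⟨t, rfl⟩
    · exact ⟨d, rfl⟩
    · exact ⟨d, mul_comm _ _⟩
    · exact ⟨t^2 + a*t + b, by linear_combination -ht⟩
  · rw [Ideal.span_singleton_le_iff_mem]
    obtain ⟨x, y, hxy⟩ := hcop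
    have hxy' : (x : A) * b + y * d = 1 := by
      have := congrArg (Int.cast : ℤ → A) hxy
      push_cast at this
      exact this
    have e : t = (-(x:A)*(t + a)) * (t*t) + (y : A) * (t * d) + (x:A) * ((d : A)*d) := by
      linear_combination (-t) * hxy' + x * ht
    have h : (-(x:A)*(t + a)) * (t*t) + (y : A) * (t * d) + (x:A) * ((d : A)*d) ∈ Ideal.span {t*t, t*(d:A), (d:A)*t, (d:A)*d} := by
      refine Ideal.add_mem _ (Ideal.add_mem _ ?_ ?_) ?_ <;>
      exact Ideal.mul_mem_left _ _ (Ideal.subset_span (by simp))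
    rwa [← e] at h

lemma quad_ext.{w} {K : Type w} [Field K] [NumberField K] (e : K) (he : ∀ r : K, r^2 ≠ e) (τ : K →+* ℝ) (hτ : 0 < τ e) :
    ∃ (L : Type w) (_ : Field L) (_ : NumberField L) (_ : Algebra K L) (_ : L →+* ℝ) (σ : L →+* L) (s : L),
      Module.finrank ℚ L = 2 * Module.finrank ℚ K ∧ (∀ x, σ (σ x) = x) ∧ (∀ a : K, σ (algebraMap K L a) = algebraMap K L a) ∧
      (∀ x, σ x = x → ∃ a : K, algebraMap K L a = x) ∧ s^2 = algebraMap K L e ∧ σ s = -s := by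
  haveI : Fact (∀ r : K, r^2 ≠ e + 0 * r) := ⟨fun r => by rw [zero_mul, add_zero]; exact he r⟩
  haveI : IsScalarTower ℚ K (QuadraticAlgebra K e 0) := IsScalarTower.of_algebraMap_eq' (Subsingleton.elim _ _)
  haveI : Module.Finite ℚ (QuadraticAlgebra K e 0) := Module.Finite.trans K _
  haveI : NumberField (QuadraticAlgebra K e 0) := ⟨⟩
  let τL : QuadraticAlgebra K e 0 →+* ℝ := by
    letI := τ.toAlgebra
    exact (QuadraticAlgebra.lift (A := ℝ) ⟨Real.sqrt (τ e), by
      rw [Real.mul_self_sqrt hτ.le, Algebra.smul_def, zero_smul, mul_one, add_zero]; rfl⟩).toRingHom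
  refine ⟨QuadraticAlgebra K e 0, inferInstance, inferInstance, inferInstance, τL, starRingEnd _, ⟨0, 1⟩, ?_, fun x => star_star x, ?_, ?_, ?_, ?_⟩
  · rw [← Module.finrank_mul_finrank ℚ K (QuadraticAlgebra K e 0), QuadraticAlgebra.finrank_eq_two, mul_comm]
  · intro x
    rw [starRingEnd_apply]
    ext <;> simp
  · intro x hx
    rw [starRingEnd_apply] at hx
    have h1 := congrArg QuadraticAlgebra.im hx
    simp at h1
    have : x.im = 0 := by
      have h2 : (2:K) * x.im = 0 := by linear_combination -h1
      simpa using h2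
    refine ⟨x.re, ?_⟩
    ext <;> simp [this]
  · ext <;> simp [sq, QuadraticAlgebra.algebraMap_eq]
  · rw [starRingEnd_apply]; ext <;> simp

/-- The class number of a cubic field of our family is even as soon as `θ` is not a square. -/
theorem hilbert94 {K : Type*} [Field K] [NumberField K] (h3 : Module.finrank ℚ K = 3) (τ : K →+* ℝ) (ρ : K →+* ℂ)
    (hρ : ¬ ComplexEmbedding.IsReal ρ) (a b d : ℤ) (θ : K) (hθ : θ^3 + a*θ^2 + b*θ - d^2 = 0) (hθ0 : θ ≠ 0)
    (ha : a % 4 = 2) (hb : b % 4 = 1) (hd : d % 2 = 1) (hcop : IsCoprime b d) (hpos : 0 < τ θ)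
    (hns : ¬ ∃ g : K, θ = g^2) : ∃ c : ClassGroup (𝓞 K), c^2 = 1 ∧ c ≠ 1 := by
  by_contra! hcl
  have hθint : IsIntegral ℤ θ := by
    refine ⟨Polynomial.X^3 + Polynomial.C a * Polynomial.X^2 + Polynomial.C b * Polynomial.X - Polynomial.C (d^2), ?_, ?_⟩
    · monicity!
    · simp only [Polynomial.eval₂_sub, Polynomial.eval₂_add, Polynomial.eval₂_mul, Polynomial.eval₂_pow, Polynomial.eval₂_X, Polynomial.eval₂_C]
      simp only [eq_intCast, Int.cast_pow]
      exact hθ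
  let t : 𝓞 K := ⟨θ, hθint⟩
  have ht : t^3 + a*t^2 + b*t - d^2 = 0 := by
    apply RingOfIntegers.ext
    push_cast
    exact hθ
  have ht0 : t ≠ 0 := fun h => hθ0 (congrArg (fun x : 𝓞 K => (x : K)) h)
  obtain ⟨κ, hκ⟩ := principal_of_sq hcl (Ideal.span {t, (d : 𝓞 K)}) t (J_sq a b d t ht hcop) ht0
  have hκ2 : Ideal.span {κ^2} = Ideal.span {t} := by
    rw [← Ideal.span_singleton_pow, ← hκ, J_sq a b d t ht hcop]
  rw [Ideal.span_singleton_eq_span_singleton] at hκ2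
  obtain ⟨ε, hε⟩ := hκ2
  have hεK : (κ : K)^2 * ((ε : 𝓞 K) : K) = θ := congrArg (fun x : 𝓞 K => (x : K)) hε
  have hκ0 : (κ : K) ≠ 0 := by
    intro h; rw [h] at hεK; exact hθ0 (by rw [← hεK]; ring)
  have hnsε : ∀ r : K, r^2 ≠ ((ε : 𝓞 K) : K) := by
    intro r hr
    exact hns ⟨κ * r, by rw [← hεK, ← hr]; ring⟩
  have hεpos : 0 < τ ((ε : 𝓞 K) : K) := by
    rw [← hεK, map_mul, map_pow] at hpos
    exact pos_of_mul_pos_right hpos (sq_nonneg _)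
  obtain ⟨L, _, _, _, τL, σ, s, h6, hσσ, hσK, hfix, hs, hσs⟩ := quad_ext ((ε : 𝓞 K) : K) hnsε τ hεpos
  rw [h3] at h6
  obtain ⟨A, rfl⟩ : ∃ A, a = 4*A+2 := ⟨a / 4, by omega⟩
  obtain ⟨B, rfl⟩ : ∃ B, b = 4*B+1 := ⟨b / 4, by omega⟩
  obtain ⟨D, rfl⟩ : ∃ D, d = 2*D+1 := ⟨d / 2, by omega⟩
  push_cast at hθ ht
  let γ : 𝓞 K := t^2 + (4*A+1)*t + 4*(B-A)
  let q : 𝓞 K := (B-2*A)*t^2 + (2*(4*A+1)*(B-A)+D^2+D-A*(4*B+1))*t + (4*(B-A)^2 + A*(2*D+1)^2)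
  have hq : γ^2 - t = 4 * q := by
    simp only [γ, q]
    linear_combination (t + 4 * A) * ht
  have hqK : (γ:K)^2 - θ = 4 * (q:K) := by
    have h := congrArg (algebraMap (𝓞 K) K) hq
    have h4 : algebraMap (𝓞 K) K 4 = 4 := map_ofNat _ 4
    rw [map_sub, map_pow, map_mul, h4] at h
    exact h
  let z : L := (algebraMap K L γ + algebraMap K L κ * s) / 2
  have hεL : (algebraMap K L κ)^2 * algebraMap K L ((ε : 𝓞 K) : K) = algebraMap K L θ := by
    rw [← hεK, map_mul, map_pow]
  have hqL : (algebraMap K L γ)^2 - algebraMap K L θ = 4 * algebraMap K L q := by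
    have h := congrArg (algebraMap K L) hqK
    rw [map_sub, map_pow, map_mul, map_ofNat] at h
    exact h
  have hzq : z^2 - algebraMap K L γ * z + algebraMap K L q = 0 := by
    simp only [z]
    linear_combination (1/4) * (algebraMap K L κ)^2 * hs + (1/4) * hεL - (1/4) * hqL
  have hzint : IsIntegral ℤ z := by
    have : IsIntegral (𝓞 L) z := by
      refine ⟨Polynomial.X^2 - Polynomial.C (algebraMap (𝓞 K) (𝓞 L) γ) * Polynomial.X + Polynomial.C (algebraMap (𝓞 K) (𝓞 L) q), ?_, ?_⟩
      · monicity!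
      · simp only [Polynomial.eval₂_sub, Polynomial.eval₂_add, Polynomial.eval₂_mul, Polynomial.eval₂_pow, Polynomial.eval₂_X, Polynomial.eval₂_C]
        exact hzq
    exact isIntegral_trans (R := ℤ) (A := 𝓞 L) z this
  refine hilbert94_abs (K := K) (L := L) h3 h6 τ τL ρ hρ hcl σ hσσ hσK hfix s ε hs hσs hεpos ?_
    z hzint κ (κ * ε * (t^2 + (4*A+2)*t + (4*B+1))) ((2*D+1)^2) ?_ ?_ ?_
  · rintro ⟨v, hv⟩
    exact hnsε ((v : 𝓞 K) : K) (by rw [hv]; simp)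
  · exact Odd.pow ⟨D, rfl⟩
  · push_cast
    linear_combination (t^2 + (4*A+2)*t + (4*B+1)) * hε + ht
  · have h2 : σ 2 = 2 := map_ofNat σ 2
    simp only [z]
    rw [map_div₀, map_add, map_mul, hσK, hσK, hσs, h2]
    ring
end

section
open Matrix MeasureTheory
open NumberField NumberField.Units
open scoped nonZeroDivisors

/-- A surjection of abelian groups with finite kernel onto a finite group does not increase 2-torsion. -/
lemma two_tors_le {P C : Type*} [CommGroup P] [CommGroup C] [Finite P] [Finite C] (f : P →* C)
    (hf : Function.Surjective f) : Nat.card {c : C // c^2 = 1} ≤ Nat.card {c : P // c^2 = 1} := by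
  have key : ∀ (G : Type _) [CommGroup G] [Finite G],
      Nat.card (powMonoidHom 2 : G →* G).ker = (powMonoidHom 2 : G →* G).range.index := by
    intro G _ _
    have h1 := (powMonoidHom 2 : G →* G).ker.card_mul_index
    have h2 := (powMonoidHom 2 : G →* G).range.card_mul_index
    rw [Subgroup.index_ker] at h1
    have h3 : 0 < Nat.card (powMonoidHom 2 : G →* G).range := Nat.card_pos
    rw [← h1, mul_comm] at h2
    exact (Nat.eq_of_mul_eq_mul_right h3 h2).symm
  have key' : ∀ (G : Type _) [CommGroup G] [Finite G],
      Nat.card (powMonoidHom 2 : G →* G).ker = (powMonoidHom 2 : G →* G).range.index := by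
    intro G _ _
    have h1 := (powMonoidHom 2 : G →* G).ker.card_mul_index
    have h2 := (powMonoidHom 2 : G →* G).range.card_mul_index
    rw [Subgroup.index_ker] at h1
    have h3 : 0 < Nat.card (powMonoidHom 2 : G →* G).range := Nat.card_pos
    rw [← h1, mul_comm] at h2
    exact (Nat.eq_of_mul_eq_mul_right h3 h2).symm
  have e1 : Nat.card {c : C // c^2 = 1} = Nat.card (powMonoidHom 2 : C →* C).ker :=
    Nat.card_congr (Equiv.subtypeEquivRight fun c => by rw [MonoidHom.mem_ker]; rfl)
  have e2 : Nat.card {c : P // c^2 = 1} = Nat.card (powMonoidHom 2 : P →* P).ker :=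
    Nat.card_congr (Equiv.subtypeEquivRight fun c => by rw [MonoidHom.mem_ker]; rfl)
  rw [e1, e2, key C, key' P, ← Subgroup.index_comap_of_surjective _ hf]
  refine Nat.le_of_dvd (Nat.pos_of_ne_zero Subgroup.index_ne_zero_of_finite) (Subgroup.index_dvd_of_le ?_)
  rintro _ ⟨y, rfl⟩
  exact ⟨f y, by simp⟩

section Ord
variable {R O : Type*} [CommRing R] [IsDomain R] [CommRing O] [IsDedekindDomain O] [Algebra R O]

/-- contraction of an ideal prime to the conductor is invertible -/
lemma contr_inv (hinj : Function.Injective (algebraMap R O)) (n : O) (hn : ∀ y : O, ∃ r : R, algebraMap R O r = n * y)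
    (A : Ideal O) (x : O) (hx : x ∈ A) (y : O) (hxy : 1 - x = n^2 * y) :
    ∃ (x' : R) (B : Ideal R), algebraMap R O x' = x ∧ A.comap (algebraMap R O) * B = Ideal.span {x'} ∧
      (A.comap (algebraMap R O)).map (algebraMap R O) = A := by
  obtain ⟨r1, hr1⟩ := hn (n * y)
  have hx' : algebraMap R O (1 - r1) = x := by rw [map_sub, map_one, hr1]; linear_combination hxy
  obtain ⟨B, hB⟩ : A ∣ Ideal.span {x} := Ideal.dvd_span_singleton.mpr hx
  refine ⟨1 - r1, B.comap (algebraMap R O), hx', le_antisymm ?_ ?_, le_antisymm Ideal.map_comap_le ?_⟩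
  · rw [Ideal.mul_le]
    intro r hr s hs
    rw [Ideal.mem_comap] at hr hs
    have h : algebraMap R O r * algebraMap R O s ∈ Ideal.span {x} := by rw [hB]; exact Ideal.mul_mem_mul hr hs
    obtain ⟨z, hz⟩ := Ideal.mem_span_singleton.mp h
    obtain ⟨r2, hr2⟩ := hn (n * y * z)
    refine Ideal.mem_span_singleton.mpr ⟨r * s + r2, hinj ?_⟩
    rw [map_mul, map_mul, map_add, map_mul, hr2, hx', hz]
    linear_combination (x * z) * hxy
  · rw [Ideal.span_singleton_le_iff_mem]
    have hxB : x ∈ B := by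
      have : x ∈ A * B := by rw [← hB]; exact Ideal.mem_span_singleton_self x
      exact Ideal.mul_le_right this
    have h1 : (1 - r1) * (1 - r1) ∈ A.comap (algebraMap R O) * B.comap (algebraMap R O) :=
      Ideal.mul_mem_mul (by rw [Ideal.mem_comap, hx']; exact hx) (by rw [Ideal.mem_comap, hx']; exact hxB)
    have h2 : ∀ z ∈ A * B, ∀ r : R, algebraMap R O r = n^2 * z → r ∈ A.comap (algebraMap R O) * B.comap (algebraMap R O) := by
      intro z hz
      induction hz using Submodule.mul_induction_on' with
      | mem_mul_mem a ha b hb =>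
        intro r hr
        obtain ⟨ra, hra⟩ := hn a
        obtain ⟨rb, hrb⟩ := hn b
        have : r = ra * rb := hinj (by rw [map_mul, hra, hrb, hr]; ring)
        rw [this]
        exact Ideal.mul_mem_mul (by rw [Ideal.mem_comap, hra]; exact A.mul_mem_left _ ha)
          (by rw [Ideal.mem_comap, hrb]; exact B.mul_mem_left _ hb)
      | add u hu v hv ihu ihv =>
        intro r hr
        obtain ⟨ru, hru⟩ := hn (n * u)
        obtain ⟨rv, hrv⟩ := hn (n * v)
        have : r = ru + rv := hinj (by rw [map_add, hru, hrv, hr]; ring)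
        rw [this]
        exact Ideal.add_mem _ (ihu _ (by rw [hru]; ring)) (ihv _ (by rw [hrv]; ring))
    have h3 : r1 * (1 - r1) ∈ A.comap (algebraMap R O) * B.comap (algebraMap R O) := by
      refine h2 (x * y) ?_ _ ?_
      · rw [← hB]; exact Ideal.mul_mem_right _ _ (Ideal.mem_span_singleton_self x)
      · rw [map_mul, hx', hr1]; ring
    have := Ideal.add_mem _ h1 h3
    convert this using 1; ring
  · intro a ha
    obtain ⟨r, hr⟩ := hn (n * y * a)
    have e : a = a * algebraMap R O (1 - r1) + algebraMap R O r := by rw [hx', hr]; linear_combination a * hxy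
    rw [e]
    refine Ideal.add_mem _ (Ideal.mul_mem_left _ _ (Ideal.mem_map_of_mem _ ?_)) (Ideal.mem_map_of_mem _ ?_)
    · rw [Ideal.mem_comap, hx']; exact hx
    · rw [Ideal.mem_comap, hr]; exact A.mul_mem_left _ (A.mul_mem_left _ ha)

lemma coprime_rep (n : O) (hn0 : n ≠ 0) (c : ClassGroup O) :
    ∃ (A : (Ideal O)⁰) (x y : O), x ≠ 0 ∧ x ∈ (A : Ideal O) ∧ 1 - x = n^2 * y ∧ ClassGroup.mk0 A = c := by
  obtain ⟨J, hJ⟩ := ClassGroup.mk0_surjective c⁻¹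
  have hJ0 : (J : Ideal O) ≠ ⊥ := nonZeroDivisors.ne_zero J.2
  have hI : Ideal.span {n^2} * (J : Ideal O) ≠ 0 := mul_ne_zero (by
    rw [Ne, Ideal.zero_eq_bot, Ideal.span_singleton_eq_bot]; exact pow_ne_zero 2 hn0) hJ0
  obtain ⟨a, ha0, ha⟩ : ∃ a, a ≠ 0 ∧ Ideal.span {n^2} * (J : Ideal O) ⊔ Ideal.span {a} = J := by
    obtain ⟨a, ha⟩ := IsDedekindDomain.exists_sup_span_eq (I := Ideal.span {n^2} * (J : Ideal O)) (J := J) Ideal.mul_le_right hI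
    rcases eq_or_ne a 0 with rfl | h
    · obtain ⟨b, hb, hb0⟩ := Submodule.exists_mem_ne_zero_of_ne_bot hI
      refine ⟨b, hb0, ?_⟩
      have : Ideal.span {(0:O)} = ⊥ := Ideal.span_singleton_eq_bot.mpr rfl
      rw [this, sup_bot_eq] at ha
      rw [sup_eq_left.mpr, ha]
      rw [Ideal.span_singleton_le_iff_mem]; exact hb
    · exact ⟨a, h, ha⟩
  have haJ : a ∈ (J : Ideal O) := by
    rw [← ha]; exact Ideal.mem_sup_right (Ideal.mem_span_singleton_self a)
  obtain ⟨A, hA⟩ : (J : Ideal O) ∣ Ideal.span {a} := Ideal.dvd_span_singleton.mpr haJ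
  have hA0 : A ≠ ⊥ := by
    rintro rfl
    rw [Ideal.mul_bot, Ideal.span_singleton_eq_bot] at hA
    exact ha0 hA
  have htop : Ideal.span {n^2} ⊔ A = ⊤ := by
    rw [hA, mul_comm (Ideal.span {n^2}), ← Ideal.mul_sup] at ha
    have := mul_left_cancel₀ (M₀ := Ideal O) hJ0 (ha.trans (mul_one _).symm)
    rw [this, Ideal.one_eq_top]
  obtain ⟨x, y, hx0, hx, hxy⟩ : ∃ x y : O, x ≠ 0 ∧ x ∈ A ∧ 1 - x = n^2 * y := by
    obtain ⟨u, hu, x, hx, hux⟩ := Submodule.mem_sup.mp ((Ideal.eq_top_iff_one _).mp htop)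
    obtain ⟨y, hy⟩ := Ideal.mem_span_singleton.mp hu
    rcases eq_or_ne x 0 with rfl | h
    · obtain ⟨b, hb, hb0⟩ := Submodule.exists_mem_ne_zero_of_ne_bot hA0
      refine ⟨b, y * (1 - b), hb0, hb, ?_⟩
      rw [add_zero] at hux
      linear_combination (1 - b) * hy - (1 - b) * hux
    · exact ⟨x, y, h, hx, by rw [← hy, ← hux]; ring⟩
  refine ⟨⟨A, mem_nonZeroDivisors_of_ne_zero hA0⟩, x, y, hx0, hx, hxy, ?_⟩
  · rw [← inv_inv c, ← hJ, eq_comm, inv_eq_iff_mul_eq_one, ← map_mul]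
    have hm : (J : Ideal O) * A ∈ (Ideal O)⁰ := mul_mem J.2 (mem_nonZeroDivisors_of_ne_zero hA0)
    have h1 : ClassGroup.mk0 ⟨(J : Ideal O) * A, hm⟩ = 1 := (ClassGroup.mk0_eq_one_iff hm).mpr (by
      rw [← hA]; exact ⟨⟨a, rfl⟩⟩)
    exact h1

variable {K : Type*} [Field K] [Algebra R K] [Algebra O K] [IsScalarTower R O K] [IsFractionRing R K] [IsFractionRing O K]
  [Module.IsTorsionFree R O] [Algebra.IsIntegral R O]

lemma ext_mem (I : FractionalIdeal R⁰ K) (x : K) (hx : x ∈ I) : x ∈ FractionalIdeal.extendedHom K O I := by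
  have := FractionalIdeal.coe_extendedHom_eq_span (L := K) (B := O) I
  rw [← FractionalIdeal.mem_coe, this]
  exact Submodule.subset_span ⟨x, hx, rfl⟩

lemma ext_span (κ : K) : FractionalIdeal.extendedHom K O (FractionalIdeal.spanSingleton R⁰ κ) = FractionalIdeal.spanSingleton O⁰ κ := by
  rw [FractionalIdeal.extendedHom_spanSingleton]
  congr 1
  have : (IsFractionRing.map (FaithfulSMul.algebraMap_injective R O) : K →+* K) = RingHom.id K := by
    apply IsFractionRing.ringHom_ext (A := R)
    intro x
    simp [IsFractionRing.map, ← IsScalarTower.algebraMap_apply]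
  rw [this]; rfl

noncomputable def exH (R O K : Type*) [CommRing R] [IsDomain R] [CommRing O] [IsDedekindDomain O] [Algebra R O]
    [Field K] [Algebra R K] [Algebra O K] [IsScalarTower R O K] [IsFractionRing R K] [IsFractionRing O K]
    [Module.IsTorsionFree R O] [Algebra.IsIntegral R O] :
    ((FractionalIdeal R⁰ K)ˣ ⧸ (toPrincipalIdeal R K).range) →* ClassGroup O :=
  QuotientGroup.lift _ ((ClassGroup.mk K).comp (Units.map (FractionalIdeal.extendedHom K O : FractionalIdeal R⁰ K →+* FractionalIdeal O⁰ K).toMonoidHom)) (by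
    rintro _ ⟨κ, rfl⟩
    rw [MonoidHom.mem_ker, MonoidHom.comp_apply, ClassGroup.mk_eq_one_iff]
    refine ⟨⟨(κ : K), ?_⟩⟩
    have : ((Units.map (FractionalIdeal.extendedHom K O : FractionalIdeal R⁰ K →+* FractionalIdeal O⁰ K).toMonoidHom (toPrincipalIdeal R K κ) : (FractionalIdeal O⁰ K)ˣ) : FractionalIdeal O⁰ K) = FractionalIdeal.spanSingleton O⁰ (κ : K) := by
      rw [Units.coe_map, coe_toPrincipalIdeal]
      exact ext_span _
    rw [this, FractionalIdeal.coe_spanSingleton])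

lemma exH_surj (n : O) (hn0 : n ≠ 0) (hn : ∀ y : O, ∃ r : R, algebraMap R O r = n * y) :
    Function.Surjective (exH R O K) := by
  intro c
  obtain ⟨A, x, y, hx0, hx, hxy, rfl⟩ := coprime_rep n hn0 c
  have hinj := FaithfulSMul.algebraMap_injective R O
  obtain ⟨x', B, hx', hAB, hmap⟩ := contr_inv hinj n hn A x hx y hxy
  have hκ : algebraMap R K x' ≠ 0 := by
    rw [IsScalarTower.algebraMap_apply R O K, hx']
    exact (map_ne_zero_iff _ (IsFractionRing.injective O K)).mpr hx0
  let U : (FractionalIdeal R⁰ K)ˣ := Units.mkOfMulEqOne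
    (((A : Ideal O).comap (algebraMap R O) : Ideal R) : FractionalIdeal R⁰ K)
    ((B : FractionalIdeal R⁰ K) * FractionalIdeal.spanSingleton R⁰ (algebraMap R K x')⁻¹) (by
      rw [← mul_assoc, ← FractionalIdeal.coeIdeal_mul, hAB, FractionalIdeal.coeIdeal_span_singleton,
        FractionalIdeal.spanSingleton_mul_spanSingleton, mul_inv_cancel₀ hκ, FractionalIdeal.spanSingleton_one])
  refine ⟨QuotientGroup.mk U, ?_⟩
  rw [← ClassGroup.mk_mk0 K A]
  change ClassGroup.mk K (Units.map _ U) = _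
  congr 1
  apply Units.ext
  rw [Units.coe_map, FractionalIdeal.coe_mk0]
  refine (FractionalIdeal.extendedHom_coeIdeal_eq_map K O _).trans ?_
  rw [hmap]

lemma exH_fin (n : O) (hn : ∀ y : O, ∃ r : R, algebraMap R O r = n * y)
    [Finite (O ⧸ Ideal.span {n})] :
    Finite (exH R O K).ker := by
  let T : Set (FractionalIdeal R⁰ K)ˣ := {I | FractionalIdeal.extendedHom K O (I : FractionalIdeal R⁰ K) = 1}
  have hsub : ∀ I ∈ T, ∀ x : K, x ∈ (I : FractionalIdeal R⁰ K) → ∃ y : O, algebraMap O K y = x := by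
    intro I hI x hx
    have := ext_mem (O := O) _ _ hx
    rw [hI] at this
    exact (FractionalIdeal.mem_one_iff _).mp this
  have hsup : ∀ I ∈ T, ∀ y : O, algebraMap O K (n * y) ∈ (I : FractionalIdeal R⁰ K) := by
    intro I hI y
    have h1 : (1 : K) ∈ FractionalIdeal.extendedHom K O (I : FractionalIdeal R⁰ K) := by
      rw [hI]; exact FractionalIdeal.one_mem_one _
    rw [← FractionalIdeal.mem_coe, FractionalIdeal.coe_extendedHom_eq_span] at h1
    have key : ∀ z ∈ Submodule.span O (algebraMap K K '' (I : FractionalIdeal R⁰ K)), ∀ c : O, algebraMap O K (n * c) * z ∈ (I : FractionalIdeal R⁰ K) := by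
      intro z hz
      induction hz using Submodule.span_induction with
      | mem w hw =>
        obtain ⟨w, hw, rfl⟩ := hw
        intro c
        obtain ⟨r, hr⟩ := hn c
        rw [← hr, ← IsScalarTower.algebraMap_apply, ← Algebra.smul_def]
        exact Submodule.smul_mem (I : FractionalIdeal R⁰ K).1 r hw
      | zero => intro c; rw [mul_zero]; exact FractionalIdeal.zero_mem _
      | add u v _ _ hu hv => intro c; rw [mul_add]; exact Submodule.add_mem (I : FractionalIdeal R⁰ K).1 (hu c) (hv c)
      | smul a u _ hu =>
        intro c
        have := hu (c * a)
        rw [← mul_assoc, map_mul, mul_assoc, ← Algebra.smul_def a] at this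
        exact this
    simpa using key 1 h1 y
  have hT : T.Finite := by
    have : Function.Injective (fun I : T => {q : O ⧸ Ideal.span {n} | ∃ y : O, Ideal.Quotient.mk _ y = q ∧ algebraMap O K y ∈ ((I : (FractionalIdeal R⁰ K)ˣ) : FractionalIdeal R⁰ K)}) := by
      have half : ∀ I J : T, {q : O ⧸ Ideal.span {n} | ∃ y : O, Ideal.Quotient.mk _ y = q ∧ algebraMap O K y ∈ ((I : (FractionalIdeal R⁰ K)ˣ) : FractionalIdeal R⁰ K)} = {q : O ⧸ Ideal.span {n} | ∃ y : O, Ideal.Quotient.mk _ y = q ∧ algebraMap O K y ∈ ((J : (FractionalIdeal R⁰ K)ˣ) : FractionalIdeal R⁰ K)} →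
          ∀ x, x ∈ ((I : (FractionalIdeal R⁰ K)ˣ) : FractionalIdeal R⁰ K) → x ∈ ((J : (FractionalIdeal R⁰ K)ˣ) : FractionalIdeal R⁰ K) := by
        intro I J h x hx
        obtain ⟨y, rfl⟩ := hsub I I.2 x hx
        have : (Ideal.Quotient.mk (Ideal.span {n}) y) ∈ {q : O ⧸ Ideal.span {n} | ∃ y : O, Ideal.Quotient.mk _ y = q ∧ algebraMap O K y ∈ ((I : (FractionalIdeal R⁰ K)ˣ) : FractionalIdeal R⁰ K)} := ⟨y, rfl, hx⟩
        rw [h] at this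
        obtain ⟨y', h1, h2⟩ := this
        rw [Ideal.Quotient.eq] at h1
        obtain ⟨c, hc⟩ := Ideal.mem_span_singleton.mp h1
        have h3 := hsup J J.2 c
        rw [← hc, map_sub] at h3
        have := Submodule.sub_mem ((J : (FractionalIdeal R⁰ K)ˣ) : FractionalIdeal R⁰ K).1 h2 h3
        rwa [sub_sub_cancel] at this
      intro I J h
      apply Subtype.ext
      apply Units.ext
      apply FractionalIdeal.ext
      exact fun x => ⟨half I J h x, half J I h.symm x⟩
    haveI := Finite.of_injective _ this
    exact Set.toFinite T
  have hk : ((exH R O K).ker : Set ((FractionalIdeal R⁰ K)ˣ ⧸ (toPrincipalIdeal R K).range)).Finite := by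
    refine (hT.image (QuotientGroup.mk : (FractionalIdeal R⁰ K)ˣ → _)).subset ?_
    intro c hc
    obtain ⟨I, rfl⟩ := QuotientGroup.mk_surjective c
    have h1 : ClassGroup.mk K (Units.map (FractionalIdeal.extendedHom K O : FractionalIdeal R⁰ K →+* FractionalIdeal O⁰ K).toMonoidHom I) = 1 := hc
    rw [ClassGroup.mk_eq_one_iff] at h1
    obtain ⟨⟨κ, hκ⟩⟩ := h1
    have h2 : FractionalIdeal.extendedHom K O (I : FractionalIdeal R⁰ K) = FractionalIdeal.spanSingleton O⁰ κ := by
      apply FractionalIdeal.coeToSubmodule_injective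
      refine Eq.trans ?_ (FractionalIdeal.coe_spanSingleton _ _).symm
      exact hκ
    have hκ0 : κ ≠ 0 := by
      rintro rfl
      rw [FractionalIdeal.spanSingleton_zero, FractionalIdeal.extendedHom_eq_zero_iff] at h2
      exact I.ne_zero h2
    refine ⟨I * toPrincipalIdeal R K (Units.mk0 κ hκ0)⁻¹, ?_, ?_⟩
    · change FractionalIdeal.extendedHom K O (((I * toPrincipalIdeal R K (Units.mk0 κ hκ0)⁻¹ : (FractionalIdeal R⁰ K)ˣ)) : FractionalIdeal R⁰ K) = 1
      rw [Units.val_mul, coe_toPrincipalIdeal, map_mul, ext_span, h2, FractionalIdeal.spanSingleton_mul_spanSingleton]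
      simp [hκ0]
    · rw [QuotientGroup.eq]
      exact ⟨Units.mk0 κ hκ0, by simp⟩
  exact hk

/-- the two-torsion of the Picard group of `R` is at least that of the class group of `O` -/
theorem pic_two (n : O) (hn0 : n ≠ 0) (hn : ∀ y : O, ∃ r : R, algebraMap R O r = n * y)
    [Finite (O ⧸ Ideal.span {n})] [Finite (ClassGroup O)] (k : ℕ) (hk : k ≤ Nat.card {c : ClassGroup O // c^2 = 1}) :
    ∃ (I : Fin k → (FractionalIdeal R⁰ K)ˣ) (α : Fin k → Kˣ), (∀ i, (I i)^2 = toPrincipalIdeal R K (α i)) ∧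
      ∀ i j (κ : Kˣ), I i = toPrincipalIdeal R K κ * I j → i = j := by
  have hs := exH_surj (K := K) n hn0 hn
  haveI := exH_fin (K := K) n hn
  haveI : Finite ((FractionalIdeal R⁰ K)ˣ ⧸ (toPrincipalIdeal R K).range) := by
    haveI : Finite (((FractionalIdeal R⁰ K)ˣ ⧸ (toPrincipalIdeal R K).range) ⧸ (exH R O K).ker) :=
      Finite.of_equiv _ (QuotientGroup.quotientKerEquivOfSurjective _ hs).symm.toEquiv
    exact Finite.of_equiv _ (Subgroup.groupEquivQuotientProdSubgroup (s := (exH R O K).ker)).symm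
  have h := hk.trans (two_tors_le (P := (FractionalIdeal R⁰ K)ˣ ⧸ (toPrincipalIdeal R K).range) (C := ClassGroup O) (exH R O K) hs)
  let e := Finite.equivFin {c : (FractionalIdeal R⁰ K)ˣ ⧸ (toPrincipalIdeal R K).range // c^2 = 1}
  let c : Fin k → {c : (FractionalIdeal R⁰ K)ˣ ⧸ (toPrincipalIdeal R K).range // c^2 = 1} := fun i => e.symm (Fin.castLE h i)
  have hc : Function.Injective c := fun i j hij => Fin.castLE_injective h (e.symm.injective hij)
  choose I hI using fun i => QuotientGroup.mk_surjective (c i).1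
  have : ∀ i, ∃ α : Kˣ, toPrincipalIdeal R K α = (I i)^2 := by
    intro i
    have h2 := (c i).2
    rw [← hI, ← QuotientGroup.mk_pow, QuotientGroup.eq_one_iff] at h2
    exact h2
  choose α hα using this
  refine ⟨I, α, fun i => (hα i).symm, fun i j κ h => hc (Subtype.ext ?_)⟩
  rw [← hI, ← hI, QuotientGroup.eq, h]
  exact ⟨κ⁻¹, by simp⟩

end Ord
end

section
open Matrix MeasureTheory
open NumberField NumberField.Units
open scoped nonZeroDivisors

namespace CD
variable {K : Type*} [Field K] [NumberField K] (C : CD K)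

lemma θ_int : IsIntegral ℤ C.θ := by
  refine ⟨Polynomial.X^3 + Polynomial.C C.a * Polynomial.X^2 + Polynomial.C C.b * Polynomial.X - Polynomial.C (C.d^2), ?_, ?_⟩
  · monicity!
  · simp only [Polynomial.eval₂_add, Polynomial.eval₂_sub, Polynomial.eval₂_mul, Polynomial.eval₂_pow, Polynomial.eval₂_X, Polynomial.eval₂_C]
    rw [← C.hθ]; simp

lemma R_int {x : K} (h : x ∈ C.R) : IsIntegral ℤ x := by
  have : C.R ≤ integralClosure ℤ K := Algebra.adjoin_le (by
    intro y hy; rw [Set.mem_singleton_iff] at hy; rw [hy]; exact C.θ_int)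
  exact this h

lemma exists_den (x : K) : ∃ m : ℕ, m ≠ 0 ∧ (m : K) * x ∈ C.R := by
  obtain ⟨c0, c1, c2, rfl⟩ := C.span x
  refine ⟨c0.den * c1.den * c2.den, by simp, C.mem_R.2 ⟨c0.num * c1.den * c2.den, c0.den * c1.num * c2.den, c0.den * c1.den * c2.num, ?_⟩⟩
  have e : ∀ c : ℚ, (c.den : K) * (c : K) = c.num := fun c => by exact_mod_cast congrArg (Rat.cast : ℚ → K) (Rat.den_mul_eq_num c)
  push_cast
  linear_combination (c1.den * c2.den : K) * e c0 + (c0.den * c2.den : K) * C.θ * e c1 + (c0.den * c1.den : K) * C.θ^2 * e c2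

lemma exists_cond : ∃ n : ℕ, n ≠ 0 ∧ ∀ y : 𝓞 K, (n : K) * (y : K) ∈ C.R := by
  let b := RingOfIntegers.basis K
  choose m hm0 hm using fun i => C.exists_den ((b i : 𝓞 K) : K)
  refine ⟨∏ i, m i, Finset.prod_ne_zero_iff.2 fun i _ => hm0 i, fun y => ?_⟩
  have hy : (y : K) = ∑ i, (b.repr y i : K) * ((b i : 𝓞 K) : K) := by
    conv_lhs => rw [← b.sum_repr y]
    simp [zsmul_eq_mul]
  rw [hy, Finset.mul_sum]
  refine sum_mem fun i _ => ?_
  obtain ⟨k, hk⟩ : m i ∣ ∏ i, m i := Finset.dvd_prod_of_mem _ (Finset.mem_univ i)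
  rw [hk]
  have : ((m i * k : ℕ) : K) * ((b.repr y i : K) * ((b i : 𝓞 K) : K)) = ((k * b.repr y i : ℤ) : K) * ((m i : K) * ((b i : 𝓞 K) : K)) := by
    push_cast; ring
  rw [this]
  exact mul_mem (intCast_mem _ _) (hm i)

lemma fin_quot (n : ℕ) (hn : n ≠ 0) : Finite (𝓞 K ⧸ Ideal.span {(n : 𝓞 K)}) :=
  Ideal.finiteQuotientOfFreeOfNeBot _ (by
    rw [Ne, Ideal.span_singleton_eq_bot]; exact_mod_cast hn)

variable {C} in
lemma Emb.not_real (E : C.Emb) : ¬ ComplexEmbedding.IsReal E.ρ := by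
  intro h
  have h1 := RingHom.congr_fun h C.θ
  rw [ComplexEmbedding.conjugate_coe_eq, Complex.conj_eq_iff_im] at h1
  exact E.hz h1

variable {C} in
lemma eps_exists (E : C.Emb) (h3 : Module.finrank ℚ K = 3) :
    ∃ ε : K, ε ∈ C.R ∧ ε⁻¹ ∈ C.R ∧ ε ≠ 0 ∧ 0 < E.τ ε ∧ ∀ w : K, w ∈ C.R → w⁻¹ ∈ C.R → ε ≠ w^2 := by
  classical
  obtain ⟨e, he, ⟨u, hu⟩, h0⟩ := unit_sq K h3 E.ρ E.not_real
  obtain ⟨n, hn0, hn⟩ := C.exists_cond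
  haveI := fin_quot (K := K) n hn0
  let RU : (𝓞 K)ˣ → Prop := fun v => ((v : 𝓞 K) : K) ∈ C.R ∧ (((v⁻¹ : (𝓞 K)ˣ) : 𝓞 K) : K) ∈ C.R
  have hR : ∀ x y : 𝓞 K, x - 1 = n * y → (x : K) ∈ C.R := by
    intro x y hxy
    have : (x : K) = 1 + (n : K) * (y : K) := by
      have : x = 1 + n * y := by linear_combination hxy
      rw [this]; simp
    rw [this]; exact add_mem (one_mem _) (hn y)
  have hpow : ∃ k : ℕ, 0 < k ∧ RU (u^k) := by
    let q := Ideal.Quotient.mk (Ideal.span {(n : 𝓞 K)})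
    let U := Units.map q.toMonoidHom u
    haveI : Finite (𝓞 K ⧸ Ideal.span {(n : 𝓞 K)})ˣ := inferInstance
    refine ⟨orderOf U, orderOf_pos _, ?_⟩
    have hm : ∀ v : (𝓞 K)ˣ, Units.map q.toMonoidHom v = 1 → ((v : 𝓞 K) : K) ∈ C.R := by
      intro v hv
      have h1 := congrArg Units.val hv
      have h2 : q (v : 𝓞 K) = q 1 := by rw [map_one]; exact h1
      rw [Ideal.Quotient.eq] at h2
      obtain ⟨y, hy⟩ := Ideal.mem_span_singleton.mp h2
      exact hR _ y hy
    have hU : Units.map q.toMonoidHom (u ^ orderOf U) = 1 := by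
      rw [map_pow]; exact pow_orderOf_eq_one U
    exact ⟨hm _ hU, hm (u ^ orderOf U)⁻¹ (by rw [map_inv, hU, inv_one])⟩
  have e1 : e 1 = 0 := (h0 1).2 (Or.inl rfl)
  have en1 : e (-1) = 0 := (h0 (-1)).2 (Or.inr rfl)
  have epow : ∀ k : ℕ, e (u^k) = k := by
    intro k
    induction k with
    | zero => simpa using e1
    | succ k ih => rw [pow_succ, he, ih, hu]; push_cast; ring
  have hex : ∃ m : ℕ, 0 < m ∧ ∃ v, RU v ∧ e v = m := by
    obtain ⟨k, hk, hk'⟩ := hpow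
    exact ⟨k, hk, u^k, hk', epow k⟩
  obtain ⟨hm, v, hv, hev⟩ := Nat.find_spec hex
  have hmin := fun {m : ℕ} (h : m < Nat.find hex) => Nat.find_min hex h
  have main : ∀ v : (𝓞 K)ˣ, RU v → e v = Nat.find hex → 0 < E.τ ((v : 𝓞 K) : K) →
      ∃ ε : K, ε ∈ C.R ∧ ε⁻¹ ∈ C.R ∧ ε ≠ 0 ∧ 0 < E.τ ε ∧ ∀ w : K, w ∈ C.R → w⁻¹ ∈ C.R → ε ≠ w^2 := by
    intro v hv hev hpos
    have hinv : (((v⁻¹ : (𝓞 K)ˣ) : 𝓞 K) : K) = ((v : 𝓞 K) : K)⁻¹ := by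
      rw [eq_comm, inv_eq_iff_eq_inv, eq_comm]; apply inv_eq_of_mul_eq_one_left
      rw [← map_mul, Units.mul_inv, map_one]
    refine ⟨((v : 𝓞 K) : K), hv.1, hinv ▸ hv.2, Units.coe_ne_zero v, hpos, ?_⟩
    intro w hw hw' hvw
    have hw0 : w ≠ 0 := by
      rintro rfl
      exact Units.coe_ne_zero v (hvw.trans (by simp))
    let W : (𝓞 K)ˣ := ⟨⟨w, C.R_int hw⟩, ⟨w⁻¹, C.R_int hw'⟩, RingOfIntegers.ext (mul_inv_cancel₀ hw0), RingOfIntegers.ext (inv_mul_cancel₀ hw0)⟩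
    have hWv : v = W * W := by
      apply Units.ext
      apply RingOfIntegers.ext
      rw [hvw, pow_two]; rfl
    have : e v = e W + e W := by rw [hWv, he]
    have hp : 0 < e W := by omega
    refine hmin (m := (e W).toNat) (by omega) ⟨by omega, W, ⟨hw, hw'⟩, by omega⟩
  rcases lt_trichotomy (E.τ ((v : 𝓞 K) : K)) 0 with h | h | h
  · refine main (-1 * v) ?_ (by rw [he, en1, zero_add, hev]) ?_
    · constructor
      · have : (((-1 * v : (𝓞 K)ˣ) : 𝓞 K) : K) = - ((v : 𝓞 K) : K) := by simp
        rw [this]; exact neg_mem hv.1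
      · have : ((((-1 * v : (𝓞 K)ˣ)⁻¹ : (𝓞 K)ˣ) : 𝓞 K) : K) = - (((v⁻¹ : (𝓞 K)ˣ) : 𝓞 K) : K) := by
          rw [_root_.mul_inv_rev]; simp
        rw [this]; exact neg_mem hv.2
    · have : (((-1 * v : (𝓞 K)ˣ) : 𝓞 K) : K) = - ((v : 𝓞 K) : K) := by simp
      rw [this, map_neg]; linarith
  · exact absurd ((map_eq_zero _).1 h) (Units.coe_ne_zero v)
  · exact main v hv hev h

variable {C} in
/-- sixteen inequivalent pairs from eight 2-torsion classes -/
theorem sixteen (E : C.Emb) (h3 : Module.finrank ℚ K = 3) (h8 : 8 ≤ Nat.card {c : ClassGroup (𝓞 K) // c^2 = 1}) :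
    ∃ (I : Fin 8 × Bool → Submodule ℤ K) (α : Fin 8 × Bool → K), (∀ i, C.Pr (I i) (α i)) ∧ (∀ i, 0 < E.τ (α i)) ∧
      ∀ i j, Eqv (I i) (α i) (I j) (α j) → i = j := by
  obtain ⟨ε, hε, hε', hε0, hεpos, hns⟩ := eps_exists E h3
  obtain ⟨n, hn0, hn⟩ := C.exists_cond
  haveI := fin_quot (K := K) n hn0
  have hle : C.R ≤ integralClosure ℤ K := fun x hx => C.R_int hx
  letI : Algebra C.R (𝓞 K) := (Subalgebra.inclusion hle).toRingHom.toAlgebra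
  haveI : IsScalarTower C.R (𝓞 K) K := IsScalarTower.of_algebraMap_eq fun x => rfl
  haveI : IsScalarTower ℤ C.R (𝓞 K) := IsScalarTower.of_algebraMap_eq' (Subsingleton.elim _ _)
  haveI : IsFractionRing C.R K := IsFractionRing.of_field _ _ (by
    intro z
    obtain ⟨m, hm0, hm⟩ := C.exists_den z
    refine ⟨⟨_, hm⟩, ⟨(m : K), natCast_mem _ _⟩, ?_⟩
    have : (m : K) ≠ 0 := by exact_mod_cast hm0
    change z = (m * z) / m
    field_simp)
  haveI : FaithfulSMul C.R (𝓞 K) := (faithfulSMul_iff_algebraMap_injective _ _).2 (Subalgebra.inclusion_injective hle)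
  haveI : Module.IsTorsionFree C.R (𝓞 K) := inferInstance
  haveI : Algebra.IsIntegral C.R (𝓞 K) := ⟨fun x => (RingOfIntegers.isIntegral x).tower_top⟩
  obtain ⟨I, α, hI, hinj⟩ := pic_two (R := C.R) (O := 𝓞 K) (K := K) (n : 𝓞 K) (by exact_mod_cast hn0)
    (fun y => ⟨⟨_, hn y⟩, RingOfIntegers.ext (by simp; rfl)⟩) 8 h8
  have hβ : ∀ i, ∃ β : K, β ≠ 0 ∧ 0 < E.τ β ∧ ((I i : FractionalIdeal C.R⁰ K))^2 = FractionalIdeal.spanSingleton C.R⁰ β := by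
    intro i
    have h1 : ((I i : FractionalIdeal C.R⁰ K))^2 = FractionalIdeal.spanSingleton C.R⁰ (α i : K) := by
      rw [← coe_toPrincipalIdeal, ← hI, Units.val_pow_eq_pow_val]
    rcases lt_trichotomy (E.τ (α i : K)) 0 with h | h | h
    · refine ⟨-(α i : K), neg_ne_zero.2 (α i).ne_zero, by rw [map_neg]; linarith, ?_⟩
      rw [h1]
      apply FractionalIdeal.coeToSubmodule_injective
      refine (FractionalIdeal.coe_spanSingleton _ _).trans (Eq.trans ?_ (FractionalIdeal.coe_spanSingleton _ _).symm)
      rw [← Set.neg_singleton, Submodule.span_neg]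
    · exact absurd ((map_eq_zero _).1 h) (α i).ne_zero
    · exact ⟨α i, (α i).ne_zero, h, h1⟩
  choose β hβ0 hβp hβI using hβ
  have hprod : ∀ i, ∀ x ∈ (I i : FractionalIdeal C.R⁰ K), ∀ y ∈ (I i : FractionalIdeal C.R⁰ K), x * y / β i ∈ C.R := by
    intro i x hx y hy
    have h1 : x * y ∈ ((I i : FractionalIdeal C.R⁰ K))^2 := by
      rw [pow_two]; exact FractionalIdeal.mul_mem_mul hx hy
    rw [hβI, FractionalIdeal.mem_spanSingleton] at h1
    obtain ⟨r, hr⟩ := h1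
    rw [← hr, Algebra.smul_def, mul_div_assoc, div_self (hβ0 i), mul_one]
    exact r.2
  have hβmem : ∀ i, β i ∈ (((I i : FractionalIdeal C.R⁰ K) : Submodule C.R K) * ((I i : FractionalIdeal C.R⁰ K) : Submodule C.R K)) := by
    intro i
    rw [← FractionalIdeal.coe_mul, ← pow_two, hβI]
    exact FractionalIdeal.mem_spanSingleton_self _ _
  have hsm : ∀ i, ∀ r ∈ C.R, ∀ x ∈ (I i : FractionalIdeal C.R⁰ K), r * x ∈ (I i : FractionalIdeal C.R⁰ K) := by
    intro i r hr x hx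
    exact Submodule.smul_mem (I i : FractionalIdeal C.R⁰ K).1 (⟨r, hr⟩ : C.R) hx
  let J : Fin 8 × Bool → Submodule ℤ K := fun i => ((I i.1 : FractionalIdeal C.R⁰ K) : Submodule C.R K).restrictScalars ℤ
  have hJ : ∀ i x, x ∈ J i ↔ x ∈ (I i.1 : FractionalIdeal C.R⁰ K) := fun i x => Iff.rfl
  have hJJ : ∀ i, ∀ r ∈ C.R, r * β i.1 ∈ J i * J i := by
    intro i r hr
    have key : ∀ z ∈ (((I i.1 : FractionalIdeal C.R⁰ K) : Submodule C.R K) * ((I i.1 : FractionalIdeal C.R⁰ K) : Submodule C.R K)), r * z ∈ J i * J i := by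
      intro z hz
      induction hz using Submodule.mul_induction_on' with
      | mem_mul_mem x hx y hy =>
        rw [← mul_assoc]
        exact Submodule.mul_mem_mul ((hJ i _).2 (hsm _ r hr x hx)) ((hJ i _).2 hy)
      | add x _ y _ hx hy => rw [mul_add]; exact add_mem hx hy
    exact key _ (hβmem _)
  refine ⟨J, fun i => if i.2 then ε * β i.1 else β i.1, ?_, ?_, ?_⟩
  · rintro ⟨i, s⟩
    refine ⟨?_, fun x hx => hsm i _ C.θ_mem x hx, fun x hx y hy => ?_, ?_⟩
    · cases s <;> simp [hβ0, hε0]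
    · have h1 := hprod i x hx y hy
      cases s
      · simpa using h1
      · have : x * y / (ε * β i) = ε⁻¹ * (x * y / β i) := by
          have := hβ0 i
          field_simp
        simp only [if_true]
        rw [this]; exact mul_mem hε' h1
    · cases s
      · simpa using hJJ (i, false) 1 (one_mem _)
      · simpa using hJJ (i, true) ε hε
  · rintro ⟨i, s⟩
    cases s
    · simpa using hβp i
    · simpa using mul_pos hεpos (hβp i)
  · rintro ⟨i, s⟩ ⟨j, t⟩ ⟨κ, hκ0, hκ, hIJ⟩
    have hij : j = i := by
      refine hinj j i (Units.mk0 κ hκ0) ?_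
      apply Units.ext
      rw [Units.val_mul, coe_toPrincipalIdeal]
      apply FractionalIdeal.ext
      intro x
      rw [FractionalIdeal.mem_singleton_mul]
      constructor
      · intro hx
        refine ⟨κ⁻¹ * x, (hIJ _).2 ?_, ?_⟩
        · rw [mul_inv_cancel_left₀ hκ0]; exact hx
        · rw [Units.val_mk0, mul_inv_cancel_left₀ hκ0]
      · rintro ⟨y, hy, rfl⟩
        exact (hIJ y).1 hy
    subst hij
    have hstab : ∀ μ : K, (∀ x ∈ (I j : FractionalIdeal C.R⁰ K), μ * x ∈ (I j : FractionalIdeal C.R⁰ K)) → μ ∈ C.R := by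
      intro μ hμ
      have key : ∀ z ∈ (((I j : FractionalIdeal C.R⁰ K) : Submodule C.R K) * ((I j : FractionalIdeal C.R⁰ K) : Submodule C.R K)), μ * z / β j ∈ C.R := by
        intro z hz
        induction hz using Submodule.mul_induction_on' with
        | mem_mul_mem x hx y hy =>
          rw [← mul_assoc]
          exact hprod j _ (hμ x hx) y hy
        | add x _ y _ hx hy => rw [mul_add, add_div]; exact add_mem hx hy
      have := key _ (hβmem j)
      rwa [mul_div_assoc, div_self (hβ0 j), mul_one] at this
    have k1 : κ ∈ C.R := hstab κ fun x hx => (hIJ x).1 hx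
    have k2 : κ⁻¹ ∈ C.R := hstab κ⁻¹ fun x hx => (hIJ _).2 (by rw [mul_inv_cancel_left₀ hκ0]; exact hx)
    have hb := hβ0 j
    cases s <;> cases t
    · rfl
    · exfalso
      simp only [if_true] at hκ
      exact hns κ k1 k2 (mul_right_cancel₀ hb (by simpa using hκ))
    · exfalso
      simp only [if_true] at hκ
      refine hns κ⁻¹ k2 (by rwa [inv_inv]) ?_
      have h1 : β j = κ^2 * (ε * β j) := by simpa using hκ
      have h2 : κ^2 * ε = 1 := mul_right_cancel₀ hb (by linear_combination -h1)
      rw [inv_pow]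
      exact eq_inv_of_mul_eq_one_right h2
    · rfl

end CD
end

section
open Matrix MeasureTheory
open NumberField NumberField.Units

/-- the cubic polynomial -/
noncomputable def cubP (a b d : ℤ) : Polynomial ℚ :=
  Polynomial.X^3 + Polynomial.C (a:ℚ) * Polynomial.X^2 + Polynomial.C (b:ℚ) * Polynomial.X - Polynomial.C ((d:ℚ)^2)

lemma cubP_monic (a b d : ℤ) : (cubP a b d).Monic := by unfold cubP; monicity!
lemma cubP_deg (a b d : ℤ) : (cubP a b d).natDegree = 3 := by unfold cubP; compute_degree!

lemma cubP_irr (a b d : ℤ) (ha : a % 4 = 2) (hb : b % 4 = 1) (hd : d % 2 = 1) : Irreducible (cubP a b d) := by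
  refine Polynomial.irreducible_of_degree_le_three_of_not_isRoot (by rw [cubP_deg]; decide) ?_
  intro x hx
  have h1 : x^3 + a * x^2 + b * x - (d:ℚ)^2 = 0 := by
    simpa [cubP, Polynomial.IsRoot.def] using hx
  have hIntg : IsIntegral ℤ x := by
    refine ⟨Polynomial.X^3 + Polynomial.C a * Polynomial.X^2 + Polynomial.C b * Polynomial.X - Polynomial.C (d^2), by monicity!, ?_⟩
    simp only [Polynomial.eval₂_add, Polynomial.eval₂_sub, Polynomial.eval₂_mul, Polynomial.eval₂_pow, Polynomial.eval₂_X, Polynomial.eval₂_C]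
    rw [← h1]; simp
  obtain ⟨m, rfl⟩ := IsIntegrallyClosed.isIntegral_iff.1 hIntg
  have h2 : m^3 + a * m^2 + b * m - d^2 = 0 := by
    have h1' : (m:ℚ)^3 + a * (m:ℚ)^2 + b * (m:ℚ) - (d:ℚ)^2 = 0 := h1
    exact_mod_cast h1'
  obtain ⟨A, rfl⟩ : ∃ A, a = 2*A := ⟨a / 2, by omega⟩
  obtain ⟨B, rfl⟩ : ∃ B, b = 2*B+1 := ⟨b / 2, by omega⟩
  obtain ⟨D, rfl⟩ : ∃ D, d = 2*D+1 := ⟨d / 2, by omega⟩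
  obtain ⟨k, hk⟩ := Int.even_mul_succ_self m
  obtain ⟨k', hk'⟩ := Int.even_mul_succ_self (m^2)
  have : 2 * (m * k - k + m - k' + k' + A * m^2 + B * m - 2*D^2 - 2*D) = 1 := by
    linear_combination h2 - (m-1) * hk
  omega

lemma real_root (a b d : ℤ) (X : ℝ) (hX : 0 < X) (ha : 0 ≤ (a:ℝ) ∧ (a:ℝ) ≤ X^2) (hb : 0 ≤ (b:ℝ) ∧ (b:ℝ) ≤ X^4) (hd : X^3 ≤ d) :
    ∃ (r : ℝ) (z : ℂ), Vieta a b d (sv r z) ∧ z.im ≠ 0 ∧ r^3 + a * r^2 + b * r - d^2 = 0 ∧ z^3 + a * z^2 + b * z - d^2 = 0 := by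
  have hd0 : 0 < (d:ℝ) := lt_of_lt_of_le (by positivity) hd
  obtain ⟨r, ⟨h1, h2⟩, hr⟩ : ∃ r ∈ Set.Icc ((a:ℝ)/3) ((d:ℝ)^2 + 1 + a/3), r^3 + a * r^2 + b * r - d^2 = (0:ℝ) := by
    apply intermediate_value_Icc (f := fun r : ℝ => r^3 + a * r^2 + b * r - (d:ℝ)^2) (by nlinarith) (by fun_prop)
    have hX6 : X^6 ≤ (d:ℝ)^2 := by
      have := pow_le_pow_left₀ (by positivity) hd 2
      nlinarith
    have e1 : (a:ℝ)^3 ≤ X^6 := by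
      have := pow_le_pow_left₀ ha.1 ha.2 3
      nlinarith
    have e2 : (a:ℝ) * b ≤ X^6 := by
      have := mul_le_mul ha.2 hb.2 hb.1 (by positivity)
      nlinarith
    have : 0 < X^6 := by positivity
    constructor
    · nlinarith
    · have h0 : 0 ≤ (a:ℝ)/3 := by linarith [ha.1]
      set t := (d:ℝ)^2 + 1 + a/3 with htdef
      have ht : 1 ≤ t := by rw [htdef]; nlinarith [sq_nonneg (d:ℝ)]
      have ht1 : (d:ℝ)^2 ≤ t := by rw [htdef]; linarith
      have : t ≤ t^3 := by nlinarith [sq_nonneg t]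
      have : 0 ≤ (a:ℝ) * t^2 := mul_nonneg ha.1 (sq_nonneg _)
      have : 0 ≤ (b:ℝ) * t := mul_nonneg hb.1 (by linarith)
      linarith
  have hr3 : (a:ℝ)/3 < r := by
    rcases h1.lt_or_eq with h | h
    · exact h
    · exfalso
      have hX6 : X^6 ≤ (d:ℝ)^2 := by
        have := pow_le_pow_left₀ (by positivity) hd 2
        nlinarith
      have e1 : (a:ℝ)^3 ≤ X^6 := by
        have := pow_le_pow_left₀ ha.1 ha.2 3
        nlinarith
      have e2 : (a:ℝ) * b ≤ X^6 := by
        have := mul_le_mul ha.2 hb.2 hb.1 (by positivity)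
        nlinarith
      have : 0 < X^6 := by positivity
      rw [← h] at hr
      nlinarith
  have hr0 : 0 < r := lt_of_le_of_lt (by linarith [ha.1]) hr3
  have hD : 0 < 4 * (b + a * r + r^2) - (a + r)^2 := by nlinarith [ha.1, hb.1]
  set D := 4 * (b + a * r + r^2) - (a + r)^2
  set z : ℂ := ⟨-(a+r)/2, Real.sqrt D / 2⟩
  have hs : Real.sqrt D ^ 2 = D := Real.sq_sqrt hD.le
  have hzc1 : z + (starRingEnd ℂ) z = -((a:ℂ) + r) := by
    apply Complex.ext <;> simp [z]
  have hzc2 : z * (starRingEnd ℂ) z = (b:ℂ) + a * r + r^2 := by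
    rw [Complex.mul_conj, Complex.normSq_apply]
    have : (b:ℂ) + a * r + r^2 = ((b + a * r + r^2 : ℝ) : ℂ) := by push_cast; ring
    rw [this]
    congr 1
    simp only [z, D] at hs ⊢
    nlinarith
  have hrC : (r:ℂ)^3 + a * r^2 + b * r - d^2 = 0 := by exact_mod_cast congrArg (Complex.ofReal) hr
  refine ⟨r, z, ?_, ?_, hr, ?_⟩
  · refine ⟨?_, ?_, ?_⟩
    · simp [sv]; linear_combination hzc1
    · simp [sv]; linear_combination -(r:ℂ) * hzc1 - hzc2
    · simp [sv]; linear_combination -(r:ℂ) * hzc2 - hrC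
  · simp [z, (Real.sqrt_pos.2 hD).ne']
  · have : z^2 = -((a:ℂ) + r) * z - ((b:ℂ) + a * r + r^2) := by rw [← hzc1, ← hzc2]; ring
    linear_combination (z - r) * this + hrC

theorem field_exists (a b d : ℤ) (X : ℝ) (hX : 0 < X) (ha : 0 ≤ (a:ℝ) ∧ (a:ℝ) ≤ X^2) (hb : 0 ≤ (b:ℝ) ∧ (b:ℝ) ≤ X^4) (hd : X^3 ≤ d)
    (ha4 : a % 4 = 2) (hb4 : b % 4 = 1) (hd2 : d % 2 = 1) :
    ∃ (K : IntermediateField ℚ ℂ) (_ : NumberField K) (C : CD K) (_ : C.Emb), Module.finrank ℚ K = 3 ∧ C.a = a ∧ C.b = b ∧ C.d = d := by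
  obtain ⟨r, z, hV, hz, hr, hzr⟩ := real_root a b d X hX ha hb hd
  have hirr := cubP_irr a b d ha4 hb4 hd2
  have hrC : Polynomial.aeval (r:ℂ) (cubP a b d) = 0 := by
    have : (r:ℂ)^3 + a * r^2 + b * r - d^2 = 0 := by exact_mod_cast congrArg (Complex.ofReal) hr
    simpa [cubP] using this
  have hIntg : IsIntegral ℚ (r:ℂ) := ⟨cubP a b d, cubP_monic a b d, hrC⟩
  have hmin : minpoly ℚ (r:ℂ) = cubP a b d := (minpoly.eq_of_irreducible_of_monic hirr hrC (cubP_monic a b d)).symm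
  let K := IntermediateField.adjoin ℚ {(r:ℂ)}
  let pb : PowerBasis ℚ K := IntermediateField.adjoin.powerBasis hIntg
  have hdim : pb.dim = 3 := by
    rw [IntermediateField.adjoin.powerBasis_dim, hmin, cubP_deg]
  have hfr : Module.finrank ℚ K = 3 := by rw [pb.finrank, hdim]
  haveI : FiniteDimensional ℚ K := pb.finite
  haveI : NumberField K := ⟨⟩
  have hgenmin : minpoly ℚ pb.gen = cubP a b d := by
    rw [← hmin, IntermediateField.adjoin.powerBasis_gen]
    exact IntermediateField.minpoly_gen ℚ (r:ℂ)
  let B : Module.Basis (Fin 3) ℚ K := pb.basis.reindex (finCongr hdim)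
  have hB : ∀ i, B i = pb.gen ^ (i : ℕ) := by
    intro i; simp [B, Module.Basis.reindex_apply, pb.basis_eq_pow]
  let φ : K →+ ℚ := (B.coord 2).toAddMonoidHom
  have hφ : ∀ i, φ (pb.gen ^ (i : Fin 3).1) = if i = 2 then 1 else 0 := by
    intro i
    rw [← hB i]
    change B.repr (B i) 2 = _
    rw [B.repr_self, Finsupp.single_apply]
  have hgen : pb.gen^3 + (a:K) * pb.gen^2 + (b:K) * pb.gen - (d:K)^2 = 0 := by
    have := minpoly.aeval ℚ pb.gen
    rw [hgenmin] at this
    simpa [cubP] using this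
  let C : CD K := ⟨a, b, d, pb.gen, φ, hgen, by simpa using hφ 0, by simpa using hφ 1, by simpa using hφ 2, by
    intro x
    refine ⟨B.repr x 0, B.repr x 1, B.repr x 2, ?_⟩
    conv_lhs => rw [← B.sum_repr x]
    rw [Fin.sum_univ_three, hB, hB, hB]
    simp [Rat.smul_def], by rintro rfl; simp at hd2⟩
  have hτ : Polynomial.aeval r (minpoly ℚ pb.gen) = 0 := by
    rw [hgenmin]; simpa [cubP] using hr
  have hρ : Polynomial.aeval z (minpoly ℚ pb.gen) = 0 := by
    rw [hgenmin]; simpa [cubP] using hzr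
  have e1 : pb.lift r hτ pb.gen = r := pb.lift_gen _ _
  have e2 : pb.lift z hρ pb.gen = z := pb.lift_gen _ _
  let E : C.Emb := ⟨(pb.lift r hτ : K →+* ℝ), (pb.lift z hρ : K →+* ℂ), by
      change Vieta a b d (sv (pb.lift r hτ pb.gen) (pb.lift z hρ pb.gen))
      rw [e1, e2]; exact hV, by
      change (pb.lift z hρ pb.gen).im ≠ 0
      rw [e2]; exact hz⟩
  exact ⟨K, inferInstance, C, E, hfr, rfl, rfl, rfl⟩

/-- any complex root of the cubic is small -/
lemma root_small (a b d : ℤ) (X : ℝ) (hX : 0 < X) (ha : 0 ≤ (a:ℝ) ∧ (a:ℝ) ≤ X^2) (hb : 0 ≤ (b:ℝ) ∧ (b:ℝ) ≤ X^4)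
    (hd : X^3 ≤ d ∧ d ≤ 2 * X^3) (w : ℂ) (hw : w^3 + a * w^2 + b * w - d^2 = 0) : ‖w‖ ≤ 3 * X^2 := by
  by_contra! h
  have h1 : w^3 = d^2 - (a * w^2 + b * w) := by linear_combination hw
  have h2 : ‖w‖^3 ≤ (d:ℝ)^2 + (a * ‖w‖^2 + b * ‖w‖) := by
    rw [← norm_pow, h1]
    refine (norm_sub_le _ _).trans (add_le_add ?_ ((norm_add_le _ _).trans (add_le_add ?_ ?_)))
    · simp
    · simp [abs_of_nonneg ha.1]
    · simp [abs_of_nonneg hb.1]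
  have h3 : (d:ℝ)^2 ≤ 4 * X^6 := by
    have := pow_le_pow_left₀ (le_trans (by positivity) hd.1) hd.2 2
    nlinarith
  set t := ‖w‖
  set Z := X^2
  have hZ : 0 < Z := by positivity
  have e6 : X^6 = Z^3 := by simp only [Z]; ring
  have e4 : X^4 = Z^2 := by simp only [Z]; ring
  rw [e6] at h3; rw [e4] at hb
  have e1 : a * t^2 ≤ Z * t^2 := mul_le_mul_of_nonneg_right ha.2 (sq_nonneg _)
  have e2 : b * t ≤ Z^2 * t := mul_le_mul_of_nonneg_right hb.2 (norm_nonneg _)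
  obtain ⟨s, hs, ht⟩ : ∃ s, 0 < s ∧ t = 3 * Z + s := ⟨t - 3 * Z, by linarith, by ring⟩
  rw [ht] at h2 e1 e2
  have : 0 < Z^3 := by positivity
  have : 0 < Z^2*s := by positivity
  have : 0 < Z*s^2 := by positivity
  have : 0 < s^3 := by positivity
  nlinarith
end

section
open Matrix MeasureTheory
open NumberField NumberField.Units

lemma cubic_eq {K : Type*} [Field K] [NumberField K] (h3 : Module.finrank ℚ K = 3) (g : 𝓞 K) :
    ∃ p q s : ℤ, g^3 + p * g^2 + q * g + s = 0 := by
  let P := (Algebra.lmul ℤ (𝓞 K) g).charpoly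
  have hm : P.Monic := LinearMap.charpoly_monic _
  have hd : P.natDegree = 3 := by
    rw [LinearMap.charpoly_natDegree, RingOfIntegers.rank, h3]
  have h0 : Polynomial.aeval g P = 0 := by
    have h1 := LinearMap.aeval_self_charpoly (Algebra.lmul ℤ (𝓞 K) g)
    rw [Polynomial.aeval_algHom_apply] at h1
    have h2 := LinearMap.congr_fun h1 1
    rw [LinearMap.zero_apply] at h2
    exact (mul_one _).symm.trans h2
  refine ⟨P.coeff 2, P.coeff 1, P.coeff 0, ?_⟩
  rw [Polynomial.aeval_eq_sum_range, hd, Finset.sum_range_succ, Finset.sum_range_succ, Finset.sum_range_succ, Finset.sum_range_succ, Finset.sum_range_zero] at h0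
  have h3' : P.coeff 3 = 1 := by rw [← hd]; exact hm
  rw [h3'] at h0
  simp [zsmul_eq_mul] at h0
  linear_combination h0

lemma sq_case {K : Type*} [Field K] [NumberField K] (C : CD K) (h3 : Module.finrank ℚ K = 3) (g : K) (hg : C.θ = g^2) :
    ∃ p q s : ℤ, C.a = 2*q - p^2 ∧ C.b = q^2 - 2*p*s ∧ C.d^2 = s^2 := by
  have hgi : IsIntegral ℤ g := IsIntegral.of_pow (n := 2) (by norm_num) (by rw [← hg]; exact C.θ_int)
  obtain ⟨γ, hγ⟩ : ∃ γ : 𝓞 K, algebraMap (𝓞 K) K γ = g := ⟨⟨g, hgi⟩, rfl⟩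
  obtain ⟨p, q, s, h⟩ := cubic_eq h3 γ
  have hK : g^3 + p * g^2 + q * g + s = 0 := by
    have := congrArg (algebraMap (𝓞 K) K) h
    rw [map_add, map_add, map_add, map_mul, map_mul, map_pow, map_pow, map_intCast, map_intCast, map_intCast, map_zero, hγ] at this
    exact this
  have e : (((s^2 - C.d^2 : ℤ) : ℚ):K) + (((C.b - q^2 + 2*p*s : ℤ) : ℚ) : K) * C.θ + (((C.a - 2 * q + p^2 : ℤ) : ℚ) : K) * C.θ^2 = 0 := by
    have hθ := C.hθ
    rw [hg] at hθ ⊢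
    push_cast
    linear_combination hθ - (g^3 + q * g - p * g^2 - s) * hK
  obtain ⟨h1, h2, h3⟩ := C.coef_zero _ _ _ e
  refine ⟨p, q, s, ?_, ?_, ?_⟩
  · have : C.a - 2 * q + p^2 = 0 := by exact_mod_cast h3
    linarith
  · have : C.b - q^2 + 2*p*s = 0 := by exact_mod_cast h2
    linarith
  · have : s^2 - C.d^2 = 0 := by exact_mod_cast h1
    linarith

lemma card_icc_le (x : ℝ) (hx : 1 ≤ x) : ((Finset.Icc (-⌊x⌋) ⌊x⌋).card : ℝ) ≤ 3 * x := by
  have h0 : 0 ≤ ⌊x⌋ := Int.floor_nonneg.2 (by linarith)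
  rw [Int.card_Icc]
  have : (((⌊x⌋ + 1 - (-⌊x⌋)).toNat : ℤ) : ℝ) = 2 * ⌊x⌋ + 1 := by
    rw [Int.toNat_of_nonneg (by omega)]; push_cast; ring
  have h2 : (((⌊x⌋ + 1 - (-⌊x⌋)).toNat : ℕ) : ℝ) = 2 * ⌊x⌋ + 1 := by exact_mod_cast this
  rw [h2]
  linarith [Int.floor_le x]

lemma mem_icc_floor {n : ℤ} {x : ℝ} (h : |(n:ℝ)| ≤ x) : n ∈ Finset.Icc (-⌊x⌋) ⌊x⌋ := by
  rw [Finset.mem_Icc]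
  obtain ⟨h1, h2⟩ := abs_le.1 h
  refine ⟨?_, Int.le_floor.2 h2⟩
  rw [neg_le]; exact Int.le_floor.2 (by push_cast; linarith)

/-- box conditions -/
def Box (X : ℝ) (t : ℤ × ℤ × ℤ) : Prop :=
  (0 ≤ (t.1:ℝ) ∧ (t.1:ℝ) ≤ X^2) ∧ (0 ≤ (t.2.1:ℝ) ∧ (t.2.1:ℝ) ≤ X^4) ∧ (X^3 ≤ (t.2.2:ℝ) ∧ (t.2.2:ℝ) ≤ 2 * X^3)

lemma sq_count (X : ℝ) (hX : 1 ≤ X) (T : Finset (ℤ × ℤ × ℤ)) (hB : ∀ t ∈ T, Box X t)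
    (hs : ∀ t ∈ T, ∃ p q s : ℤ, t.1 = 2*q - p^2 ∧ t.2.1 = q^2 - 2*p*s ∧ t.2.2^2 = s^2) :
    (T.card : ℝ) ≤ 1000 * X^6 := by
  classical
  let S := Finset.Icc (-⌊3*X⌋) ⌊3*X⌋ ×ˢ Finset.Icc (-⌊5*X^2⌋) ⌊5*X^2⌋ ×ˢ Finset.Icc (-⌊2*X^3⌋) ⌊2*X^3⌋
  have hsub : T ⊆ S.image (fun u : ℤ × ℤ × ℤ => (2*u.2.1 - u.1^2, u.2.1^2 - 2*u.1*u.2.2, |u.2.2|)) := by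
    rintro ⟨a, b, d⟩ ht
    obtain ⟨⟨ha0, ha⟩, ⟨hb0, hb⟩, hd0, hd⟩ := hB _ ht
    obtain ⟨p, q, s, e1, e2, e3⟩ := hs _ ht
    simp only at ha0 ha hb0 hb hd0 hd e1 e2 e3
    have hdpos : 0 ≤ (d:ℝ) := le_trans (by positivity) hd0
    have hds : |s| = d := by
      have : |d| = |s| := sq_eq_sq_iff_abs_eq_abs _ _ |>.1 e3
      rw [← this, abs_of_nonneg]; exact_mod_cast hdpos
    have hs' : |(s:ℝ)| = d := by exact_mod_cast congrArg (Int.cast : ℤ → ℝ) hds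
    have e1' : (a:ℝ) = 2 * q - p^2 := by exact_mod_cast e1
    have e2' : (b:ℝ) = q^2 - 2*p*s := by exact_mod_cast e2
    have hp : |(p:ℝ)| ≤ 3 * X := by
      by_contra! h
      set P := |(p:ℝ)|
      have hP2 : P^2 = (p:ℝ)^2 := sq_abs _
      have hps : (p:ℝ) * s ≤ P * (2 * X^3) := by
        calc (p:ℝ) * s ≤ |(p:ℝ) * s| := le_abs_self _
          _ = P * |(s:ℝ)| := abs_mul _ _
          _ ≤ P * (2 * X^3) := by rw [hs']; exact mul_le_mul_of_nonneg_left hd (abs_nonneg _)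
      have hq : (q:ℝ) = (a + P^2)/2 := by rw [hP2]; linarith
      have h1 : (P^2)^2 ≤ (2 * q)^2 := by
        apply pow_le_pow_left₀ (sq_nonneg _); rw [hq]; linarith
      have h2 : P^4 ≤ 4 * X^4 + 16 * P * X^3 := by nlinarith
      obtain ⟨u, hu, hPu⟩ : ∃ u, 0 < u ∧ P = 3 * X + u := ⟨P - 3*X, by linarith, by ring⟩
      rw [hPu] at h2
      have hX0 : 0 < X := by linarith
      have : 0 < X^4 := by positivity
      have : 0 < X^3*u := by positivity
      have : 0 < X^2*u^2 := by positivity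
      have : 0 < X*u^3 := by positivity
      have : 0 < u^4 := by positivity
      nlinarith
    have hp2 : (p:ℝ)^2 ≤ 9 * X^2 := by
      rw [← sq_abs]; nlinarith [abs_nonneg (p:ℝ)]
    rw [Finset.mem_image]
    refine ⟨(p, q, s), ?_, ?_⟩
    · simp only [S, Finset.mem_product]
      refine ⟨mem_icc_floor hp, mem_icc_floor ?_, mem_icc_floor ?_⟩
      · rw [abs_le]; constructor <;> nlinarith [sq_nonneg (p:ℝ), sq_nonneg X]
      · rw [hs']; exact hd
    · simp only; rw [← e1, ← e2, hds]
  have hX2 : 1 ≤ X^2 := one_le_pow₀ hX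
  have hX3 : 1 ≤ X^3 := one_le_pow₀ hX
  have c1 := card_icc_le (3*X) (by linarith)
  have c2 := card_icc_le (5*X^2) (by linarith)
  have c3 := card_icc_le (2*X^3) (by linarith)
  calc (T.card : ℝ) ≤ S.card := by exact_mod_cast (Finset.card_le_card hsub).trans Finset.card_image_le
    _ = ((Finset.Icc (-⌊3*X⌋) ⌊3*X⌋).card : ℝ) * (((Finset.Icc (-⌊5*X^2⌋) ⌊5*X^2⌋).card : ℝ) * ((Finset.Icc (-⌊2*X^3⌋) ⌊2*X^3⌋).card : ℝ)) := by
        simp only [S, Finset.card_product]; push_cast; ring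
    _ ≤ (3 * (3*X)) * ((3 * (5*X^2)) * (3 * (2*X^3))) := by gcongr
    _ ≤ 1000 * X^6 := by nlinarith [pow_pos (by linarith : 0 < X) 6]

lemma repr_bound (K : Type*) [Field K] [NumberField K] : ∃ c : ℝ, ∀ (α : 𝓞 K) (i), |(((RingOfIntegers.basis K).repr α i : ℤ) : ℝ)| ≤ c * house (α : K) := by
  classical
  have : ∃ c : ℝ, ∀ (α : 𝓞 K) (i : K →+* ℂ), ‖(((integralBasis K).reindex (equivReindex K).symm).repr α i : ℂ)‖ ≤ c * house (algebraMap (𝓞 K) K α) :=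
    ⟨_, fun α i => house.basis_repr_norm_le_const_mul_house K α i⟩
  obtain ⟨c, hc⟩ := this
  refine ⟨c, fun α i => ?_⟩
  have := hc α ((equivReindex K).symm i)
  rw [Module.Basis.repr_reindex_apply, Equiv.symm_symm, Equiv.apply_symm_apply, integralBasis_repr_apply] at this
  simpa using this

/-- few cubics generate a given field -/
lemma field_count (K : Type*) [Field K] [NumberField K] : ∃ M : ℝ, ∀ X : ℝ, 1 ≤ X → ∀ T : Finset (ℤ × ℤ × ℤ), (∀ t ∈ T, Box X t) →
    (∀ t ∈ T, ∃ C : CD K, C.a = t.1 ∧ C.b = t.2.1 ∧ C.d = t.2.2) → Module.finrank ℚ K = 3 → (T.card : ℝ) ≤ M * X^6 := by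
  classical
  obtain ⟨c, hc⟩ := repr_bound K
  set c' : ℝ := max c 1
  refine ⟨(9 * c')^3, fun X hX T hB hC h3 => ?_⟩
  have hX2 : 1 ≤ X^2 := one_le_pow₀ hX
  have hc1 : 1 ≤ c' := le_max_right _ _
  have hcX : 1 ≤ 3 * c' * X^2 := by nlinarith
  rcases T.eq_empty_or_nonempty with rfl | ⟨t0, ht0⟩
  · simp; positivity
  have : Nonempty (CD K) := ⟨(hC t0 ht0).choose⟩
  choose! C h1 h2 h4 using hC
  let ι := Module.Free.ChooseBasisIndex ℤ (𝓞 K)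
  let v : (ℤ × ℤ × ℤ) → (ι → ℤ) := fun t i => (RingOfIntegers.basis K).repr ⟨(C t).θ, (C t).θ_int⟩ i
  let S : Finset (ι → ℤ) := Fintype.piFinset fun _ => Finset.Icc (-⌊3 * c' * X^2⌋) ⌊3 * c' * X^2⌋
  have hmem : ∀ t ∈ T, v t ∈ S := by
    intro t ht
    rw [Fintype.mem_piFinset]
    intro i
    apply mem_icc_floor
    refine (hc _ i).trans ?_
    have hh : house ((C t).θ) ≤ 3 * X^2 := by
      rw [house, pi_norm_le_iff_of_nonneg (by positivity)]
      intro φ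
      obtain ⟨b1, b2, b3⟩ := hB t ht
      refine root_small t.1 t.2.1 t.2.2 X (by linarith) b1 b2 b3 _ ?_
      have := congrArg φ (C t).hθ
      rw [h1 t ht, h2 t ht, h4 t ht] at this
      simpa using this
    calc c * house ((C t).θ) ≤ c' * house ((C t).θ) := mul_le_mul_of_nonneg_right (le_max_left _ _) (house_nonneg _)
      _ ≤ c' * (3 * X^2) := by gcongr
      _ = 3 * c' * X^2 := by ring
  have hinj : Set.InjOn v T := by
    intro t ht u hu h
    have e1 : (RingOfIntegers.basis K).repr ⟨(C t).θ, (C t).θ_int⟩ = (RingOfIntegers.basis K).repr ⟨(C u).θ, (C u).θ_int⟩ := by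
      ext i; exact congrFun h i
    have e2 := (RingOfIntegers.basis K).repr.injective e1
    have e3 : (C t).θ = (C u).θ := congrArg (algebraMap (𝓞 K) K) e2
    have e : (((u.2.2^2 - t.2.2^2 : ℤ) : ℚ):K) + (((t.2.1 - u.2.1 : ℤ) : ℚ) : K) * (C t).θ + (((t.1 - u.1 : ℤ) : ℚ) : K) * (C t).θ^2 = 0 := by
      have hθ := (C t).hθ
      have hθ2 := (C u).hθ
      rw [← e3, h1 u hu, h2 u hu, h4 u hu] at hθ2
      rw [h1 t ht, h2 t ht, h4 t ht] at hθ
      push_cast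
      linear_combination hθ - hθ2
    obtain ⟨f1, f2, f3⟩ := (C t).coef_zero _ _ _ e
    have g1 : u.2.2^2 - t.2.2^2 = 0 := by exact_mod_cast f1
    have g2 : t.2.1 - u.2.1 = 0 := by exact_mod_cast f2
    have g3 : t.1 - u.1 = 0 := by exact_mod_cast f3
    have p1 : 0 ≤ t.2.2 := by
      have := (hB t ht).2.2.1
      have h0 : (0:ℝ) ≤ t.2.2 := le_trans (by positivity) this
      exact_mod_cast h0
    have p2 : 0 ≤ u.2.2 := by
      have := (hB u hu).2.2.1
      have h0 : (0:ℝ) ≤ u.2.2 := le_trans (by positivity) this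
      exact_mod_cast h0
    have g4 : t.2.2 = u.2.2 := by
      rw [← sq_eq_sq₀ p1 p2]; linarith
    ext
    · linarith
    · linarith
    · exact g4
  have hcard : Fintype.card ι = 3 := by
    rw [← h3, ← RingOfIntegers.rank K]
    exact (Module.finrank_eq_card_chooseBasisIndex ℤ (𝓞 K)).symm
  calc (T.card : ℝ) ≤ S.card := by exact_mod_cast Finset.card_le_card_of_injOn v hmem hinj
    _ = ((Finset.Icc (-⌊3 * c' * X^2⌋) ⌊3 * c' * X^2⌋).card : ℝ)^3 := by
        simp only [S, Fintype.card_piFinset, Finset.prod_const, Finset.card_univ, hcard]; push_cast; ring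
    _ ≤ (3 * (3 * c' * X^2))^3 := by
        gcongr; exact card_icc_le _ hcX
    _ = (9 * c')^3 * X^6 := by ring
end

section
open Matrix MeasureTheory
open NumberField NumberField.Units

def Target : Set (IntermediateField ℚ ℂ) := {K | Module.finrank ℚ K = 3 ∧ discOf K < 0 ∧
        (twoTorsionCard K = 2 ∨ twoTorsionCard K = 4)}

lemma two_pow_card (G : Type*) [CommGroup G] [Finite G] : ∃ n, Nat.card {I : G // I^2 = 1} = 2^n := by
  let H : Subgroup G := (powMonoidHom 2 : G →* G).ker
  have hH : Nat.card {I : G // I^2 = 1} = Nat.card H := rfl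
  have : IsPGroup 2 H := by
    intro g
    exact ⟨1, Subtype.ext g.2⟩
  obtain ⟨n, hn⟩ := (IsPGroup.iff_card (p := 2)).1 this
  exact ⟨n, hH.trans hn⟩

/-- congruence conditions -/
def Fam (t : ℤ × ℤ × ℤ) : Prop := t.1 % 4 = 2 ∧ t.2.1 % 4 = 1 ∧ t.2.2 % 2 = 1

def Bad (X : ℝ) (t : ℤ × ℤ × ℤ) : Prop :=
  ∃ N p, CD.Data (Fin 8 × Bool) X t.1 t.2.1 t.2.2 N p

def SqT (t : ℤ × ℤ × ℤ) : Prop := ∃ p q s : ℤ, t.1 = 2*q - p^2 ∧ t.2.1 = q^2 - 2*p*s ∧ t.2.2^2 = s^2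

theorem dichotomy (X : ℝ) (hX : 0 < X) (t : ℤ × ℤ × ℤ) (hB : Box X t) (hF : Fam t) (hcop : IsCoprime t.2.1 t.2.2) :
    Bad X t ∨ SqT t ∨ ∃ K ∈ Target, ∃ C : CD K, C.a = t.1 ∧ C.b = t.2.1 ∧ C.d = t.2.2 := by
  obtain ⟨a, b, d⟩ := t
  obtain ⟨ha, hb, hd⟩ := hB
  obtain ⟨ha4, hb4, hd2⟩ := hF
  simp only at *
  obtain ⟨K, inst, C, E, h3, rfl, rfl, rfl⟩ := field_exists a b d X hX ha hb hd.1 ha4 hb4 hd2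
  by_cases hsq : ∃ g : K, C.θ = g^2
  · obtain ⟨g, hg⟩ := hsq
    exact Or.inr (Or.inl (sq_case C h3 g hg))
  by_cases h8 : 8 ≤ Nat.card {c : ClassGroup (𝓞 K) // c^2 = 1}
  · left
    obtain ⟨I, α, hP, hpos, hne⟩ := C.sixteen E h3 h8
    exact C.data_exists E hcop X hX ha hb hd I α hP hpos hne
  · right; right
    refine ⟨K, ⟨h3, ?_, ?_⟩, C, rfl, rfl, rfl⟩
    · have hfd : FiniteDimensional ℚ K := inferInstance
      rw [discOf, dif_pos hfd]
      have h1 := (rank_cubic K h3 E.ρ E.not_real).1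
      have h2 := NumberField.sign_discr K
      rw [h1, pow_one] at h2
      exact Int.sign_eq_neg_one_iff_neg.1 h2
    · obtain ⟨c, hc, hc1⟩ := hilbert94 h3 E.τ E.ρ E.not_real C.a C.b C.d C.θ C.hθ C.θ_ne ha4 hb4 hd2 hcop E.τ_pos hsq
      obtain ⟨n, hn⟩ := two_pow_card (ClassGroup (𝓞 K))
      have hgt : 1 < Nat.card {c : ClassGroup (𝓞 K) // c^2 = 1} := by
        rw [Finite.one_lt_card_iff_nontrivial]
        exact ⟨⟨c, hc⟩, ⟨1, one_pow 2⟩, fun h => hc1 (congrArg Subtype.val h)⟩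
      unfold twoTorsionCard
      rw [hn] at hgt h8 ⊢
      have hn3 : n < 3 := by
        by_contra! h
        exact h8 (by calc 8 = 2^3 := by norm_num
              _ ≤ 2^n := Nat.pow_le_pow_right (by norm_num) h)
      interval_cases n
      · simp at hgt
      · left; norm_num
      · right; norm_num
end

section
open Matrix MeasureTheory
open NumberField NumberField.Units

lemma class_card (S : Finset ℤ) (A L : ℝ) (k : ℕ) (hk : 0 < k) (h1 : ∀ x ∈ S, A ≤ (x:ℝ)) (h2 : ∀ x ∈ S, (x:ℝ) ≤ A + L)
    (h3 : ∀ x ∈ S, ∀ y ∈ S, (k:ℤ) ∣ x - y) : S.card ≤ ⌊L/k⌋₊ + 1 := by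
  classical
  rcases S.eq_empty_or_nonempty with rfl | hne
  · simp
  set m := S.min' hne
  have hm : m ∈ S := S.min'_mem hne
  rw [← Finset.card_range (⌊L/k⌋₊ + 1)]
  have hk' : (0:ℝ) < k := by exact_mod_cast hk
  have key : ∀ x ∈ S, ∃ c : ℕ, x = m + k * c := by
    intro x hx
    obtain ⟨c, hc⟩ := h3 x hx m hm
    have hle : m ≤ x := S.min'_le x hx
    have : 0 ≤ c := by
      by_contra! h
      have : (k:ℤ) * c < 0 := mul_neg_of_pos_of_neg (by exact_mod_cast hk) h
      omega
    obtain ⟨e, rfl⟩ := Int.eq_ofNat_of_zero_le this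
    exact ⟨e, by linarith⟩
  choose! c hc using key
  refine Finset.card_le_card_of_injOn c ?_ ?_
  · intro x hx
    rw [Finset.coe_range, Set.mem_Iio, Nat.lt_succ_iff]
    apply Nat.le_floor
    rw [le_div_iff₀ hk']
    have e : (x:ℝ) = m + k * c x := by exact_mod_cast congrArg (Int.cast : ℤ → ℝ) (hc x hx)
    nlinarith [h1 m hm, h2 x hx]
  · intro x hx y hy h
    rw [hc x hx, hc y hy, h]

lemma triple_count (X : ℝ) (hX : 0 ≤ X) (T : Finset (ℤ × ℤ × ℤ)) (hB : ∀ t ∈ T, Box X t) (k1 k2 k3 : ℕ)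
    (hk1 : 0 < k1) (hk2 : 0 < k2) (hk3 : 0 < k3)
    (h3 : ∀ t ∈ T, ∀ u ∈ T, (k3:ℤ) ∣ t.2.2 - u.2.2)
    (h1 : ∀ t ∈ T, ∀ u ∈ T, t.2.2 = u.2.2 → (k1:ℤ) ∣ t.1 - u.1)
    (h2 : ∀ t ∈ T, ∀ u ∈ T, t.2.2 = u.2.2 → t.1 = u.1 → (k2:ℤ) ∣ t.2.1 - u.2.1) :
    (T.card : ℝ) ≤ (X^2/k1 + 1) * (X^4/k2 + 1) * (X^3/k3 + 1) := by
  classical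
  have c3 : (T.image fun t => t.2.2).card ≤ ⌊X^3/k3⌋₊ + 1 := by
    refine class_card _ (X^3) _ k3 hk3 ?_ ?_ ?_
    · intro x hx
      obtain ⟨t, ht, rfl⟩ := Finset.mem_image.1 hx
      exact (hB t ht).2.2.1
    · intro x hx
      obtain ⟨t, ht, rfl⟩ := Finset.mem_image.1 hx
      linarith [(hB t ht).2.2.2]
    · intro x hx y hy
      obtain ⟨t, ht, rfl⟩ := Finset.mem_image.1 hx
      obtain ⟨u, hu, rfl⟩ := Finset.mem_image.1 hy
      exact h3 t ht u hu
  have c1 : (T.image fun t => (t.1, t.2.2)).card ≤ (⌊X^2/k1⌋₊ + 1) * (⌊X^3/k3⌋₊ + 1) := by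
    refine le_trans (Finset.card_le_mul_card_image (f := fun u : ℤ × ℤ => u.2) _ (⌊X^2/k1⌋₊ + 1) ?_) ?_
    · intro e he
      rw [← Finset.card_image_of_injOn (f := fun u : ℤ × ℤ => u.1)]
      · refine class_card _ 0 _ k1 hk1 ?_ ?_ ?_
        · intro x hx
          simp only [Finset.mem_image, Finset.mem_filter] at hx
          obtain ⟨_, ⟨⟨t, ht, rfl⟩, _⟩, rfl⟩ := hx
          exact (hB t ht).1.1
        · intro x hx
          simp only [Finset.mem_image, Finset.mem_filter] at hx
          obtain ⟨_, ⟨⟨t, ht, rfl⟩, _⟩, rfl⟩ := hx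
          rw [zero_add]; exact (hB t ht).1.2
        · intro x hx y hy
          simp only [Finset.mem_image, Finset.mem_filter] at hx hy
          obtain ⟨_, ⟨⟨t, ht, rfl⟩, e1⟩, rfl⟩ := hx
          obtain ⟨_, ⟨⟨u, hu, rfl⟩, e2⟩, rfl⟩ := hy
          exact h1 t ht u hu (e1.trans e2.symm)
      · intro x hx y hy h
        simp only [Finset.coe_filter, Set.mem_setOf_eq] at hx hy
        exact Prod.ext h (hx.2.trans hy.2.symm)
    · rw [Finset.image_image]
      exact Nat.mul_le_mul_left _ c3
  have c2 : T.card ≤ (⌊X^4/k2⌋₊ + 1) * ((⌊X^2/k1⌋₊ + 1) * (⌊X^3/k3⌋₊ + 1)) := by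
    refine le_trans (Finset.card_le_mul_card_image (f := fun t : ℤ × ℤ × ℤ => (t.1, t.2.2)) _ (⌊X^4/k2⌋₊ + 1) ?_) (Nat.mul_le_mul_left _ c1)
    intro e he
    rw [← Finset.card_image_of_injOn (f := fun t : ℤ × ℤ × ℤ => t.2.1)]
    · refine class_card _ 0 _ k2 hk2 ?_ ?_ ?_
      · intro x hx
        simp only [Finset.mem_image, Finset.mem_filter] at hx
        obtain ⟨t, ⟨ht, _⟩, rfl⟩ := hx
        exact (hB t ht).2.1.1
      · intro x hx
        simp only [Finset.mem_image, Finset.mem_filter] at hx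
        obtain ⟨t, ⟨ht, _⟩, rfl⟩ := hx
        rw [zero_add]; exact (hB t ht).2.1.2
      · intro x hx y hy
        simp only [Finset.mem_image, Finset.mem_filter] at hx hy
        obtain ⟨t, ⟨ht, e1⟩, rfl⟩ := hx
        obtain ⟨u, ⟨hu, e2⟩, rfl⟩ := hy
        have := e1.trans e2.symm
        rw [Prod.mk.injEq] at this
        exact h2 t ht u hu this.2 this.1
    · intro x hx y hy h
      simp only [Finset.coe_filter, Set.mem_setOf_eq] at hx hy
      have := hx.2.trans hy.2.symm
      rw [Prod.mk.injEq] at this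
      exact Prod.ext this.1 (Prod.ext h this.2)
  have f1 : ((⌊X^2/k1⌋₊ : ℕ) : ℝ) ≤ X^2/k1 := Nat.floor_le (by positivity)
  have f2 : ((⌊X^4/k2⌋₊ : ℕ) : ℝ) ≤ X^4/k2 := Nat.floor_le (by positivity)
  have f3 : ((⌊X^3/k3⌋₊ : ℕ) : ℝ) ≤ X^3/k3 := Nat.floor_le (by positivity)
  calc (T.card : ℝ) ≤ ((⌊X^4/k2⌋₊ : ℕ) + 1 : ℝ) * (((⌊X^2/k1⌋₊ : ℕ) + 1 : ℝ) * ((⌊X^3/k3⌋₊ : ℕ) + 1 : ℝ)) := by exact_mod_cast c2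
    _ ≤ (X^4/k2 + 1) * ((X^2/k1 + 1) * (X^3/k3 + 1)) := by gcongr
    _ = _ := by ring

lemma sum_sq_le (M : ℕ) : ∑ m ∈ Finset.range M, (1:ℝ)/(2*m+3)^2 ≤ (1/4:ℝ) := by
  have h : ∀ M : ℕ, ∑ m ∈ Finset.range M, (1:ℝ)/(2*m+3)^2 ≤ (1/4:ℝ) * (1 - 1/((M:ℝ)+1)) := by
    intro M
    induction M with
    | zero => simp
    | succ n ih =>
      rw [Finset.sum_range_succ]
      have : (1:ℝ)/(2*n+3)^2 ≤ 1/4 * (1/(n+1) - 1/(n+2)) := by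
        have e : (1:ℝ)/4 * (1/(n+1) - 1/(n+2)) = 1/(4*((n+1)*(n+2))) := by field_simp; ring
        rw [e]
        apply one_div_le_one_div_of_le (by positivity)
        nlinarith
      push_cast
      have e2 : (n:ℝ) + 1 + 1 = n + 2 := by ring
      rw [e2]
      linarith
  refine (h M).trans ?_
  have : (0:ℝ) ≤ 1/(M+1) := by positivity
  linarith

lemma inv_le_mix (X n : ℝ) (hX : 0 < X) (hn : 0 < n) : 1/n ≤ X * (1/n^2) + 1/X := by
  rcases le_or_gt n X with h | h
  · have : 1/n ≤ X * (1/n^2) := by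
      rw [mul_one_div, div_le_div_iff₀ hn (by positivity)]; nlinarith
    have : 0 ≤ 1/X := by positivity
    linarith
  · have : 1/n ≤ 1/X := one_div_le_one_div_of_le hX h.le
    have : 0 ≤ X * (1/n^2) := by positivity
    linarith
end

section
open Matrix MeasureTheory
open NumberField NumberField.Units

lemma dvd_four_mul {n x : ℤ} (hn : Odd n) (h4 : (4:ℤ) ∣ x) (h : n ∣ x) : 4 * n ∣ x := by
  have : IsCoprime (4:ℤ) n := by
    obtain ⟨k, rfl⟩ := hn
    have h2 : IsCoprime (2:ℤ) (2*k+1) := ⟨-k, 1, by ring⟩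
    exact (by norm_num : (4:ℤ) = 2^2) ▸ h2.pow_left
  exact this.mul_dvd h4 h

lemma dvd_two_mul {n x : ℤ} (hn : Odd n) (h2 : (2:ℤ) ∣ x) (h : n ∣ x) : 2 * n ∣ x := by
  have : IsCoprime (2:ℤ) n := by
    obtain ⟨k, rfl⟩ := hn
    exact ⟨-k, 1, by ring⟩
  exact this.mul_dvd h2 h

lemma noncop_count (X : ℝ) (hX : 1 ≤ X) (T : Finset (ℤ × ℤ × ℤ)) (hB : ∀ t ∈ T, Box X t) (hF : ∀ t ∈ T, Fam t)
    (hc : ∀ t ∈ T, ¬ IsCoprime t.2.1 t.2.2) : (T.card : ℝ) ≤ X^9/128 + 10 * X^8 := by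
  classical
  set M := ⌊2 * X^3⌋₊
  have hX0 : 0 < X := by linarith
  have hM : (M:ℝ) ≤ 2 * X^3 := Nat.floor_le (by positivity)
  have hsub : T ⊆ (Finset.range M).biUnion fun m => T.filter fun t => ((2*m+3:ℕ):ℤ) ∣ t.2.1 ∧ ((2*m+3:ℕ):ℤ) ∣ t.2.2 := by
    intro t ht
    have h1 := hc t ht
    obtain ⟨f1, f2, f3⟩ := hF t ht
    rw [Int.isCoprime_iff_gcd_eq_one] at h1
    have g1 : (Int.gcd t.2.1 t.2.2 : ℤ) ∣ t.2.1 := Int.gcd_dvd_left ..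
    have g2 : (Int.gcd t.2.1 t.2.2 : ℤ) ∣ t.2.2 := Int.gcd_dvd_right ..
    set g := Int.gcd t.2.1 t.2.2
    have hdpos : (0:ℝ) < t.2.2 := lt_of_lt_of_le (by positivity) (hB t ht).2.2.1
    have hdpos' : 0 < t.2.2 := by exact_mod_cast hdpos
    have hgle : (g:ℤ) ≤ t.2.2 := Int.le_of_dvd hdpos' g2
    have hg0 : g ≠ 0 := by
      intro h; rw [h] at g2; simp at g2; omega
    have hgo : g % 2 = 1 := by
      by_contra h
      have : (2:ℤ) ∣ g := by omega
      have := this.trans g2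
      omega
    obtain ⟨m, hm⟩ : ∃ m, g = 2*m+3 := ⟨(g-3)/2, by omega⟩
    rw [Finset.mem_biUnion]
    refine ⟨m, ?_, ?_⟩
    · rw [Finset.mem_range]
      apply lt_of_lt_of_le (show m < g by omega)
      apply Nat.le_floor
      have : (g:ℝ) ≤ t.2.2 := by exact_mod_cast hgle
      exact this.trans (hB t ht).2.2.2
    · rw [Finset.mem_filter, ← hm]
      exact ⟨ht, g1, g2⟩
  have hfib : ∀ m ∈ Finset.range M, ((T.filter fun t => ((2*m+3:ℕ):ℤ) ∣ t.2.1 ∧ ((2*m+3:ℕ):ℤ) ∣ t.2.2).card : ℝ) ≤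
      (X^2/4+1) * ((X^7/8 + X^5) * (1/(2*m+3)^2) + X^3 + 1) := by
    intro m _
    set n : ℕ := 2*m+3 with hn
    have hno : Odd (n:ℤ) := ⟨m+1, by rw [hn]; push_cast; ring⟩
    have := triple_count X hX0.le (T.filter fun t => (n:ℤ) ∣ t.2.1 ∧ (n:ℤ) ∣ t.2.2)
      (fun t ht => hB t (Finset.mem_filter.1 ht).1) 4 (4*n) (2*n) (by norm_num) (by omega) (by omega) ?_ ?_ ?_
    · refine this.trans ?_
      have hnr : ((2:ℝ)*m+3) = n := by rw [hn]; push_cast; ring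
      rw [hnr]
      push_cast
      have hnp : (0:ℝ) < n := by rw [hn]; positivity
      have hmix := inv_le_mix X n hX0 hnp
      rw [mul_assoc]
      refine mul_le_mul_of_nonneg_left ?_ (by positivity)
      have e : (X^4/(4*n)+1) * (X^3/(2*n)+1) = X^7/8 * (1/(n:ℝ)^2) + (X^4/4 + X^3/2) * (1/n) + 1 := by
        field_simp; ring
      rw [e]
      have h34 : X^4/4 + X^3/2 ≤ X^4 := by nlinarith [pow_pos hX0 3]
      have h1 : (X^4/4 + X^3/2) * (1/n) ≤ X^4 * (X * (1/(n:ℝ)^2) + 1/X) := by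
        apply mul_le_mul h34 hmix (by positivity) (by positivity)
      have h2 : X^4 * (X * (1/(n:ℝ)^2) + 1/X) = X^5 * (1/(n:ℝ)^2) + X^3 := by field_simp
      rw [h2] at h1
      linarith
    · intro t ht u hu
      simp only [Finset.mem_filter] at ht hu
      have := (hF t ht.1).2.2
      have := (hF u hu.1).2.2
      push_cast
      exact dvd_two_mul hno (by omega) (dvd_sub ht.2.2 hu.2.2)
    · intro t ht u hu _
      simp only [Finset.mem_filter] at ht hu
      have := (hF t ht.1).1
      have := (hF u hu.1).1
      omega
    · intro t ht u hu _ _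
      simp only [Finset.mem_filter] at ht hu
      have := (hF t ht.1).2.1
      have := (hF u hu.1).2.1
      push_cast
      exact dvd_four_mul hno (by omega) (dvd_sub ht.2.1 hu.2.1)
  have h1 : (T.card : ℝ) ≤ ∑ m ∈ Finset.range M, (X^2/4+1) * ((X^7/8 + X^5) * (1/(2*m+3)^2) + X^3 + 1) := by
    refine le_trans ?_ (Finset.sum_le_sum hfib)
    exact_mod_cast (Finset.card_le_card hsub).trans Finset.card_biUnion_le
  have h2 : ∑ m ∈ Finset.range M, (X^2/4+1) * ((X^7/8 + X^5) * (1/(2*(m:ℝ)+3)^2) + X^3 + 1) =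
      (X^2/4+1) * ((X^7/8+X^5) * ∑ m ∈ Finset.range M, (1:ℝ)/(2*m+3)^2 + M * (X^3+1)) := by
    rw [← Finset.mul_sum]
    congr 1
    simp only [add_assoc]
    rw [Finset.sum_add_distrib, ← Finset.mul_sum]
    simp only [Finset.sum_const, Finset.sum_add_distrib, Finset.card_range, nsmul_eq_mul]
  rw [h2] at h1
  refine h1.trans ?_
  have hs := sum_sq_le M
  have h3 : (X^2/4+1) * ((X^7/8+X^5) * ∑ m ∈ Finset.range M, (1:ℝ)/(2*m+3)^2 + M * (X^3+1)) ≤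
     (X^2/4+1) * ((X^7/8+X^5) * (1/4) + (2*X^3) * (X^3+1)) := by gcongr
  refine h3.trans ?_
  obtain ⟨y, hy, rfl⟩ : ∃ y, 0 ≤ y ∧ X = 1 + y := ⟨X-1, by linarith, by ring⟩
  rw [← sub_nonneg]; ring_nf; positivity

def ZC (n r : ℤ) (t : ℤ × ℤ × ℤ) : Prop := 2*n ∣ 3*r^2 + 2*t.1*r + t.2.1 ∧ n^2 ∣ r^3 + t.1*r^2 + t.2.1*r - t.2.2^2

lemma ZC_coprime {n r : ℤ} {t : ℤ × ℤ × ℤ} (h : ZC n r t) (hc : IsCoprime t.2.1 t.2.2) : IsCoprime n r := by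
  rw [Int.isCoprime_iff_gcd_eq_one]
  by_contra hg
  obtain ⟨p, hp, hpd⟩ := Nat.exists_prime_and_dvd hg
  have hpn : (p:ℤ) ∣ n := (Int.natCast_dvd_natCast.2 hpd).trans (Int.gcd_dvd_left ..)
  have hpr : (p:ℤ) ∣ r := (Int.natCast_dvd_natCast.2 hpd).trans (Int.gcd_dvd_right ..)
  have hpp := Nat.prime_iff_prime_int.1 hp
  have h1 : (p:ℤ) ∣ 3*r^2 + 2*t.1*r + t.2.1 := (hpn.mul_left 2).trans h.1
  have h2 : (p:ℤ) ∣ r^3 + t.1*r^2 + t.2.1*r - t.2.2^2 := (dvd_pow hpn two_ne_zero).trans h.2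
  have hb : (p:ℤ) ∣ t.2.1 := by
    have e : t.2.1 = (3*r^2 + 2*t.1*r + t.2.1) - r * (3*r + 2*t.1) := by ring
    rw [e]; exact dvd_sub h1 (hpr.mul_right _)
  have hd : (p:ℤ) ∣ t.2.2^2 := by
    have e : t.2.2^2 = r * (r^2 + t.1*r + t.2.1) - (r^3 + t.1*r^2 + t.2.1*r - t.2.2^2) := by ring
    rw [e]; exact dvd_sub (hpr.mul_right _) h2
  have hd' := hpp.dvd_of_dvd_pow hd
  exact hpp.not_unit (hc.isUnit_of_dvd' hb hd')

lemma red_count (c : ℝ) (hc1 : 1 ≤ c) (X : ℝ) (hX : 1 ≤ X) (Q : Finset ((ℤ × ℤ × ℤ) × ℕ × ℕ)) (hB : ∀ q ∈ Q, Box X q.1) (hF : ∀ q ∈ Q, Fam q.1)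
    (hc : ∀ q ∈ Q, IsCoprime q.1.2.1 q.1.2.2) (hm : ∀ q ∈ Q, (2*q.2.1+3:ℝ) ≤ c * X^2) (hρ : ∀ q ∈ Q, q.2.2 < 2*q.2.1+3)
    (hZ : ∀ q ∈ Q, ZC (2*q.2.1+3) (2*q.2.2+1) q.1) : (Q.card : ℝ) ≤ X^9/128 + (10*c^2+10) * X^8 := by
  classical
  set M := ⌊c * X^2⌋₊
  have hX0 : 0 < X := by linarith
  have hM : (M:ℝ) ≤ c * X^2 := Nat.floor_le (by positivity)
  have hf2 : ∀ m ρ : ℕ, ((Q.filter fun q => q.2.1 = m ∧ q.2.2 = ρ).card : ℝ) ≤ (X^2/(4*(2*m+3)) + 1) * (X^4/(4*(2*m+3)^2) + 1) * (X^3/2+1) := by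
    intro m ρ
    set n : ℕ := 2*m+3 with hn
    have hno : Odd (n:ℤ) := ⟨m+1, by rw [hn]; push_cast; ring⟩
    set r : ℤ := 2*ρ+1
    have hinj : ((Q.filter fun q => q.2.1 = m ∧ q.2.2 = ρ).image Prod.fst).card = (Q.filter fun q => q.2.1 = m ∧ q.2.2 = ρ).card := by
      apply Finset.card_image_of_injOn
      intro x hx y hy h
      simp only [Finset.coe_filter, Set.mem_setOf_eq] at hx hy
      exact Prod.ext h (Prod.ext (hx.2.1.trans hy.2.1.symm) (hx.2.2.trans hy.2.2.symm))
    rw [← hinj]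
    have hmem : ∀ t ∈ (Q.filter fun q => q.2.1 = m ∧ q.2.2 = ρ).image Prod.fst, Box X t ∧ Fam t ∧ IsCoprime t.2.1 t.2.2 ∧ ZC n r t := by
      intro t ht
      simp only [Finset.mem_image, Finset.mem_filter] at ht
      obtain ⟨q, ⟨hq, h1, h2⟩, rfl⟩ := ht
      refine ⟨hB q hq, hF q hq, hc q hq, ?_⟩
      have := hZ q hq
      rw [h1, h2] at this
      rw [hn]; push_cast; exact this
    have hnr : ((2:ℝ)*m+3) = n := by rw [hn]; push_cast; ring
    rw [hnr]
    have := triple_count X hX0.le _ (fun t ht => (hmem t ht).1) (4*n) (4*n^2) 2 (by omega) (by positivity) (by norm_num) ?_ ?_ ?_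
    · push_cast at this; exact this
    · intro t ht u hu
      have := (hmem t ht).2.1.2.2
      have := (hmem u hu).2.1.2.2
      omega
    · intro t ht u hu hd
      have z1 := (hmem t ht).2.2.2
      have z2 := (hmem u hu).2.2.2
      have cop := ZC_coprime z1 (hmem t ht).2.2.1
      have := (hmem t ht).2.1.1
      have := (hmem u hu).2.1.1
      push_cast
      refine dvd_four_mul hno (by omega) ?_
      have key : ∀ v, ZC n r v → (n:ℤ) ∣ 2*r^3 + v.1*r^2 + v.2.2^2 := by
        intro v hv
        have e : 2*r^3 + v.1*r^2 + v.2.2^2 = r * (3*r^2 + 2*v.1*r + v.2.1) - (r^3 + v.1*r^2 + v.2.1*r - v.2.2^2) := by ring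
        rw [e]
        exact dvd_sub (((dvd_mul_left _ _).trans hv.1).mul_left _) ((dvd_pow_self _ two_ne_zero).trans hv.2)
      have h1 := dvd_sub (key t z1) (key u z2)
      have e : 2*r^3 + t.1*r^2 + t.2.2^2 - (2*r^3 + u.1*r^2 + u.2.2^2) = r^2 * (t.1 - u.1) := by rw [hd]; ring
      rw [e] at h1
      exact cop.pow_right.dvd_of_dvd_mul_left h1
    · intro t ht u hu hd ha
      have z1 := (hmem t ht).2.2.2
      have z2 := (hmem u hu).2.2.2
      have cop := ZC_coprime z1 (hmem t ht).2.2.1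
      have := (hmem t ht).2.1.2.1
      have := (hmem u hu).2.1.2.1
      push_cast
      refine dvd_four_mul hno.pow (by omega) ?_
      have h1 := dvd_sub z1.2 z2.2
      have e : r^3 + t.1*r^2 + t.2.1*r - t.2.2^2 - (r^3 + u.1*r^2 + u.2.1*r - u.2.2^2) = r * (t.2.1 - u.2.1) := by rw [hd, ha]; ring
      rw [e] at h1
      exact cop.pow_left.dvd_of_dvd_mul_left h1
  have hsub : Q ⊆ (Finset.range M).biUnion fun m => (Finset.range (2*m+3)).biUnion fun ρ => Q.filter fun q => q.2.1 = m ∧ q.2.2 = ρ := by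
    intro q hq
    simp only [Finset.mem_biUnion, Finset.mem_range, Finset.mem_filter]
    refine ⟨q.2.1, ?_, q.2.2, hρ q hq, hq, rfl, rfl⟩
    apply lt_of_lt_of_le (show q.2.1 < 2*q.2.1+3 by omega)
    apply Nat.le_floor
    push_cast; exact hm q hq
  have h1 : (Q.card : ℝ) ≤ ∑ m ∈ Finset.range M, ∑ ρ ∈ Finset.range (2*m+3), ((X^2/(4*(2*(m:ℝ)+3)) + 1) * (X^4/(4*(2*m+3)^2) + 1) * (X^3/2+1)) := by
    have h0 : Q.card ≤ ∑ m ∈ Finset.range M, ∑ ρ ∈ Finset.range (2*m+3), (Q.filter fun q => q.2.1 = m ∧ q.2.2 = ρ).card :=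
      (Finset.card_le_card hsub).trans (Finset.card_biUnion_le.trans (Finset.sum_le_sum fun m _ => Finset.card_biUnion_le))
    calc (Q.card : ℝ) ≤ ((∑ m ∈ Finset.range M, ∑ ρ ∈ Finset.range (2*m+3), (Q.filter fun q => q.2.1 = m ∧ q.2.2 = ρ).card : ℕ) : ℝ) := by exact_mod_cast h0
      _ = ∑ m ∈ Finset.range M, ∑ ρ ∈ Finset.range (2*m+3), ((Q.filter fun q => q.2.1 = m ∧ q.2.2 = ρ).card : ℝ) := by push_cast; rfl
      _ ≤ _ := Finset.sum_le_sum fun m _ => Finset.sum_le_sum fun ρ _ => hf2 m ρ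
  have h2 : ∀ m ∈ Finset.range M, ∑ ρ ∈ Finset.range (2*m+3), ((X^2/(4*(2*(m:ℝ)+3)) + 1) * (X^4/(4*(2*m+3)^2) + 1) * (X^3/2+1)) ≤
      (X^3/2+1) * ((X^6/16 + X^5/4) * (1/(2*m+3)^2) + (X^3/4 + X^2/4 + 5 * c * X^2)) := by
    intro m hm'
    rw [Finset.sum_const, Finset.card_range, nsmul_eq_mul]
    push_cast
    have hmM : (m:ℝ) ≤ c * X^2 := le_trans (by exact_mod_cast (Finset.mem_range.1 hm').le) hM
    set n : ℝ := 2*(m:ℝ)+3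
    have hnp : (0:ℝ) < n := by positivity
    have hmix := inv_le_mix X n hX0 hnp
    have e : n * ((X^2/(4*n) + 1) * (X^4/(4*n^2) + 1) * (X^3/2+1)) = (X^3/2+1) * (X^6/16*(1/n^2) + X^4/4*(1/n) + X^2/4 + n) := by
      field_simp; ring
    rw [e]
    refine mul_le_mul_of_nonneg_left ?_ (by positivity)
    have h3 : X^4/4*(1/n) ≤ X^4/4 * (X * (1/n^2) + 1/X) := mul_le_mul_of_nonneg_left hmix (by positivity)
    have h4 : X^4/4 * (X * (1/n^2) + 1/X) = X^5/4*(1/n^2) + X^3/4 := by field_simp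
    have h5 : n ≤ 5 * c * X^2 := by
      have : 1 ≤ c * X^2 := by nlinarith [one_le_pow₀ hX (n := 2)]
      simp only [n]; linarith
    linarith
  have h3 : ∑ m ∈ Finset.range M, (X^3/2+1) * ((X^6/16 + X^5/4) * (1/(2*(m:ℝ)+3)^2) + (X^3/4 + X^2/4 + 5 * c * X^2)) =
      (X^3/2+1) * ((X^6/16 + X^5/4) * ∑ m ∈ Finset.range M, (1:ℝ)/(2*m+3)^2 + M * (X^3/4 + X^2/4 + 5 * c * X^2)) := by
    rw [← Finset.mul_sum]
    congr 1
    rw [Finset.sum_add_distrib, ← Finset.mul_sum]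
    simp only [Finset.sum_const, Finset.sum_add_distrib, Finset.card_range, nsmul_eq_mul]
  have hs := sum_sq_le M
  have h4 : (Q.card : ℝ) ≤ (X^3/2+1) * ((X^6/16 + X^5/4) * (1/4) + (c*X^2) * (X^3/4 + X^2/4 + 5 * c * X^2)) := by
    refine h1.trans ((Finset.sum_le_sum h2).trans ?_)
    rw [h3]; gcongr
  refine h4.trans ?_
  obtain ⟨y, hy, rfl⟩ : ∃ y, 0 ≤ y ∧ X = 1 + y := ⟨X-1, by linarith, by ring⟩
  obtain ⟨z, hz, rfl⟩ : ∃ z, 0 ≤ z ∧ c = 1 + z := ⟨c-1, by linarith, by ring⟩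
  rw [← sub_nonneg]; ring_nf; positivity
end

section
open Matrix MeasureTheory
open NumberField NumberField.Units

lemma tot_count (X : ℝ) (hX : 2 ≤ X) : ∃ T : Finset (ℤ × ℤ × ℤ), (∀ t ∈ T, Box X t ∧ Fam t) ∧ X^9/32 - X^8 ≤ (T.card : ℝ) := by
  classical
  have hX2 : 4 ≤ X^2 := by nlinarith
  have hX3 : 8 ≤ X^3 := by nlinarith
  have hX4 : 16 ≤ X^4 := by nlinarith
  set A := ⌊X^2/4⌋₊
  set B := ⌊X^4/4⌋₊
  set D := ⌊X^3/2⌋₊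
  set D0 := ⌈X^3/2⌉₊
  have hA : (A:ℝ) ≤ X^2/4 := Nat.floor_le (by positivity)
  have hA' : X^2/4 < A + 1 := Nat.lt_floor_add_one _
  have hBb : (B:ℝ) ≤ X^4/4 := Nat.floor_le (by positivity)
  have hBb' : X^4/4 < B + 1 := Nat.lt_floor_add_one _
  have hD : (D:ℝ) ≤ X^3/2 := Nat.floor_le (by positivity)
  have hD' : X^3/2 < D + 1 := Nat.lt_floor_add_one _
  have hD0 : X^3/2 ≤ D0 := Nat.le_ceil _
  have hD0' : (D0:ℝ) < X^3/2 + 1 := Nat.ceil_lt_add_one (by positivity)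
  have hD1 : 1 ≤ D := by
    have : (1:ℝ) < D + 1 := by linarith
    have : (0:ℝ) < D := by linarith
    have : 0 < D := by exact_mod_cast this
    omega
  let f : ℕ × ℕ × ℕ → ℤ × ℤ × ℤ := fun x => (4*x.1+2, 4*x.2.1+1, 2*(x.2.2+D0)+1)
  refine ⟨(Finset.range A ×ˢ Finset.range B ×ˢ Finset.range (D-1)).image f, ?_, ?_⟩
  · intro t ht
    simp only [Finset.mem_image, Finset.mem_product, Finset.mem_range] at ht
    obtain ⟨⟨i, j, k⟩, ⟨h1, h2, h3⟩, rfl⟩ := ht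
    simp only at h1 h2 h3
    have h1' : (i:ℝ) + 1 ≤ A := by exact_mod_cast h1
    have h2' : (j:ℝ) + 1 ≤ B := by exact_mod_cast h2
    have h3' : (k:ℝ) + 2 ≤ D := by exact_mod_cast (by omega : k + 2 ≤ D)
    refine ⟨⟨⟨?_, ?_⟩, ⟨?_, ?_⟩, ?_, ?_⟩, ?_, ?_, ?_⟩
    · simp only [f]; push_cast; positivity
    · simp only [f]; push_cast; linarith
    · simp only [f]; push_cast; positivity
    · simp only [f]; push_cast; linarith
    · simp only [f]; push_cast
      have : (0:ℝ) ≤ k := by positivity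
      linarith
    · simp only [f]; push_cast; linarith
    · simp only [f]; omega
    · simp only [f]; omega
    · simp only [f]; omega
  · rw [Finset.card_image_of_injective]
    · rw [Finset.card_product, Finset.card_product, Finset.card_range, Finset.card_range, Finset.card_range]
      push_cast [hD1]
      calc X^9/32 - X^8 ≤ (X^2/4-1) * ((X^4/4-1) * (X^3/2-2)) := by
            obtain ⟨y, hy, rfl⟩ : ∃ y, 0 ≤ y ∧ X = 2 + y := ⟨X-2, by linarith, by ring⟩
            rw [← sub_nonneg]; ring_nf; positivity
        _ ≤ _ := by
            apply mul_le_mul (by linarith) ?_ ?_ (by positivity)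
            · apply mul_le_mul (by linarith) (by linarith) (by linarith) (by positivity)
            · apply mul_nonneg <;> linarith
    · rintro ⟨i, j, k⟩ ⟨i', j', k'⟩ h
      simp only [f, Prod.mk.injEq] at h ⊢
      omega

lemma ZC_of {n s u r : ℤ} {t : ℤ × ℤ × ℤ} (hn : n = s ∨ n = -s) (h1 : 2*s ∣ 3*u^2 + 2*t.1*u + t.2.1)
    (h2 : s^2 ∣ u^3 + t.1*u^2 + t.2.1*u - t.2.2^2) (h : 2*n ∣ u - r) : ZC n r t := by
  have h1' : 2*n ∣ 3*u^2 + 2*t.1*u + t.2.1 := by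
    rcases hn with rfl | rfl
    · exact h1
    · rw [mul_neg, neg_dvd]; exact h1
  have h2' : n^2 ∣ u^3 + t.1*u^2 + t.2.1*u - t.2.2^2 := by
    rcases hn with rfl | rfl
    · exact h2
    · rw [neg_sq]; exact h2
  have h3 : 2*n ∣ 3*r^2 + 2*t.1*r + t.2.1 := by
    have e : 3*r^2 + 2*t.1*r + t.2.1 = (3*u^2 + 2*t.1*u + t.2.1) - (u - r) * (3*(u+r) + 2*t.1) := by ring
    rw [e]; exact dvd_sub h1' (h.mul_right _)
  refine ⟨h3, ?_⟩
  have hn' : n ∣ u - r := (dvd_mul_left _ _).trans h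
  have e : r^3 + t.1*r^2 + t.2.1*r - t.2.2^2 = (u^3 + t.1*u^2 + t.2.1*u - t.2.2^2) -
     ((u-r) * (3*r^2 + 2*t.1*r + t.2.1) + (u-r)*(u-r) * (3*r + t.1 + (u-r))) := by ring
  rw [e, sq]
  rw [sq] at h2'
  exact dvd_sub h2' (dvd_add (mul_dvd_mul hn' ((dvd_mul_left _ _).trans h3)) ((mul_dvd_mul hn' hn').mul_right _))

lemma odd_of {s u : ℤ} {t : ℤ × ℤ × ℤ} (hF : Fam t) (h1 : 2*s ∣ 3*u^2 + 2*t.1*u + t.2.1)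
    (h2 : s^2 ∣ u^3 + t.1*u^2 + t.2.1*u - t.2.2^2) : u % 2 = 1 ∧ s % 2 = 1 := by
  obtain ⟨f1, f2, f3⟩ := hF
  have hu : u % 2 = 1 := by
    by_contra h
    have hu : (2:ℤ) ∣ u := by omega
    have h3 : (2:ℤ) ∣ 3*u^2 + 2*t.1*u + t.2.1 := (dvd_mul_right _ _).trans h1
    have e : t.2.1 = (3*u^2 + 2*t.1*u + t.2.1) - u * (3*u+2*t.1) := by ring
    have : (2:ℤ) ∣ t.2.1 := by rw [e]; exact dvd_sub h3 (hu.mul_right _)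
    omega
  refine ⟨hu, ?_⟩
  by_contra h
  have hs : (2:ℤ) ∣ s := by omega
  have h3 : (2:ℤ) ∣ u^3 + t.1*u^2 + t.2.1*u - t.2.2^2 := (dvd_pow hs two_ne_zero).trans h2
  have h4 : Even (u^3 + t.1*u^2 + t.2.1*u - t.2.2^2) := even_iff_two_dvd.2 h3
  have ou : Odd u := Int.odd_iff.2 hu
  have ea : Even t.1 := Int.even_iff.2 (by omega)
  have ob : Odd t.2.1 := Int.odd_iff.2 (by omega)
  have od : Odd t.2.2 := Int.odd_iff.2 f3
  have : Odd (u^3 + t.1*u^2 + t.2.1*u - t.2.2^2) := by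
    apply Even.sub_odd ?_ od.pow
    apply Odd.add_odd ?_ (ob.mul ou)
    exact ou.pow.add_even (ea.mul_right _)
  exact (Int.not_even_iff_odd.2 this) h4

lemma red_part (c : ℝ) (hc1 : 1 ≤ c) (X : ℝ) (hX : 1 ≤ X) (T : Finset (ℤ × ℤ × ℤ)) (hB : ∀ t ∈ T, Box X t) (hF : ∀ t ∈ T, Fam t)
    (hc : ∀ t ∈ T, IsCoprime t.2.1 t.2.2) (M : (ℤ × ℤ × ℤ) → (Fin 8 × Bool) → Bool → Matrix (Fin 3) (Fin 3) ℤ)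
    (row : ∀ t ∈ T, ∀ i s, RowT (M t i s) → sN (M t i s) ≠ 0 ∧ 2 * sN (M t i s) ∣ 3*(uN (M t i s))^2 + 2*t.1*(uN (M t i s)) + t.2.1 ∧
      (sN (M t i s))^2 ∣ (uN (M t i s))^3 + t.1*(uN (M t i s))^2 + t.2.1*(uN (M t i s)) - t.2.2^2)
    (row_inj : ∀ t ∈ T, ∀ i j s s', RowT (M t i s) → RowT (M t j s') → (sN (M t j s') = sN (M t i s) ∨ sN (M t j s') = - sN (M t i s)) →
      2 * sN (M t i s) ∣ uN (M t j s') - uN (M t i s) → i = j)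
    (hs : ∀ t ∈ T, ∀ i s, |(sN (M t i s) : ℝ)| ≤ c * X^2)
    (S : Finset ((ℤ × ℤ × ℤ) × (Fin 8 × Bool) × Bool)) (hST : ∀ x ∈ S, x.1 ∈ T) (hR : ∀ x ∈ S, RowT (M x.1 x.2.1 x.2.2)) :
    (S.card : ℝ) ≤ 2 * T.card + 2 * (X^9/128 + (10*c^2+10) * X^8) := by
  classical
  set s : ((ℤ × ℤ × ℤ) × (Fin 8 × Bool) × Bool) → ℤ := fun x => sN (M x.1 x.2.1 x.2.2)
  set u : ((ℤ × ℤ × ℤ) × (Fin 8 × Bool) × Bool) → ℤ := fun x => uN (M x.1 x.2.1 x.2.2)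
  have hodd : ∀ x ∈ S, u x % 2 = 1 ∧ s x % 2 = 1 := by
    intro x hx
    obtain ⟨_, h1, h2⟩ := row _ (hST x hx) _ _ (hR x hx)
    exact odd_of (hF _ (hST x hx)) h1 h2
  have hinj : ∀ x ∈ S, ∀ y ∈ S, x.1 = y.1 → x.2.2 = y.2.2 → (s x).natAbs = (s y).natAbs → 2 * s x ∣ u y - u x → x = y := by
    intro x hx y hy h1 h2 h3 h4
    have : x.2.1 = y.2.1 := by
      apply row_inj _ (hST x hx) _ _ x.2.2 y.2.2 (hR x hx) (by rw [h1]; exact hR y hy) ?_ ?_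
      · rw [h1]
        have := Int.natAbs_eq_natAbs_iff.1 h3.symm
        simp only [s] at this; rw [h1] at this; exact this
      · simp only [s, u] at h4
        rw [h1] at h4 ⊢; exact h4
    exact Prod.ext h1 (Prod.ext this h2)
  have hA : (S.filter fun x => (s x).natAbs = 1).card ≤ 2 * T.card := by
    have : (S.filter fun x => (s x).natAbs = 1).card ≤ (T ×ˢ (Finset.univ : Finset Bool)).card := by
      refine Finset.card_le_card_of_injOn (fun x => (x.1, x.2.2)) ?_ ?_
      · intro x hx
        simp only [Finset.coe_filter, Set.mem_setOf_eq] at hx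
        simp [hST x hx.1]
      · intro x hx y hy h
        simp only [Finset.coe_filter, Set.mem_setOf_eq] at hx hy
        rw [Prod.mk.injEq] at h
        refine hinj x hx.1 y hy.1 h.1 h.2 (hx.2.trans hy.2.symm) ?_
        have h1 := (hodd x hx.1).1
        have h2 := (hodd y hy.1).1
        have h3 : (2:ℤ) ∣ u y - u x := by omega
        rcases Int.natAbs_eq_iff.1 hx.2 with h4 | h4 <;> rw [h4]
        · simpa using h3
        · simpa using h3
    rw [Finset.card_product] at this
    simp at this
    omega
  let m : ((ℤ × ℤ × ℤ) × (Fin 8 × Bool) × Bool) → ℕ := fun x => ((s x).natAbs - 3)/2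
  let ρ : ((ℤ × ℤ × ℤ) × (Fin 8 × Bool) × Bool) → ℕ := fun x => ((u x % (2 * ((s x).natAbs : ℤ)))/2).toNat
  have hBs : ∀ b : Bool, ((S.filter fun x => (s x).natAbs ≠ 1 ∧ x.2.2 = b).card : ℝ) ≤ X^9/128 + (10*c^2+10) * X^8 := by
    intro b
    set F := S.filter fun x => (s x).natAbs ≠ 1 ∧ x.2.2 = b
    have hFm : ∀ x ∈ F, x ∈ S ∧ (s x).natAbs ≠ 1 ∧ x.2.2 = b := fun x hx => Finset.mem_filter.1 hx
    have hmn : ∀ x ∈ F, (s x).natAbs = 2 * m x + 3 := by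
      intro x hx
      obtain ⟨h1, h2, _⟩ := hFm x hx
      have h3 := (hodd x h1).2
      simp only [m]; omega
    have hρu : ∀ x ∈ F, u x % (2 * ((s x).natAbs : ℤ)) = 2 * ρ x + 1 ∧ ρ x < 2 * m x + 3 := by
      intro x hx
      have h0 := hmn x hx
      obtain ⟨h1, h2, _⟩ := hFm x hx
      have h3 := (hodd x h1).1
      have hpos : (0:ℤ) < 2 * ((s x).natAbs : ℤ) := by omega
      have h4 := Int.emod_nonneg (u x) hpos.ne'
      have h5 := Int.emod_lt_of_pos (u x) hpos
      have h6 : (u x % (2 * ((s x).natAbs : ℤ))) % 2 = 1 := by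
        rw [Int.emod_emod_of_dvd _ (dvd_mul_right _ _)]; exact h3
      have h7 : ((ρ x : ℕ) : ℤ) = (u x % (2 * ((s x).natAbs : ℤ)))/2 := by
        simp only [ρ]; exact Int.toNat_of_nonneg (by omega)
      omega
    have hinjF : Set.InjOn (fun x => (x.1, m x, ρ x)) (F : Set ((ℤ × ℤ × ℤ) × (Fin 8 × Bool) × Bool)) := by
      intro x hx y hy h
      simp only [Prod.mk.injEq] at h
      obtain ⟨e1, e2, e3⟩ := h
      have hx' := hFm x hx
      have hy' := hFm y hy
      have hn : (s x).natAbs = (s y).natAbs := by rw [hmn x hx, hmn y hy, e2]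
      refine hinj x hx'.1 y hy'.1 e1 (hx'.2.2.trans hy'.2.2.symm) hn ?_
      have h1 := (hρu x hx).1
      have h2 := (hρu y hy).1
      rw [← hn, ← e3, ← h1] at h2
      have h3 : 2 * ((s x).natAbs : ℤ) ∣ u y - u x := Int.ModEq.dvd h2.symm
      rcases Int.natAbs_eq (s x) with h4 | h4
      · rw [h4]; exact h3
      · rw [h4, mul_neg, neg_dvd]; exact h3
    rw [← Finset.card_image_of_injOn hinjF]
    apply red_count c hc1 X hX
    · intro q hq
      obtain ⟨x, hx, rfl⟩ := Finset.mem_image.1 hq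
      exact hB _ (hST x (hFm x hx).1)
    · intro q hq
      obtain ⟨x, hx, rfl⟩ := Finset.mem_image.1 hq
      exact hF _ (hST x (hFm x hx).1)
    · intro q hq
      obtain ⟨x, hx, rfl⟩ := Finset.mem_image.1 hq
      exact hc _ (hST x (hFm x hx).1)
    · intro q hq
      obtain ⟨x, hx, rfl⟩ := Finset.mem_image.1 hq
      have h1 := hs _ (hST x (hFm x hx).1) x.2.1 x.2.2
      have h2 : (((s x).natAbs : ℕ) : ℝ) = |(s x : ℝ)| := by
        rw [Nat.cast_natAbs, Int.cast_abs]
      rw [hmn x hx] at h2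
      push_cast at h2
      simp only
      rw [h2]; exact h1
    · intro q hq
      obtain ⟨x, hx, rfl⟩ := Finset.mem_image.1 hq
      exact (hρu x hx).2
    · intro q hq
      obtain ⟨x, hx, rfl⟩ := Finset.mem_image.1 hq
      have hxS := (hFm x hx).1
      obtain ⟨_, h1, h2⟩ := row _ (hST x hxS) _ _ (hR x hxS)
      have hn : ((2 * (m x : ℤ) + 3)) = ((s x).natAbs : ℤ) := by rw [hmn x hx]; push_cast; ring
      simp only
      rw [hn, ← (hρu x hx).1]
      refine ZC_of (s := s x) (u := u x) ?_ h1 h2 ?_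
      · rcases Int.natAbs_eq (s x) with h4 | h4
        · left; exact h4.symm
        · right; omega
      · exact Int.dvd_self_sub_emod
  have hcov : S ⊆ (S.filter fun x => (s x).natAbs = 1) ∪ ((S.filter fun x => (s x).natAbs ≠ 1 ∧ x.2.2 = true) ∪ (S.filter fun x => (s x).natAbs ≠ 1 ∧ x.2.2 = false)) := by
    intro x hx
    simp only [Finset.mem_union, Finset.mem_filter]
    rcases Bool.eq_false_or_eq_true x.2.2 with h | h <;> tauto
  have h1 : S.card ≤ (S.filter fun x => (s x).natAbs = 1).card + ((S.filter fun x => (s x).natAbs ≠ 1 ∧ x.2.2 = true).card + (S.filter fun x => (s x).natAbs ≠ 1 ∧ x.2.2 = false).card) :=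
    (Finset.card_le_card hcov).trans ((Finset.card_union_le _ _).trans (Nat.add_le_add_left (Finset.card_union_le _ _) _))
  have h2 : (S.card : ℝ) ≤ ((S.filter fun x => (s x).natAbs = 1).card : ℝ) + (((S.filter fun x => (s x).natAbs ≠ 1 ∧ x.2.2 = true).card : ℝ) + ((S.filter fun x => (s x).natAbs ≠ 1 ∧ x.2.2 = false).card : ℝ)) := by
    exact_mod_cast h1
  have h3 : ((S.filter fun x => (s x).natAbs = 1).card : ℝ) ≤ 2 * T.card := by exact_mod_cast hA
  have := hBs true
  have := hBs false
  linarith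
end

section
open Matrix MeasureTheory
open NumberField NumberField.Units

lemma sN_bound (X : ℝ) (hX : 0 < X) (N : Matrix (Fin 3) (Fin 3) ℤ) (p : I9 → ℝ) (hp : p ∈ D0)
    (hN : ∀ k l, (N k l : ℝ) = X * Psi p (k, l)) : |(sN N : ℝ)| ≤ 104976 * X^2 ∧ |(sN Nᵀ : ℝ)| ≤ 104976 * X^2 := by
  obtain ⟨_, _, _, ⟨x1, x2, x3, _, _⟩, ⟨y1, y2, y3, _, _⟩⟩ := id hp
  obtain ⟨k, hk1, hk2⟩ := dyadic _ x2 (q_le_of _ _ x1 x3)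
  obtain ⟨l, hl1, hl2⟩ := dyadic _ y2 (q_le_of _ _ y1 y3)
  have hk0 : 0 < 2^k := by positivity
  have hl0 : 0 < 2^l := by positivity
  have h := Psi_le p hp (2^k) (2^l) hk0 hk1 hk2 hl0 hl1 hl2
  have hk : (1:ℝ) ≤ ((2^k:ℕ):ℝ) := by exact_mod_cast hk0
  have hl : (1:ℝ) ≤ ((2^l:ℕ):ℝ) := by exact_mod_cast hl0
  set K : ℝ := ((2^k:ℕ):ℝ)
  set L : ℝ := ((2^l:ℕ):ℝ)
  have key : ∀ P Q A B : ℝ, |P| ≤ A → |Q| ≤ B → A * B ≤ 104976 → |X * P * (X * Q)| ≤ 104976 * X^2 := by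
    intro P Q A B h1 h2 h3
    have e : X * P * (X * Q) = X^2 * (P * Q) := by ring
    rw [e, abs_mul, abs_mul, abs_of_nonneg (by positivity : (0:ℝ) ≤ X^2), mul_comm]
    have h4 : |P| * |Q| ≤ A * B := mul_le_mul h1 h2 (abs_nonneg _) ((abs_nonneg _).trans h1)
    exact mul_le_mul_of_nonneg_right (h4.trans h3) (by positivity)
  constructor
  · simp only [sN]; push_cast; rw [hN, hN]
    refine key _ _ _ _ (h 0 2) (h 1 0) ?_
    simp [Wt]
    have e : 162 * (2/K) * L * (162 * (2/L)) = 104976 * (1/K) := by field_simp; norm_num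
    rw [e]
    have : 1/K ≤ 1 := by rw [div_le_one (by linarith)]; exact hk
    linarith
  · simp only [sN, Matrix.transpose_apply]; push_cast; rw [hN, hN]
    refine key _ _ _ _ (h 2 0) (h 0 1) ?_
    simp [Wt]
    have e : 162 * K * (2/L) * (162 * (2/K)) = 104976 * (1/L) := by field_simp; norm_num
    rw [e]
    have : 1/L ≤ 1 := by rw [div_le_one (by linarith)]; exact hl
    linarith

lemma aN_tr (N : Matrix (Fin 3) (Fin 3) ℤ) : aN Nᵀ = aN N := by
  simp only [aN, Matrix.transpose_apply]; ring
lemma bN_tr (N : Matrix (Fin 3) (Fin 3) ℤ) : bN Nᵀ = bN N := by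
  simp only [bN, Matrix.transpose_apply]; ring
lemma nZ_apply (t : ℤ) (N : Matrix (Fin 3) (Fin 3) ℤ) (j : Fin 3) : (nZ t * N) 0 j = N 0 j ∧ (nZ t * N) 1 j = 2*t*N 0 j + N 1 j ∧
    (nZ t * N) 2 j = -2*t^2*N 0 j - 2*t*N 1 j + N 2 j := by
  simp only [Matrix.mul_apply, Fin.sum_univ_three, nZ]
  refine ⟨?_, ?_, ?_⟩ <;> simp <;> ring
lemma aN_nZ (t : ℤ) (N : Matrix (Fin 3) (Fin 3) ℤ) : aN (nZ t * N) = aN N := by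
  simp only [aN, (nZ_apply t N _).1, (nZ_apply t N _).2.1, (nZ_apply t N _).2.2]; ring
lemma bN_nZ (t : ℤ) (N : Matrix (Fin 3) (Fin 3) ℤ) : bN (nZ t * N) = bN N := by
  simp only [bN, (nZ_apply t N _).1, (nZ_apply t N _).2.1, (nZ_apply t N _).2.2]; ring
lemma nZ_det (t : ℤ) : (nZ t).det = 1 := by
  rw [Matrix.det_fin_three]; simp [nZ]
lemma shear_coef (t t' : ℤ) (N : Matrix (Fin 3) (Fin 3) ℤ) : aN (nZ t * N * (nZ t')ᵀ) = aN N ∧ bN (nZ t * N * (nZ t')ᵀ) = bN N ∧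
    (nZ t * N * (nZ t')ᵀ).det = N.det := by
  refine ⟨?_, ?_, ?_⟩
  · rw [← aN_tr, Matrix.transpose_mul, Matrix.transpose_transpose, aN_nZ, aN_tr, aN_nZ]
  · rw [← bN_tr, Matrix.transpose_mul, Matrix.transpose_transpose, bN_nZ, bN_tr, bN_nZ]
  · rw [Matrix.det_mul, Matrix.det_mul, Matrix.det_transpose, nZ_det, nZ_det]; ring

set_option maxHeartbeats 1000000 in
theorem bad_count : ∃ X0 : ℝ, 1 ≤ X0 ∧ ∀ X : ℝ, X0 ≤ X → ∀ T : Finset (ℤ × ℤ × ℤ), (∀ t ∈ T, Box X t) → (∀ t ∈ T, Fam t) →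
    (∀ t ∈ T, IsCoprime t.2.1 t.2.2) → (∀ t ∈ T, Bad X t) → 28 * (T.card : ℝ) ≤ 0.653 * X^9 := by
  classical
  obtain ⟨Y, hY, X1, hX1, htail⟩ := tail_count 0.0005 (by norm_num)
  obtain ⟨X2, hX2, hmain⟩ := main_count Y hY
  set C : ℝ := 4 * (10*104976^2+10)
  refine ⟨max 1 (max (max X1 X2) (C*10000)), le_max_left _ _, fun X hX T hB hF hcop hBad => ?_⟩
  have hXa : 1 ≤ X := (le_max_left _ _).trans hX
  have hXb : X1 ≤ X := ((le_max_left _ _).trans ((le_max_left _ _).trans (le_max_right _ _))).trans hX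
  have hXc : X2 ≤ X := ((le_max_right _ _).trans ((le_max_left _ _).trans (le_max_right _ _))).trans hX
  have hXd : C * 10000 ≤ X := ((le_max_right _ _).trans (le_max_right _ _)).trans hX
  have hX0 : 0 < X := by linarith
  choose! N p hD using hBad
  have hdpos : ∀ t ∈ T, 0 < t.2.2 := by
    intro t ht
    have : (0:ℝ) < t.2.2 := lt_of_lt_of_le (by positivity) (hB t ht).2.2.1
    exact_mod_cast this
  let J := (ℤ × ℤ × ℤ) × (Fin 8 × Bool) × Bool
  let M : J → Matrix (Fin 3) (Fin 3) ℤ := fun x => N x.1 x.2.1 x.2.2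
  let P : J → I9 → ℝ := fun x => p x.1 x.2.1 x.2.2
  let S : Finset J := T ×ˢ Finset.univ
  have hS : ∀ x ∈ S, x.1 ∈ T := fun x hx => (Finset.mem_product.1 hx).1
  have hcardS : S.card = 32 * T.card := by
    have h1 : S.card = T.card * (Finset.univ : Finset ((Fin 8 × Bool) × Bool)).card := Finset.card_product _ _
    have h2 : (Finset.univ : Finset ((Fin 8 × Bool) × Bool)).card = 32 := by simp
    rw [h1, h2, mul_comm]
  have hteq : ∀ x ∈ S, ∀ y ∈ S, aN (M x) = aN (M y) → bN (M x) = bN (M y) → (M x).det = (M y).det → x.1 = y.1 := by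
    intro x hx y hy h1 h2 h3
    obtain ⟨a1, a2, a3⟩ := (hD _ (hS x hx)).coef x.2.1 x.2.2
    obtain ⟨b1, b2, b3⟩ := (hD _ (hS y hy)).coef y.2.1 y.2.2
    simp only [M] at h1 h2 h3
    rw [a1, b1] at h1
    rw [a2, b2] at h2
    rw [h3, b3] at a3
    have h4 : x.1.2.2 = y.1.2.2 := by
      rw [← sq_eq_sq₀ (hdpos _ (hS x hx)).le (hdpos _ (hS y hy)).le]; exact a3.symm
    exact Prod.ext h1 (Prod.ext h2 h4)
  have hMinj : ∀ x ∈ S, ∀ y ∈ S, M x = M y → x = y := by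
    intro x hx y hy h
    have h1 := hteq x hx y hy (by rw [h]) (by rw [h]) (by rw [h])
    have h2 : N x.1 x.2.1 x.2.2 = N x.1 y.2.1 y.2.2 := by
      have : N x.1 x.2.1 x.2.2 = N y.1 y.2.1 y.2.2 := h
      rw [this, h1]
    obtain ⟨h3, h4⟩ := (hD _ (hS x hx)).inj _ _ _ _ h2
    exact Prod.ext h1 (Prod.ext h3 h4)
  -- reducible parts
  set A := S.filter fun x => RowT (M x)
  set A' := S.filter fun x => RowT (M x)ᵀ
  have hA : (A.card : ℝ) ≤ 2 * T.card + 2 * (X^9/128 + (10*104976^2+10) * X^8) :=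
    red_part 104976 (by norm_num) X hXa T hB hF hcop N (fun t ht i s => (hD t ht).row i s) (fun t ht i j s s' => (hD t ht).row_inj i j s s')
      (fun t ht i s => (sN_bound X hX0 _ _ ((hD t ht).hp i s) ((hD t ht).hN i s)).1) A
      (fun x hx => hS x (Finset.mem_filter.1 hx).1) (fun x hx => (Finset.mem_filter.1 hx).2)
  have hA' : (A'.card : ℝ) ≤ 2 * T.card + 2 * (X^9/128 + (10*104976^2+10) * X^8) :=
    red_part 104976 (by norm_num) X hXa T hB hF hcop (fun t i s => (N t i s)ᵀ) (fun t ht i s => (hD t ht).col i s) (fun t ht i j s s' => (hD t ht).col_inj i j s s')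
      (fun t ht i s => (sN_bound X hX0 _ _ ((hD t ht).hp i s) ((hD t ht).hN i s)).2) A'
      (fun x hx => hS x (Finset.mem_filter.1 hx).1) (fun x hx => (Finset.mem_filter.1 hx).2)
  set Irr : J → Prop := fun x => M x 0 0 ≠ 0 ∨ (M x 0 1 ≠ 0 ∧ M x 1 0 ≠ 0)
  set Big : J → Prop := fun x => 1/Y ≤ P x (1,1) ∧ 1/Y ≤ P x (1,2)
  -- tail
  have hT : ∀ b : Bool, ((S.filter fun x => Irr x ∧ ¬ Big x ∧ x.2.2 = b).card : ℝ) ≤ 0.0005 * X^9 := by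
    intro b
    refine htail X hXb J _ M P ?_ ?_ ?_ ?_ ?_
    · intro x hx
      exact (hD _ (hS x (Finset.mem_filter.1 hx).1)).hp _ _
    · intro x hx
      exact (hD _ (hS x (Finset.mem_filter.1 hx).1)).hN _ _
    · intro x hx y hy t t' h
      obtain ⟨hx, _, _, hxb⟩ := Finset.mem_filter.1 hx
      obtain ⟨hy, _, _, hyb⟩ := Finset.mem_filter.1 hy
      obtain ⟨c1, c2, c3⟩ := shear_coef t t' (M y)
      have h1 := hteq x hx y hy (by rw [h, c1]) (by rw [h, c2]) (by rw [h, c3])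
      have h2 : x.2.2 = y.2.2 := hxb.trans hyb.symm
      have h3 : N x.1 x.2.1 x.2.2 = nZ t * N x.1 y.2.1 x.2.2 * (nZ t')ᵀ := by
        have : N x.1 x.2.1 x.2.2 = nZ t * N y.1 y.2.1 y.2.2 * (nZ t')ᵀ := h
        rw [this, h1, h2]
      exact Prod.ext h1 (Prod.ext ((hD _ (hS x hx)).shear _ _ _ _ _ h3) h2)
    · intro x hx
      exact (Finset.mem_filter.1 hx).2.1
    · intro x hx
      have := (Finset.mem_filter.1 hx).2.2.1
      simp only [Big, not_and_or, not_le] at this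
      exact this
  -- main
  have hMn : ((S.filter fun x => Irr x ∧ Big x).card : ℝ) ≤ 12 * (26.44 * (X/2)^9) := by
    rw [← Finset.card_image_of_injOn (f := M)]
    · apply hmain X hXc
      · intro Z hZ
        obtain ⟨x, hx, rfl⟩ := Finset.mem_image.1 hZ
        obtain ⟨hx, _, hb⟩ := Finset.mem_filter.1 hx
        refine ⟨P x, ?_, (hD _ (hS x hx)).hN _ _⟩
        obtain ⟨d1, d2, d3, ⟨x1, x2, x3⟩, ⟨y1, y2, y3⟩⟩ := (hD _ (hS x hx)).hp x.2.1 x.2.2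
        exact ⟨d1, d2, d3, ⟨x1, hb.1, x3⟩, ⟨y1, hb.2, y3⟩⟩
      · intro Z hZ
        obtain ⟨x, hx, rfl⟩ := Finset.mem_image.1 hZ
        obtain ⟨hx, _, hb⟩ := Finset.mem_filter.1 hx
        obtain ⟨a1, a2, a3⟩ := (hD _ (hS x hx)).coef x.2.1 x.2.2
        obtain ⟨f1, f2, f3⟩ := hF _ (hS x hx)
        apply res_of
        · simp only [M]; rw [a1]; exact f1
        · simp only [M]; rw [a2]; exact f2
        · have : Odd ((N x.1 x.2.1 x.2.2).det^2) := by rw [a3]; exact (Int.odd_iff.2 f3).pow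
          exact Int.odd_iff.1 ((Int.odd_pow' two_ne_zero).1 this)
    · intro x hx y hy h
      exact hMinj x (Finset.mem_filter.1 hx).1 y (Finset.mem_filter.1 hy).1 h
  have hcov : S ⊆ (A ∪ A') ∪ ((S.filter fun x => Irr x ∧ Big x) ∪ ((S.filter fun x => Irr x ∧ ¬ Big x ∧ x.2.2 = true) ∪ (S.filter fun x => Irr x ∧ ¬ Big x ∧ x.2.2 = false))) := by
    intro x hx
    rw [Finset.mem_union, Finset.mem_union, Finset.mem_union, Finset.mem_union]
    by_cases h1 : RowT (M x)
    · exact Or.inl (Or.inl (Finset.mem_filter.2 ⟨hx, h1⟩))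
    by_cases h2 : RowT (M x)ᵀ
    · exact Or.inl (Or.inr (Finset.mem_filter.2 ⟨hx, h2⟩))
    have hI : Irr x := by
      simp only [RowT, Matrix.transpose_apply] at h1 h2
      by_cases h0 : M x 0 0 = 0
      · exact Or.inr ⟨fun h => h1 ⟨h0, h⟩, fun h => h2 ⟨h0, h⟩⟩
      · exact Or.inl h0
    by_cases hb : Big x
    · exact Or.inr (Or.inl (Finset.mem_filter.2 ⟨hx, hI, hb⟩))
    by_cases hv : x.2.2 = true
    · exact Or.inr (Or.inr (Or.inl (Finset.mem_filter.2 ⟨hx, hI, hb, hv⟩)))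
    · exact Or.inr (Or.inr (Or.inr (Finset.mem_filter.2 ⟨hx, hI, hb, Bool.eq_false_iff.2 hv⟩)))
  have hc := (Finset.card_le_card hcov).trans ((Finset.card_union_le _ _).trans (Nat.add_le_add (Finset.card_union_le _ _)
    ((Finset.card_union_le _ _).trans (Nat.add_le_add_left (Finset.card_union_le _ _) _))))
  rw [hcardS] at hc
  have hc' : 32 * (T.card:ℝ) ≤ ((A.card:ℝ) + A'.card) + (((S.filter fun x => Irr x ∧ Big x).card : ℝ) +
    (((S.filter fun x => Irr x ∧ ¬ Big x ∧ x.2.2 = true).card : ℝ) + ((S.filter fun x => Irr x ∧ ¬ Big x ∧ x.2.2 = false).card : ℝ))) := by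
    exact_mod_cast hc
  have t1 := hT true
  have t2 := hT false
  have hC8 : C * X^8 ≤ 0.0001 * X^9 := by
    have : 0 ≤ X^8 := by positivity
    have : X^9 = X * X^8 := by ring
    nlinarith
  have hCe : 2 * ((10*104976^2+10) * X^8) + 2 * ((10*104976^2+10) * X^8) = C * X^8 := by simp only [C]; ring
  have hX9 : (X/2)^9 = X^9/512 := by ring
  rw [hX9] at hMn
  have hp9 : 0 ≤ X^9 := by positivity
  linarith
end

section
open Matrix MeasureTheory
open NumberField NumberField.Units

lemma target_count (K : IntermediateField ℚ ℂ) (hK : K ∈ Target) : ∃ M : ℝ, 0 ≤ M ∧ ∀ X : ℝ, 1 ≤ X → ∀ T : Finset (ℤ × ℤ × ℤ),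
    (∀ t ∈ T, Box X t) → (∀ t ∈ T, ∃ C : CD K, C.a = t.1 ∧ C.b = t.2.1 ∧ C.d = t.2.2) → (T.card : ℝ) ≤ M * X^6 := by
  have h3 : Module.finrank ℚ K = 3 := hK.1
  haveI : FiniteDimensional ℚ K := FiniteDimensional.of_finrank_pos (by omega)
  haveI : NumberField K := ⟨⟩
  obtain ⟨M, hM⟩ := field_count K
  refine ⟨max M 0, le_max_right _ _, fun X hX T hB hC => (hM X hX T hB hC h3).trans ?_⟩
  exact mul_le_mul_of_nonneg_right (le_max_left _ _) (by positivity)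

theorem target_infinite : Target.Infinite := by
  classical
  intro hfin
  have hex : ∀ K : IntermediateField ℚ ℂ, ∃ M : ℝ, 0 ≤ M ∧ (K ∈ Target → ∀ X : ℝ, 1 ≤ X → ∀ T : Finset (ℤ × ℤ × ℤ),
    (∀ t ∈ T, Box X t) → (∀ t ∈ T, ∃ C : CD K, C.a = t.1 ∧ C.b = t.2.1 ∧ C.d = t.2.2) → (T.card : ℝ) ≤ M * X^6) := by
    intro K
    by_cases hK : K ∈ Target
    · obtain ⟨M, h0, hM⟩ := target_count K hK
      exact ⟨M, h0, fun _ => hM⟩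
    · exact ⟨0, le_rfl, fun h => absurd h hK⟩
  choose Mf hM0 hMf using hex
  obtain ⟨X0, hX0, hbad⟩ := bad_count
  set F := hfin.toFinset
  set W : ℝ := ∑ K ∈ F, Mf K
  have hW : 0 ≤ W := Finset.sum_nonneg fun K _ => hM0 K
  set X : ℝ := X0 + 10000 * (W + 1012) with hXdef
  have hX1 : 1 ≤ X := by linarith
  have hX2 : 2 ≤ X := by linarith
  obtain ⟨T, hT, hTc⟩ := tot_count X hX2
  set T1 := T.filter fun t => ¬ IsCoprime t.2.1 t.2.2
  set T2 := T.filter fun t => IsCoprime t.2.1 t.2.2 ∧ Bad X t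
  set T3 := T.filter fun t => SqT t
  set T4 : IntermediateField ℚ ℂ → Finset (ℤ × ℤ × ℤ) := fun K =>
    T.filter fun t => ∃ C : CD K, C.a = t.1 ∧ C.b = t.2.1 ∧ C.d = t.2.2 with hT4
  have hcov : T ⊆ (T1 ∪ T2) ∪ (T3 ∪ F.biUnion T4) := by
    intro t ht
    rw [Finset.mem_union, Finset.mem_union, Finset.mem_union]
    by_cases hc : IsCoprime t.2.1 t.2.2
    · rcases dichotomy X (by linarith) t (hT t ht).1 (hT t ht).2 hc with h | h | ⟨K, hK, h⟩
      · exact Or.inl (Or.inr (Finset.mem_filter.2 ⟨ht, hc, h⟩))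
      · exact Or.inr (Or.inl (Finset.mem_filter.2 ⟨ht, h⟩))
      · exact Or.inr (Or.inr (Finset.mem_biUnion.2 ⟨K, hfin.mem_toFinset.2 hK, Finset.mem_filter.2 ⟨ht, h⟩⟩))
    · exact Or.inl (Or.inl (Finset.mem_filter.2 ⟨ht, hc⟩))
  have hc := (Finset.card_le_card hcov).trans ((Finset.card_union_le _ _).trans (Nat.add_le_add (Finset.card_union_le _ _)
    ((Finset.card_union_le _ _).trans (Nat.add_le_add_left Finset.card_biUnion_le _))))
  have hc' : (T.card : ℝ) ≤ ((T1.card : ℝ) + T2.card) + ((T3.card : ℝ) + ∑ K ∈ F, ((T4 K).card : ℝ)) := by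
    exact_mod_cast hc
  have h1 : (T1.card : ℝ) ≤ X^9/128 + 10*X^8 :=
    noncop_count X hX1 T1 (fun t ht => (hT t (Finset.mem_filter.1 ht).1).1) (fun t ht => (hT t (Finset.mem_filter.1 ht).1).2)
      (fun t ht => (Finset.mem_filter.1 ht).2)
  have h2 : 28 * (T2.card : ℝ) ≤ 0.653 * X^9 :=
    hbad X (by linarith) T2 (fun t ht => (hT t (Finset.mem_filter.1 ht).1).1) (fun t ht => (hT t (Finset.mem_filter.1 ht).1).2)
      (fun t ht => (Finset.mem_filter.1 ht).2.1) (fun t ht => (Finset.mem_filter.1 ht).2.2)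
  have h3 : (T3.card : ℝ) ≤ 1000 * X^6 :=
    sq_count X hX1 T3 (fun t ht => (hT t (Finset.mem_filter.1 ht).1).1) (fun t ht => (Finset.mem_filter.1 ht).2)
  have h4 : ∑ K ∈ F, ((T4 K).card : ℝ) ≤ W * X^6 := by
    rw [Finset.sum_mul]
    refine Finset.sum_le_sum fun K hK => hMf K (hfin.mem_toFinset.1 hK) X hX1 _ (fun t ht => (hT t (Finset.mem_filter.1 ht).1).1)
      (fun t ht => (Finset.mem_filter.1 ht).2)
  have h68 : X^6 ≤ X^8 := pow_le_pow_right₀ hX1 (by norm_num)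
  have h8 : 0 < X^8 := by positivity
  have h9 : X^9 = X * X^8 := by ring
  have h5 : (1000 + W) * X^6 ≤ (1000 + W) * X^8 := mul_le_mul_of_nonneg_left h68 (by linarith)
  have h6 : (W + 1012) * X^8 ≤ 0.0001 * X^9 := by
    rw [h9, ← mul_assoc]
    exact mul_le_mul_of_nonneg_right (by linarith) h8.le
  have h9p : 0 < X^9 := by positivity
  linarith
end

/-- There are infinitely many complex cubic fields (subfields of `ℂ` of degree 3 over
`ℚ` with negative discriminant) whose class group has 2-rank equal to 1 or 2, i.e.
with `|Cl[2]| ∈ {2, 4}`. -/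
theorem infinitely_many_complex_cubic_fields_two_rank_one_or_two :
    {K : IntermediateField ℚ ℂ |
      Module.finrank ℚ K = 3 ∧ discOf K < 0 ∧
        (twoTorsionCard K = 2 ∨ twoTorsionCard K = 4)}.Infinite := by
  exact target_infinite
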